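/- There exists a constant C > 0 such that for all integers r ≥ 2 and k with k ≥ r⁵ there is a threshold q₀ (depending only on k and r) so that for every prime power q ≥ q₀, every integer d > k, and every group Γ the following holds. Let Z = F^r(B(2d,S_k,q)) be the r-faces complex of the projected flags complex. Then for every Γ-valued 1-cochain f on Z there exists g from the vertices of Z to Γ with exp(−C·√r·(log(r+1))²)·dist(f,δg) ≤ wt(δf); that is, Z is a 1-coboundary expander with expansion at least exp(−C·√r·(log(r+1))²) with respect to every group. -/

import Mathlib

open Finset
open scoped Classical

noncomputable instance (F : Type) [Field F] [Fintype F] (n : ℕ) :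
    Fintype (Submodule F (Fin n → F)) :=
  Fintype.ofInjective (fun W => (W : Set (Fin n → F)))
    fun _ _ h => SetLike.coe_injective h

/-- A face of the projected flags complex `B(n,S,q)`: a finite chain of subspaces of `F^n`
whose dimensions all lie in `S`. -/
def IsFlagFace (F : Type) [Field F] [Fintype F] (n : ℕ) (S : Finset ℕ)
    (s : Finset (Submodule F (Fin n → F))) : Prop :=
  IsChain (· ≤ ·) (s : Set (Submodule F (Fin n → F))) ∧
    ∀ W ∈ s, Module.finrank F W ∈ S

/-- A maximal face of `B(n,S,q)`: a chain containing one subspace of each dimension in `S`. -/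
def IsMaxFlagFace (F : Type) [Field F] [Fintype F] (n : ℕ) (S : Finset ℕ)
    (T : Finset (Submodule F (Fin n → F))) : Prop :=
  IsFlagFace F n S T ∧ ∀ i ∈ S, ∃ W ∈ T, Module.finrank F W = i

/-- The maximal faces of `B(n,S,q)`. -/
noncomputable def maxFlagFaces (F : Type) [Field F] [Fintype F] (n : ℕ) (S : Finset ℕ) :
    Finset (Finset (Submodule F (Fin n → F))) :=
  Finset.univ.filter fun T => IsMaxFlagFace F n S T

/-- The sets of `m` pairwise disjoint `(r+1)`-element subsets of a maximal face `T`. -/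
noncomputable def rPartitions (F : Type) [Field F] [Fintype F] (n r m : ℕ)
    (T : Finset (Submodule F (Fin n → F))) :
    Finset (Finset (Finset (Submodule F (Fin n → F)))) :=
  Finset.univ.filter fun P : Finset (Finset (Submodule F (Fin n → F))) =>
    P.card = m ∧ (∀ e ∈ P, e.card = r + 1 ∧ e ⊆ T) ∧
      ∀ e ∈ P, ∀ e' ∈ P, e ≠ e' → Disjoint e e'

/-- `wt(δf)` for the `r`-faces complex of `B(n,S,q)`: the probability that `δf ≠ 1` on a
random triangle, where one samples a uniform maximal face `T`, a uniform set `P` of `m`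
pairwise disjoint `(r+1)`-element subsets of `T`, and a uniform 3-element subset of `P`. -/
noncomputable def facesWt (F : Type) [Field F] [Fintype F] (n : ℕ) (S : Finset ℕ)
    (r m : ℕ) (Γ : Type) [Group Γ]
    (f : Finset (Submodule F (Fin n → F)) → Finset (Submodule F (Fin n → F)) → Γ) : ℝ :=
  (∑ T ∈ maxFlagFaces F n S,
      (∑ P ∈ rPartitions F n r m T,
          (∑ E ∈ P.powersetCard 3,
              if ∃ a ∈ E, ∃ b ∈ E, ∃ c ∈ E, a ≠ b ∧ b ≠ c ∧ a ≠ c ∧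
                  f a b * f b c * f c a ≠ 1
              then (1 : ℝ) else 0) / ((P.powersetCard 3).card : ℝ)) /
        ((rPartitions F n r m T).card : ℝ)) /
    ((maxFlagFaces F n S).card : ℝ)

/-- `dist(f, δg)` for the `r`-faces complex of `B(n,S,q)`: the probability that
`f(s,s') ≠ g(s)·g(s')⁻¹` on a random edge, sampled as a uniform 2-element subset of a
uniform set `P` of `m` pairwise disjoint `(r+1)`-element subsets of a uniform maximal
face. -/
noncomputable def facesDist (F : Type) [Field F] [Fintype F] (n : ℕ) (S : Finset ℕ)
    (r m : ℕ) (Γ : Type) [Group Γ]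
    (f : Finset (Submodule F (Fin n → F)) → Finset (Submodule F (Fin n → F)) → Γ)
    (g : Finset (Submodule F (Fin n → F)) → Γ) : ℝ :=
  (∑ T ∈ maxFlagFaces F n S,
      (∑ P ∈ rPartitions F n r m T,
          (∑ E ∈ P.powersetCard 2,
              if ∃ a ∈ E, ∃ b ∈ E, a ≠ b ∧ f a b ≠ g a * (g b)⁻¹
              then (1 : ℝ) else 0) / ((P.powersetCard 2).card : ℝ)) /
        ((rPartitions F n r m T).card : ℝ)) /
    ((maxFlagFaces F n S).card : ℝ)


set_option linter.unusedSectionVars false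
set_option linter.unusedVariables false
set_option linter.style.show false

/-- Coordinates on a finite type. -/
class Crd (Ω : Type) (α : outParam Type) where
  co : Ω → ℕ → α

section generic
variable {Ω α : Type} [Fintype Ω] [Crd Ω α]

def Agr (C : Set ℕ) (T T' : Ω) : Prop := ∀ c ∈ C, Crd.co T c = Crd.co T' c

def Meas {γ : Type*} (C : Set ℕ) (φ : Ω → γ) : Prop := ∀ T T', Agr C T T' → φ T = φ T'

noncomputable def fib (C : Set ℕ) (T : Ω) : Finset Ω := univ.filter (fun T' => Agr C T T')

noncomputable def ce (C : Set ℕ) (X : Ω → ℝ) (T : Ω) : ℝ :=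
  (∑ T' ∈ fib C T, X T') / ((fib C T).card : ℝ)

noncomputable def nsq (X : Ω → ℝ) : ℝ := ∑ T, X T ^ 2

theorem Agr.refl (C : Set ℕ) (T : Ω) : Agr C T T := fun _ _ => rfl
theorem Agr.symm {C : Set ℕ} {T T' : Ω} (h : Agr C T T') : Agr C T' T := fun c hc => (h c hc).symm
theorem Agr.trans {C : Set ℕ} {T T' T'' : Ω} (h : Agr C T T') (h' : Agr C T' T'') : Agr C T T'' :=
  fun c hc => (h c hc).trans (h' c hc)
theorem Agr.mono {C D : Set ℕ} (hCD : C ⊆ D) {T T' : Ω} (h : Agr D T T') : Agr C T T' :=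
  fun c hc => h c (hCD hc)

theorem mem_fib {C : Set ℕ} {T T' : Ω} : T' ∈ fib C T ↔ Agr C T T' := by simp [fib]

theorem fib_eq {C : Set ℕ} {T T' : Ω} (h : Agr C T T') : fib C T = fib C T' := by
  ext U; simp only [mem_fib]; exact ⟨fun h' => h.symm.trans h', fun h' => h.trans h'⟩

theorem self_mem_fib (C : Set ℕ) (T : Ω) : T ∈ fib C T := mem_fib.2 (Agr.refl _ _)

theorem fib_card_pos (C : Set ℕ) (T : Ω) : 0 < ((fib C T).card : ℝ) := by
  exact_mod_cast Finset.card_pos.2 ⟨T, self_mem_fib C T⟩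

theorem Meas.mono {γ : Type*} {C D : Set ℕ} (hCD : C ⊆ D) {φ : Ω → γ} (h : Meas C φ) : Meas D φ :=
  fun T T' hT => h T T' (hT.mono hCD)

theorem Meas.comp {γ δ : Type*} {C : Set ℕ} {φ : Ω → γ} (h : Meas C φ) (u : γ → δ) :
    Meas C (fun T => u (φ T)) := fun T T' hT => by simp only [h T T' hT]

theorem Meas.comp₂ {γ δ ε : Type*} {C : Set ℕ} {φ : Ω → γ} {ψ : Ω → δ} (h : Meas C φ)
    (h' : Meas C ψ) (u : γ → δ → ε) :
    Meas C (fun T => u (φ T) (ψ T)) := fun T T' hT => by simp only [h T T' hT, h' T T' hT]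

theorem meas_fib (C : Set ℕ) : Meas C (fun T : Ω => fib C T) := fun _ _ h => fib_eq h

theorem ce_meas (C : Set ℕ) (X : Ω → ℝ) : Meas C (ce C X) := fun T T' h => by
  simp only [ce, fib_eq h]

theorem ce_mul_meas {C : Set ℕ} (X : Ω → ℝ) {Y : Ω → ℝ} (hY : Meas C Y) (T : Ω) :
    ce C (fun T => X T * Y T) T = ce C X T * Y T := by
  unfold ce
  rw [div_mul_eq_mul_div, Finset.sum_mul]
  congr 1
  apply Finset.sum_congr rfl
  intro U hU
  rw [hY T U (mem_fib.1 hU)]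

theorem ce_const (C : Set ℕ) (a : ℝ) (T : Ω) : ce C (fun _ => a) T = a := by
  unfold ce
  have := fib_card_pos C T
  rw [Finset.sum_const, nsmul_eq_mul]; field_simp

theorem ce_of_meas {C : Set ℕ} {Y : Ω → ℝ} (hY : Meas C Y) (T : Ω) : ce C Y T = Y T := by
  have := ce_mul_meas (fun _ => (1:ℝ)) hY T
  simpa [ce_const] using this

theorem ce_add (C : Set ℕ) (X Y : Ω → ℝ) (T : Ω) :
    ce C (fun T => X T + Y T) T = ce C X T + ce C Y T := by
  unfold ce; rw [Finset.sum_add_distrib, add_div]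

theorem ce_sub (C : Set ℕ) (X Y : Ω → ℝ) (T : Ω) :
    ce C (fun T => X T - Y T) T = ce C X T - ce C Y T := by
  unfold ce; rw [Finset.sum_sub_distrib, sub_div]

theorem ce_smul (C : Set ℕ) (a : ℝ) (X : Ω → ℝ) (T : Ω) :
    ce C (fun T => a * X T) T = a * ce C X T := by
  unfold ce; rw [← Finset.mul_sum, mul_div_assoc]

theorem ce_sum {ι : Type*} (s : Finset ι) (C : Set ℕ) (X : ι → Ω → ℝ) (T : Ω) :
    ce C (fun T => ∑ i ∈ s, X i T) T = ∑ i ∈ s, ce C (X i) T := by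
  unfold ce; rw [Finset.sum_comm, Finset.sum_div]

theorem ce_mono (C : Set ℕ) {X Y : Ω → ℝ} (T : Ω) (h : ∀ U, Agr C T U → X U ≤ Y U) :
    ce C X T ≤ ce C Y T := by
  unfold ce
  apply div_le_div_of_nonneg_right _ (fib_card_pos C T).le
  exact Finset.sum_le_sum fun U hU => h U (mem_fib.1 hU)

theorem ce_congr (C : Set ℕ) {X Y : Ω → ℝ} (T : Ω) (h : ∀ U, Agr C T U → X U = Y U) :
    ce C X T = ce C Y T :=
  le_antisymm (ce_mono C T fun U hU => (h U hU).le) (ce_mono C T fun U hU => (h U hU).ge)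

theorem ce_nonneg (C : Set ℕ) {X : Ω → ℝ} (T : Ω) (h : ∀ U, 0 ≤ X U) : 0 ≤ ce C X T := by
  have := ce_mono C (X := fun _ => 0) (Y := X) T (fun U _ => h U)
  rwa [ce_const] at this

theorem ce_exists_le (C : Set ℕ) (X : Ω → ℝ) (T : Ω) : ∃ U, Agr C T U ∧ X U ≤ ce C X T := by
  by_contra! h
  have hp := fib_card_pos C T
  have : ∑ U ∈ fib C T, ce C X T < ∑ U ∈ fib C T, X U :=
    Finset.sum_lt_sum_of_nonempty ⟨T, self_mem_fib C T⟩ fun U hU => h U (mem_fib.1 hU)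
  rw [Finset.sum_const, nsmul_eq_mul] at this
  have h2 : ((fib C T).card : ℝ) * ce C X T = ∑ U ∈ fib C T, X U := by
    unfold ce; field_simp
  linarith

theorem sum_ce_mul {C : Set ℕ} (X : Ω → ℝ) {Y : Ω → ℝ} (hY : Meas C Y) :
    ∑ T, ce C X T * Y T = ∑ T, X T * Y T := by
  have h1 : ∀ T, ce C X T * Y T = ∑ U, if Agr C T U then X U * Y U / ((fib C U).card : ℝ) else 0 := by
    intro T
    rw [← ce_mul_meas X hY, ce, Finset.sum_div, fib, Finset.sum_filter]
    apply Finset.sum_congr rfl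
    intro U _
    split_ifs with h
    · rw [← fib, fib_eq h]
    · rfl
  simp_rw [h1]
  rw [Finset.sum_comm]
  apply Finset.sum_congr rfl
  intro U _
  have : ∀ T, Agr C T U ↔ T ∈ fib C U := fun T => ⟨fun h => mem_fib.2 h.symm, fun h => (mem_fib.1 h).symm⟩
  simp_rw [this]
  rw [← Finset.sum_filter, Finset.filter_mem_eq_inter, Finset.univ_inter, Finset.sum_const,
    nsmul_eq_mul]
  have := fib_card_pos C U
  field_simp

theorem sum_ce (C : Set ℕ) (X : Ω → ℝ) : ∑ T, ce C X T = ∑ T, X T := by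
  have := sum_ce_mul (C := C) X (Y := fun _ => 1) (fun _ _ _ => rfl)
  simpa using this

theorem ce_tower {C D : Set ℕ} (h : C ⊆ D) (X : Ω → ℝ) (T : Ω) : ce C (ce D X) T = ce C X T := by
  unfold ce
  congr 1
  have hm : Meas D (fun U : Ω => if Agr C T U then (1:ℝ) else 0) := by
    intro U U' hU
    have : Agr C T U ↔ Agr C T U' :=
      ⟨fun h' => h'.trans (hU.mono h), fun h' => h'.trans (hU.mono h).symm⟩
    simp only [this]
  have := sum_ce_mul X hm
  simp only [mul_ite, mul_one, mul_zero] at this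
  rw [← Finset.sum_filter, ← Finset.sum_filter] at this
  exact this

theorem ce_tower' {C D : Set ℕ} (h : C ⊆ D) (X : Ω → ℝ) (T : Ω) : ce D (ce C X) T = ce C X T :=
  ce_of_meas ((ce_meas C X).mono h) T

theorem sum_mul_ce {C : Set ℕ} (X : Ω → ℝ) {Y : Ω → ℝ} (hY : Meas C Y) :
    ∑ T, Y T * ce C X T = ∑ T, Y T * X T := by
  have := sum_ce_mul X hY
  simpa [mul_comm] using this

theorem nsq_nonneg (X : Ω → ℝ) : 0 ≤ nsq X := Finset.sum_nonneg fun _ _ => sq_nonneg _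

theorem nsq_ce (C : Set ℕ) (X : Ω → ℝ) : nsq (ce C X) = ∑ T, X T * ce C X T := by
  rw [← sum_ce_mul X (ce_meas C X)]; simp [nsq, sq]

theorem nsq_sub_ce (C : Set ℕ) (X : Ω → ℝ) :
    nsq (fun T => X T - ce C X T) = nsq X - nsq (ce C X) := by
  have h := nsq_ce C X
  have : nsq (fun T => X T - ce C X T) = nsq X - 2 * ∑ T, X T * ce C X T + nsq (ce C X) := by
    simp only [nsq, Finset.mul_sum]
    rw [← Finset.sum_sub_distrib, ← Finset.sum_add_distrib]
    exact Finset.sum_congr rfl fun T _ => by ring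
  rw [this, ← h]; ring

theorem nsq_ce_le (C : Set ℕ) (X : Ω → ℝ) : nsq (ce C X) ≤ nsq X := by
  have := nsq_sub_ce C X
  have := nsq_nonneg (fun T => X T - ce C X T)
  linarith

theorem nsq_best {C : Set ℕ} (X : Ω → ℝ) {Y : Ω → ℝ} (hY : Meas C Y) :
    nsq (fun T => X T - ce C X T) ≤ nsq (fun T => X T - Y T) := by
  have h1 : nsq (fun T => X T - Y T) = nsq X - 2 * ∑ T, X T * Y T + nsq Y := by
    simp only [nsq, Finset.mul_sum]
    rw [← Finset.sum_sub_distrib, ← Finset.sum_add_distrib]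
    exact Finset.sum_congr rfl fun T _ => by ring
  have h2 : nsq (fun T => ce C X T - Y T) = nsq (ce C X) - 2 * ∑ T, ce C X T * Y T + nsq Y := by
    simp only [nsq, Finset.mul_sum]
    rw [← Finset.sum_sub_distrib, ← Finset.sum_add_distrib]
    exact Finset.sum_congr rfl fun T _ => by ring
  have h3 := nsq_nonneg (fun T => ce C X T - Y T)
  have h4 := sum_ce_mul X hY
  have h5 := nsq_sub_ce C X
  rw [h4] at h2
  linarith

/-- nested differences -/
theorem nsq_ce_sub_ce {C D : Set ℕ} (h : C ⊆ D) (X : Ω → ℝ) :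
    nsq (fun T => ce D X T - ce C X T) = nsq (ce D X) - nsq (ce C X) := by
  have := nsq_sub_ce C (ce D X)
  have h2 : ce C (ce D X) = ce C X := funext fun T => ce_tower h X T
  rw [h2] at this; exact this

theorem nsq_sub_ce_mono {C D : Set ℕ} (h : C ⊆ D) (X : Ω → ℝ) :
    nsq (fun T => X T - ce D X T) ≤ nsq (fun T => X T - ce C X T) :=
  nsq_best X ((ce_meas C X).mono h)

/-- indicator -/
noncomputable def ind {γ : Type*} (φ : Ω → γ) (v : γ) (T : Ω) : ℝ := if φ T = v then 1 else 0

theorem ind_meas {γ : Type*} {C : Set ℕ} {φ : Ω → γ} (h : Meas C φ) (v : γ) : Meas C (ind φ v) :=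
  h.comp (fun x => if x = v then (1:ℝ) else 0)

noncomputable def dis {γ : Type*} (C : Set ℕ) (φ : Ω → γ) : ℝ :=
  ∑ v ∈ univ.image φ, nsq (fun T => ind φ v T - ce C (ind φ v) T)

theorem dis_eq_sum {γ : Type*} (C : Set ℕ) (φ : Ω → γ) (W : Finset γ) (hW : univ.image φ ⊆ W) :
    dis C φ = ∑ v ∈ W, nsq (fun T => ind φ v T - ce C (ind φ v) T) := by
  unfold dis
  apply Finset.sum_subset hW
  intro v _ hv
  have : ind φ v = fun _ => 0 := by
    funext T
    simp only [ind]
    rw [if_neg]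
    rintro rfl
    exact hv (Finset.mem_image_of_mem _ (Finset.mem_univ T))
  simp [this, ce_const, nsq]

theorem dis_nonneg {γ : Type*} (C : Set ℕ) (φ : Ω → γ) : 0 ≤ dis C φ :=
  Finset.sum_nonneg fun _ _ => nsq_nonneg _

theorem sum_ind {γ : Type*} (φ : Ω → γ) (W : Finset γ) (hW : univ.image φ ⊆ W) (u : γ → ℝ) (T : Ω) :
    ∑ v ∈ W, ind φ v T * u v = u (φ T) := by
  simp only [ind, ite_mul, one_mul, zero_mul]
  rw [Finset.sum_ite_eq]
  simp [hW (Finset.mem_image_of_mem φ (Finset.mem_univ T))]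

theorem dis_eq {γ : Type*} (C : Set ℕ) (φ : Ω → γ) :
    dis C φ = ∑ T, (1 - ce C (ind φ (φ T)) T) := by
  unfold dis
  simp_rw [nsq_sub_ce, nsq_ce]
  simp only [nsq]
  rw [Finset.sum_sub_distrib, Finset.sum_sub_distrib]
  congr 1
  · rw [Finset.sum_comm]
    apply Finset.sum_congr rfl
    intro T _
    have := sum_ind φ (univ.image φ) subset_rfl (fun _ => 1) T
    simp only [mul_one] at this
    rw [← this]
    apply Finset.sum_congr rfl
    intro v _
    simp only [ind]; split_ifs <;> norm_num
  · rw [Finset.sum_comm]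
    apply Finset.sum_congr rfl
    intro T _
    exact sum_ind φ (univ.image φ) subset_rfl (fun v => ce C (ind φ v) T) T

/-- number of disagreements -/
noncomputable def nd {γ : Type*} (φ ψ : Ω → γ) : ℝ := ∑ T, if φ T ≠ ψ T then (1:ℝ) else 0

theorem nd_nonneg {γ : Type*} (φ ψ : Ω → γ) : 0 ≤ nd φ ψ :=
  Finset.sum_nonneg fun _ _ => by split_ifs <;> norm_num

theorem nd_comm {γ : Type*} (φ ψ : Ω → γ) : nd φ ψ = nd ψ φ := by
  simp only [nd, ne_comm]

theorem nd_triangle {γ : Type*} (φ ψ χ : Ω → γ) : nd φ χ ≤ nd φ ψ + nd ψ χ := by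
  simp only [nd]
  rw [← Finset.sum_add_distrib]
  apply Finset.sum_le_sum
  intro T _
  by_cases h1 : φ T = ψ T
  · by_cases h2 : ψ T = χ T
    · simp [h1, h2]
    · simp [h1]
  · by_cases h2 : φ T = χ T
    · simp [h2]; positivity
    · simp [h1, h2]; split_ifs <;> norm_num

theorem sum_nsq_ind_sub {γ : Type*} (φ ψ : Ω → γ) (W : Finset γ) :
    ∑ v ∈ W, nsq (fun T => ind φ v T - ind ψ v T) ≤ 2 * nd φ ψ := by
  simp only [nsq, nd]
  rw [Finset.sum_comm, Finset.mul_sum]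
  apply Finset.sum_le_sum
  intro T _
  by_cases h : φ T = ψ T
  · simp [ind, h]
  · have : ∀ v ∈ W, (ind φ v T - ind ψ v T)^2 ≤ (if φ T = v then 1 else 0) + (if ψ T = v then (1:ℝ) else 0) := by
      intro v _
      simp only [ind]
      split_ifs <;> norm_num
    refine (Finset.sum_le_sum this).trans ?_
    rw [Finset.sum_add_distrib, Finset.sum_ite_eq, Finset.sum_ite_eq]
    simp only [ne_eq, h, not_false_eq_true, if_true]
    split_ifs <;> norm_num

theorem dis_le {γ : Type*} {C : Set ℕ} (φ : Ω → γ) {ψ : Ω → γ} (hψ : Meas C ψ) :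
    dis C φ ≤ 2 * nd φ ψ := by
  refine le_trans ?_ (sum_nsq_ind_sub φ ψ (univ.image φ))
  unfold dis
  exact Finset.sum_le_sum fun v _ => nsq_best _ (ind_meas hψ v)

theorem dis_of_meas {γ : Type*} {C : Set ℕ} {φ : Ω → γ} (hφ : Meas C φ) : dis C φ = 0 := by
  apply le_antisymm _ (dis_nonneg _ _)
  refine (dis_le φ hφ).trans ?_
  simp [nd]

theorem dis_anti {γ : Type*} {C D : Set ℕ} (h : C ⊆ D) (φ : Ω → γ) : dis D φ ≤ dis C φ :=
  Finset.sum_le_sum fun _ _ => nsq_sub_ce_mono h _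

/-- selection -/
theorem exists_sel {γ : Type*} (C : Set ℕ) (φ : Ω → γ) :
    ∃ ψ : Ω → γ, Meas C ψ ∧ nd φ ψ ≤ dis C φ := by
  by_cases hn : Nonempty Ω
  swap
  · exact ⟨φ, fun T => absurd ⟨T⟩ hn, by
      rw [show nd φ φ = 0 by simp [nd]]; exact dis_nonneg _ _⟩
  have key : ∀ s : Finset Ω, ∃ v : Ω, s.Nonempty → (∀ w ∈ s, (∑ U ∈ s, ind φ (φ w) U) ≤ ∑ U ∈ s, ind φ (φ v) U) := by
    intro s
    by_cases hs : s.Nonempty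
    · obtain ⟨v, _, hv⟩ := Finset.exists_max_image s (fun w => ∑ U ∈ s, ind φ (φ w) U) hs
      exact ⟨v, fun _ => hv⟩
    · exact ⟨hn.some, fun h => absurd h hs⟩
  choose v hv using key
  refine ⟨fun T => φ (v (fib C T)), (meas_fib C).comp (fun s => φ (v s)), ?_⟩
  rw [dis_eq]
  have h1 : nd φ (fun T => φ (v (fib C T))) = ∑ T, (1 - ce C (ind φ (φ (v (fib C T)))) T) := by
    rw [Finset.sum_sub_distrib]
    have : ∑ T, ce C (ind φ (φ (v (fib C T)))) T = ∑ T, ind φ (φ (v (fib C T))) T := by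
      have h2 := sum_ce C (fun T => ind φ (φ (v (fib C T))) T)
      rw [← h2]
      apply Finset.sum_congr rfl
      intro T _
      apply ce_congr
      intro U hU
      rw [fib_eq hU]
    rw [this, ← Finset.sum_sub_distrib]
    unfold nd
    apply Finset.sum_congr rfl
    intro T _
    simp only [ind]
    split_ifs <;> simp_all
  rw [h1]
  apply Finset.sum_le_sum
  intro T _
  have := hv (fib C T) ⟨T, self_mem_fib C T⟩ T (self_mem_fib C T)
  unfold ce
  have hp := fib_card_pos C T
  have := div_le_div_of_nonneg_right this hp.le
  linarith

end generic


section generic2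
variable {Ω α : Type} [Fintype Ω] [Crd Ω α]

variable (Ω) in
/-- Pair correlation bound. -/
def PL (l : ℝ) : Prop :=
  ∀ (C : Set ℕ) (b b' : ℕ), b ≠ b' → ∀ X Y : Ω → ℝ, Meas (insert b C) X → Meas (insert b' C) Y →
    (∀ T, ce C X T = 0) → (∀ T, ce C Y T = 0) →
    (∑ T, X T * Y T) ^ 2 ≤ l ^ 2 * nsq X * nsq Y

theorem PL.half {l : ℝ} (hl : 0 ≤ l) (h : PL Ω l) {C : Set ℕ} {b b' : ℕ} (hb : b ≠ b')
    {X Y : Ω → ℝ} (hX : Meas (insert b C) X) (hY : Meas (insert b' C) Y)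
    (hX0 : ∀ T, ce C X T = 0) (hY0 : ∀ T, ce C Y T = 0) :
    ∑ T, X T * Y T ≤ l * ((nsq X + nsq Y) / 2) := by
  have h1 := h C b b' hb X Y hX hY hX0 hY0
  have hx := nsq_nonneg X
  have hy := nsq_nonneg Y
  apply le_of_sq_le_sq _ (by positivity)
  refine h1.trans ?_
  nlinarith [sq_nonneg (nsq X - nsq Y), sq_nonneg l, mul_nonneg (sq_nonneg l) (sq_nonneg (nsq X - nsq Y))]

theorem bessel {l : ℝ} (hl : 0 ≤ l) (h : PL Ω l) (C : Set ℕ) (B : Finset ℕ) (hB : B.Nonempty) (φ : Ω → ℝ)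
    (h0 : ∀ T, ce C φ T = 0) :
    ∑ b ∈ B, nsq (ce (insert b C) φ) ≤ (1 + (B.card - 1) * l) * nsq φ := by
  set m : ℝ := (B.card : ℝ) with hm
  have hm1 : 1 ≤ m := by rw [hm]; exact_mod_cast hB.card_pos
  set Q := ∑ b ∈ B, nsq (ce (insert b C) φ) with hQ
  have hQ0 : 0 ≤ Q := Finset.sum_nonneg fun _ _ => nsq_nonneg _
  set t : ℝ := 1 + (m - 1) * l with ht
  have ht1 : 1 ≤ t := by nlinarith
  set s : Ω → ℝ := fun T => ∑ b ∈ B, ce (insert b C) φ T with hs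
  have hsφ : ∑ T, φ T * s T = Q := by
    simp only [hs, Finset.mul_sum]
    rw [Finset.sum_comm, hQ]
    exact Finset.sum_congr rfl fun b _ => (nsq_ce _ _).symm
  have hss : nsq s ≤ t * Q := by
    have e1 : nsq s = ∑ b ∈ B, ∑ b' ∈ B, ∑ T, ce (insert b C) φ T * ce (insert b' C) φ T := by
      simp only [nsq, hs, sq, Finset.sum_mul_sum]
      rw [Finset.sum_comm]
      exact Finset.sum_congr rfl fun b _ => Finset.sum_comm
    have e2 : ∀ b ∈ B, ∀ b' ∈ B, ∑ T, ce (insert b C) φ T * ce (insert b' C) φ T ≤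
        (l * ((nsq (ce (insert b C) φ) + nsq (ce (insert b' C) φ)) / 2))
         + if b = b' then (1 - l) * nsq (ce (insert b C) φ) else 0 := by
      intro b _ b' _
      by_cases hbb : b = b'
      · subst hbb
        simp only [if_true, nsq, sq]; linarith
      · rw [if_neg hbb, add_zero]
        apply h.half hl hbb (ce_meas _ _) (ce_meas _ _)
        · intro T; rw [ce_tower (Set.subset_insert _ _), h0]
        · intro T; rw [ce_tower (Set.subset_insert _ _), h0]
    rw [e1]
    refine (Finset.sum_le_sum fun b hb => Finset.sum_le_sum fun b' hb' => e2 b hb b' hb').trans ?_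
    have e3 : ∑ b ∈ B, ∑ b' ∈ B, ((l * ((nsq (ce (insert b C) φ) + nsq (ce (insert b' C) φ)) / 2))
         + if b = b' then (1 - l) * nsq (ce (insert b C) φ) else 0) = l * m * Q + (1 - l) * Q := by
      simp_rw [Finset.sum_add_distrib]
      have : ∑ b ∈ B, ∑ b' ∈ B, (if b = b' then (1 - l) * nsq (ce (insert b C) φ) else 0) = (1 - l) * Q := by
        rw [hQ, Finset.mul_sum]
        apply Finset.sum_congr rfl
        intro b hb
        rw [Finset.sum_ite_eq, if_pos hb]
      rw [this]
      congr 1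
      simp_rw [← Finset.mul_sum, ← Finset.sum_div, Finset.sum_add_distrib, Finset.sum_const, nsmul_eq_mul,
        ← Finset.mul_sum, ← hQ]
      rw [← hm]; ring
    rw [e3, ht]; apply le_of_eq; ring
  have hp := nsq_nonneg (fun T => t * φ T - s T)
  have e : nsq (fun T => t * φ T - s T) = t ^ 2 * nsq φ - 2 * t * Q + nsq s := by
    rw [← hsφ]
    simp only [nsq, Finset.mul_sum]
    rw [← Finset.sum_sub_distrib, ← Finset.sum_add_distrib]
    exact Finset.sum_congr rfl fun T _ => by ring
  rw [e] at hp
  have : t * Q ≤ t * (t * nsq φ) := by nlinarith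
  exact le_of_mul_le_mul_left this (by linarith)

theorem AT {l : ℝ} (hl : 0 ≤ l) (hl1 : l ≤ 1) (h : PL Ω l) (m : ℕ) :
    ∀ (C : Set ℕ) (B : Finset ℕ) (φ : Ω → ℝ), B.card = m → Meas (C ∪ ↑B) φ →
    (1 - l) ^ m * nsq (fun T => φ T - ce C φ T) ≤
      ∑ b ∈ B, nsq (fun T => φ T - ce (C ∪ ↑(B.erase b)) φ T) := by
  induction m with
  | zero =>
    intro C B φ hB hφ
    rw [Finset.card_eq_zero] at hB
    subst hB
    have : ∀ T, φ T - ce C φ T = 0 := fun T => by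
      rw [ce_of_meas, sub_self]; simpa using hφ
    simp [this, nsq]
  | succ m ih =>
    intro C B φ hB hφ
    have hV0 := nsq_nonneg (fun T => φ T - ce C φ T)
    rcases Nat.eq_zero_or_pos m with rfl | hm
    · obtain ⟨b, rfl⟩ := Finset.card_eq_one.1 hB
      simp only [Finset.sum_singleton, Finset.erase_singleton, Finset.coe_empty, Set.union_empty, zero_add, pow_one]
      nlinarith
    have hm' : (0:ℝ) < m := by exact_mod_cast hm
    set V := nsq (fun T => φ T - ce C φ T) with hV
    set E := ∑ b ∈ B, nsq (fun T => φ T - ce (C ∪ ↑(B.erase b)) φ T) with hE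
    have h1 : ∀ b ∈ B, (1 - l) ^ m * nsq (fun T => φ T - ce (insert b C) φ T) ≤
        ∑ b' ∈ B.erase b, nsq (fun T => φ T - ce (C ∪ ↑(B.erase b')) φ T) := by
      intro b hb
      have hset : insert b C ∪ ↑(B.erase b) = C ∪ (↑B : Set ℕ) := by
        ext x; simp; by_cases hx : x = b
        · subst hx; simp [hb]
        · simp [hx]
      have := ih (insert b C) (B.erase b) φ (by rw [Finset.card_erase_of_mem hb, hB]; rfl)
        (by rw [hset]; exact hφ)
      refine this.trans (le_of_eq ?_)
      apply Finset.sum_congr rfl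
      intro b' hb'
      have hset2 : insert b C ∪ ↑((B.erase b).erase b') = C ∪ (↑(B.erase b') : Set ℕ) := by
        rw [Finset.mem_erase] at hb'
        ext x; simp; by_cases hx : x = b
        · subst hx; simp [hb, Ne.symm hb'.1]
        · simp [hx]
      rw [hset2]
    have h2 : ∀ b ∈ B, nsq (fun T => φ T - ce (insert b C) φ T) =
        V - nsq (ce (insert b C) (fun T => φ T - ce C φ T)) := by
      intro b _
      have e : ce (insert b C) (fun T => φ T - ce C φ T) = fun T => ce (insert b C) φ T - ce C φ T := by
        funext T; rw [ce_sub, ce_tower' (Set.subset_insert _ _)]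
      rw [e, hV, nsq_sub_ce, nsq_sub_ce, nsq_ce_sub_ce (Set.subset_insert _ _)]; ring
    have hbes := bessel hl h C B (Finset.card_pos.1 (by omega)) (fun T => φ T - ce C φ T) (by
      intro T; rw [ce_sub, ce_tower' subset_rfl, sub_self])
    rw [← hV, hB] at hbes
    have hsum : (1 - l) ^ m * ∑ b ∈ B, nsq (fun T => φ T - ce (insert b C) φ T) ≤ m * E := by
      rw [Finset.mul_sum]
      refine (Finset.sum_le_sum h1).trans (le_of_eq ?_)
      have : ∀ b ∈ B, ∑ b' ∈ B.erase b, nsq (fun T => φ T - ce (C ∪ ↑(B.erase b')) φ T) =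
          E - nsq (fun T => φ T - ce (C ∪ ↑(B.erase b)) φ T) := by
        intro b hb
        rw [hE, ← Finset.add_sum_erase B _ hb]; ring
      rw [Finset.sum_congr rfl this, Finset.sum_sub_distrib, Finset.sum_const, hB, ← hE]
      simp
      ring
    rw [Finset.sum_congr rfl h2, Finset.sum_sub_distrib, Finset.sum_const, hB, nsmul_eq_mul] at hsum
    push_cast at hsum hbes
    have hpow : 0 ≤ (1 - l) ^ m := pow_nonneg (by linarith) _
    have h3 : (1 - l) ^ m * (m * (1 - l) * V) ≤ m * E := by
      refine le_trans (mul_le_mul_of_nonneg_left ?_ hpow) hsum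
      nlinarith
    have h4 : (m:ℝ) * ((1 - l) ^ (m+1) * V) ≤ m * E := by
      rw [pow_succ]; nlinarith
    exact le_of_mul_le_mul_left h4 hm'

theorem AT_dis {l : ℝ} (hl : 0 ≤ l) (hl1 : l ≤ 1) (h : PL Ω l) {γ : Type*} (C : Set ℕ) (B : Finset ℕ)
    (φ : Ω → γ) (hφ : Meas (C ∪ ↑B) φ) :
    (1 - l) ^ B.card * dis C φ ≤ ∑ b ∈ B, dis (C ∪ ↑(B.erase b)) φ := by
  unfold dis
  rw [Finset.sum_comm, Finset.mul_sum]
  exact Finset.sum_le_sum fun v _ => AT hl hl1 h _ C B _ rfl (ind_meas hφ v)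

theorem bip {l : ℝ} (hl : 0 ≤ l) (h : PL Ω l) {γ : Type*} (C : Set ℕ) (B B' : Finset ℕ)
    (hl2 : (B.card + B'.card) * l ≤ 1 / 2)
    (hd : Disjoint B B') (φ φ' : Ω → γ) (hφ : Meas (C ∪ ↑B) φ) (hφ' : Meas (C ∪ ↑B') φ') :
    dis C φ ≤ 4 * B.card * nd φ φ' := by
  rcases B.eq_empty_or_nonempty with rfl | hB
  · rw [dis_of_meas]
    · simp
    · simpa using hφ
  have hB1 : (1:ℝ) ≤ B.card := by exact_mod_cast hB.card_pos
  have hl1 : l ≤ 1 := by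
    have : (0:ℝ) ≤ B'.card := by positivity
    nlinarith
  have key := AT_dis hl hl1 h C (B ∪ B') φ (hφ.mono (by
    apply Set.union_subset_union_right; simp))
  rw [Finset.card_union_of_disjoint hd] at key
  have hpow : (1:ℝ)/2 ≤ (1 - l) ^ (B.card + B'.card) := by
    have := one_add_mul_le_pow (a := -l) (by linarith) (B.card + B'.card)
    push_cast at this
    have h3 : (1 + -l) = 1 - l := by ring
    rw [h3] at this
    nlinarith
  have hd0 := dis_nonneg C φ
  have hsum : ∑ b ∈ B ∪ B', dis (C ∪ ↑((B ∪ B').erase b)) φ ≤ ∑ b ∈ B, 2 * nd φ φ' := by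
    rw [Finset.sum_union hd]
    have : ∑ b ∈ B', dis (C ∪ ↑((B ∪ B').erase b)) φ = 0 := by
      apply Finset.sum_eq_zero
      intro b hb
      apply dis_of_meas
      apply hφ.mono
      apply Set.union_subset_union_right
      intro x hx
      have hx' : x ∈ B := hx
      have : x ≠ b := fun e => Finset.disjoint_left.1 hd hx' (e ▸ hb)
      simp [this, hx']
    rw [this, add_zero]
    apply Finset.sum_le_sum
    intro b hb
    apply dis_le
    apply hφ'.mono
    apply Set.union_subset_union_right
    intro x hx
    have hx' : x ∈ B' := hx
    have : x ≠ b := fun e => Finset.disjoint_left.1 hd hb (e ▸ hx')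
    simp [this, hx']
  rw [Finset.sum_const, nsmul_eq_mul] at hsum
  nlinarith

/-- variance reduction -/
theorem VR {l : ℝ} (hl : 0 ≤ l) (h : PL Ω l) (C : Set ℕ) (i : ℕ) (ψ X : Ω → ℝ)
    (hX : Meas (insert i C) X) (hX0 : ∀ T, ce C X T = 0) :
    ∀ (n : ℕ) (B : Finset ℕ), B.card = n → i ∉ B →
    (∑ T, X T * ce (C ∪ ↑B) ψ T) ^ 2 ≤ (l ^ 2 * n) * nsq X * nsq (fun T => ce (C ∪ ↑B) ψ T - ce C ψ T) := by
  intro n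
  induction n with
  | zero =>
    intro B hB _
    rw [Finset.card_eq_zero] at hB
    subst hB
    have : ∑ T, X T * ce (C ∪ ↑(∅ : Finset ℕ)) ψ T = 0 := by
      simp only [Finset.coe_empty, Set.union_empty]
      have := sum_ce_mul X (ce_meas C ψ)
      rw [← this]; simp [hX0]
    rw [this]; simp
  | succ n ih =>
    intro B hB hi
    obtain ⟨b, hb⟩ : B.Nonempty := Finset.card_pos.1 (by omega)
    set B0 := B.erase b with hB0
    have hc : B0.card = n := by rw [hB0, Finset.card_erase_of_mem hb, hB]; rfl
    have ih' := ih B0 hc (fun h' => hi (Finset.mem_of_mem_erase h'))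
    set D := C ∪ (↑B0 : Set ℕ) with hD
    have hD' : C ∪ (↑B : Set ℕ) = insert b D := by
      rw [hD, hB0]; ext x; simp; by_cases hx : x = b
      · subst hx; simp [hb]
      · simp [hx]
    rw [hD']
    set Y : Ω → ℝ := fun T => ce (insert b D) ψ T - ce D ψ T with hY
    have hib : i ≠ b := fun e => hi (e ▸ hb)
    have hCD : C ⊆ D := Set.subset_union_left
    -- correlation of X with Y
    have h1 : (∑ T, X T * Y T) ^ 2 ≤ l ^ 2 * nsq X * nsq Y := by
      have e : ∑ T, X T * Y T = ∑ T, (X T - ce D X T) * Y T := by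
        have : ∑ T, ce D X T * Y T = 0 := by
          have h2 := sum_mul_ce (C := D) Y (ce_meas D X)
          rw [← h2]
          apply Finset.sum_eq_zero
          intro T _
          have : ce D Y T = 0 := by
            rw [hY, ce_sub, ce_tower (Set.subset_insert _ _), ce_tower' subset_rfl, sub_self]
          rw [this, mul_zero]
        simp_rw [sub_mul]
        rw [Finset.sum_sub_distrib, this, sub_zero]
      rw [e]
      have := h D i b hib (fun T => X T - ce D X T) Y
        ((hX.mono (Set.insert_subset_insert hCD)).comp₂ ((ce_meas D X).mono (Set.subset_insert _ _)) (fun a b => a - b))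
        ((ce_meas _ ψ).comp₂ ((ce_meas D ψ).mono (Set.subset_insert _ _)) (fun a b => a - b))
        (by intro T; rw [ce_sub, ce_tower' subset_rfl, sub_self])
        (by intro T; rw [hY, ce_sub, ce_tower (Set.subset_insert _ _), ce_tower' subset_rfl, sub_self])
      refine this.trans ?_
      have h3 : nsq (fun T => X T - ce D X T) ≤ nsq X := by
        rw [nsq_sub_ce]; have := nsq_nonneg (ce D X); linarith
      have := nsq_nonneg Y
      gcongr
    have e2 : ∑ T, X T * ce (insert b D) ψ T = ∑ T, X T * ce D ψ T + ∑ T, X T * Y T := by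
      rw [← Finset.sum_add_distrib]
      exact Finset.sum_congr rfl fun T _ => by simp only [hY]; ring
    have e3 : nsq (fun T => ce (insert b D) ψ T - ce C ψ T) =
        nsq (fun T => ce D ψ T - ce C ψ T) + nsq Y := by
      rw [hY, nsq_ce_sub_ce (hCD.trans (Set.subset_insert _ _)), nsq_ce_sub_ce hCD,
        nsq_ce_sub_ce (Set.subset_insert _ _)]; ring
    rw [e2, e3]
    set a := ∑ T, X T * ce D ψ T
    set c := ∑ T, X T * Y T
    set u := nsq (fun T => ce D ψ T - ce C ψ T) with hu
    set w := nsq Y with hw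
    have hu0 : 0 ≤ u := nsq_nonneg _
    have hw0 : 0 ≤ w := nsq_nonneg _
    set p := l ^ 2 * nsq X with hp
    have hp0 : 0 ≤ p := mul_nonneg (sq_nonneg _) (nsq_nonneg _)
    have hA : a ^ 2 ≤ n * (p * u) := by rw [hp]; nlinarith [ih']
    have hB : c ^ 2 ≤ p * w := h1
    have hgoal : (a + c) ^ 2 ≤ (n + 1) * (p * (u + w)) := by
      rcases Nat.eq_zero_or_pos n with hn | hn
      · rw [hn] at hA ⊢
        have ha : a = 0 := by
          have : a ^ 2 ≤ 0 := by simpa using hA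
          exact pow_eq_zero_iff (two_ne_zero) |>.1 (le_antisymm this (sq_nonneg _))
        rw [ha]
        have : 0 ≤ p * u := mul_nonneg hp0 hu0
        simp only [zero_add]; push_cast; nlinarith
      · have hn' : (0:ℝ) < n := by exact_mod_cast hn
        -- (a+c)^2 ≤ (1+1/n) a^2 + (1+n) c^2
        have h5 : n * (a + c)^2 ≤ (n+1) * a^2 + n * (n+1) * c^2 := by nlinarith [sq_nonneg (a - n * c)]
        have h6 : n * (a + c)^2 ≤ n * ((n + 1) * (p * (u + w))) := by
          have h7 := mul_le_mul_of_nonneg_left hA (by positivity : (0:ℝ) ≤ n + 1)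
          have h8 := mul_le_mul_of_nonneg_left hB (by positivity : (0:ℝ) ≤ n * (n + 1))
          linarith
        exact le_of_mul_le_mul_left h6 hn'
    push_cast
    calc (a + c)^2 ≤ _ := hgoal
      _ = _ := by rw [hp]; ring

theorem VR_main {l : ℝ} (hl : 0 ≤ l) (h : PL Ω l) (C : Set ℕ) (i : ℕ) (B : Finset ℕ) (hi : i ∉ B)
    (ψ : Ω → ℝ) (hψ : Meas (C ∪ ↑B) ψ) :
    nsq (fun T => ce (insert i C) ψ T - ce C ψ T) ≤ (l ^ 2 * B.card) * nsq ψ := by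
  set X : Ω → ℝ := fun T => ce (insert i C) ψ T - ce C ψ T with hX
  have hCi : C ⊆ insert i C := Set.subset_insert _ _
  have h1 := VR hl h C i ψ X ((ce_meas _ ψ).comp₂ ((ce_meas C ψ).mono hCi) (fun a b => a - b))
    (by intro T; rw [hX, ce_sub, ce_tower hCi, ce_tower' subset_rfl, sub_self]) B.card B rfl hi
  have h2 : ∑ T, X T * ce (C ∪ ↑B) ψ T = nsq X := by
    have : ∀ T, ce (C ∪ ↑B) ψ T = ψ T := fun T => ce_of_meas hψ T
    simp_rw [this]
    have h4 : ∑ T, X T * ψ T = nsq (ce (insert i C) ψ) - nsq (ce C ψ) := by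
      rw [nsq_ce, nsq_ce, ← Finset.sum_sub_distrib]
      exact Finset.sum_congr rfl fun T _ => by simp only [hX]; ring
    rw [h4, ← nsq_ce_sub_ce hCi]
  rw [h2] at h1
  have h3 : nsq (fun T => ce (C ∪ ↑B) ψ T - ce C ψ T) ≤ nsq ψ := by
    rw [nsq_ce_sub_ce Set.subset_union_left]
    have := nsq_ce_le (C ∪ ↑B) ψ
    have := nsq_nonneg (ce C ψ)
    linarith
  have hX0 := nsq_nonneg X
  have hq : 0 ≤ l ^ 2 * (B.card:ℝ) := by positivity
  rcases hX0.eq_or_lt with h0 | h0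
  · rw [← h0]; exact mul_nonneg hq (nsq_nonneg _)
  · have : nsq X * nsq X ≤ nsq X * ((l ^ 2 * B.card) * nsq ψ) := by
      calc nsq X * nsq X = nsq X ^ 2 := by ring
        _ ≤ _ := h1
        _ ≤ (l ^ 2 * B.card) * nsq X * nsq ψ := by gcongr
        _ = _ := by ring
    exact le_of_mul_le_mul_left this h0

end generic2


section flags
variable {F V : Type} [Field F] [AddCommGroup V] [Module F V] [FiniteDimensional F V]

theorem exists_succ {U W : Submodule F V} (h : U ≤ W)
    (hlt : Module.finrank F U < Module.finrank F W) :
    ∃ X, U ≤ X ∧ X ≤ W ∧ Module.finrank F X = Module.finrank F U + 1 := by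
  have hne : ¬ W ≤ U := fun h' => by
    have := Submodule.finrank_mono h'; omega
  obtain ⟨v, hvW, hvU⟩ := SetLike.not_le_iff_exists.1 hne
  exact ⟨U ⊔ Submodule.span F {v}, le_sup_left,
    sup_le h (by rwa [Submodule.span_singleton_le_iff_mem]), Submodule.finrank_sup_span_singleton hvU⟩

theorem exists_chain {X Y : Submodule F V} (h : X ≤ Y) : ∃ c : ℕ → Submodule F V, Monotone c ∧
    (∀ i, X ≤ c i ∧ c i ≤ Y) ∧
    (∀ i, Module.finrank F (c i) = min (Module.finrank F X + i) (Module.finrank F Y)) := by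
  have step : ∀ Z : {Z : Submodule F V // X ≤ Z ∧ Z ≤ Y}, ∃ Z' : {Z : Submodule F V // X ≤ Z ∧ Z ≤ Y},
      Z.1 ≤ Z'.1 ∧ Module.finrank F Z'.1 = min (Module.finrank F Z.1 + 1) (Module.finrank F Y) := by
    rintro ⟨Z, hXZ, hZY⟩
    by_cases hlt : Module.finrank F Z < Module.finrank F Y
    · obtain ⟨W, h1, h2, h3⟩ := exists_succ hZY hlt
      exact ⟨⟨W, hXZ.trans h1, h2⟩, h1, by simp only; omega⟩
    · exact ⟨⟨Y, h, le_rfl⟩, hZY, by have := Submodule.finrank_mono hZY; simp only; omega⟩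
  choose nx h1 h2 using step
  let c : ℕ → {Z : Submodule F V // X ≤ Z ∧ Z ≤ Y} := fun i => Nat.rec ⟨X, le_rfl, h⟩ (fun _ Z => nx Z) i
  refine ⟨fun i => (c i).1, monotone_nat_of_le_succ fun i => h1 (c i), fun i => (c i).2, ?_⟩
  intro i
  have hxy := Submodule.finrank_mono h
  induction i with
  | zero => simp only [add_zero]; show Module.finrank F X = _; omega
  | succ i ih => 
    show Module.finrank F (nx (c i)).1 = _
    rw [h2]; simp only at ih; rw [ih]; omega

theorem exists_mid {U W : Submodule F V} (h : U ≤ W) {m : ℕ}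
    (h1 : Module.finrank F U ≤ m) (h2 : m ≤ Module.finrank F W) :
    ∃ X, U ≤ X ∧ X ≤ W ∧ Module.finrank F X = m := by
  obtain ⟨c, _, hb, hr⟩ := exists_chain h
  refine ⟨c (m - Module.finrank F U), (hb _).1, (hb _).2, ?_⟩
  rw [hr]; omega

variable (F V) in
/-- full flags -/
structure Flg where
  f : ℕ → Submodule F V
  mono : Monotone f
  rank : ∀ i, Module.finrank F (f i) = min i (Module.finrank F V)

theorem Flg.ext' {T T' : Flg F V} (h : ∀ i, T.f i = T'.f i) : T = T' := by
  cases T; cases T'; congr; funext i; exact h i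

theorem Flg.top (T : Flg F V) {i : ℕ} (hi : Module.finrank F V ≤ i) : T.f i = ⊤ :=
  Submodule.eq_top_of_finrank_eq (by rw [T.rank]; omega)

theorem Flg.zero (T : Flg F V) : T.f 0 = ⊥ := by
  rw [← Submodule.finrank_eq_zero (R := F), T.rank]; omega

instance flgFinite [Finite F] : Finite (Flg F V) := by
  have : Finite V := Module.finite_of_finite F
  apply Finite.of_injective (β := Fin (Module.finrank F V) → Submodule F V) (fun T i => T.f i)
  intro T T' h
  apply Flg.ext'
  intro i
  by_cases hi : i < Module.finrank F V
  · exact congrFun h ⟨i, hi⟩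
  · rw [T.top (by omega), T'.top (by omega)]

noncomputable instance flgFintype [Finite F] : Fintype (Flg F V) := Fintype.ofFinite _

instance flgCrd : Crd (Flg F V) (Submodule F V) := ⟨Flg.f⟩

theorem agr_iff {C : Set ℕ} {T T' : Flg F V} : Agr C T T' ↔ ∀ c ∈ C, T.f c = T'.f c := Iff.rfl

/-- hybrid at `c` -/
def hyb (T T' : Flg F V) (c : ℕ) (h : T.f c = T'.f c) : Flg F V where
  f i := if i ≤ c then T.f i else T'.f i
  mono := by
    intro i j hij
    simp only
    split_ifs with h1 h2
    · exact T.mono hij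
    · exact (T.mono h1).trans (h ▸ T'.mono (by omega))
    · omega
    · exact T'.mono hij
  rank i := by
    by_cases hi : i ≤ c
    · rw [if_pos hi]; exact T.rank i
    · rw [if_neg hi]; exact T'.rank i

theorem hyb_le {T T' : Flg F V} {c : ℕ} (h : T.f c = T'.f c) {i : ℕ} (hi : i ≤ c) :
    (hyb T T' c h).f i = T.f i := by simp [hyb, hi]

theorem hyb_ge {T T' : Flg F V} {c : ℕ} (h : T.f c = T'.f c) {i : ℕ} (hi : c ≤ i) :
    (hyb T T' c h).f i = T'.f i := by
  rcases hi.eq_or_lt with rfl | hi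
  · simp [hyb, h]
  · simp [hyb, not_le.2 hi]

theorem exists_rel {U Y : Submodule F V} (h : U ≤ Y) : ∃ p : ℕ → Submodule F V, Monotone p ∧
    (∀ i, p i ≤ Y) ∧ (∀ i, Module.finrank F (p i) = min i (Module.finrank F Y)) ∧
    p (Module.finrank F U) = U := by
  obtain ⟨c, cm, cb, cr⟩ := exists_chain (bot_le : (⊥ : Submodule F V) ≤ U)
  obtain ⟨e, em, eb, er⟩ := exists_chain h
  have hU := Submodule.finrank_mono h
  simp only [finrank_bot, zero_add] at cr
  refine ⟨fun i => if i ≤ Module.finrank F U then c i else e (i - Module.finrank F U), ?_, ?_, ?_, ?_⟩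
  · intro i j hij
    simp only
    split_ifs with h1 h2
    · exact cm hij
    · exact (cb i).2.trans (eb _).1
    · omega
    · exact em (by omega)
  · intro i; simp only; split_ifs
    · exact (cb i).2.trans h
    · exact (eb _).2
  · intro i
    by_cases hi : i ≤ Module.finrank F U <;> beta_reduce
    · rw [if_pos hi, cr]; omega
    · rw [if_neg hi, er]; omega
  · simp only [le_refl, if_true]
    exact Submodule.eq_of_le_of_finrank_eq (cb _).2 (by rw [cr]; omega)

theorem exists_flag_through (U : Submodule F V) : ∃ T : Flg F V, T.f (Module.finrank F U) = U := by
  obtain ⟨p, pm, pb, pr, pu⟩ := exists_rel (le_top : U ≤ ⊤)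
  exact ⟨⟨p, pm, by simpa using pr⟩, pu⟩

theorem exists_flag_through₂ {U W : Submodule F V} (h : U ≤ W) : ∃ T : Flg F V,
    T.f (Module.finrank F U) = U ∧ T.f (Module.finrank F W) = W := by
  obtain ⟨T, hT⟩ := exists_flag_through W
  obtain ⟨p, pm, pb, pr, pu⟩ := exists_rel h
  have hU := Submodule.finrank_mono h
  have hW := Submodule.finrank_le W
  refine ⟨⟨fun i => if i ≤ Module.finrank F W then p i else T.f i, ?_, ?_⟩, ?_, ?_⟩
  · intro i j hij
    simp only
    split_ifs with h1 h2
    · exact pm hij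
    · exact (pb i).trans (hT ▸ T.mono (by omega))
    · omega
    · exact T.mono hij
  · intro i
    by_cases hi : i ≤ Module.finrank F W
    · rw [if_pos hi, pr]; omega
    · rw [if_neg hi, T.rank]
  · simp only [hU, if_true, pu]
  · simp only [le_refl, if_true]
    exact Submodule.eq_of_le_of_finrank_eq (pb _) (by rw [pr]; omega)

theorem exists_flag : Nonempty (Flg F V) := ⟨(exists_flag_through (⊥ : Submodule F V)).choose⟩

theorem splice_up (T : Flg F V) {x : ℕ} {W : Submodule F V} (h : T.f x ≤ W) :
    ∃ T' : Flg F V, (∀ c ≤ x, T'.f c = T.f c) ∧ T'.f (Module.finrank F W) = W := by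
  by_cases hx : Module.finrank F V ≤ x
  · refine ⟨T, fun _ _ => rfl, ?_⟩
    have : W = ⊤ := top_le_iff.1 ((T.top hx) ▸ h)
    subst this
    rw [T.top]; simp
  · obtain ⟨T', h1, h2⟩ := exists_flag_through₂ h
    have hr : Module.finrank F (T.f x) = x := by rw [T.rank]; omega
    rw [hr] at h1
    refine ⟨hyb T T' x h1.symm, fun c hc => hyb_le _ hc, ?_⟩
    have := Submodule.finrank_mono h
    rw [hyb_ge _ (by omega), h2]

theorem splice_down (T : Flg F V) {x : ℕ} {W : Submodule F V} (h : W ≤ T.f x) :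
    ∃ T' : Flg F V, (∀ c ≥ x, T'.f c = T.f c) ∧ T'.f (Module.finrank F W) = W := by
  obtain ⟨T', h1, h2⟩ := exists_flag_through₂ h
  have hr : Module.finrank F (T.f x) = min x (Module.finrank F V) := T.rank x
  have hxx : T'.f x = T.f x := by
    by_cases hx : Module.finrank F V ≤ x
    · rw [T.top hx, T'.top hx]
    · rw [show Module.finrank F (T.f x) = x by omega] at h2; exact h2
  refine ⟨hyb T' T x hxx, fun c hc => hyb_ge _ hc, ?_⟩
  have := Submodule.finrank_mono h
  rw [hyb_le _ (by omega), h1]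

/-- splice between two levels -/
theorem splice_mid (T : Flg F V) {x y : ℕ} {W : Submodule F V} (h : T.f x ≤ W) (h' : W ≤ T.f y) :
    ∃ T' : Flg F V, (∀ c ≤ x, T'.f c = T.f c) ∧ (∀ c ≥ y, T'.f c = T.f c) ∧
      T'.f (Module.finrank F W) = W := by
  obtain ⟨T1, a1, a2⟩ := splice_up T h
  obtain ⟨T2, b1, b2⟩ := splice_down T h'
  have hx := Submodule.finrank_mono h
  have hy := Submodule.finrank_mono h'
  have hW := Submodule.finrank_le W
  rw [T.rank] at hx hy
  refine ⟨hyb T1 T2 _ (a2.trans b2.symm), ?_, ?_, ?_⟩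
  · intro c hc
    by_cases hc2 : c ≤ Module.finrank F W
    · rw [hyb_le _ hc2, a1 c hc]
    · have h1 : Module.finrank F V ≤ c := by omega
      rw [Flg.top _ h1, Flg.top _ h1]
  · intro c hc
    rw [hyb_ge _ (by omega), b1 c hc]
  · rw [hyb_le _ le_rfl, a2]

theorem exists_basis (T : Flg F V) : ∃ b : Module.Basis (Fin (Module.finrank F V)) F V,
    ∀ j : ℕ, T.f j = Submodule.span F (b '' {i | (i : ℕ) < j}) := by
  have hv : ∀ i : Fin (Module.finrank F V), ∃ v, v ∈ T.f (i+1) ∧ v ∉ T.f i := by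
    intro i
    have : ¬ T.f (i+1) ≤ T.f i := fun h => by
      have := Submodule.finrank_mono h
      rw [T.rank, T.rank] at this
      have := i.2; omega
    exact SetLike.not_le_iff_exists.1 this
  choose v hv1 hv2 using hv
  have key : ∀ j : ℕ, T.f j = Submodule.span F (v '' {i | (i : ℕ) < j}) := by
    intro j
    induction j with
    | zero => simp [T.zero]
    | succ j ih =>
      by_cases hj : j < Module.finrank F V
      · symm
        have hset : {i : Fin (Module.finrank F V) | (i:ℕ) < j + 1} = insert (⟨j, hj⟩ : Fin (Module.finrank F V)) {i : Fin (Module.finrank F V) | (i:ℕ) < j} := by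
          ext i; simp [Fin.ext_iff]; omega
        rw [hset, Set.image_insert_eq, Submodule.span_insert, ← ih, sup_comm]
        apply Submodule.eq_of_le_of_finrank_eq
        · apply sup_le (T.mono (by omega))
          rw [Submodule.span_singleton_le_iff_mem]; exact hv1 ⟨j, hj⟩
        · rw [Submodule.finrank_sup_span_singleton (hv2 ⟨j, hj⟩), T.rank, T.rank]; simp only; omega
      · have hset : {i : Fin (Module.finrank F V) | (i:ℕ) < j + 1} = {i : Fin (Module.finrank F V) | (i:ℕ) < j} := by
          ext i; have := i.2; simp only [Set.mem_ofPred_eq]; omega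
        rw [hset, ← ih, T.top (by omega), T.top (by omega)]
  have hspan : ⊤ ≤ Submodule.span F (Set.range v) := by
    have := key (Module.finrank F V)
    rw [T.top le_rfl] at this
    rw [this]
    exact Submodule.span_mono (Set.image_subset_range _ _)
  refine ⟨basisOfTopLeSpanOfCardEqFinrank v hspan (by simp), ?_⟩
  intro j
  rw [key j, coe_basisOfTopLeSpanOfCardEqFinrank]

theorem trans_gl (T T' : Flg F V) : ∃ γ : V ≃ₗ[F] V, ∀ i, (T.f i).map γ.toLinearMap = T'.f i := by
  obtain ⟨b, hb⟩ := exists_basis T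
  obtain ⟨b', hb'⟩ := exists_basis T'
  refine ⟨b.equiv b' (Equiv.refl _), fun i => ?_⟩
  rw [hb, hb', Submodule.map_span, ← Set.image_comp]
  congr 1
  apply Set.image_congr
  intro x _
  simp

/-- action of `GL` on flags -/
def act (γ : V ≃ₗ[F] V) : Flg F V ≃ Flg F V where
  toFun T := ⟨fun i => (T.f i).map γ.toLinearMap, fun i j h => Submodule.map_mono (T.mono h),
    fun i => by rw [← T.rank i]; exact LinearEquiv.finrank_map_eq γ _⟩
  invFun T := ⟨fun i => (T.f i).map γ.symm.toLinearMap, fun i j h => Submodule.map_mono (T.mono h),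
    fun i => by rw [← T.rank i]; exact LinearEquiv.finrank_map_eq γ.symm _⟩
  left_inv T := by
    apply Flg.ext'; intro i
    simp [← Submodule.map_comp]
  right_inv T := by
    apply Flg.ext'; intro i
    simp [← Submodule.map_comp]

theorem act_f (γ : V ≃ₗ[F] V) (T : Flg F V) (i : ℕ) : (act γ T).f i = (T.f i).map γ.toLinearMap := rfl

theorem map_inj (γ : V ≃ₗ[F] V) {W W' : Submodule F V}
    (h : W.map γ.toLinearMap = W'.map γ.toLinearMap) : W = W' :=
  Submodule.map_injective_of_injective γ.injective h

theorem act_agr (γ : V ≃ₗ[F] V) {C : Set ℕ} {T T' : Flg F V} :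
    Agr C (act γ T) (act γ T') ↔ Agr C T T' := by
  simp only [agr_iff, act_f]
  exact forall₂_congr fun c _ => ⟨map_inj γ, fun h => by rw [h]⟩

theorem trans_gl' (T T' : Flg F V) : ∃ γ : V ≃ₗ[F] V, act γ T = T' := by
  obtain ⟨γ, h⟩ := trans_gl T T'
  exact ⟨γ, Flg.ext' h⟩

end flags

set_option linter.style.haveILetI false

section grass
variable {F V : Type} [Field F] [AddCommGroup V] [Module F V] [FiniteDimensional F V]
  [Fintype F] [Fintype (Submodule F V)]

noncomputable def Gr (U U' : Submodule F V) (m : ℕ) : Finset (Submodule F V) :=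
  univ.filter fun w => U ≤ w ∧ w ≤ U' ∧ Module.finrank F w = m

theorem mem_Gr {U U' : Submodule F V} {m : ℕ} {w : Submodule F V} :
    w ∈ Gr U U' m ↔ U ≤ w ∧ w ≤ U' ∧ Module.finrank F w = m := by simp [Gr]

def gs (q m : ℕ) : ℕ := ∑ i ∈ range m, q ^ i

theorem gs_succ (q m : ℕ) : gs q (m + 1) = q * gs q m + 1 := by
  unfold gs
  rw [Finset.sum_range_succ', Finset.mul_sum]
  simp [pow_succ, mul_comm]

theorem gs_mul (q m : ℕ) (hq : 1 ≤ q) : gs q m * (q - 1) = q ^ m - 1 := by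
  have h := geom_sum_mul_add (R := ℕ) (q - 1) m
  rw [Nat.sub_add_cancel hq] at h
  unfold gs; omega

theorem card_filter_mem [Fintype V] (X : Submodule F V) :
    (univ.filter fun v : V => v ∈ X).card = Fintype.card F ^ Module.finrank F X := by
  rw [← Module.card_eq_pow_finrank (K := F) (V := X), Fintype.card_subtype]

theorem card_filter_diff [Fintype V] {w z : Submodule F V} (h : w ≤ z) :
    (univ.filter fun v : V => v ∈ z ∧ v ∉ w).card =
      Fintype.card F ^ Module.finrank F z - Fintype.card F ^ Module.finrank F w := by
  rw [← card_filter_mem, ← card_filter_mem, ← Finset.card_sdiff_of_subset]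
  · congr 1; ext v; simp
  · intro v; simp only [Finset.mem_filter, Finset.mem_univ, true_and]; exact fun hv => h hv

theorem card_up {w U' : Submodule F V} (h : w ≤ U') {e : ℕ}
    (he : Module.finrank F U' = Module.finrank F w + e) :
    (Gr w U' (Module.finrank F w + 1)).card = gs (Fintype.card F) e := by
  haveI : Finite V := Module.finite_of_finite F
  letI : Fintype V := Fintype.ofFinite V
  set q := Fintype.card F with hq
  have hq2 : 2 ≤ q := Fintype.one_lt_card
  set b := Module.finrank F w with hb
  have hmap : ∀ v ∈ (univ.filter fun v : V => v ∈ U' ∧ v ∉ w),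
      w ⊔ Submodule.span F {v} ∈ Gr w U' (b + 1) := by
    intro v hv
    rw [Finset.mem_filter] at hv
    rw [mem_Gr]
    exact ⟨le_sup_left, sup_le h (by rw [Submodule.span_singleton_le_iff_mem]; exact hv.2.1),
      Submodule.finrank_sup_span_singleton hv.2.2⟩
  have h1 := Finset.card_eq_sum_card_fiberwise hmap
  have h2 : ∀ z ∈ Gr w U' (b + 1), ((univ.filter fun v : V => v ∈ U' ∧ v ∉ w).filter
      (fun v => w ⊔ Submodule.span F {v} = z)).card = q ^ (b + 1) - q ^ b := by
    intro z hz
    rw [mem_Gr] at hz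
    obtain ⟨hz1, hz2, hz3⟩ := hz
    rw [← hz3, hb, hq, ← card_filter_diff hz1]
    congr 1
    ext v
    simp only [Finset.mem_filter, Finset.mem_univ, true_and]
    constructor
    · rintro ⟨⟨_, h4⟩, h5⟩
      refine ⟨?_, h4⟩
      rw [← h5]
      exact (le_sup_right : _ ≤ w ⊔ Submodule.span F {v}) (Submodule.mem_span_singleton_self v)
    · rintro ⟨h4, h5⟩
      refine ⟨⟨hz2 h4, h5⟩, ?_⟩
      apply Submodule.eq_of_le_of_finrank_eq
      · exact sup_le hz1 (by rw [Submodule.span_singleton_le_iff_mem]; exact h4)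
      · rw [Submodule.finrank_sup_span_singleton h5, hz3]
  rw [Finset.sum_congr rfl h2, Finset.sum_const, smul_eq_mul, card_filter_diff h, he] at h1
  have h3 : q ^ (b + 1) - q ^ b = q ^ b * (q - 1) := by rw [Nat.mul_sub, pow_succ, mul_one]
  have h4 : q ^ (b + e) - q ^ b = q ^ b * (gs q e * (q - 1)) := by
    rw [gs_mul q e (by omega), Nat.mul_sub, pow_add, mul_one]
  rw [← hq, ← hb, h3, h4] at h1
  have hpos : 0 < q ^ b * (q - 1) := Nat.mul_pos (pow_pos (by omega) _) (by omega)
  apply Nat.eq_of_mul_eq_mul_right hpos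
  rw [← h1]; ring

theorem card_down {U w : Submodule F V} (h : U ≤ w) {m : ℕ}
    (hm : Module.finrank F w = Module.finrank F U + (m + 1)) :
    (Gr U w (Module.finrank F U + m)).card = gs (Fintype.card F) (m + 1) := by
  haveI : Finite V := Module.finite_of_finite F
  haveI : Finite (Module.Dual F V) := Module.finite_of_finite F
  letI : Fintype (Submodule F (Module.Dual F V)) := Fintype.ofFinite _
  have e := Subspace.orderIsoFiniteDimensional (K := F) (V := V)
  have r1 : ∀ W : Submodule F V, Module.finrank F W + Module.finrank F W.dualAnnihilator = Module.finrank F V :=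
    fun W => Subspace.finrank_add_finrank_dualAnnihilator_eq W
  have hle : ∀ W W' : Submodule F V, W'.dualAnnihilator ≤ W.dualAnnihilator ↔ W ≤ W' :=
    fun W W' => Subspace.dualAnnihilator_le_dualAnnihilator_iff
  have hu := card_up (w := w.dualAnnihilator) (U' := U.dualAnnihilator) ((hle _ _).2 h) (e := m + 1)
    (by have := r1 w; have := r1 U; omega)
  rw [← hu]
  apply Finset.card_bij (fun y _ => y.dualAnnihilator)
  · intro y hy
    rw [mem_Gr] at hy ⊢
    refine ⟨(hle _ _).2 hy.2.1, (hle _ _).2 hy.1, ?_⟩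
    have := r1 w; have := r1 y; omega
  · intro y _ y' _ hyy
    exact le_antisymm ((hle _ _).1 hyy.ge) ((hle _ _).1 hyy.le)
  · intro z hz
    rw [mem_Gr] at hz
    refine ⟨z.dualCoannihilator, ?_, Subspace.dualCoannihilator_dualAnnihilator_eq⟩
    have hzz : z.dualCoannihilator.dualAnnihilator = z := Subspace.dualCoannihilator_dualAnnihilator_eq
    rw [mem_Gr]
    refine ⟨(hle _ _).1 (by rw [hzz]; exact hz.2.1), (hle _ _).1 (by rw [hzz]; exact hz.1), ?_⟩
    have h1 := r1 z.dualCoannihilator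
    rw [hzz] at h1
    have := r1 w; omega

/-- incidence -/
noncomputable def inc (w z : Submodule F V) : ℝ := if w ≤ z then 1 else 0

theorem inc_mul_self (w z : Submodule F V) : inc w z * inc w z = inc w z := by
  simp only [inc]; split_ifs <;> norm_num

theorem offdiag {U U' w w' : Submodule F V} {b : ℕ} (hw : w ∈ Gr U U' (b+1)) (hw' : w' ∈ Gr U U' (b+1))
    (hne : w ≠ w') :
    ∑ z ∈ Gr U U' (b+2), inc w z * inc w' z = ∑ y ∈ Gr U U' b, inc y w * inc y w' := by
  rw [mem_Gr] at hw hw'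
  have hmod := Submodule.finrank_sup_add_finrank_inf_eq w w'
  have hlt : Module.finrank F (w ⊓ w' : Submodule F V) < b + 1 := by
    by_contra hc
    have h1 : w ⊓ w' = w := Submodule.eq_of_le_of_finrank_le inf_le_left (by omega)
    have h2 : w ⊓ w' = w' := Submodule.eq_of_le_of_finrank_le inf_le_right (by omega)
    exact hne (h1.symm.trans h2)
  have e1 : ∀ z, inc w z * inc w' z = if w ⊔ w' ≤ z then 1 else 0 := by
    intro z; simp only [inc, sup_le_iff]; split_ifs <;> simp_all
  have e2 : ∀ z, inc z w * inc z w' = if z ≤ w ⊓ w' then 1 else 0 := by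
    intro z; simp only [inc, le_inf_iff]; split_ifs <;> simp_all
  simp_rw [e1, e2]
  by_cases hr : Module.finrank F (w ⊓ w' : Submodule F V) = b
  · rw [Finset.sum_eq_single (w ⊔ w'), Finset.sum_eq_single (w ⊓ w')]
    · simp
    · intro y hy hyn
      rw [mem_Gr] at hy
      rw [if_neg]
      intro hle
      exact hyn (Submodule.eq_of_le_of_finrank_eq hle (by omega))
    · intro h; exact absurd (mem_Gr.2 ⟨le_inf hw.1 hw'.1, inf_le_left.trans hw.2.1, hr⟩) h
    · intro z hz hzn
      rw [mem_Gr] at hz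
      rw [if_neg]
      intro hle
      exact hzn (Submodule.eq_of_le_of_finrank_eq hle (by omega)).symm
    · intro h; exact absurd (mem_Gr.2 ⟨hw.1.trans le_sup_left, sup_le hw.2.1 hw'.2.1, by omega⟩) h
  · rw [Finset.sum_eq_zero, Finset.sum_eq_zero]
    · intro y hy
      rw [mem_Gr] at hy
      rw [if_neg]
      intro hle
      have := Submodule.finrank_mono hle; omega
    · intro z hz
      rw [mem_Gr] at hz
      rw [if_neg]
      intro hle
      have := Submodule.finrank_mono hle; omega

theorem diag_up {U U' : Submodule F V} {u m D : ℕ} (hu : Module.finrank F U = u)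
    (hD : Module.finrank F U' = u + D) {w : Submodule F V} (hw : w ∈ Gr U U' (u+m)) :
    ∑ z ∈ Gr U U' (u+m+1), inc w z = gs (Fintype.card F) (D - m) := by
  rw [mem_Gr] at hw
  have hle := Submodule.finrank_mono hw.2.1
  rw [← card_up hw.2.1 (e := D - m) (by omega)]
  simp only [inc]
  rw [Finset.sum_boole]
  congr 2
  ext z
  simp only [Finset.mem_filter, mem_Gr, hw.2.2]
  constructor
  · rintro ⟨⟨h1, h2, h3⟩, h4⟩; exact ⟨h4, h2, h3⟩
  · rintro ⟨h4, h2, h3⟩; exact ⟨⟨hw.1.trans h4, h2, h3⟩, h4⟩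

theorem diag_down {U U' : Submodule F V} {u m : ℕ} (hu : Module.finrank F U = u)
    {w : Submodule F V} (hw : w ∈ Gr U U' (u+(m+1))) :
    ∑ y ∈ Gr U U' (u+m), inc y w = gs (Fintype.card F) (m+1) := by
  rw [mem_Gr] at hw
  rw [← card_down hw.1 (m := m) (by omega), hu]
  simp only [inc]
  rw [Finset.sum_boole]
  congr 2
  ext z
  simp only [Finset.mem_filter, mem_Gr]
  constructor
  · rintro ⟨⟨h1, h2, h3⟩, h4⟩; exact ⟨h1, h4, h3⟩
  · rintro ⟨h1, h2, h3⟩; exact ⟨⟨h1, h2.trans hw.2.1, h3⟩, h2⟩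

noncomputable def sg (q m : ℕ) : ℝ := ∑ j ∈ range m, 1 / (gs q (j+2) : ℝ)

theorem sg_le (q m : ℕ) (hq : 2 ≤ q) : sg q m ≤ 2 / q ∧ 0 ≤ sg q m := by
  have hq' : (2:ℝ) ≤ q := by exact_mod_cast hq
  have hq0 : (0:ℝ) < q := by linarith
  constructor
  · have h1 : sg q m ≤ 2 / q * (1 - (1/2) ^ m) := by
      unfold sg
      induction m with
      | zero => simp
      | succ m ih =>
        rw [Finset.sum_range_succ]
        have hg : (q:ℝ) * 2 ^ m ≤ gs q (m+2) := by
          have : q * 2 ^ m ≤ gs q (m+2) := by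
            unfold gs
            calc q * 2 ^ m ≤ q * q ^ m := Nat.mul_le_mul_left _ (Nat.pow_le_pow_left hq m)
              _ = q ^ (m+1) := by ring
              _ ≤ _ := Finset.single_le_sum (f := fun i => q ^ i) (fun i _ => Nat.zero_le _) (by simp)
          exact_mod_cast this
        have h2 : 1 / (gs q (m+2) : ℝ) ≤ 1 / (q * 2 ^ m) :=
          one_div_le_one_div_of_le (by positivity) hg
        have h3 : 2 / (q:ℝ) * (1 - (1/2) ^ (m+1)) = 2 / q * (1 - (1/2)^m) + 1 / (q * 2 ^ m) := by
          rw [pow_succ, one_div_pow]; field_simp; ring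
        linarith
    refine h1.trans ?_
    have : 0 ≤ 2 / (q:ℝ) := by positivity
    have h2 : (0:ℝ) ≤ (1/2)^m := by positivity
    nlinarith
  · exact Finset.sum_nonneg fun _ _ => by positivity

theorem LL {U U' : Submodule F V} (hUU : U ≤ U') {u D : ℕ} (hu : Module.finrank F U = u)
    (hD : Module.finrank F U' = u + D) (m : ℕ) : m + 1 ≤ D → ∀ φ : Submodule F V → ℝ,
    ∑ w ∈ Gr U U' (u+m), φ w = 0 →
    ∑ z ∈ Gr U U' (u+m+1), (∑ w ∈ Gr U U' (u+m), φ w * inc w z) ^ 2 ≤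
      sg (Fintype.card F) m * (gs (Fintype.card F) (D - m) * gs (Fintype.card F) (m + 1)) *
        ∑ w ∈ Gr U U' (u+m), φ w ^ 2 := by
  set q := Fintype.card F with hq
  have hq2 : 2 ≤ q := Fintype.one_lt_card
  induction m with
  | zero =>
    intro _ φ hφ
    have hG : Gr U U' (u+0) = {U} := by
      ext w
      rw [mem_Gr, Finset.mem_singleton]
      constructor
      · rintro ⟨h1, h2, h3⟩
        exact (Submodule.eq_of_le_of_finrank_eq h1 (by omega)).symm
      · rintro rfl; exact ⟨le_rfl, hUU, by omega⟩
    rw [hG] at hφ ⊢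
    simp only [Finset.sum_singleton] at hφ ⊢
    simp [hφ]
  | succ m ih =>
    intro hmD φ hφ
    set G0 := Gr U U' (u+m) with hG0
    set G1 := Gr U U' (u+(m+1)) with hG1
    set G2 := Gr U U' (u+(m+1)+1) with hG2
    set ψ : Submodule F V → ℝ := fun y => ∑ w ∈ G1, φ w * inc y w with hψ
    set N := ∑ w ∈ G1, φ w ^ 2 with hN
    have hN0 : 0 ≤ N := Finset.sum_nonneg fun _ _ => sq_nonneg _
    set Sd := ∑ y ∈ G0, ψ y ^ 2 with hSd
    have hSd0 : 0 ≤ Sd := Finset.sum_nonneg fun _ _ => sq_nonneg _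
    have hdd : ∀ w ∈ G1, ∑ y ∈ G0, inc y w = (gs q (m+1) : ℝ) := fun w hw => diag_down hu hw
    have hdu : ∀ w ∈ G1, ∑ z ∈ G2, inc w z = (gs q (D - (m+1)) : ℝ) := fun w hw => diag_up hu hD hw
    have hψ0 : ∑ y ∈ G0, ψ y = 0 := by
      simp only [hψ]
      rw [Finset.sum_comm]
      simp_rw [← Finset.mul_sum]
      rw [Finset.sum_congr rfl fun w hw => by rw [hdd w hw], ← Finset.sum_mul, hφ, zero_mul]
    have hih := ih (by omega) ψ hψ0
    -- quadratic expansions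
    have expU : ∑ z ∈ G2, (∑ w ∈ G1, φ w * inc w z) ^ 2 =
        ∑ w ∈ G1, ∑ w' ∈ G1, φ w * φ w' * ∑ z ∈ G2, inc w z * inc w' z := by
      simp_rw [sq, Finset.sum_mul_sum, Finset.mul_sum]
      rw [Finset.sum_comm]
      apply Finset.sum_congr rfl; intro w _
      rw [Finset.sum_comm]
      apply Finset.sum_congr rfl; intro w' _
      apply Finset.sum_congr rfl; intro z _
      ring
    have expD : Sd = ∑ w ∈ G1, ∑ w' ∈ G1, φ w * φ w' * ∑ y ∈ G0, inc y w * inc y w' := by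
      simp only [hSd, hψ]
      simp_rw [sq, Finset.sum_mul_sum, Finset.mul_sum]
      rw [Finset.sum_comm]
      apply Finset.sum_congr rfl; intro w _
      rw [Finset.sum_comm]
      apply Finset.sum_congr rfl; intro w' _
      apply Finset.sum_congr rfl; intro z _
      ring
    have hdiff : ∑ z ∈ G2, (∑ w ∈ G1, φ w * inc w z) ^ 2 =
        Sd + ((gs q (D - (m+1)) : ℝ) - gs q (m+1)) * N := by
      rw [expU, expD, hN, Finset.mul_sum, ← Finset.sum_add_distrib]
      apply Finset.sum_congr rfl; intro w hw
      have : ∀ w' ∈ G1, φ w * φ w' * ∑ z ∈ G2, inc w z * inc w' z =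
          φ w * φ w' * ∑ y ∈ G0, inc y w * inc y w' +
           if w = w' then ((gs q (D - (m+1)) : ℝ) - gs q (m+1)) * φ w ^ 2 else 0 := by
        intro w' hw'
        by_cases hww : w = w'
        · subst hww
          simp_rw [inc_mul_self]
          rw [hdd w hw, hdu w hw, if_pos trivial]; ring
        · rw [if_neg hww, add_zero]; congr 1; exact offdiag (b := u + m) hw hw' hww
      rw [Finset.sum_congr rfl this, Finset.sum_add_distrib, Finset.sum_ite_eq, if_pos hw]
    -- bound on Sd
    set s := sg q m with hs
    have hs0 : 0 ≤ s := (sg_le q m hq2).2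
    have hs1 : s ≤ 1 := (sg_le q m hq2).1.trans (by
      have hq' : (2:ℝ) ≤ q := by exact_mod_cast hq2
      rw [div_le_one (by linarith)]; exact hq')
    set a : ℝ := (gs q (D - (m+1)) : ℝ) with ha
    set c : ℝ := (gs q (m+1) : ℝ) with hc
    have ha0 : 0 ≤ a := by positivity
    have hc1 : 1 ≤ c := by rw [hc, gs_succ]; push_cast; nlinarith [Nat.zero_le (q * gs q m), (by positivity : (0:ℝ) ≤ q * gs q m)]
    have hDm : (gs q (D - m) : ℝ) = q * a + 1 := by
      rw [show D - m = (D - (m+1)) + 1 by omega, gs_succ]; push_cast; rfl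
    have hc2 : (gs q (m+1+1) : ℝ) = q * c + 1 := by rw [gs_succ]; push_cast; rfl
    have hSdN : Sd ≤ s * ((q * a + 1) * c) * N := by
      have hadj : Sd = ∑ w ∈ G1, φ w * ∑ y ∈ G0, ψ y * inc y w := by
        rw [hSd]
        simp_rw [Finset.mul_sum]
        rw [Finset.sum_comm]
        apply Finset.sum_congr rfl; intro y _
        rw [sq]; conv_lhs => rw [hψ]
        simp only
        rw [Finset.sum_mul]
        apply Finset.sum_congr rfl; intro w _
        simp only [hψ]; ring
      have hcs := Finset.sum_mul_sq_le_sq_mul_sq G1 φ (fun w => ∑ y ∈ G0, ψ y * inc y w)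
      rw [← hadj] at hcs
      rw [hDm] at hih
      have h5 : Sd ^ 2 ≤ N * (s * ((q * a + 1) * c) * Sd) := hcs.trans (mul_le_mul_of_nonneg_left hih hN0)
      rcases hSd0.eq_or_lt with h0 | h0
      · rw [← h0]; positivity
      · have : Sd * Sd ≤ Sd * (s * ((q * a + 1) * c) * N) := by nlinarith
        exact le_of_mul_le_mul_left this h0
    rw [hdiff, hc2]
    have hsg : sg q (m+1) = s + 1 / (q * c + 1) := by
      rw [hs, ← hc2]; unfold sg; rw [Finset.sum_range_succ]
    rw [hsg]
    have hq0 : (0:ℝ) ≤ q := by positivity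
    have hqc : 0 < q * c + 1 := by positivity
    have hfin : s * ((q * a + 1) * c) + (a - c) ≤ (s + 1 / (q * c + 1)) * (a * (q * c + 1)) := by
      have : (s + 1 / (q * c + 1)) * (a * (q * c + 1)) = s * (a * (q * c + 1)) + a := by
        field_simp
      rw [this]
      nlinarith [mul_nonneg hs0 ha0]
    calc Sd + (a - c) * N ≤ (s * ((q * a + 1) * c) + (a - c)) * N := by nlinarith
      _ ≤ _ := mul_le_mul_of_nonneg_right hfin hN0

/-- double counting -/
theorem Gr_count {U U' : Submodule F V} {u D : ℕ} (hu : Module.finrank F U = u)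
    (hD : Module.finrank F U' = u + D) (m : ℕ) :
    ((Gr U U' (u+m)).card : ℝ) * gs (Fintype.card F) (D - m) =
      (Gr U U' (u+m+1)).card * gs (Fintype.card F) (m + 1) := by
  have h1 : ∑ w ∈ Gr U U' (u+m), ∑ z ∈ Gr U U' (u+m+1), inc w z =
      ∑ z ∈ Gr U U' (u+m+1), ∑ w ∈ Gr U U' (u+m), inc w z := Finset.sum_comm
  rw [Finset.sum_congr rfl fun w hw => diag_up hu hD hw,
    Finset.sum_congr rfl fun z hz => diag_down hu (m := m) (by rw [add_assoc] at hz; exact hz)] at h1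
  simpa using h1

end grass


section plflags
variable {F V : Type} [Field F] [AddCommGroup V] [Module F V] [FiniteDimensional F V]
  [Fintype F]

theorem hyb_agr {C : Set ℕ} {T T' T0 : Flg F V} {c : ℕ} (h : T.f c = T'.f c)
    (h1 : Agr C T0 T) (h2 : Agr C T0 T') : Agr C T0 (hyb T T' c h) := by
  intro i hi
  show T0.f i = (hyb T T' c h).f i
  by_cases hc : i ≤ c
  · rw [hyb_le h hc]; exact h1 i hi
  · rw [hyb_ge h (by omega)]; exact h2 i hi

theorem SEP {C : Set ℕ} {c : ℕ} (hc : c ∈ C) {X Y : Flg F V → ℝ}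
    (hX : Meas (C ∪ Set.Iio c) X) (hY : Meas (C ∪ Set.Ioi c) Y) (T0 : Flg F V) :
    ce C (fun T => X T * Y T) T0 = ce C X T0 * ce C Y T0 := by
  have hf : ∀ T ∈ fib C T0, ∀ T' ∈ fib C T0, T.f c = T'.f c := by
    intro T hT T' hT'
    exact ((mem_fib.1 hT).symm.trans (mem_fib.1 hT')) c hc
  have key : (∑ T ∈ fib C T0, X T) * (∑ T ∈ fib C T0, Y T) =
      (fib C T0).card * ∑ T ∈ fib C T0, X T * Y T := by
    rw [Finset.sum_mul_sum, ← Finset.sum_product']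
    have : ((fib C T0).card : ℝ) * ∑ T ∈ fib C T0, X T * Y T =
        ∑ p ∈ fib C T0 ×ˢ fib C T0, X p.1 * Y p.1 := by
      rw [Finset.sum_product]
      simp only [Finset.sum_const, nsmul_eq_mul]
      rw [Finset.mul_sum]
    rw [this]
    have hsw : ∀ p ∈ fib C T0 ×ˢ fib C T0, p.1.f c = p.2.f c := fun p hp => by
      rw [Finset.mem_product] at hp; exact hf _ hp.1 _ hp.2
    refine Finset.sum_bij' (fun p hp => (hyb p.1 p.2 c (hsw p hp), hyb p.2 p.1 c (hsw p hp).symm))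
      (fun p hp => (hyb p.1 p.2 c (hsw p hp), hyb p.2 p.1 c (hsw p hp).symm)) ?_ ?_ ?_ ?_ ?_
    · intro p hp
      have hpc := hsw p hp
      rw [Finset.mem_product] at hp ⊢
      exact ⟨mem_fib.2 (hyb_agr hpc (mem_fib.1 hp.1) (mem_fib.1 hp.2)),
        mem_fib.2 (hyb_agr hpc.symm (mem_fib.1 hp.2) (mem_fib.1 hp.1))⟩
    · intro p hp
      have hpc := hsw p hp
      rw [Finset.mem_product] at hp ⊢
      exact ⟨mem_fib.2 (hyb_agr hpc (mem_fib.1 hp.1) (mem_fib.1 hp.2)),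
        mem_fib.2 (hyb_agr hpc.symm (mem_fib.1 hp.2) (mem_fib.1 hp.1))⟩
    · intro p hp
      ext1 <;> apply Flg.ext' <;> intro i <;> by_cases hi : i ≤ c <;> simp [hyb, hi]
    · intro p hp
      ext1 <;> apply Flg.ext' <;> intro i <;> by_cases hi : i ≤ c <;> simp [hyb, hi]
    · intro p hp
      have hpc := hsw p hp
      rw [Finset.mem_product] at hp
      have hag : Agr C p.1 (hyb p.1 p.2 c hpc) :=
        (mem_fib.1 hp.1).symm.trans (hyb_agr _ (mem_fib.1 hp.1) (mem_fib.1 hp.2))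
      have hag2 : Agr C p.2 (hyb p.1 p.2 c hpc) :=
        (mem_fib.1 hp.2).symm.trans (hyb_agr _ (mem_fib.1 hp.1) (mem_fib.1 hp.2))
      congr 1
      · apply hX
        rintro i (hi | hi)
        · exact hag i hi
        · exact (hyb_le hpc (le_of_lt hi)).symm
      · apply hY
        rintro i (hi | hi)
        · exact hag2 i hi
        · exact (hyb_ge hpc (le_of_lt hi)).symm
  unfold ce
  have := fib_card_pos C T0
  rw [div_mul_div_comm, key]
  field_simp

variable [Fintype (Submodule F V)]

theorem UNI {C : Set ℕ} {lo b hi : ℕ} (hlo : lo ∈ C) (hhi : hi ∈ C) (h1 : lo < b) (h2 : b < hi)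
    (hn : hi ≤ Module.finrank F V) (hgap : ∀ c ∈ C, c ≤ lo ∨ hi ≤ c) (T0 : Flg F V)
    (φ : Submodule F V → ℝ) :
    ce C (fun T => φ (T.f b)) T0 =
      (∑ w ∈ Gr (T0.f lo) (T0.f hi) b, φ w) / ((Gr (T0.f lo) (T0.f hi) b).card : ℝ) := by
  set G := Gr (T0.f lo) (T0.f hi) b with hG
  have hmap : ∀ T ∈ fib C T0, T.f b ∈ G := by
    intro T hT
    have hag := mem_fib.1 hT
    rw [hG, mem_Gr]
    refine ⟨?_, ?_, by rw [T.rank]; omega⟩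
    · have : T0.f lo = T.f lo := hag lo hlo
      rw [this]; exact T.mono h1.le
    · have : T0.f hi = T.f hi := hag hi hhi
      rw [this]; exact T.mono h2.le
  have hex : ∀ w ∈ G, ∃ T, T ∈ fib C T0 ∧ T.f b = w := by
    intro w hw
    rw [hG, mem_Gr] at hw
    obtain ⟨T', a1, a2, a3⟩ := splice_mid T0 hw.1 hw.2.1
    refine ⟨T', mem_fib.2 fun c hc => ?_, by rw [← hw.2.2]; exact a3⟩
    rcases hgap c hc with h | h
    · exact (a1 c h).symm
    · exact (a2 c h).symm
  have hle : ∀ w ∈ G, ∀ w' ∈ G, ((fib C T0).filter fun T => T.f b = w).card ≤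
      ((fib C T0).filter fun T => T.f b = w').card := by
    intro w hw w' hw'
    obtain ⟨T, hT, hTw⟩ := hex w hw
    obtain ⟨T', hT', hTw'⟩ := hex w' hw'
    obtain ⟨γ, hγ⟩ := trans_gl' T T'
    apply Finset.card_le_card_of_injOn (act γ)
    · intro S hS
      have hS' := Finset.mem_filter.1 (Finset.mem_coe.1 hS)
      refine Finset.mem_coe.2 (Finset.mem_filter.2 ⟨mem_fib.2 ?_, ?_⟩)
      · have e1 : Agr C T S := (mem_fib.1 hT).symm.trans (mem_fib.1 hS'.1)
        have e2 := (act_agr γ).2 e1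
        rw [hγ] at e2
        exact (mem_fib.1 hT').trans e2
      · rw [act_f, hS'.2, ← hTw', ← hγ, act_f, hTw]
    · exact (act γ).injective.injOn
  obtain ⟨w0, hw0⟩ : G.Nonempty := ⟨T0.f b, hmap T0 (self_mem_fib C T0)⟩
  set N := ((fib C T0).filter fun T => T.f b = w0).card with hN
  have hNw : ∀ w ∈ G, ((fib C T0).filter fun T => T.f b = w).card = N := fun w hw =>
    le_antisymm (hle w hw w0 hw0) (hle w0 hw0 w hw)
  have hcard : (fib C T0).card = G.card * N := by
    rw [Finset.card_eq_sum_card_fiberwise hmap, Finset.sum_congr rfl hNw, Finset.sum_const, smul_eq_mul]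
  have hsum : ∑ T ∈ fib C T0, φ (T.f b) = N * ∑ w ∈ G, φ w := by
    rw [← Finset.sum_fiberwise_of_maps_to hmap, Finset.mul_sum]
    apply Finset.sum_congr rfl
    intro w hw
    rw [← hNw w hw, ← nsmul_eq_mul, ← Finset.sum_const]
    apply Finset.sum_congr rfl
    intro T hT
    rw [(Finset.mem_filter.1 hT).2]
  unfold ce
  have hp := fib_card_pos C T0
  rw [hsum, hcard]
  rw [hcard] at hp
  push_cast at hp ⊢
  have hN0 : (N:ℝ) ≠ 0 := fun h => by rw [h] at hp; simp at hp
  rw [mul_comm (G.card : ℝ), mul_div_mul_left _ _ hN0]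

theorem LLce_aux {C : Set ℕ} {lo b hi : ℕ} (hlo : lo ∈ C) (hhi : hi ∈ C) (h1 : lo < b) (h2 : b + 1 < hi)
    (hn : hi ≤ Module.finrank F V) (hgap : ∀ c ∈ C, c ≤ lo ∨ hi ≤ c) (T0 : Flg F V)
    (X : Flg F V → ℝ) (hX : Meas (insert b C) X) (hX0 : ∀ T, ce C X T = 0) :
    ce C (fun T => ce (insert (b+1) C) X T ^ 2) T0 ≤ 2 / (Fintype.card F : ℝ) * ce C (fun T => X T ^ 2) T0 := by
  set q := Fintype.card F with hq
  have hq2 : 2 ≤ q := Fintype.one_lt_card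
  -- the function ψ
  set ψ : Submodule F V → ℝ := fun w => if h : ∃ T, Agr C T0 T ∧ T.f b = w then X h.choose else 0 with hψ
  have hXψ : ∀ T, Agr C T0 T → X T = ψ (T.f b) := by
    intro T hT
    have hex : ∃ S, Agr C T0 S ∧ S.f b = T.f b := ⟨T, hT, rfl⟩
    simp only [hψ, dif_pos hex]
    apply hX
    have hs := hex.choose_spec
    rintro c (rfl | hc)
    · exact hs.2.symm
    · exact (hT.symm.trans hs.1) c hc
  set U := T0.f lo with hU
  set U' := T0.f hi with hU'
  obtain ⟨m, rfl⟩ : ∃ m, b = lo + m := ⟨b - lo, by omega⟩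
  obtain ⟨D, rfl⟩ : ∃ D, hi = lo + D := ⟨hi - lo, by omega⟩
  have hu : Module.finrank F U = lo := by rw [hU, T0.rank]; omega
  have hD : Module.finrank F U' = lo + D := by rw [hU', T0.rank]; omega
  have hUU : U ≤ U' := T0.mono (by omega)
  set G := Gr U U' (lo + m) with hG
  set G' := Gr U U' (lo + m + 1) with hG'
  have hceX : ∀ (u : ℝ → ℝ), ce C (fun T => u (X T)) T0 = (∑ w ∈ G, u (ψ w)) / (G.card : ℝ) := by
    intro u
    rw [← UNI hlo hhi h1 (by omega) hn hgap T0 (fun w => u (ψ w))]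
    exact ce_congr C T0 fun T hT => by rw [hXψ T hT]
  have hGne : G.Nonempty := ⟨T0.f (lo+m), mem_Gr.2 ⟨T0.mono (by omega), T0.mono (by omega), by rw [T0.rank]; omega⟩⟩
  have hG'ne : G'.Nonempty := ⟨T0.f (lo+m+1), mem_Gr.2 ⟨T0.mono (by omega), T0.mono (by omega), by rw [T0.rank]; omega⟩⟩
  have hGp : (0:ℝ) < G.card := by exact_mod_cast hGne.card_pos
  have hG'p : (0:ℝ) < G'.card := by exact_mod_cast hG'ne.card_pos
  have hψ0 : ∑ w ∈ G, ψ w = 0 := by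
    have := hceX id
    simp only [id] at this
    rw [hX0 T0, eq_comm, div_eq_zero_iff] at this
    exact this.resolve_right hGp.ne'
  set g1 : ℝ := (gs q (m+1) : ℝ) with hg1
  have hg1p : 0 < g1 := by rw [hg1, gs_succ]; positivity
  have hZ : ∀ T, Agr C T0 T → ce (insert (lo+m+1) C) X T = (∑ w ∈ G, ψ w * inc w (T.f (lo+m+1))) / g1 := by
    intro T hT
    have e0 : ce (insert (lo+m+1) C) X T = ce (insert (lo+m+1) C) (fun S => ψ (S.f (lo+m))) T :=
      ce_congr _ T fun S hS => hXψ S (hT.trans (hS.mono (Set.subset_insert _ _)))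
    rw [e0, UNI (lo := lo) (hi := lo+m+1) (Set.mem_insert_of_mem _ hlo) (Set.mem_insert _ _) h1 (by omega)
      (by omega) (by
        rintro c (rfl | hc)
        · right; rfl
        · rcases hgap c hc with h | h
          · exact Or.inl h
          · right; omega)]
    have hTlo : T.f lo = U := (hT lo hlo).symm
    have hThi : T.f (lo+D) = U' := (hT (lo+D) hhi).symm
    rw [hTlo]
    have hzr : Module.finrank F (T.f (lo+m+1)) = lo + m + 1 := by rw [T.rank]; omega
    have hc := card_down (U := U) (w := T.f (lo+m+1)) (hTlo ▸ T.mono (by omega)) (m := m) (by omega)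
    rw [hu] at hc
    rw [hc]
    congr 1
    have hsub : Gr U (T.f (lo+m+1)) (lo+m) = G.filter (fun w => w ≤ T.f (lo+m+1)) := by
      ext w
      rw [Finset.mem_filter, hG, mem_Gr, mem_Gr]
      constructor
      · rintro ⟨a1, a2, a3⟩
        exact ⟨⟨a1, a2.trans (hThi ▸ T.mono (by omega)), a3⟩, a2⟩
      · rintro ⟨⟨a1, a2, a3⟩, a4⟩; exact ⟨a1, a4, a3⟩
    rw [hsub, Finset.sum_filter]
    apply Finset.sum_congr rfl
    intro w _
    simp only [inc]; split_ifs <;> simp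
  have e1 : ce C (fun T => ce (insert (lo+m+1) C) X T ^ 2) T0 =
      (∑ z ∈ G', ((∑ w ∈ G, ψ w * inc w z) / g1) ^ 2) / (G'.card : ℝ) := by
    rw [← UNI hlo hhi (by omega) (by omega) hn hgap T0 (fun z => ((∑ w ∈ G, ψ w * inc w z) / g1) ^ 2)]
    exact ce_congr C T0 fun T hT => by rw [hZ T hT]
  rw [e1, hceX (fun x => x ^ 2)]
  have hLL := LL hUU hu hD m (by omega) ψ hψ0
  have hcnt := Gr_count hu hD m
  rw [← hG, ← hG', ← hq, ← hg1] at hcnt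
  rw [← hG, ← hG', ← hq, ← hg1] at hLL
  have hs := (sg_le q m hq2).1
  set N := ∑ w ∈ G, ψ w ^ 2 with hN
  have hN0 : 0 ≤ N := Finset.sum_nonneg fun _ _ => sq_nonneg _
  simp_rw [div_pow]
  rw [← Finset.sum_div]
  have ha : (gs q (D - m) : ℝ) = G'.card * g1 / G.card := by
    field_simp; linarith
  rw [ha] at hLL
  calc (∑ z ∈ G', (∑ w ∈ G, ψ w * inc w z) ^ 2) / g1 ^ 2 / G'.card
      ≤ (sg q m * (G'.card * g1 / G.card * g1) * N) / g1 ^ 2 / G'.card := by gcongr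
    _ = sg q m * (N / G.card) := by field_simp
    _ ≤ 2 / q * (N / G.card) := by gcongr

theorem LLce {C : Set ℕ} (h0 : 0 ∈ C) (hn : Set.Ici (Module.finrank F V) ⊆ C) {b : ℕ}
    (X : Flg F V → ℝ) (hX : Meas (insert b C) X) (hX0 : ∀ T, ce C X T = 0) :
    nsq (ce (insert (b+1) C) X) ≤ 2 / (Fintype.card F : ℝ) * nsq X := by
  have hrhs : 0 ≤ 2 / (Fintype.card F : ℝ) * nsq X := mul_nonneg (by positivity) (nsq_nonneg _)
  by_cases hb : b ∈ C
  · have hz : ∀ T, X T = 0 := fun T => by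
      rw [← hX0 T, ce_of_meas]; rwa [Set.insert_eq_of_mem hb] at hX
    have : X = fun _ => 0 := funext hz
    rw [this]; simp [nsq, ce_const]
  by_cases hb1 : b + 1 ∈ C
  · rw [Set.insert_eq_of_mem hb1]
    have : ce C X = fun _ => 0 := funext hX0
    rw [this]; simpa [nsq] using hrhs
  have hbn : b + 1 < Module.finrank F V := by
    by_contra h
    exact hb1 (hn (not_lt.1 h))
  -- lo and hi
  have hb0 : 0 < b := Nat.pos_of_ne_zero fun h => hb (h ▸ h0)
  obtain ⟨lo, hlo1, hlo2⟩ : ∃ lo, (lo ∈ C ∧ lo < b) ∧ ∀ c, (c ∈ C ∧ c < b) → c ≤ lo := by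
    let s := (Finset.range b).filter (· ∈ C)
    have hs : s.Nonempty := ⟨0, by simp [s, h0, hb0]⟩
    refine ⟨s.max' hs, ?_, ?_⟩
    · have := s.max'_mem hs
      simp only [s, Finset.mem_filter, Finset.mem_range] at this
      exact ⟨this.2, this.1⟩
    · intro c hc
      exact s.le_max' c (by simp [s, hc.1, hc.2])
  have hexi : ∃ hi, hi ∈ C ∧ b < hi := ⟨_, hn (Set.mem_Ici.2 le_rfl), by omega⟩
  set hi := Nat.find hexi with hhi
  have hi1 := Nat.find_spec hexi
  have hi2 : hi ≤ Module.finrank F V := Nat.find_min' hexi ⟨hn (Set.mem_Ici.2 le_rfl), by omega⟩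
  have hi3 : b + 1 < hi := by
    have : hi ≠ b + 1 := fun h => hb1 (h ▸ hi1.1)
    have := hi1.2; omega
  have hgap : ∀ c ∈ C, c ≤ lo ∨ hi ≤ c := by
    intro c hc
    rcases lt_trichotomy c b with h | h | h
    · exact Or.inl (hlo2 c ⟨hc, h⟩)
    · exact absurd (h ▸ hc) hb
    · exact Or.inr (Nat.find_min' hexi ⟨hc, h⟩)
  have key := fun T0 => LLce_aux hlo1.1 hi1.1 hlo1.2 hi3 hi2 hgap T0 X hX hX0
  have := Finset.sum_le_sum (s := univ) fun T0 _ => key T0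
  rw [sum_ce, ← Finset.mul_sum, sum_ce] at this
  exact this

theorem agr_ext {C : Set ℕ} {T T' : Flg F V} :
    Agr (C ∪ ({0} ∪ Set.Ici (Module.finrank F V))) T T' ↔ Agr C T T' := by
  constructor
  · exact fun h => h.mono Set.subset_union_left
  · intro h c hc
    rcases hc with hc | hc | hc
    · exact h c hc
    · rw [Set.mem_singleton_iff.1 hc]; show T.f 0 = T'.f 0; rw [T.zero, T'.zero]
    · show T.f c = T'.f c; rw [T.top hc, T'.top hc]

theorem ce_ext (C : Set ℕ) (X : Flg F V → ℝ) :
    ce (C ∪ ({0} ∪ Set.Ici (Module.finrank F V))) X = ce C X := by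
  funext T
  unfold ce fib
  simp only [agr_ext]

theorem PL_lt {C : Set ℕ} (h0 : 0 ∈ C) (hn : Set.Ici (Module.finrank F V) ⊆ C) {b b' : ℕ} (hb : b < b')
    (X Y : Flg F V → ℝ) (hX : Meas (insert b C) X) (hY : Meas (insert b' C) Y)
    (hX0 : ∀ T, ce C X T = 0) :
    (∑ T, X T * Y T) ^ 2 ≤ 2 / (Fintype.card F : ℝ) * nsq X * nsq Y := by
  set D := insert (b+1) C with hD
  have h1 := LLce h0 hn X hX hX0
  have e : ∑ T, X T * Y T = ∑ T, ce D X T * ce D Y T := by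
    by_cases hbb : b' = b + 1
    · have hYD : Meas D Y := by rw [hD, ← hbb]; exact hY
      rw [← sum_ce_mul X hYD]
      exact Finset.sum_congr rfl fun T _ => by rw [ce_of_meas hYD]
    · rw [← sum_ce D]
      apply Finset.sum_congr rfl
      intro T _
      apply SEP (c := b+1) (Set.mem_insert _ _)
      · apply hX.mono
        rintro c (rfl | hc)
        · right; simp
        · left; right; exact hc
      · apply hY.mono
        rintro c (rfl | hc)
        · right; simp; omega
        · left; right; exact hc
  rw [e]
  refine (Finset.sum_mul_sq_le_sq_mul_sq univ _ _).trans ?_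
  change nsq (ce D X) * nsq (ce D Y) ≤ _
  exact mul_le_mul h1 (nsq_ce_le D Y) (nsq_nonneg _) (mul_nonneg (by positivity) (nsq_nonneg _))

variable (F V) in
theorem PL_flags : PL (Flg F V) (Real.sqrt (2 / (Fintype.card F : ℝ))) := by
  intro C b b' hb X Y hX hY hX0 hY0
  rw [Real.sq_sqrt (by positivity)]
  set C' := C ∪ ({0} ∪ Set.Ici (Module.finrank F V)) with hC'
  have hs : C ⊆ C' := Set.subset_union_left
  have h0 : 0 ∈ C' := by right; left; rfl
  have hn : Set.Ici (Module.finrank F V) ⊆ C' := fun x hx => Or.inr (Or.inr hx)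
  rcases lt_or_gt_of_ne hb with h | h
  · exact PL_lt h0 hn h X Y (hX.mono (Set.insert_subset_insert hs)) (hY.mono (Set.insert_subset_insert hs))
      (by rw [hC', ce_ext]; exact hX0)
  · have := PL_lt h0 hn h Y X (hY.mono (Set.insert_subset_insert hs)) (hX.mono (Set.insert_subset_insert hs))
      (by rw [hC', ce_ext]; exact hY0)
    simp_rw [mul_comm (Y _)] at this
    linarith [this]

end plflags


section step
variable {Ω α : Type} [Fintype Ω] [Crd Ω α]

theorem nd_imp1 {γ δ : Type*} {a b : Ω → γ} {e e' : Ω → δ} (h : ∀ T, a T = b T → e T = e' T) :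
    nd e e' ≤ nd a b := by
  unfold nd
  apply Finset.sum_le_sum
  intro T _
  by_cases h1 : a T = b T
  · simp [h1, h T h1]
  · simp only [ne_eq, h1, not_false_eq_true, if_true]; split_ifs <;> norm_num

theorem nd_imp2 {γ δ ε : Type*} {a b : Ω → γ} {c d : Ω → ε} {e e' : Ω → δ}
    (h : ∀ T, a T = b T → c T = d T → e T = e' T) :
    nd e e' ≤ nd a b + nd c d := by
  unfold nd
  rw [← Finset.sum_add_distrib]
  apply Finset.sum_le_sum
  intro T _
  by_cases h1 : a T = b T
  · by_cases h2 : c T = d T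
    · simp [h1, h2, h T h1 h2]
    · simp only [h1, ne_eq, h2, not_false_eq_true, if_true]; split_ifs <;> norm_num
  · simp only [ne_eq, h1, not_false_eq_true, if_true]; split_ifs <;> norm_num

theorem nd_imp3 {γ δ ε ζ : Type*} {a b : Ω → γ} {c d : Ω → ε} {k k' : Ω → ζ} {e e' : Ω → δ}
    (h : ∀ T, a T = b T → c T = d T → k T = k' T → e T = e' T) :
    nd e e' ≤ nd a b + nd c d + nd k k' := by
  have h1 : nd e e' ≤ nd (fun T => (a T, c T)) (fun T => (b T, d T)) + nd k k' := by
    apply nd_imp2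
    intro T h1 h2
    rw [Prod.mk.injEq] at h1
    exact h T h1.1 h1.2 h2
  have h2 : nd (fun T => (a T, c T)) (fun T => (b T, d T)) ≤ nd a b + nd c d := by
    apply nd_imp2
    intro T h1 h2
    rw [h1, h2]
  linarith

theorem nd_self {γ : Type*} (a : Ω → γ) : nd a a = 0 := by simp [nd]

theorem Meas.mul {Γ : Type} [Group Γ] {C : Set ℕ} {a b : Ω → Γ} (ha : Meas C a) (hb : Meas C b) :
    Meas C (a * b) := ha.comp₂ hb (fun x y => x * y)

theorem Meas.inv {Γ : Type} [Group Γ] {C : Set ℕ} {a : Ω → Γ} (ha : Meas C a) :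
    Meas C (a⁻¹) := ha.comp (fun x => x⁻¹)

/-- colour disjointness is likely -/
def Avd (cs : Finset (Finset ℕ)) : Prop := ∀ B ∈ cs, ∀ B' ∈ cs,
  (cs.card : ℝ) ≤ 2 * ((cs.filter (fun D => Disjoint B D ∧ Disjoint D B')).card : ℝ)

theorem NL {l : ℝ} (hl : 0 ≤ l) (h : PL Ω l) {γ : Type*} (A : Set ℕ) (cs : Finset (Finset ℕ)) (r : ℕ)
    (hcs : ∀ B ∈ cs, B.card = r + 1) (hne : cs.Nonempty) (hav : Avd cs)
    (hlr : 2 * (r + 1) * l ≤ 1 / 2) (ξ : Finset ℕ → Ω → γ) (hξ : ∀ B ∈ cs, Meas (A ∪ ↑B) (ξ B)) :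
    ∃ H : Ω → γ, Meas A H ∧ (cs.card : ℝ) * ∑ B ∈ cs, nd (ξ B) H ≤
      76 * (r + 1) * ∑ B ∈ cs, ∑ B' ∈ cs, if Disjoint B B' then nd (ξ B) (ξ B') else 0 := by
  set N : ℝ := (cs.card : ℝ) with hN
  have hNpos : 0 < N := by rw [hN]; exact_mod_cast hne.card_pos
  set η := ∑ B ∈ cs, ∑ B' ∈ cs, if Disjoint B B' then nd (ξ B) (ξ B') else 0 with hη
  choose sel hsel1 hsel2 using fun B => exists_sel A (ξ B)
  have h1 : ∀ B ∈ cs, N * nd (ξ B) (sel B) ≤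
      8 * (r + 1) * ∑ B' ∈ cs, if Disjoint B B' then nd (ξ B) (ξ B') else 0 := by
    intro B hB
    have h2 : ∀ B' ∈ cs, Disjoint B B' → nd (ξ B) (sel B) ≤ 4 * (r + 1) * nd (ξ B) (ξ B') := by
      intro B' hB' hd
      refine (hsel2 B).trans ?_
      have := bip hl h A B B' (by rw [hcs B hB, hcs B' hB']; push_cast; linarith) hd _ _ (hξ B hB) (hξ B' hB')
      rw [hcs B hB] at this; push_cast at this; exact this
    have h3 := hav B hB B hB
    have h4 : ((cs.filter (fun D => Disjoint B D ∧ Disjoint D B)).card : ℝ) * nd (ξ B) (sel B) ≤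
        ∑ B' ∈ cs, if Disjoint B B' then 4 * (r + 1) * nd (ξ B) (ξ B') else 0 := by
      rw [← nsmul_eq_mul, ← Finset.sum_const, Finset.sum_filter]
      apply Finset.sum_le_sum
      intro B' hB'
      by_cases hd : Disjoint B B'
      · rw [if_pos ⟨hd, hd.symm⟩, if_pos hd]; exact h2 B' hB' hd
      · rw [if_neg (fun h => hd h.1), if_neg hd]
    have h5 : (∑ B' ∈ cs, if Disjoint B B' then 4 * ((r:ℝ) + 1) * nd (ξ B) (ξ B') else 0) =
        4 * (r + 1) * ∑ B' ∈ cs, if Disjoint B B' then nd (ξ B) (ξ B') else 0 := by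
      rw [Finset.mul_sum]; apply Finset.sum_congr rfl; intros; split_ifs <;> simp
    have h6 := mul_le_mul_of_nonneg_right h3 (nd_nonneg (ξ B) (sel B))
    rw [h5] at h4
    linarith
  set s := ∑ B ∈ cs, nd (ξ B) (sel B) with hs
  have hs0 : 0 ≤ s := Finset.sum_nonneg fun _ _ => nd_nonneg _ _
  have h2 : N * s ≤ 8 * (r + 1) * η := by
    rw [hs, hη, Finset.mul_sum, Finset.mul_sum]
    exact Finset.sum_le_sum h1
  -- disjoint pairs
  have h3 : (∑ B ∈ cs, ∑ B' ∈ cs, if Disjoint B B' then nd (sel B) (sel B') else 0) ≤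
      η + 2 * (N * s) := by
    have e1 : N * s = ∑ B ∈ cs, ∑ B' ∈ cs, nd (ξ B) (sel B) := by
      rw [hs, Finset.mul_sum]; simp [hN]
    have e2 : N * s = ∑ B ∈ cs, ∑ B' ∈ cs, nd (ξ B') (sel B') := by
      rw [e1, Finset.sum_comm]
    have : η + 2 * (N * s) = ∑ B ∈ cs, ∑ B' ∈ cs, ((if Disjoint B B' then nd (ξ B) (ξ B') else 0) +
        (nd (ξ B) (sel B) + nd (ξ B') (sel B'))) := by
      simp only [Finset.sum_add_distrib]
      rw [← e1, ← e2, hη]; ring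
    rw [this]
    apply Finset.sum_le_sum; intro B hB
    apply Finset.sum_le_sum; intro B' hB'
    have p1 := nd_nonneg (ξ B) (sel B)
    have p2 := nd_nonneg (ξ B') (sel B')
    split_ifs
    · have q1 := nd_triangle (sel B) (ξ B) (sel B')
      have q2 := nd_triangle (ξ B) (ξ B') (sel B')
      rw [nd_comm (sel B) (ξ B)] at q1
      linarith
    · linarith
  set η' := ∑ B ∈ cs, ∑ B' ∈ cs, if Disjoint B B' then nd (sel B) (sel B') else 0 with hη'
  have h4 : (∑ B ∈ cs, ∑ B' ∈ cs, nd (sel B) (sel B')) ≤ 4 * η' := by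
    have q : N * (∑ B ∈ cs, ∑ B' ∈ cs, nd (sel B) (sel B')) ≤ N * (4 * η') := by
      have e1 : ∑ B ∈ cs, ∑ B' ∈ cs, ∑ D ∈ cs,
          ((if Disjoint B D then nd (sel B) (sel D) else 0) +
           (if Disjoint D B' then nd (sel D) (sel B') else 0)) = N * (2 * η') := by
        simp only [Finset.sum_add_distrib]
        have a1 : (∑ B ∈ cs, ∑ B' ∈ cs, ∑ D ∈ cs, if Disjoint B D then nd (sel B) (sel D) else 0)
            = N * η' := by
          rw [hη', Finset.mul_sum]
          apply Finset.sum_congr rfl; intro B _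
          rw [Finset.sum_const, nsmul_eq_mul]
        have a2 : (∑ B ∈ cs, ∑ B' ∈ cs, ∑ D ∈ cs, if Disjoint D B' then nd (sel D) (sel B') else 0)
            = N * η' := by
          rw [Finset.sum_const, nsmul_eq_mul, hη', Finset.sum_comm]
        rw [a1, a2]; ring
      have e2 : N * (∑ B ∈ cs, ∑ B' ∈ cs, nd (sel B) (sel B')) ≤ 2 * (∑ B ∈ cs, ∑ B' ∈ cs, ∑ D ∈ cs,
          ((if Disjoint B D then nd (sel B) (sel D) else 0) +
           (if Disjoint D B' then nd (sel D) (sel B') else 0))) := by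
        simp only [Finset.mul_sum (s := cs) (a := N), Finset.mul_sum (s := cs) (a := (2:ℝ))]
        apply Finset.sum_le_sum; intro B hB
        apply Finset.sum_le_sum; intro B' hB'
        have a1 := mul_le_mul_of_nonneg_right (hav B hB B' hB') (nd_nonneg (sel B) (sel B'))
        refine a1.trans ?_
        rw [mul_assoc, ← Finset.mul_sum]
        apply mul_le_mul_of_nonneg_left _ (by norm_num : (0:ℝ) ≤ 2)
        rw [← nsmul_eq_mul, ← Finset.sum_const, Finset.sum_filter]
        apply Finset.sum_le_sum; intro D hD
        have p1 := nd_nonneg (sel B) (sel D)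
        have p2 := nd_nonneg (sel D) (sel B')
        by_cases hd : Disjoint B D ∧ Disjoint D B'
        · rw [if_pos hd, if_pos hd.1, if_pos hd.2]; exact nd_triangle _ _ _
        · rw [if_neg hd]; split_ifs <;> linarith
      rw [e1] at e2; linarith
    exact le_of_mul_le_mul_left q hNpos
  obtain ⟨B0, hB0, hb⟩ : ∃ B0 ∈ cs, N * (∑ B ∈ cs, nd (sel B) (sel B0)) ≤ 4 * η' := by
    by_contra! hc
    have : ∑ B0 ∈ cs, (4 * η') < ∑ B0 ∈ cs, N * (∑ B ∈ cs, nd (sel B) (sel B0)) :=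
      Finset.sum_lt_sum_of_nonempty hne hc
    rw [Finset.sum_const, nsmul_eq_mul, ← Finset.mul_sum, Finset.sum_comm] at this
    have := lt_of_mul_lt_mul_left this hNpos.le
    linarith
  refine ⟨sel B0, hsel1 B0, ?_⟩
  have h5 : ∑ B ∈ cs, nd (ξ B) (sel B0) ≤ s + ∑ B ∈ cs, nd (sel B) (sel B0) := by
    rw [hs, ← Finset.sum_add_distrib]
    exact Finset.sum_le_sum fun B _ => nd_triangle _ _ _
  have h6 := mul_le_mul_of_nonneg_left h5 hNpos.le
  have hη0 : 0 ≤ η := Finset.sum_nonneg fun _ _ => Finset.sum_nonneg fun _ _ => by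
    split_ifs
    · exact nd_nonneg _ _
    · exact le_rfl
  have : (0:ℝ) ≤ r * η := mul_nonneg (Nat.cast_nonneg r) hη0
  nlinarith

variable {Γ : Type} [Group Γ]

/-- total disagreement between a pair function and a coboundary -/
noncomputable def D2 (cs : Finset (Finset ℕ)) (fh : Finset ℕ → Finset ℕ → Ω → Γ)
    (g : Finset ℕ → Ω → Γ) : ℝ :=
  ∑ B ∈ cs, ∑ B' ∈ cs, if Disjoint B B' then nd (fh B B') (g B * (g B')⁻¹) else 0

/-- solvability relative to a set of conditioned coordinates -/
def PP (cs : Finset (Finset ℕ)) (fh : Finset ℕ → Finset ℕ → Ω → Γ) (A : Set ℕ) (e : ℝ) : Prop :=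
  ∃ g : Finset ℕ → Ω → Γ, (∀ B ∈ cs, Meas (A ∪ ↑B) (g B)) ∧ (cs.card : ℝ) * D2 cs fh g ≤ e

theorem D2_pert (cs : Finset (Finset ℕ)) (fh : Finset ℕ → Finset ℕ → Ω → Γ)
    (g g' : Finset ℕ → Ω → Γ) :
    D2 cs fh g' ≤ D2 cs fh g + 2 * ((cs.card : ℝ) * ∑ B ∈ cs, nd (g B) (g' B)) := by
  have e1 : (cs.card : ℝ) * ∑ B ∈ cs, nd (g B) (g' B) = ∑ B ∈ cs, ∑ B' ∈ cs, nd (g B) (g' B) := by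
    rw [Finset.mul_sum]; simp
  have e2 : (cs.card : ℝ) * ∑ B ∈ cs, nd (g B) (g' B) = ∑ B ∈ cs, ∑ B' ∈ cs, nd (g B') (g' B') := by
    rw [e1, Finset.sum_comm]
  rw [two_mul]
  nth_rw 1 [e1]
  rw [e2]
  unfold D2
  simp only [← Finset.sum_add_distrib]
  apply Finset.sum_le_sum; intro B hB
  apply Finset.sum_le_sum; intro B' hB'
  have p1 := nd_nonneg (g B) (g' B)
  have p2 := nd_nonneg (g B') (g' B')
  split_ifs
  · have := nd_imp3 (a := fh B B') (b := g B * (g B')⁻¹) (c := g B) (d := g' B) (k := g B') (k' := g' B')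
      (e := fh B B') (e' := g' B * (g' B')⁻¹) (by
        intro T h1 h2 h3
        rw [h1, Pi.mul_apply, Pi.mul_apply, Pi.inv_apply, Pi.inv_apply, h2, h3])
    linarith
  · linarith

/-- increasing triples of indices below `m` -/
def trip (m : ℕ) : Finset (ℕ × ℕ × ℕ) :=
  (range m ×ˢ range m ×ˢ range m).filter (fun p => p.1 < p.2.1 ∧ p.2.1 < p.2.2)

/-- one-dimensional expansion of the colours `y 0, …, y (m-1)` over `A`. -/
def E1 (Ω : Type) {α : Type} [Fintype Ω] [Crd Ω α] (Γ : Type) [Group Γ]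
    (m : ℕ) (y : ℕ → ℕ) (A : Set ℕ) (K : ℝ) : Prop :=
  ∀ H : ℕ → ℕ → Ω → Γ, (∀ i j, i < j → j < m → Meas (A ∪ {y i, y j}) (H i j)) →
    ∃ c0 c1 : Ω → Γ, Meas (A ∪ {y 0}) c0 ∧ Meas (A ∪ {y 1}) c1 ∧
      nd (H 0 1) (c0⁻¹ * c1) ≤ K * ∑ p ∈ trip m, nd (H p.1 p.2.1 * H p.2.1 p.2.2) (H p.1 p.2.2)

theorem step {l : ℝ} (hl : 0 ≤ l) (h : PL Ω l) (A : Set ℕ) (cs : Finset (Finset ℕ)) (r : ℕ)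
    (hcs : ∀ B ∈ cs, B.card = r + 1) (hne : cs.Nonempty) (hav : Avd cs)
    (hlr : 2 * (r + 1) * l ≤ 1 / 2) (fh : Finset ℕ → Finset ℕ → Ω → Γ)
    (m : ℕ) (hm : 2 ≤ m) (hm4 : m ≤ 4) (y : ℕ → ℕ) (hy : y 0 ≠ y 1) (K : ℝ) (hK : 1 ≤ K)
    (hE : E1 Ω Γ m y A K)
    (e : ℝ) (he : 0 ≤ e) (hP : ∀ i < m, PP cs fh (A ∪ {y i}) e) :
    PP cs fh A (300000 * (r + 1) * K * e) := by
  set N : ℝ := (cs.card : ℝ) with hN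
  have hNpos : 0 < N := by rw [hN]; exact_mod_cast hne.card_pos
  choose! g hg1 hg2 using hP
  set R : ℝ := (r:ℝ) + 1 with hR
  have hR1 : 1 ≤ R := by rw [hR]; have := Nat.cast_nonneg (α := ℝ) r; linarith
  have hH : ∀ i j, ∃ H : Ω → Γ, i < j → j < m → (Meas (A ∪ {y i, y j}) H ∧
      N ^ 2 * ∑ B ∈ cs, nd ((g i B)⁻¹ * g j B) H ≤ 152 * R * e) := by
    intro i j
    by_cases hij : i < j ∧ j < m
    · have hi : i < m := hij.1.trans hij.2
      obtain ⟨H, hH1, hH2⟩ := NL hl h (A ∪ {y i, y j}) cs r hcs hne hav hlr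
        (fun B => (g i B)⁻¹ * g j B) (by
          intro B hB
          apply Meas.mul
          · refine Meas.mono ?_ (hg1 i hi B hB).inv
            intro x hx; simp only [Set.mem_union, Set.mem_singleton_iff, Set.mem_insert_iff] at hx ⊢; tauto
          · refine Meas.mono ?_ (hg1 j hij.2 B hB)
            intro x hx; simp only [Set.mem_union, Set.mem_singleton_iff, Set.mem_insert_iff] at hx ⊢; tauto)
      refine ⟨H, fun _ _ => ⟨hH1, ?_⟩⟩
      have h1 : (∑ B ∈ cs, ∑ B' ∈ cs, if Disjoint B B' then nd ((g i B)⁻¹ * g j B) ((g i B')⁻¹ * g j B') else 0)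
          ≤ D2 cs fh (g i) + D2 cs fh (g j) := by
        unfold D2
        simp only [← Finset.sum_add_distrib]
        apply Finset.sum_le_sum; intro B hB
        apply Finset.sum_le_sum; intro B' hB'
        split_ifs
        · apply nd_imp2
          intro T q1 q2
          simp only [Pi.mul_apply, Pi.inv_apply] at q1 q2 ⊢
          rw [q1] at q2
          have q3 : g j B T = g i B T * (g i B' T)⁻¹ * g j B' T := by rw [q2]; group
          rw [q3]; group
        · simp
      have h2 := hg2 i hi
      have h3 := hg2 j hij.2
      have h4 : N * (N * ∑ B ∈ cs, nd ((g i B)⁻¹ * g j B) H) ≤ N * (76 * R * (D2 cs fh (g i) + D2 cs fh (g j))) := by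
        apply mul_le_mul_of_nonneg_left _ hNpos.le
        refine hH2.trans ?_
        apply mul_le_mul_of_nonneg_left h1; positivity
      have h5 : N * (76 * R * (D2 cs fh (g i) + D2 cs fh (g j))) = 76 * R * (N * D2 cs fh (g i) + N * D2 cs fh (g j)) := by ring
      rw [h5] at h4
      have h6 : 76 * R * (N * D2 cs fh (g i) + N * D2 cs fh (g j)) ≤ 76 * R * (e + e) :=
        mul_le_mul_of_nonneg_left (add_le_add h2 h3) (by positivity)
      calc _ = N * (N * ∑ B ∈ cs, nd ((g i B)⁻¹ * g j B) H) := by ring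
        _ ≤ _ := h4.trans h6
        _ = _ := by ring
    · exact ⟨1, fun a b => absurd ⟨a, b⟩ hij⟩
  choose H hH using hH
  obtain ⟨c0, c1, hc0, hc1, hc⟩ := hE H (fun i j hij hj => (hH i j hij hj).1)
  have htr : ∀ p ∈ trip m, N ^ 3 * nd (H p.1 p.2.1 * H p.2.1 p.2.2) (H p.1 p.2.2) ≤ 456 * R * e := by
    rintro ⟨i, j, k⟩ hp
    simp only [trip, Finset.mem_filter, Finset.mem_product, Finset.mem_range] at hp
    obtain ⟨⟨hi, hj, hk⟩, hij, hjk⟩ := hp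
    have a1 := (hH i j hij hj).2
    have a2 := (hH j k hjk hk).2
    have a3 := (hH i k (hij.trans hjk) hk).2
    have a4 : N * nd (H i j * H j k) (H i k) ≤ ∑ B ∈ cs, nd ((g i B)⁻¹ * g j B) (H i j) +
        ∑ B ∈ cs, nd ((g j B)⁻¹ * g k B) (H j k) + ∑ B ∈ cs, nd ((g i B)⁻¹ * g k B) (H i k) := by
      rw [hN, ← nsmul_eq_mul, ← Finset.sum_const, ← Finset.sum_add_distrib, ← Finset.sum_add_distrib]
      apply Finset.sum_le_sum
      intro B hB
      apply nd_imp3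
      intro T q1 q2 q3
      simp only [Pi.mul_apply, Pi.inv_apply] at q1 q2 q3 ⊢
      rw [← q1, ← q2, ← q3]; group
    have a5 := mul_le_mul_of_nonneg_left a4 (by positivity : 0 ≤ N ^ 2)
    show N ^ 3 * nd (H i j * H j k) (H i k) ≤ 456 * R * e
    calc _ = N ^ 2 * (N * nd (H i j * H j k) (H i k)) := by ring
      _ ≤ _ := a5
      _ ≤ _ := by linarith
  have hcard : ((trip m).card : ℝ) ≤ 64 := by
    have : (trip m).card ≤ 64 := by
      refine (Finset.card_filter_le _ _).trans ?_
      simp only [Finset.card_product, Finset.card_range]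
      interval_cases m <;> norm_num
    exact_mod_cast this
  have hsum : N ^ 3 * nd (H 0 1) (c0⁻¹ * c1) ≤ K * (64 * (456 * R * e)) := by
    have b1 := mul_le_mul_of_nonneg_left hc (by positivity : 0 ≤ N ^ 3)
    refine b1.trans ?_
    rw [mul_left_comm]
    apply mul_le_mul_of_nonneg_left _ (by linarith)
    rw [Finset.mul_sum]
    refine (Finset.sum_le_sum htr).trans ?_
    rw [Finset.sum_const, nsmul_eq_mul]
    exact mul_le_mul_of_nonneg_right hcard (by positivity)
  have hm0 : 0 < m := by omega
  have hm1 : 1 < m := by omega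
  choose G hG1 hG2 using fun B : Finset ℕ => exists_sel (A ∪ ↑B) (g 0 B * c0⁻¹)
  refine ⟨G, fun B hB => hG1 B, ?_⟩
  have k1 : ∀ B ∈ cs, nd (g 0 B * c0⁻¹) (G B) ≤ 4 * (nd ((g 0 B)⁻¹ * g 1 B) (H 0 1) + nd (H 0 1) (c0⁻¹ * c1)) := by
    intro B hB
    refine (hG2 B).trans ?_
    have hl4 : ((({y 0} : Finset ℕ).card : ℝ) + (({y 1} : Finset ℕ).card : ℝ)) * l ≤ 1 / 2 := by
      simp only [Finset.card_singleton]; push_cast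
      nlinarith
    have := bip hl h (A ∪ ↑B) {y 0} {y 1} hl4 (by simpa using hy) (g 0 B * c0⁻¹) (g 1 B * c1⁻¹)
      (by
        apply Meas.mul
        · refine Meas.mono ?_ (hg1 0 hm0 B hB)
          intro x hx; simp only [Set.mem_union, Set.mem_singleton_iff, Finset.coe_singleton] at hx ⊢; tauto
        · refine Meas.mono ?_ hc0.inv
          intro x hx; simp only [Set.mem_union, Set.mem_singleton_iff, Finset.coe_singleton] at hx ⊢; tauto)
      (by
        apply Meas.mul
        · refine Meas.mono ?_ (hg1 1 hm1 B hB)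
          intro x hx; simp only [Set.mem_union, Set.mem_singleton_iff, Finset.coe_singleton] at hx ⊢; tauto
        · refine Meas.mono ?_ hc1.inv
          intro x hx; simp only [Set.mem_union, Set.mem_singleton_iff, Finset.coe_singleton] at hx ⊢; tauto)
    refine this.trans ?_
    simp only [Finset.card_singleton]; push_cast
    rw [mul_one]
    apply mul_le_mul_of_nonneg_left _ (by norm_num : (0:ℝ) ≤ 4)
    apply nd_imp2
    intro T q1 q2
    simp only [Pi.mul_apply, Pi.inv_apply] at q1 q2 ⊢
    rw [q2, inv_mul_eq_iff_eq_mul] at q1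
    rw [q1]; group
  have k2 : N ^ 2 * ∑ B ∈ cs, nd (g 0 B * c0⁻¹) (G B) ≤ 4 * (152 * R * e + K * (64 * (456 * R * e))) := by
    have := Finset.sum_le_sum k1
    rw [← Finset.mul_sum, Finset.sum_add_distrib, Finset.sum_const, nsmul_eq_mul] at this
    have a1 := mul_le_mul_of_nonneg_left this (by positivity : 0 ≤ N ^ 2)
    have a2 := (hH 0 1 (by norm_num) hm1).2
    refine a1.trans ?_
    rw [← hN]
    nlinarith
  have k3 := D2_pert cs fh (fun B => g 0 B * c0⁻¹) G
  have k4 : D2 cs fh (fun B => g 0 B * c0⁻¹) = D2 cs fh (g 0) := by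
    unfold D2
    congr 1; ext B; congr 1; ext B'
    have : g 0 B * c0⁻¹ * (g 0 B' * c0⁻¹)⁻¹ = g 0 B * (g 0 B')⁻¹ := by group
    rw [this]
  rw [k4] at k3
  have k5 := mul_le_mul_of_nonneg_left k3 hNpos.le
  refine k5.trans ?_
  have k6 := hg2 0 hm0
  have hRe : e ≤ R * e := by nlinarith
  have hKRe : R * e ≤ K * (R * e) := by nlinarith [mul_nonneg (by linarith : (0:ℝ) ≤ R) he]
  have : N * (D2 cs fh (g 0) + 2 * (N * ∑ B ∈ cs, nd (g 0 B * c0⁻¹) (G B))) =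
    N * D2 cs fh (g 0) + 2 * (N ^ 2 * ∑ B ∈ cs, nd (g 0 B * c0⁻¹) (G B)) := by ring
  rw [← hN, this]
  calc _ ≤ e + 2 * (4 * (152 * R * e + K * (64 * (456 * R * e)))) := by linarith
    _ ≤ K * (R * e) + 2 * (4 * (152 * (K * (R * e)) + K * (64 * (456 * R * e)))) := by nlinarith
    _ = 234689 * (K * (R * e)) := by ring
    _ ≤ _ := by nlinarith [mul_nonneg (by linarith : (0:ℝ) ≤ K) (mul_nonneg (by linarith : (0:ℝ) ≤ R) he)]

end step


section abscone
variable {P Γ : Type} [Group Γ]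

/-- three edge labellings -/
structure Lab (P Γ : Type) where
  h01 : P → P → Γ
  h12 : P → P → Γ
  h02 : P → P → Γ

def Lab.good (h : Lab P Γ) (t : P × P × P) : Prop :=
  h.h01 t.1 t.2.1 * h.h12 t.2.1 t.2.2 = h.h02 t.1 t.2.2

/-- `Q` is a consequence of the goodness of at most `K` valid triangles -/
def Cons (val : P × P × P → Prop) (K : ℕ) (Q : Lab P Γ → Prop) : Prop :=
  ∃ S : Finset (P × P × P), S.card ≤ K ∧ (∀ t ∈ S, val t) ∧ ∀ h : Lab P Γ, (∀ t ∈ S, h.good t) → Q h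

theorem Cons.and {val : P × P × P → Prop} {K K' : ℕ} {Q Q' : Lab P Γ → Prop}
    (h : Cons val K Q) (h' : Cons val K' Q') : Cons val (K + K') (fun h => Q h ∧ Q' h) := by
  obtain ⟨S, a, b, c⟩ := h
  obtain ⟨S', a', b', c'⟩ := h'
  refine ⟨S ∪ S', (Finset.card_union_le _ _).trans (by omega), ?_, ?_⟩
  · intro t ht
    rcases Finset.mem_union.1 ht with h | h
    · exact b t h
    · exact b' t h
  · intro h ht
    exact ⟨c h fun t hh => ht t (Finset.mem_union_left _ hh), c' h fun t hh => ht t (Finset.mem_union_right _ hh)⟩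

theorem Cons.mono {val : P × P × P → Prop} {K K' : ℕ} {Q Q' : Lab P Γ → Prop}
    (h : Cons val K Q) (hK : K ≤ K') (hQ : ∀ h, Q h → Q' h) : Cons val K' Q' := by
  obtain ⟨S, a, b, c⟩ := h
  exact ⟨S, a.trans hK, b, fun h hh => hQ h (c h hh)⟩

theorem Cons.single {val : P × P × P → Prop} {a b c : P} (hv : val (a, b, c)) :
    Cons (Γ := Γ) val 1 (fun h => h.h01 a b * h.h12 b c = h.h02 a c) :=
  ⟨{(a, b, c)}, by simp, by simpa using hv, fun h hh => hh _ (Finset.mem_singleton_self _)⟩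

/-- the labelling is given by potentials on the triangle -/
def Lab.pot (h : Lab P Γ) (c : (P → Γ) × (P → Γ) × (P → Γ)) (t : P × P × P) : Prop :=
  h.h01 t.1 t.2.1 = (c.1 t.1)⁻¹ * c.2.1 t.2.1 ∧ h.h12 t.2.1 t.2.2 = (c.2.1 t.2.1)⁻¹ * c.2.2 t.2.2 ∧
  h.h02 t.1 t.2.2 = (c.1 t.1)⁻¹ * c.2.2 t.2.2

/-- abstract filling property -/
def AFill (Γ : Type) [Group Γ] (val : P × P × P → Prop) (K : ℕ) : Prop :=
  ∃ c : Lab P Γ → (P → Γ) × (P → Γ) × (P → Γ), ∀ t, val t → Cons val K (fun h => h.pot (c h) t)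

theorem beta_cone (R01 R12 R02 : P → P → Prop) (p0 : P → Prop) (a0 : P) (ha0 : p0 a0)
    (r1 : ∀ a b, R01 a b → p0 a) (r2 : ∀ a c, R02 a c → p0 a)
    (r3 : ∀ a b c, R01 a b → R12 b c → R02 a c)
    (X1 : ∀ a a', p0 a → p0 a' → ∃ b, R01 a b ∧ R01 a' b)
    (X2 : ∀ a b b', R01 a b → R01 a b' → ∃ c, R12 b c ∧ R12 b' c)
    (X3 : ∀ a b, R01 a b → ∃ c, R12 b c ∧ R02 a0 c)
    (X4 : ∀ a a' c, R02 a c → R02 a' c → ∃ b, R01 a b ∧ R01 a' b ∧ R12 b c) :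
    AFill Γ (fun t => R01 t.1 t.2.1 ∧ R12 t.2.1 t.2.2) 45 := by
  set val : P × P × P → Prop := fun t => R01 t.1 t.2.1 ∧ R12 t.2.1 t.2.2 with hval
  have hb : ∀ a, ∃ b, p0 a → R01 a b ∧ R01 a0 b := by
    intro a
    by_cases h : p0 a
    · obtain ⟨b, hb⟩ := X1 a a0 h ha0; exact ⟨b, fun _ => hb⟩
    · exact ⟨a, fun h' => absurd h' h⟩
  choose bb hbb using hb
  have hs1 : ∀ b, ∃ a, (∃ a', R01 a' b) → R01 a b := by
    intro b
    by_cases h : ∃ a', R01 a' b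
    · obtain ⟨a, ha⟩ := h; exact ⟨a, fun _ => ha⟩
    · exact ⟨b, fun h' => absurd h' h⟩
  choose s1 hs1 using hs1
  have hs2 : ∀ b, ∃ a, (∃ a', R02 a' b) → R02 a b := by
    intro b
    by_cases h : ∃ a', R02 a' b
    · obtain ⟨a, ha⟩ := h; exact ⟨a, fun _ => ha⟩
    · exact ⟨b, fun h' => absurd h' h⟩
  choose s2 hs2 using hs2
  let g : Lab P Γ → P → Γ := fun h a => h.h01 a (bb a) * (h.h01 a0 (bb a))⁻¹
  have L : ∀ a c, R02 a c → R02 a0 c → Cons val 6 (fun h => g h a = h.h02 a c * (h.h02 a0 c)⁻¹) := by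
    intro a c hac h0c
    obtain ⟨b', h1, h2, h3⟩ := X4 a a0 c hac h0c
    obtain ⟨k1, k2⟩ := hbb a (r2 a c hac)
    obtain ⟨c', h4, h5⟩ := X2 a b' (bb a) h1 k1
    have C1 := Cons.single (Γ := Γ) (val := val) (a := a) (b := b') (c := c) ⟨h1, h3⟩
    have C2 := Cons.single (Γ := Γ) (val := val) (a := a0) (b := b') (c := c) ⟨h2, h3⟩
    have C3 := Cons.single (Γ := Γ) (val := val) (a := a) (b := b') (c := c') ⟨h1, h4⟩
    have C4 := Cons.single (Γ := Γ) (val := val) (a := a0) (b := b') (c := c') ⟨h2, h4⟩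
    have C5 := Cons.single (Γ := Γ) (val := val) (a := a) (b := bb a) (c := c') ⟨k1, h5⟩
    have C6 := Cons.single (Γ := Γ) (val := val) (a := a0) (b := bb a) (c := c') ⟨k2, h5⟩
    refine (((((C1.and C2).and C3).and C4).and C5).and C6).mono le_rfl ?_
    rintro h ⟨⟨⟨⟨⟨e1, e2⟩, e3⟩, e4⟩, e5⟩, e6⟩
    show h.h01 a (bb a) * (h.h01 a0 (bb a))⁻¹ = _
    have : h.h01 a (bb a) * (h.h01 a0 (bb a))⁻¹ = h.h02 a c' * (h.h02 a0 c')⁻¹ := by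
      rw [← e5, ← e6]; group
    rw [this, ← e3, ← e4, ← e1, ← e2]; group
  have M : ∀ a a' b, R01 a b → R01 a' b →
      Cons val 14 (fun h => g h a = h.h01 a b * (h.h01 a' b)⁻¹ * g h a') := by
    intro a a' b h1 h2
    obtain ⟨c, h3, h4⟩ := X3 a b h1
    have C1 := L a c (r3 _ _ _ h1 h3) h4
    have C2 := L a' c (r3 _ _ _ h2 h3) h4
    have C3 := Cons.single (Γ := Γ) (val := val) (a := a) (b := b) (c := c) ⟨h1, h3⟩
    have C4 := Cons.single (Γ := Γ) (val := val) (a := a') (b := b) (c := c) ⟨h2, h3⟩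
    refine (((C1.and C2).and C3).and C4).mono le_rfl ?_
    rintro h ⟨⟨⟨e1, e2⟩, e3⟩, e4⟩
    rw [e1, e2, ← e3, ← e4]; group
  refine ⟨fun h => (fun a => (g h a)⁻¹, fun b => (g h (s1 b))⁻¹ * h.h01 (s1 b) b,
    fun c => (g h (s2 c))⁻¹ * h.h02 (s2 c) c), ?_⟩
  rintro ⟨a, b, c⟩ ⟨hab, hbc⟩
  simp only at hab hbc
  have hac := r3 _ _ _ hab hbc
  have C1 := M a (s1 b) b hab (hs1 b ⟨a, hab⟩)
  have hs := hs2 c ⟨a, hac⟩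
  obtain ⟨b', k1, k2, k3⟩ := X4 a (s2 c) c hac hs
  have C2 := M a (s2 c) b' k1 k2
  have C3 := Cons.single (Γ := Γ) (val := val) (a := a) (b := b') (c := c) ⟨k1, k3⟩
  have C4 := Cons.single (Γ := Γ) (val := val) (a := s2 c) (b := b') (c := c) ⟨k2, k3⟩
  have C5 := Cons.single (Γ := Γ) (val := val) (a := a) (b := b) (c := c) ⟨hab, hbc⟩
  refine ((((C1.and C2).and C3).and C4).and C5).mono (by norm_num) ?_
  rintro h ⟨⟨⟨⟨e1, e2⟩, e3⟩, e4⟩, e5⟩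
  have f1 : h.h01 a b = g h a * ((g h (s1 b))⁻¹ * h.h01 (s1 b) b) := by rw [e1]; group
  have f2 : h.h02 a c = g h a * ((g h (s2 c))⁻¹ * h.h02 (s2 c) c) := by
    rw [e2, ← e3, ← e4]; group
  refine ⟨?_, ?_, ?_⟩
  · show h.h01 a b = _
    simp only [inv_inv]; exact f1
  · show h.h12 b c = _
    have : h.h12 b c = (h.h01 a b)⁻¹ * h.h02 a c := by rw [← e5]; group
    rw [this, f2, f1]; group
  · show h.h02 a c = _
    simp only [inv_inv]; exact f2

theorem join_cone (R12 : P → P → Prop) (p0 p1 : P → Prop) (a0 b0 : P) (ha0 : p0 a0) (hb0 : p1 b0)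
    (Y1 : ∀ b, p1 b → ∃ c, R12 b c ∧ R12 b0 c) :
    AFill Γ (fun t => (p0 t.1 ∧ p1 t.2.1) ∧ R12 t.2.1 t.2.2) 45 := by
  set val : P × P × P → Prop := fun t => (p0 t.1 ∧ p1 t.2.1) ∧ R12 t.2.1 t.2.2 with hval
  refine ⟨fun h => (fun a => h.h01 a0 b0 * (h.h01 a b0)⁻¹, fun b => h.h01 a0 b, fun c => h.h02 a0 c), ?_⟩
  rintro ⟨a, b, c⟩ ⟨⟨ha, hb⟩, hbc⟩
  simp only at ha hb hbc
  obtain ⟨c', h1, h2⟩ := Y1 b hb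
  have C1 := Cons.single (Γ := Γ) (val := val) (a := a0) (b := b) (c := c) ⟨⟨ha0, hb⟩, hbc⟩
  have C2 := Cons.single (Γ := Γ) (val := val) (a := a) (b := b) (c := c) ⟨⟨ha, hb⟩, hbc⟩
  have C3 := Cons.single (Γ := Γ) (val := val) (a := a) (b := b) (c := c') ⟨⟨ha, hb⟩, h1⟩
  have C4 := Cons.single (Γ := Γ) (val := val) (a := a) (b := b0) (c := c') ⟨⟨ha, hb0⟩, h2⟩
  have C5 := Cons.single (Γ := Γ) (val := val) (a := a0) (b := b) (c := c') ⟨⟨ha0, hb⟩, h1⟩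
  have C6 := Cons.single (Γ := Γ) (val := val) (a := a0) (b := b0) (c := c') ⟨⟨ha0, hb0⟩, h2⟩
  refine (((((C1.and C2).and C3).and C4).and C5).and C6).mono (by norm_num) ?_
  rintro h ⟨⟨⟨⟨⟨e1, e2⟩, e3⟩, e4⟩, e5⟩, e6⟩
  have f1 : h.h01 a b = (h.h01 a0 b0 * (h.h01 a b0)⁻¹)⁻¹ * h.h01 a0 b := by
    have q1 : h.h01 a b = h.h01 a b0 * h.h12 b0 c' * (h.h12 b c')⁻¹ := by rw [e4, ← e3]; group
    have q2 : h.h01 a0 b = h.h01 a0 b0 * h.h12 b0 c' * (h.h12 b c')⁻¹ := by rw [e6, ← e5]; group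
    rw [q1, q2]; group
  refine ⟨f1, ?_, ?_⟩
  · show h.h12 b c = (h.h01 a0 b)⁻¹ * h.h02 a0 c
    rw [← e1]; group
  · show h.h02 a c = (h.h01 a0 b0 * (h.h01 a b0)⁻¹)⁻¹ * h.h02 a0 c
    rw [← e1, ← e2, f1]; group
end abscone

section avg
variable {F V : Type} [Field F] [AddCommGroup V] [Module F V] [FiniteDimensional F V] [Fintype F]
variable {Γ : Type} [Group Γ]

/-- flags filling: a cone in the fibre of `T0` over `A`. -/
theorem fill_of_abs {A : Set ℕ} {T0 : Flg F V} {u0 u1 u2 : ℕ} {K : ℕ}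
    {val : Submodule F V × Submodule F V × Submodule F V → Prop} (hA : AFill Γ val K)
    (hv : ∀ T ∈ fib A T0, val (T.f u0, T.f u1, T.f u2))
    (hext : ∀ t, val t → ∃ T ∈ fib A T0, T.f u0 = t.1 ∧ T.f u1 = t.2.1 ∧ T.f u2 = t.2.2) :
    ∃ L : Flg F V → Finset (Flg F V), (∀ T ∈ fib A T0, L T ⊆ fib A T0 ∧ (L T).card ≤ K) ∧
      ∀ h01 h12 h02 : Flg F V → Γ, Meas (A ∪ {u0, u1}) h01 → Meas (A ∪ {u1, u2}) h12 →
        Meas (A ∪ {u0, u2}) h02 → ∃ c0 c1 c2 : Flg F V → Γ, Meas {u0} c0 ∧ Meas {u1} c1 ∧ Meas {u2} c2 ∧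
        ∀ T ∈ fib A T0, (∀ T' ∈ L T, h01 T' * h12 T' = h02 T') →
          h01 T = (c0 T)⁻¹ * c1 T ∧ h12 T = (c1 T)⁻¹ * c2 T ∧ h02 T = (c0 T)⁻¹ * c2 T := by
  obtain ⟨c, hc⟩ := hA
  have hne : Nonempty (Flg F V) := ⟨T0⟩
  choose! lift hl0 hl1 hl2 hl3 using hext
  choose! S hS1 hS2 hS3 using hc
  refine ⟨fun T => (S (T.f u0, T.f u1, T.f u2)).image lift, ?_, ?_⟩
  · intro T hT
    refine ⟨?_, Finset.card_image_le.trans (hS1 _ (hv T hT))⟩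
    intro T' hT'
    obtain ⟨t, ht, rfl⟩ := Finset.mem_image.1 hT'
    exact hl0 t (hS2 _ (hv T hT) t ht)
  · intro h01 h12 h02 m01 m12 m02
    let mk : (Flg F V → Γ) → ℕ → ℕ → Submodule F V → Submodule F V → Γ := fun h i j w w' =>
      if hh : ∃ T ∈ fib A T0, T.f i = w ∧ T.f j = w' then h hh.choose else 1
    have mkeq : ∀ (h : Flg F V → Γ) (i j : ℕ), Meas (A ∪ {i, j}) h → ∀ T ∈ fib A T0,
        mk h i j (T.f i) (T.f j) = h T := by
      intro h i j hm T hT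
      have hh : ∃ T' ∈ fib A T0, T'.f i = T.f i ∧ T'.f j = T.f j := ⟨T, hT, rfl, rfl⟩
      show (if hh : _ then _ else _) = _
      rw [dif_pos hh]
      obtain ⟨q1, q2, q3⟩ := hh.choose_spec
      apply hm
      rintro x (hx | hx | hx)
      · exact ((mem_fib.1 q1).symm.trans (mem_fib.1 hT)) x hx
      · rw [hx]; exact q2
      · rw [Set.mem_singleton_iff.1 hx]; exact q3
    let h : Lab (Submodule F V) Γ := ⟨mk h01 u0 u1, mk h12 u1 u2, mk h02 u0 u2⟩
    refine ⟨fun T => (c h).1 (T.f u0), fun T => (c h).2.1 (T.f u1), fun T => (c h).2.2 (T.f u2),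
      fun T T' hT => congrArg _ (hT u0 rfl), fun T T' hT => congrArg _ (hT u1 rfl),
      fun T T' hT => congrArg _ (hT u2 rfl), ?_⟩
    intro T hT hg
    have := hS3 (T.f u0, T.f u1, T.f u2) (hv T hT) h (by
      intro t ht
      have hvt := hS2 _ (hv T hT) t ht
      have := hg (lift t) (Finset.mem_image_of_mem _ ht)
      show mk h01 u0 u1 t.1 t.2.1 * mk h12 u1 u2 t.2.1 t.2.2 = mk h02 u0 u2 t.1 t.2.2
      rw [← mkeq h01 u0 u1 m01 _ (hl0 t hvt), ← mkeq h12 u1 u2 m12 _ (hl0 t hvt),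
        ← mkeq h02 u0 u2 m02 _ (hl0 t hvt), hl1 t hvt, hl2 t hvt, hl3 t hvt] at this
      exact this)
    obtain ⟨e1, e2, e3⟩ := this
    refine ⟨?_, ?_, ?_⟩
    · rw [← mkeq h01 u0 u1 m01 T hT]; exact e1
    · rw [← mkeq h12 u1 u2 m12 T hT]; exact e2
    · rw [← mkeq h02 u0 u2 m02 T hT]; exact e3

instance finite_gl : Finite (V ≃ₗ[F] V) := by
  have : Finite V := Module.finite_of_finite F
  exact Finite.of_injective (fun γ : V ≃ₗ[F] V => (γ : V → V)) DFunLike.coe_injective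

noncomputable instance fintype_gl : Fintype (V ≃ₗ[F] V) := Fintype.ofFinite _

theorem act_trans (γ δ : V ≃ₗ[F] V) (T : Flg F V) : act (γ.trans δ) T = act δ (act γ T) := by
  apply Flg.ext'; intro i
  simp only [act_f]
  rw [← Submodule.map_comp]; rfl

/-- stabiliser -/
noncomputable def stb (A : Set ℕ) (T0 : Flg F V) : Finset (V ≃ₗ[F] V) :=
  univ.filter (fun γ => Agr A T0 (act γ T0))

theorem act_mem {A : Set ℕ} {T0 : Flg F V} {γ : V ≃ₗ[F] V} (h : γ ∈ stb A T0) {T : Flg F V}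
    : act γ T ∈ fib A T0 ↔ T ∈ fib A T0 := by
  have h1 : Agr A T0 (act γ T0) := (Finset.mem_filter.1 h).2
  rw [mem_fib, mem_fib]
  constructor
  · intro h2; exact (act_agr γ).1 (h1.symm.trans h2)
  · intro h2; exact h1.trans ((act_agr γ).2 h2)

theorem stb_avg {A : Set ℕ} {T0 : Flg F V} (X : Flg F V → ℝ) {T1 : Flg F V} (hT1 : T1 ∈ fib A T0) :
    ((fib A T0).card : ℝ) * ∑ γ ∈ stb A T0, X (act γ T1) =
      ((stb A T0).card : ℝ) * ∑ T ∈ fib A T0, X T := by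
  have hind : ∀ T2 ∈ fib A T0, ∑ γ ∈ stb A T0, X (act γ T2) = ∑ γ ∈ stb A T0, X (act γ T1) := by
    intro T2 hT2
    obtain ⟨δ, hδ⟩ := trans_gl' T1 T2
    have hds : ∀ γ : V ≃ₗ[F] V, δ.trans γ ∈ stb A T0 ↔ γ ∈ stb A T0 := by
      intro γ
      simp only [stb, Finset.mem_filter, Finset.mem_univ, true_and]
      rw [act_trans]
      have hd1 : Agr A T0 (act δ T0) := by
        have := (act_agr δ).2 (mem_fib.1 hT1)
        rw [hδ] at this
        exact (mem_fib.1 hT2).trans this.symm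
      constructor
      · intro h; exact h.trans ((act_agr γ).2 hd1.symm)
      · intro h; exact h.trans ((act_agr γ).2 hd1)
    refine Finset.sum_bij' (fun γ _ => δ.trans γ) (fun γ _ => δ.symm.trans γ) ?_ ?_ ?_ ?_ ?_
    · intro γ h; exact (hds γ).2 h
    · intro γ h
      rw [← hds]
      have : δ.trans (δ.symm.trans γ) = γ := by ext; simp
      rw [this]; exact h
    · intro γ _; ext; simp
    · intro γ _; ext; simp
    · intro γ _; rw [act_trans, hδ]
  calc _ = ∑ T2 ∈ fib A T0, ∑ γ ∈ stb A T0, X (act γ T2) := by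
        rw [Finset.sum_congr rfl hind, Finset.sum_const, nsmul_eq_mul]
    _ = ∑ γ ∈ stb A T0, ∑ T ∈ fib A T0, X T := by
        rw [Finset.sum_comm]
        apply Finset.sum_congr rfl
        intro γ hγ
        refine Finset.sum_bij' (fun T _ => act γ T) (fun T _ => (act γ).symm T) ?_ ?_ ?_ ?_ ?_
        · intro T h; exact (act_mem hγ).2 h
        · intro T h; rw [← act_mem hγ, Equiv.apply_symm_apply]; exact h
        · intro T _; simp
        · intro T _; simp
        · intro T _; rfl
    _ = _ := by rw [Finset.sum_const, nsmul_eq_mul]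

theorem meas_act {γ' : Type*} {C : Set ℕ} {h : Flg F V → γ'} (hm : Meas C h) (γ : V ≃ₗ[F] V) :
    Meas C (fun T => h (act γ T)) := fun T T' hT => hm _ _ ((act_agr γ).2 hT)

theorem meas_act_symm {γ' : Type*} {C : Set ℕ} {h : Flg F V → γ'} (hm : Meas C h) (γ : V ≃ₗ[F] V) :
    Meas C (fun T => h ((act γ).symm T)) := fun T T' hT => hm _ _ (by
      rw [← act_agr γ, Equiv.apply_symm_apply, Equiv.apply_symm_apply]; exact hT)

/-- conclusion of the cone argument with all three potentials, fibrewise -/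
def ConeP (F V : Type) [Field F] [AddCommGroup V] [Module F V] [FiniteDimensional F V] [Fintype F]
    (Γ : Type) [Group Γ] (A : Set ℕ) (u0 u1 u2 : ℕ) : Prop :=
  ∀ h01 h12 h02 : Flg F V → Γ, Meas (A ∪ {u0, u1}) h01 → Meas (A ∪ {u1, u2}) h12 →
    Meas (A ∪ {u0, u2}) h02 → ∃ c0 c1 c2 : Flg F V → Γ,
      Meas (A ∪ {u0}) c0 ∧ Meas (A ∪ {u1}) c1 ∧ Meas (A ∪ {u2}) c2 ∧
      ∀ T0, ce A (fun T => if h01 T = (c0 T)⁻¹ * c1 T ∧ h12 T = (c1 T)⁻¹ * c2 T ∧ h02 T = (c0 T)⁻¹ * c2 T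
        then 0 else 1) T0 ≤ 45 * ce A (fun T => if h01 T * h12 T = h02 T then 0 else 1) T0

theorem cone_of_abs {A : Set ℕ} {u0 u1 u2 : ℕ}
    (hA : ∀ T0 : Flg F V, ∃ val : Submodule F V × Submodule F V × Submodule F V → Prop, AFill Γ val 45 ∧
    (∀ T ∈ fib A T0, val (T.f u0, T.f u1, T.f u2)) ∧
    (∀ t, val t → ∃ T ∈ fib A T0, T.f u0 = t.1 ∧ T.f u1 = t.2.1 ∧ T.f u2 = t.2.2)) :
    ConeP F V Γ A u0 u1 u2 := by
  intro h01 h12 h02 m01 m12 m02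
  have key : ∀ S : Finset (Flg F V), ∃ c0 c1 c2 : Flg F V → Γ, Meas {u0} c0 ∧ Meas {u1} c1 ∧ Meas {u2} c2 ∧
      ∀ T0, S = fib A T0 → ∑ T ∈ S, (if h01 T = (c0 T)⁻¹ * c1 T ∧ h12 T = (c1 T)⁻¹ * c2 T ∧ h02 T = (c0 T)⁻¹ * c2 T
        then (0:ℝ) else 1) ≤ 45 * ∑ T ∈ S, if h01 T * h12 T = h02 T then 0 else 1 := by
    intro S
    by_cases hS : ∃ T0, S = fib A T0
    swap
    · exact ⟨1, 1, 1, fun _ _ _ => rfl, fun _ _ _ => rfl, fun _ _ _ => rfl, fun T0 h => absurd ⟨T0, h⟩ hS⟩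
    obtain ⟨T0, rfl⟩ := hS
    obtain ⟨val, a1, a2, a3⟩ := hA T0
    obtain ⟨L, hL, hLc⟩ := fill_of_abs a1 a2 a3
    let X : Flg F V → ℝ := fun T => if h01 T * h12 T = h02 T then 0 else 1
    have hX0 : ∀ T, 0 ≤ X T := fun T => by simp only [X]; split_ifs <;> norm_num
    have hfp := fib_card_pos A T0
    have hone : LinearEquiv.refl F V ∈ stb A T0 := by
      simp only [stb, Finset.mem_filter, Finset.mem_univ, true_and]
      intro c _
      show T0.f c = (T0.f c).map _
      simp
    have hsp : (0:ℝ) < (stb A T0).card := by exact_mod_cast Finset.card_pos.2 ⟨_, hone⟩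
    -- best γ
    obtain ⟨γ, hγ, hb⟩ : ∃ γ ∈ stb A T0, ∑ T ∈ fib A T0, ∑ T' ∈ L T, X (act γ T') ≤ 45 * ∑ T ∈ fib A T0, X T := by
      by_contra! hc
      have h1 := Finset.sum_lt_sum_of_nonempty ⟨_, hone⟩ hc
      rw [Finset.sum_const, nsmul_eq_mul] at h1
      have h2 : ((fib A T0).card : ℝ) * ∑ γ ∈ stb A T0, ∑ T ∈ fib A T0, ∑ T' ∈ L T, X (act γ T') ≤
          (fib A T0).card * ((stb A T0).card * (45 * ∑ T ∈ fib A T0, X T)) := by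
        rw [Finset.sum_comm]
        have h3 : ∀ T ∈ fib A T0, ((fib A T0).card : ℝ) * ∑ γ ∈ stb A T0, ∑ T' ∈ L T, X (act γ T') ≤
            45 * ((stb A T0).card * ∑ T ∈ fib A T0, X T) := by
          intro T hT
          rw [Finset.sum_comm, Finset.mul_sum]
          have h4 : ∀ T' ∈ L T, ((fib A T0).card : ℝ) * ∑ γ ∈ stb A T0, X (act γ T') =
              (stb A T0).card * ∑ T ∈ fib A T0, X T := fun T' hT' => stb_avg X ((hL T hT).1 hT')
          rw [Finset.sum_congr rfl h4, Finset.sum_const, nsmul_eq_mul]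
          apply mul_le_mul_of_nonneg_right
          · exact_mod_cast (hL T hT).2
          · exact mul_nonneg hsp.le (Finset.sum_nonneg fun T _ => hX0 T)
        rw [Finset.mul_sum]
        refine (Finset.sum_le_sum h3).trans ?_
        rw [Finset.sum_const, nsmul_eq_mul]
        apply le_of_eq; ring
      have h5 := mul_lt_mul_of_pos_left h1 hfp
      linarith
    obtain ⟨c0, c1, c2, n0, n1, n2, hcc⟩ := hLc _ _ _ (meas_act m01 γ) (meas_act m12 γ) (meas_act m02 γ)
    refine ⟨fun T => c0 ((act γ).symm T), fun T => c1 ((act γ).symm T), fun T => c2 ((act γ).symm T),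
      meas_act_symm n0 γ, meas_act_symm n1 γ, meas_act_symm n2 γ, fun T1 hT1 => ?_⟩
    refine le_trans ?_ hb
    rw [← Finset.sum_bij' (s := fib A T0) (t := fib A T0)
      (f := fun T => if h01 (act γ T) = (c0 T)⁻¹ * c1 T ∧ h12 (act γ T) = (c1 T)⁻¹ * c2 T ∧
        h02 (act γ T) = (c0 T)⁻¹ * c2 T then (0:ℝ) else 1) (fun T _ => act γ T) (fun T _ => (act γ).symm T)
        (fun T h => (act_mem hγ).2 h)
        (fun T h => by rw [← act_mem hγ, Equiv.apply_symm_apply]; exact h)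
        (fun T _ => by simp) (fun T _ => by simp) (fun T _ => by simp)]
    apply Finset.sum_le_sum
    intro T hT
    split_ifs with hg
    · exact Finset.sum_nonneg fun T _ => hX0 _
    · by_contra hlt
      apply hg
      apply hcc T hT
      intro T' hT'
      by_contra hbad
      apply hlt
      refine le_trans ?_ (Finset.single_le_sum (f := fun T' => X (act γ T')) (fun T _ => hX0 _) hT')
      simp only [X, hbad, if_false]; exact le_rfl
  choose c0 c1 c2 n0 n1 n2 hcc using key
  have hm : ∀ (c : Finset (Flg F V) → Flg F V → Γ) (u : ℕ), (∀ S, Meas {u} (c S)) →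
      Meas (A ∪ {u}) (fun T => c (fib A T) T) := by
    intro c u hc T T' hT
    show c (fib A T) T = c (fib A T') T'
    rw [fib_eq (hT.mono Set.subset_union_left)]
    exact hc _ _ _ (hT.mono Set.subset_union_right)
  refine ⟨fun T => c0 (fib A T) T, fun T => c1 (fib A T) T, fun T => c2 (fib A T) T,
    hm c0 u0 n0, hm c1 u1 n1, hm c2 u2 n2, ?_⟩
  intro T0
  have h1 := hcc (fib A T0) T0 rfl
  unfold ce
  rw [← mul_div_assoc]
  refine div_le_div_of_nonneg_right (le_trans (le_of_eq ?_) h1) (fib_card_pos A T0).le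
  apply Finset.sum_congr rfl
  intro T hT
  simp only [← fib_eq (mem_fib.1 hT)]

/-- E1 for three colours from a cone -/
theorem E1_of_cone {A : Set ℕ} {y : ℕ → ℕ} (h : ConeP F V Γ A (y 0) (y 1) (y 2)) :
    E1 (Flg F V) Γ 3 y A 45 := by
  intro H hH
  obtain ⟨c0, c1, c2, n0, n1, n2, hc⟩ := h (H 0 1) (H 1 2) (H 0 2) (hH 0 1 (by norm_num) (by norm_num))
    (hH 1 2 (by norm_num) (by norm_num)) (hH 0 2 (by norm_num) (by norm_num))
  refine ⟨c0, c1, n0, n1, ?_⟩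
  have h1 := Finset.sum_le_sum (s := univ) (fun T _ => hc T)
  rw [← Finset.mul_sum, sum_ce, sum_ce] at h1
  have h2 : nd (H 0 1) (c0⁻¹ * c1) ≤ ∑ T, (if H 0 1 T = (c0 T)⁻¹ * c1 T ∧ H 1 2 T = (c1 T)⁻¹ * c2 T ∧
      H 0 2 T = (c0 T)⁻¹ * c2 T then (0:ℝ) else 1) := by
    unfold nd
    apply Finset.sum_le_sum
    intro T _
    simp only [Pi.mul_apply, Pi.inv_apply]
    split_ifs with q1 q2
    · exact absurd q2.1 q1
    · exact le_rfl
    · exact le_rfl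
    · norm_num
  refine h2.trans (h1.trans ?_)
  apply mul_le_mul_of_nonneg_left _ (by norm_num)
  have hmem : ((0, 1, 2) : ℕ × ℕ × ℕ) ∈ trip 3 := by decide
  refine le_trans (le_of_eq ?_) (Finset.single_le_sum
    (f := fun p : ℕ × ℕ × ℕ => nd (H p.1 p.2.1 * H p.2.1 p.2.2) (H p.1 p.2.2))
    (fun p _ => nd_nonneg _ _) hmem)
  unfold nd
  apply Finset.sum_congr rfl
  intro T _
  simp only [Pi.mul_apply]
  by_cases q : H 0 1 T * H 1 2 T = H 0 2 T <;> simp [q]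

end avg


section coneinst
variable {F V : Type} [Field F] [AddCommGroup V] [Module F V] [FiniteDimensional F V] [Fintype F]
variable {Γ : Type} [Group Γ]

theorem rank_sup_le' {U a b : Submodule F V} (ha : U ≤ a) (hb : U ≤ b) :
    Module.finrank F ↥(a ⊔ b) + Module.finrank F U ≤ Module.finrank F a + Module.finrank F b := by
  have h1 := Submodule.finrank_sup_add_finrank_inf_eq a b
  have h2 := Submodule.finrank_mono (le_inf ha hb)
  omega

theorem rank_inf_ge' {U a b : Submodule F V} (ha : a ≤ U) (hb : b ≤ U) :
    Module.finrank F a + Module.finrank F b ≤ Module.finrank F ↥(a ⊓ b) + Module.finrank F U := by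
  have h1 := Submodule.finrank_sup_add_finrank_inf_eq a b
  have h2 := Submodule.finrank_mono (sup_le ha hb)
  omega

theorem Flg.rk (T : Flg F V) {i : ℕ} (h : i ≤ Module.finrank F V) : Module.finrank F (T.f i) = i := by
  rw [T.rank]; omega

/-- extend upwards to a larger space of given rank -/
theorem ext_up (W : Submodule F V) {m : ℕ} (h1 : Module.finrank F W ≤ m) (h2 : m ≤ Module.finrank F V) :
    ∃ X, W ≤ X ∧ Module.finrank F X = m := by
  obtain ⟨X, a, _, b⟩ := exists_mid (le_top : W ≤ ⊤) h1 (by rw [finrank_top]; exact h2)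
  exact ⟨X, a, b⟩

theorem ext_down (W : Submodule F V) {m : ℕ} (h1 : m ≤ Module.finrank F W) :
    ∃ X, X ≤ W ∧ Module.finrank F X = m := by
  obtain ⟨X, _, a, b⟩ := exists_mid (bot_le : ⊥ ≤ W) (m := m) (by rw [finrank_bot]; omega) h1
  exact ⟨X, a, b⟩

theorem cone_up (A : Set ℕ) (x h : ℕ) (hxA : x ∈ A) (hA : ∀ c ∈ A, c ≤ x)
    (hn : x + 3 * h ≤ Module.finrank F V) : ConeP F V Γ A (x + h) (x + 2 * h) (x + 3 * h) := by
  apply cone_of_abs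
  intro T0
  set U := T0.f x with hU
  have rU : Module.finrank F U = x := T0.rk (by omega)
  let R01 : Submodule F V → Submodule F V → Prop := fun a b =>
    U ≤ a ∧ a ≤ b ∧ Module.finrank F a = x + h ∧ Module.finrank F b = x + 2 * h
  let R12 : Submodule F V → Submodule F V → Prop := fun b c =>
    U ≤ b ∧ b ≤ c ∧ Module.finrank F b = x + 2 * h ∧ Module.finrank F c = x + 3 * h
  let R02 : Submodule F V → Submodule F V → Prop := fun a c =>
    U ≤ a ∧ a ≤ c ∧ Module.finrank F a = x + h ∧ Module.finrank F c = x + 3 * h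
  refine ⟨fun t => R01 t.1 t.2.1 ∧ R12 t.2.1 t.2.2, ?_, ?_, ?_⟩
  · refine beta_cone R01 R12 R02 (fun a => U ≤ a ∧ Module.finrank F a = x + h) (T0.f (x + h))
      ⟨T0.mono (by omega), T0.rk (by omega)⟩ (fun a b q => ⟨q.1, q.2.2.1⟩) (fun a b q => ⟨q.1, q.2.2.1⟩)
      (fun a b c q q' => ⟨q.1, q.2.1.trans q'.2.1, q.2.2.1, q'.2.2.2⟩) ?_ ?_ ?_ ?_
    · rintro a a' ⟨q1, q2⟩ ⟨q3, q4⟩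
      have := rank_sup_le' q1 q3
      obtain ⟨b, k1, k2⟩ := ext_up (a ⊔ a') (m := x + 2 * h) (by omega) (by omega)
      exact ⟨b, ⟨q1, le_sup_left.trans k1, q2, k2⟩, ⟨q3, le_sup_right.trans k1, q4, k2⟩⟩
    · rintro a b b' ⟨q1, q2, q3, q4⟩ ⟨q1', q2', q3', q4'⟩
      have := rank_sup_le' q2 q2'
      obtain ⟨c, k1, k2⟩ := ext_up (b ⊔ b') (m := x + 3 * h) (by omega) (by omega)
      exact ⟨c, ⟨q1.trans q2, le_sup_left.trans k1, q4, k2⟩, ⟨q1.trans q2', le_sup_right.trans k1, q4', k2⟩⟩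
    · rintro a b ⟨q1, q2, q3, q4⟩
      have h0 : U ≤ T0.f (x + h) := T0.mono (by omega)
      have h1 : Module.finrank F (T0.f (x + h)) = x + h := T0.rk (by omega)
      have := rank_sup_le' (q1.trans q2) h0
      obtain ⟨c, k1, k2⟩ := ext_up (b ⊔ T0.f (x + h)) (m := x + 3 * h) (by omega) (by omega)
      exact ⟨c, ⟨q1.trans q2, le_sup_left.trans k1, q4, k2⟩, ⟨h0, le_sup_right.trans k1, h1, k2⟩⟩
    · rintro a a' c ⟨q1, q2, q3, q4⟩ ⟨q1', q2', q3', q4'⟩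
      have := rank_sup_le' q1 q1'
      obtain ⟨b, k1, k3, k2⟩ := exists_mid (sup_le q2 q2') (m := x + 2 * h) (by omega) (by omega)
      exact ⟨b, ⟨q1, le_sup_left.trans k1, q3, k2⟩, ⟨q1', le_sup_right.trans k1, q3', k2⟩,
        ⟨q1.trans (le_sup_left.trans k1), k3, k2, q4⟩⟩
  · intro T hT
    have e : T.f x = U := ((mem_fib.1 hT) x hxA).symm
    refine ⟨⟨?_, T.mono (by omega), T.rk (by omega), T.rk (by omega)⟩, ⟨?_, T.mono (by omega), T.rk (by omega), T.rk (by omega)⟩⟩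
    · rw [← e]; exact T.mono (by omega)
    · rw [← e]; exact T.mono (by omega)
  · rintro ⟨a, b, c⟩ ⟨⟨q1, q2, q3, q4⟩, ⟨q1', q2', q3', q4'⟩⟩
    simp only at *
    obtain ⟨T1, a1, a2⟩ := splice_up T0 q1
    rw [q3] at a2
    obtain ⟨T2, b1, b2⟩ := splice_up T1 (x := x + h) (W := b) (by rw [a2]; exact q2)
    rw [q4] at b2
    obtain ⟨T3, c1, c2⟩ := splice_up T2 (x := x + 2 * h) (W := c) (by rw [b2]; exact q2')
    rw [q4'] at c2
    refine ⟨T3, ?_, ?_, ?_, c2⟩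
    · rw [mem_fib]; intro i hi
      have := hA i hi
      show T0.f i = T3.f i
      rw [c1 i (by omega), b1 i (by omega), a1 i this]
    · rw [c1 _ (by omega), b1 _ (by omega), a2]
    · rw [c1 _ (by omega), b2]

theorem cone_down (A : Set ℕ) (x h : ℕ) (hxA : x ∈ A) (hA : ∀ c ∈ A, x ≤ c)
    (hn : x ≤ Module.finrank F V) (h3 : 3 * h ≤ x) : ConeP F V Γ A (x - h) (x - 2 * h) (x - 3 * h) := by
  apply cone_of_abs
  intro T0
  set U := T0.f x with hU
  have rU : Module.finrank F U = x := T0.rk (by omega)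
  let R01 : Submodule F V → Submodule F V → Prop := fun a b =>
    a ≤ U ∧ b ≤ a ∧ Module.finrank F a = x - h ∧ Module.finrank F b = x - 2 * h
  let R12 : Submodule F V → Submodule F V → Prop := fun b c =>
    b ≤ U ∧ c ≤ b ∧ Module.finrank F b = x - 2 * h ∧ Module.finrank F c = x - 3 * h
  let R02 : Submodule F V → Submodule F V → Prop := fun a c =>
    a ≤ U ∧ c ≤ a ∧ Module.finrank F a = x - h ∧ Module.finrank F c = x - 3 * h
  refine ⟨fun t => R01 t.1 t.2.1 ∧ R12 t.2.1 t.2.2, ?_, ?_, ?_⟩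
  · refine beta_cone R01 R12 R02 (fun a => a ≤ U ∧ Module.finrank F a = x - h) (T0.f (x - h))
      ⟨T0.mono (by omega), T0.rk (by omega)⟩ (fun a b q => ⟨q.1, q.2.2.1⟩) (fun a b q => ⟨q.1, q.2.2.1⟩)
      (fun a b c q q' => ⟨q.1, q'.2.1.trans q.2.1, q.2.2.1, q'.2.2.2⟩) ?_ ?_ ?_ ?_
    · rintro a a' ⟨q1, q2⟩ ⟨q3, q4⟩
      have := rank_inf_ge' q1 q3
      obtain ⟨b, k1, k2⟩ := ext_down (a ⊓ a') (m := x - 2 * h) (by omega)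
      exact ⟨b, ⟨q1, k1.trans inf_le_left, q2, k2⟩, ⟨q3, k1.trans inf_le_right, q4, k2⟩⟩
    · rintro a b b' ⟨q1, q2, q3, q4⟩ ⟨q1', q2', q3', q4'⟩
      have := rank_inf_ge' q2 q2'
      obtain ⟨c, k1, k2⟩ := ext_down (b ⊓ b') (m := x - 3 * h) (by omega)
      exact ⟨c, ⟨q2.trans q1, k1.trans inf_le_left, q4, k2⟩, ⟨q2'.trans q1, k1.trans inf_le_right, q4', k2⟩⟩
    · rintro a b ⟨q1, q2, q3, q4⟩
      have h0 : T0.f (x - h) ≤ U := T0.mono (by omega)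
      have h1 : Module.finrank F (T0.f (x - h)) = x - h := T0.rk (by omega)
      have := rank_inf_ge' (q2.trans q1) h0
      obtain ⟨c, k1, k2⟩ := ext_down (b ⊓ T0.f (x - h)) (m := x - 3 * h) (by omega)
      exact ⟨c, ⟨q2.trans q1, k1.trans inf_le_left, q4, k2⟩, ⟨h0, k1.trans inf_le_right, h1, k2⟩⟩
    · rintro a a' c ⟨q1, q2, q3, q4⟩ ⟨q1', q2', q3', q4'⟩
      have := rank_inf_ge' q1 q1'
      obtain ⟨b, k1, k3, k2⟩ := exists_mid (le_inf q2 q2') (m := x - 2 * h) (by omega) (by omega)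
      exact ⟨b, ⟨q1, k3.trans inf_le_left, q3, k2⟩, ⟨q1', k3.trans inf_le_right, q3', k2⟩,
        ⟨k3.trans (inf_le_left.trans q1), k1, k2, q4⟩⟩
  · intro T hT
    have e : T.f x = U := ((mem_fib.1 hT) x hxA).symm
    refine ⟨⟨?_, T.mono (by omega), T.rk (by omega), T.rk (by omega)⟩, ⟨?_, T.mono (by omega), T.rk (by omega), T.rk (by omega)⟩⟩
    · rw [← e]; exact T.mono (by omega)
    · rw [← e]; exact T.mono (by omega)
  · rintro ⟨a, b, c⟩ ⟨⟨q1, q2, q3, q4⟩, ⟨q1', q2', q3', q4'⟩⟩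
    simp only at *
    obtain ⟨T1, a1, a2⟩ := splice_down T0 q1
    rw [q3] at a2
    obtain ⟨T2, b1, b2⟩ := splice_down T1 (x := x - h) (W := b) (by rw [a2]; exact q2)
    rw [q4] at b2
    obtain ⟨T3, c1, c2⟩ := splice_down T2 (x := x - 2 * h) (W := c) (by rw [b2]; exact q2')
    rw [q4'] at c2
    refine ⟨T3, ?_, ?_, ?_, c2⟩
    · rw [mem_fib]; intro i hi
      have := hA i hi
      show T0.f i = T3.f i
      rw [c1 i (by omega), b1 i (by omega), a1 i this]
    · rw [c1 _ (by omega), b1 _ (by omega), a2]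
    · rw [c1 _ (by omega), b2]

theorem cone_jup (x h : ℕ) (hn : x + 2 * h ≤ Module.finrank F V) (h3 : h ≤ x) :
    ConeP F V Γ {x} (x - h) (x + h) (x + 2 * h) := by
  apply cone_of_abs
  intro T0
  set U := T0.f x with hU
  have rU : Module.finrank F U = x := T0.rk (by omega)
  let R12 : Submodule F V → Submodule F V → Prop := fun b c =>
    U ≤ b ∧ b ≤ c ∧ Module.finrank F b = x + h ∧ Module.finrank F c = x + 2 * h
  let p0 : Submodule F V → Prop := fun a => a ≤ U ∧ Module.finrank F a = x - h
  let p1 : Submodule F V → Prop := fun b => U ≤ b ∧ Module.finrank F b = x + h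
  refine ⟨fun t => (p0 t.1 ∧ p1 t.2.1) ∧ R12 t.2.1 t.2.2, ?_, ?_, ?_⟩
  · have hb0 : p1 (T0.f (x + h)) := ⟨T0.mono (by omega), T0.rk (by omega)⟩
    refine join_cone R12 p0 p1 (T0.f (x - h)) (T0.f (x + h)) ⟨T0.mono (by omega), T0.rk (by omega)⟩ hb0 ?_
    rintro b ⟨q1, q2⟩
    have := rank_sup_le' q1 hb0.1
    rw [hb0.2] at this
    obtain ⟨c, k1, k2⟩ := ext_up (b ⊔ T0.f (x + h)) (m := x + 2 * h) (by omega) (by omega)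
    exact ⟨c, ⟨q1, le_sup_left.trans k1, q2, k2⟩, ⟨hb0.1, le_sup_right.trans k1, hb0.2, k2⟩⟩
  · intro T hT
    have e : T.f x = U := ((mem_fib.1 hT) x rfl).symm
    have e1 : U ≤ T.f (x + h) := by rw [← e]; exact T.mono (by omega)
    have e2 : T.f (x - h) ≤ U := by rw [← e]; exact T.mono (by omega)
    exact ⟨⟨⟨e2, T.rk (by omega)⟩, ⟨e1, T.rk (by omega)⟩⟩, ⟨e1, T.mono (by omega), T.rk (by omega), T.rk (by omega)⟩⟩
  · rintro ⟨a, b, c⟩ ⟨⟨⟨q1, q2⟩, ⟨q3, q4⟩⟩, ⟨q1', q2', q3', q4'⟩⟩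
    simp only at *
    obtain ⟨T1, a1, a2⟩ := splice_down T0 q1
    rw [q2] at a2
    obtain ⟨T2, b1, b2⟩ := splice_up T1 (x := x) (W := b) (by rw [a1 x le_rfl]; exact q3)
    rw [q4] at b2
    obtain ⟨T3, c1, c2⟩ := splice_up T2 (x := x + h) (W := c) (by rw [b2]; exact q2')
    rw [q4'] at c2
    refine ⟨T3, ?_, ?_, ?_, c2⟩
    · rw [mem_fib]; intro i hi
      rw [Set.mem_singleton_iff] at hi
      show T0.f i = T3.f i
      rw [c1 i (by omega), b1 i (by omega), a1 i (by omega)]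
    · rw [c1 _ (by omega), b1 _ (by omega), a2]
    · rw [c1 _ (by omega), b2]

theorem cone_jdown (x h : ℕ) (hn : x + h ≤ Module.finrank F V) (h3 : 2 * h ≤ x) :
    ConeP F V Γ {x} (x + h) (x - h) (x - 2 * h) := by
  apply cone_of_abs
  intro T0
  set U := T0.f x with hU
  have rU : Module.finrank F U = x := T0.rk (by omega)
  let R12 : Submodule F V → Submodule F V → Prop := fun b c =>
    b ≤ U ∧ c ≤ b ∧ Module.finrank F b = x - h ∧ Module.finrank F c = x - 2 * h
  let p0 : Submodule F V → Prop := fun a => U ≤ a ∧ Module.finrank F a = x + h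
  let p1 : Submodule F V → Prop := fun b => b ≤ U ∧ Module.finrank F b = x - h
  refine ⟨fun t => (p0 t.1 ∧ p1 t.2.1) ∧ R12 t.2.1 t.2.2, ?_, ?_, ?_⟩
  · have hb0 : p1 (T0.f (x - h)) := ⟨T0.mono (by omega), T0.rk (by omega)⟩
    refine join_cone R12 p0 p1 (T0.f (x + h)) (T0.f (x - h)) ⟨T0.mono (by omega), T0.rk (by omega)⟩ hb0 ?_
    rintro b ⟨q1, q2⟩
    have := rank_inf_ge' q1 hb0.1
    rw [hb0.2] at this
    obtain ⟨c, k1, k2⟩ := ext_down (b ⊓ T0.f (x - h)) (m := x - 2 * h) (by omega)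
    exact ⟨c, ⟨q1, k1.trans inf_le_left, q2, k2⟩, ⟨hb0.1, k1.trans inf_le_right, hb0.2, k2⟩⟩
  · intro T hT
    have e : T.f x = U := ((mem_fib.1 hT) x rfl).symm
    have e1 : U ≤ T.f (x + h) := by rw [← e]; exact T.mono (by omega)
    have e2 : T.f (x - h) ≤ U := by rw [← e]; exact T.mono (by omega)
    exact ⟨⟨⟨e1, T.rk (by omega)⟩, ⟨e2, T.rk (by omega)⟩⟩, ⟨e2, T.mono (by omega), T.rk (by omega), T.rk (by omega)⟩⟩
  · rintro ⟨a, b, c⟩ ⟨⟨⟨q1, q2⟩, ⟨q3, q4⟩⟩, ⟨q1', q2', q3', q4'⟩⟩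
    simp only at *
    obtain ⟨T1, a1, a2⟩ := splice_up T0 q1
    rw [q2] at a2
    obtain ⟨T2, b1, b2⟩ := splice_down T1 (x := x) (W := b) (by rw [a1 x le_rfl]; exact q3)
    rw [q4] at b2
    obtain ⟨T3, c1, c2⟩ := splice_down T2 (x := x - h) (W := c) (by rw [b2]; exact q2')
    rw [q4'] at c2
    refine ⟨T3, ?_, ?_, ?_, c2⟩
    · rw [mem_fib]; intro i hi
      rw [Set.mem_singleton_iff] at hi
      show T0.f i = T3.f i
      rw [c1 i (by omega), b1 i (by omega), a1 i (by omega)]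
    · rw [c1 _ (by omega), b1 _ (by omega), a2]
    · rw [c1 _ (by omega), b2]

end coneinst


section flat
variable {F V : Type} [Field F] [Fintype F] [AddCommGroup V] [Module F V] [FiniteDimensional F V]
variable {Γ : Type} [Group Γ]

theorem up_one {U w : Submodule F V} (h : U ≤ w) (hne : Module.finrank F U ≠ Module.finrank F w) :
    ∃ U' : Submodule F V, U ≤ U' ∧ U' ≤ w ∧ Module.finrank F U' = Module.finrank F U + 1 :=
  exists_succ h (lt_of_le_of_ne (Submodule.finrank_mono h) hne)

theorem flat_conn {Y : Set ℕ} {y1 y2 : ℕ} (hy1 : y1 ∈ Y) (hy2 : y2 ∈ Y)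
    (h12 : y1 < y2) (hn : y2 ≤ Module.finrank F V) {δ : Type*} (ρ : Submodule F V → δ) :
    ∀ (j : ℕ) (W : Submodule F V), Module.finrank F W + j = y1 →
      (∀ w w' : Submodule F V, W ≤ w → w ≤ w' → Module.finrank F w ∈ Y → Module.finrank F w' ∈ Y → ρ w = ρ w') →
      ∀ w w' : Submodule F V, W ≤ w → W ≤ w' → Module.finrank F w ∈ Y → Module.finrank F w' ∈ Y → ρ w = ρ w' := by
  have hmin : ∀ W : Submodule F V, Module.finrank F W ∈ Y →
      (∀ w w' : Submodule F V, W ≤ w → w ≤ w' → Module.finrank F w ∈ Y → Module.finrank F w' ∈ Y → ρ w = ρ w') →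
      ∀ w w' : Submodule F V, W ≤ w → W ≤ w' → Module.finrank F w ∈ Y → Module.finrank F w' ∈ Y → ρ w = ρ w' := by
    intro W hW hρ w w' h1 h2 h3 h4
    rw [← hρ W w le_rfl h1 hW h3, ← hρ W w' le_rfl h2 hW h4]
  intro j
  induction j with
  | zero => intro W hW; exact hmin W (by rw [show Module.finrank F W = y1 by omega]; exact hy1)
  | succ j ih =>
    intro W hW
    by_cases hWY : Module.finrank F W ∈ Y
    · exact hmin W hWY
    intro hρ w w' h1 h2 h3 h4
    obtain ⟨A, a1, a2, a3⟩ := up_one h1 (fun h => hWY (h ▸ h3))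
    obtain ⟨B, b1, b2, b3⟩ := up_one h2 (fun h => hWY (h ▸ h4))
    have hs := rank_sup_le' a1 b1
    obtain ⟨z, z1, z2⟩ := ext_up (A ⊔ B) (m := y2) (by omega) hn
    have hz : Module.finrank F z ∈ Y := by rw [z2]; exact hy2
    rw [ih A (by omega) (fun w w' q => hρ w w' (a1.trans q)) w z a2 (le_sup_left.trans z1) h3 hz,
      ih B (by omega) (fun w w' q => hρ w w' (b1.trans q)) w' z b2 (le_sup_right.trans z1) h4 hz]

theorem flat_cob {Y : Set ℕ} {y0 y1 y2 : ℕ} (hy0 : y0 ∈ Y) (hy1 : y1 ∈ Y) (hy2 : y2 ∈ Y)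
    (h01 : y0 < y1) (h12 : y1 < y2) (hn : y2 ≤ Module.finrank F V) (hmin : ∀ y ∈ Y, y0 ≤ y)
    (K : Submodule F V → Submodule F V → Γ)
    (hK : ∀ w w' w'' : Submodule F V, w ≤ w' → w' ≤ w'' → Module.finrank F w ∈ Y → Module.finrank F w' ∈ Y →
      Module.finrank F w'' ∈ Y → K w w' * K w' w'' = K w w'') :
    ∀ (j : ℕ) (U : Submodule F V), Module.finrank F U + j = y0 → ∃ c : Submodule F V → Γ,
      ∀ w w' : Submodule F V, U ≤ w → w ≤ w' → Module.finrank F w ∈ Y → Module.finrank F w' ∈ Y → c w * K w w' = c w' := by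
  intro j
  induction j with
  | zero =>
    intro U hU
    refine ⟨fun w => K U w, fun w w' h1 h2 h3 h4 => hK U w w' h1 h2 ?_ h3 h4⟩
    rw [show Module.finrank F U = y0 by omega]; exact hy0
  | succ j ih =>
    intro U hU
    have ih' : ∀ U' : Submodule F V, ∃ c : Submodule F V → Γ, Module.finrank F U' + j = y0 →
      ∀ w w' : Submodule F V, U' ≤ w → w ≤ w' → Module.finrank F w ∈ Y → Module.finrank F w' ∈ Y → c w * K w w' = c w' := by
      intro U'
      by_cases h : Module.finrank F U' + j = y0
      · obtain ⟨c, hc⟩ := ih U' h; exact ⟨c, fun _ => hc⟩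
      · exact ⟨1, fun h' => absurd h' h⟩
    choose c hc using ih'
    -- ratio is constant
    have hrat : ∀ A B : Submodule F V, U ≤ A → U ≤ B → Module.finrank F A = Module.finrank F U + 1 →
        Module.finrank F B = Module.finrank F U + 1 → ∀ w w' : Submodule F V, A ≤ w → B ≤ w → A ≤ w' → B ≤ w' →
        Module.finrank F w ∈ Y → Module.finrank F w' ∈ Y → c A w * (c B w)⁻¹ = c A w' * (c B w')⁻¹ := by
      intro A B hA hB rA rB w w' h1 h2 h3 h4 h5 h6
      have hs := rank_sup_le' hA hB
      refine flat_conn hy1 hy2 h12 hn (fun w => c A w * (c B w)⁻¹) (y1 - Module.finrank F ↥(A ⊔ B)) (A ⊔ B)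
        (by omega) ?_ w w' (sup_le h1 h2) (sup_le h3 h4) h5 h6
      intro w w' q1 q2 q3 q4
      rw [← hc A (by omega) w w' (le_sup_left.trans q1) q2 q3 q4,
        ← hc B (by omega) w w' (le_sup_right.trans q1) q2 q3 q4]
      group
    obtain ⟨U0, u1, u2⟩ := ext_up U (m := Module.finrank F U + 1) (by omega) (by omega)
    have hz : ∀ A : Submodule F V, ∃ z : Submodule F V, U ≤ A → Module.finrank F A = Module.finrank F U + 1 →
        (A ≤ z ∧ U0 ≤ z ∧ Module.finrank F z ∈ Y) := by
      intro A
      by_cases h : U ≤ A ∧ Module.finrank F A = Module.finrank F U + 1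
      · have hs := rank_sup_le' h.1 u1
        obtain ⟨z, z1, z2⟩ := ext_up (A ⊔ U0) (m := y2) (by omega) hn
        exact ⟨z, fun _ _ => ⟨le_sup_left.trans z1, le_sup_right.trans z1, by rw [z2]; exact hy2⟩⟩
      · exact ⟨A, fun a b => absurd ⟨a, b⟩ h⟩
    choose z hz using hz
    have hp : ∀ w : Submodule F V, ∃ A : Submodule F V, U ≤ w → Module.finrank F w ∈ Y →
        (U ≤ A ∧ A ≤ w ∧ Module.finrank F A = Module.finrank F U + 1) := by
      intro w
      by_cases h : U ≤ w ∧ Module.finrank F w ∈ Y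
      · have := hmin _ h.2
        obtain ⟨A, a⟩ := up_one h.1 (by omega)
        exact ⟨A, fun _ _ => a⟩
      · exact ⟨w, fun a b => absurd ⟨a, b⟩ h⟩
    choose p hp using hp
    let r : Submodule F V → Γ := fun A => c U0 (z A) * (c A (z A))⁻¹
    have hind : ∀ A B w : Submodule F V, U ≤ A → U ≤ B → Module.finrank F A = Module.finrank F U + 1 →
        Module.finrank F B = Module.finrank F U + 1 → A ≤ w → B ≤ w → Module.finrank F w ∈ Y →
        r A * c A w = r B * c B w := by
      intro A B w hA hB rA rB h1 h2 h3
      have hs := rank_sup_le' hA hB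
      have hs2 := rank_sup_le' (hA.trans le_sup_left : U ≤ A ⊔ B) u1
      obtain ⟨v, v1, v2⟩ := ext_up (A ⊔ B ⊔ U0) (m := y2) (by omega) hn
      have hv : Module.finrank F v ∈ Y := by rw [v2]; exact hy2
      have vA : A ≤ v := le_sup_left.trans (le_sup_left.trans v1)
      have vB : B ≤ v := le_sup_right.trans (le_sup_left.trans v1)
      have v0 : U0 ≤ v := le_sup_right.trans v1
      obtain ⟨zA1, zA2, zA3⟩ := hz A hA rA
      obtain ⟨zB1, zB2, zB3⟩ := hz B hB rB
      have e1 : r A = c U0 v * (c A v)⁻¹ := hrat U0 A u1 hA u2 rA _ _ zA2 zA1 v0 vA zA3 hv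
      have e2 : r B = c U0 v * (c B v)⁻¹ := hrat U0 B u1 hB u2 rB _ _ zB2 zB1 v0 vB zB3 hv
      have e3 := hrat A B hA hB rA rB w v h1 h2 vA vB h3 hv
      have e4 : c A w = c A v * (c B v)⁻¹ * c B w := by rw [← e3]; group
      rw [e1, e2, e4]; group
    refine ⟨fun w => r (p w) * c (p w) w, ?_⟩
    intro w w' h1 h2 h3 h4
    obtain ⟨a1, a2, a3⟩ := hp w h1 h3
    obtain ⟨b1, b2, b3⟩ := hp w' (h1.trans h2) h4
    simp only
    rw [← hind (p w) (p w') w' a1 b1 a3 b3 (a2.trans h2) b2 h4, ← hc (p w) (by omega) w w' a2 h2 h3 h4]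
    group

/-- flat labellings of flags are coboundaries -/
theorem flat_flags (y : ℕ → ℕ) (hy : StrictMono y) (hn : y 3 ≤ Module.finrank F V)
    (H : ℕ → ℕ → Flg F V → Γ) (hm : ∀ i j, i < j → j < 4 → Meas {y i, y j} (H i j))
    (hflat : ∀ i j k, i < j → j < k → k < 4 → ∀ T, H i j T * H j k T = H i k T) :
    ∃ c : ℕ → Flg F V → Γ, (∀ i, Meas {y i} (c i)) ∧
      ∀ i j, i < j → j < 4 → ∀ T, H i j T = (c i T)⁻¹ * c j T := by
  have hinj := hy.injective
  have hr : ∀ i < 4, y i ≤ Module.finrank F V := fun i hi => (hy.monotone (by omega : i ≤ 3)).trans hn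
  let ix : ℕ → ℕ := fun a => if h : ∃ i, y i = a then h.choose else 0
  have hix : ∀ i, ix (y i) = i := by
    intro i
    have h : ∃ j, y j = y i := ⟨i, rfl⟩
    show (if h : _ then _ else _) = _
    rw [dif_pos h]; exact hinj h.choose_spec
  let K : Submodule F V → Submodule F V → Γ := fun w w' =>
    if w = w' then 1 else if h : w ≤ w' then
      H (ix (Module.finrank F w)) (ix (Module.finrank F w')) (exists_flag_through₂ h).choose else 1
  have hK : ∀ i j, i < j → j < 4 → ∀ T : Flg F V, K (T.f (y i)) (T.f (y j)) = H i j T := by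
    intro i j hij hj T
    have r1 : Module.finrank F (T.f (y i)) = y i := T.rk (hr i (by omega))
    have r2 : Module.finrank F (T.f (y j)) = y j := T.rk (hr j (by omega))
    have hle : T.f (y i) ≤ T.f (y j) := T.mono (hy hij).le
    have hne : T.f (y i) ≠ T.f (y j) := by
      intro h
      have := hy hij
      rw [h] at r1; omega
    obtain ⟨s1, s2⟩ := (exists_flag_through₂ hle).choose_spec
    show (if _ = _ then _ else if h : _ then _ else _) = _
    rw [if_neg hne, dif_pos hle]
    revert s1 s2
    generalize (exists_flag_through₂ hle).choose = T1
    intro s1 s2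
    rw [r1, r2, hix, hix]
    apply hm i j hij hj
    rintro c (hc | hc)
    · show _ = T.f c
      rw [hc]
      rw [r1] at s1
      exact s1
    · rw [Set.mem_singleton_iff] at hc
      show _ = T.f c
      rw [hc]
      rw [r2] at s2
      exact s2
  have hone : ∀ w, K w w = 1 := fun w => if_pos rfl
  obtain ⟨c, hc⟩ := flat_cob (F := F) (V := V) (Y := {a | ∃ i < 4, y i = a}) (y0 := y 0) (y1 := y 1) (y2 := y 2)
    ⟨0, by norm_num, rfl⟩ ⟨1, by norm_num, rfl⟩ ⟨2, by norm_num, rfl⟩ (hy (by norm_num)) (hy (by norm_num))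
    (hr 2 (by norm_num)) (by rintro _ ⟨i, _, rfl⟩; exact hy.monotone (Nat.zero_le _)) K (by
      rintro w w' w'' h1 h2 ⟨i, hi, ei⟩ ⟨j, hj, ej⟩ ⟨k, hk, ek⟩
      by_cases e1 : w = w'
      · subst e1; rw [hone, one_mul]
      by_cases e2 : w' = w''
      · subst e2; rw [hone, mul_one]
      have hij : i < j := by
        have := Submodule.finrank_lt_finrank_of_lt (lt_of_le_of_ne h1 e1)
        rw [← ei, ← ej] at this; exact hy.lt_iff_lt.1 this
      have hjk : j < k := by
        have := Submodule.finrank_lt_finrank_of_lt (lt_of_le_of_ne h2 e2)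
        rw [← ej, ← ek] at this; exact hy.lt_iff_lt.1 this
      obtain ⟨T0, t1, t2⟩ := exists_flag_through₂ h1
      obtain ⟨T, s1, s2⟩ := splice_up T0 (x := Module.finrank F w') (W := w'') (by rw [t2]; exact h2)
      have q1 : T.f (y i) = w := by
        rw [ei, s1 _ (Submodule.finrank_mono h1), t1]
      have q2 : T.f (y j) = w' := by rw [ej, s1 _ le_rfl, t2]
      have q3 : T.f (y k) = w'' := by rw [ek, s2]
      have := hflat i j k hij hjk hk T
      rw [← hK i j hij hj, ← hK j k hjk hk, ← hK i k (hij.trans hjk) hk, q1, q2, q3] at this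
      exact this) (y 0) ⊥ (by rw [finrank_bot]; omega)
  refine ⟨fun i T => c (T.f (y i)), fun i T T' h => congrArg c (h _ rfl), ?_⟩
  intro i j hij hj T
  have := hc (T.f (y i)) (T.f (y j)) bot_le (T.mono (hy hij).le) ⟨i, by omega, (T.rk (hr i (by omega))).symm⟩
    ⟨j, hj, (T.rk (hr j hj)).symm⟩
  rw [hK i j hij hj] at this
  show H i j T = (c (T.f (y i)))⁻¹ * c (T.f (y j))
  rw [← this]; group

end flat


section ltg
variable {Ω α : Type} [Fintype Ω] [Crd Ω α] {Γ : Type} [Group Γ]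

def Dist4 (i j k l : Fin 4) : Prop := i ≠ j ∧ i ≠ k ∧ i ≠ l ∧ j ≠ k ∧ j ≠ l ∧ k ≠ l

/-- admissible labellings -/
def Adm (y : Fin 4 → ℕ) (H : Fin 4 → Fin 4 → Ω → Γ) : Prop :=
  (∀ i j, Meas {y i, y j} (H i j)) ∧ ∀ i j T, H j i T = (H i j T)⁻¹

def badT (H : Fin 4 → Fin 4 → Ω → Γ) (l : Fin 4) (T : Ω) : Prop :=
  ∃ i j k, Dist4 i j k l ∧ H i j T * H j k T * H k i T ≠ 1

noncomputable def XX (H : Fin 4 → Fin 4 → Ω → Γ) (l : Fin 4) (T : Ω) : ℝ := if badT H l T then 1 else 0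

theorem XX_nonneg (H : Fin 4 → Fin 4 → Ω → Γ) (l : Fin 4) (T : Ω) : 0 ≤ XX H l T := by
  unfold XX; split_ifs <;> norm_num

theorem XX_le_one (H : Fin 4 → Fin 4 → Ω → Γ) (l : Fin 4) (T : Ω) : XX H l T ≤ 1 := by
  unfold XX; split_ifs <;> norm_num

theorem mem4 {i j k l : Fin 4} (h : Dist4 i j k l) (x : Fin 4) (hx : x ≠ l) : x = i ∨ x = j ∨ x = k := by
  unfold Dist4 at h
  by_contra hc
  push Not at hc
  have : ({i, j, k, l, x} : Finset (Fin 4)).card = 5 := by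
    rw [card_insert_of_notMem, card_insert_of_notMem, card_insert_of_notMem, card_insert_of_notMem, card_singleton] <;>
    simp <;> tauto
  have h2 := Finset.card_le_univ ({i, j, k, l, x} : Finset (Fin 4))
  simp at h2
  omega

theorem perm6 {i j k l i' j' k' : Fin 4} (h : Dist4 i j k l) (h' : Dist4 i' j' k' l) :
    (i' = i ∧ j' = j ∧ k' = k) ∨ (i' = j ∧ j' = k ∧ k' = i) ∨ (i' = k ∧ j' = i ∧ k' = j) ∨
    (i' = i ∧ j' = k ∧ k' = j) ∨ (i' = k ∧ j' = j ∧ k' = i) ∨ (i' = j ∧ j' = i ∧ k' = k) := by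
  have m : ∀ x, x ≠ l → x = i ∨ x = j ∨ x = k := mem4 h
  obtain ⟨a1, a2, a3, a4, a5, a6⟩ := h'
  rcases m i' a3 with rfl | rfl | rfl <;> rcases m j' a5 with rfl | rfl | rfl <;>
    rcases m k' a6 with rfl | rfl | rfl <;> simp_all

theorem badT_iff {H : Fin 4 → Fin 4 → Ω → Γ} (hA : ∀ i j T, H j i T = (H i j T)⁻¹) {i j k l : Fin 4}
    (h : Dist4 i j k l) (T : Ω) : badT H l T ↔ H i j T * H j k T * H k i T ≠ 1 := by
  constructor
  · rintro ⟨i', j', k', h', hb⟩ hg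
    apply hb
    have e1 : H i k T = H i j T * H j k T := by
      rw [hA k i]; exact (eq_inv_of_mul_eq_one_left hg).symm
    have e2 := hA i j T
    have e3 := hA j k T
    have e4 := hA i k T
    rcases perm6 h h' with ⟨rfl, rfl, rfl⟩ | ⟨rfl, rfl, rfl⟩ | ⟨rfl, rfl, rfl⟩ | ⟨rfl, rfl, rfl⟩ | ⟨rfl, rfl, rfl⟩ | ⟨rfl, rfl, rfl⟩ <;>
    · simp only [e2, e3, e4, e1]; group
  · intro hb
    exact ⟨i, j, k, h, hb⟩

theorem XX_eq {H : Fin 4 → Fin 4 → Ω → Γ} (hA : ∀ i j T, H j i T = (H i j T)⁻¹) {i j k l : Fin 4}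
    (h : Dist4 i j k l) (T : Ω) : XX H l T = if H i j T * H j k T = H i k T then 0 else 1 := by
  unfold XX
  have : badT H l T ↔ ¬ (H i j T * H j k T = H i k T) := by
    rw [badT_iff hA h, hA i k, Ne, mul_inv_eq_one]
  by_cases h1 : H i j T * H j k T = H i k T
  · rw [if_neg (fun h' => this.1 h' h1), if_pos h1]
  · rw [if_pos (this.2 h1), if_neg h1]

theorem XX_meas {y : Fin 4 → ℕ} {H : Fin 4 → Fin 4 → Ω → Γ} (hH : Adm y H) {i j k l : Fin 4}
    (h : Dist4 i j k l) : Meas {y i, y j, y k} (XX H l) := by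
  intro T T' hT
  rw [XX_eq hH.2 h, XX_eq hH.2 h, hH.1 i j T T' (hT.mono (by intro x; simp; tauto)),
    hH.1 j k T T' (hT.mono (by intro x; simp; tauto)), hH.1 i k T T' (hT.mono (by intro x; simp; tauto))]

/-- number of bad faces is never one -/
theorem tetra {H : Fin 4 → Fin 4 → Ω → Γ} (hA : ∀ i j T, H j i T = (H i j T)⁻¹) {i j k l : Fin 4}
    (h : Dist4 i j k l) (T : Ω) : XX H l T ≤ XX H i T + XX H j T + XX H k T := by
  have hi : Dist4 j k l i := by unfold Dist4 at *; tauto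
  have hj : Dist4 i k l j := by unfold Dist4 at *; tauto
  have hk : Dist4 i j l k := by unfold Dist4 at *; tauto
  have hl := h
  by_cases b1 : badT H i T
  · have : XX H i T = 1 := if_pos b1
    linarith [XX_nonneg H j T, XX_nonneg H k T, XX_le_one H l T]
  by_cases b2 : badT H j T
  · have : XX H j T = 1 := if_pos b2
    linarith [XX_nonneg H i T, XX_nonneg H k T, XX_le_one H l T]
  by_cases b3 : badT H k T
  · have : XX H k T = 1 := if_pos b3
    linarith [XX_nonneg H i T, XX_nonneg H j T, XX_le_one H l T]
  have : XX H l T = 0 := by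
    rw [XX_eq hA hl, if_pos]
    rw [badT_iff hA hi, not_not, hA j l, mul_inv_eq_one] at b1
    rw [badT_iff hA hj, not_not, hA i l, mul_inv_eq_one] at b2
    rw [badT_iff hA hk, not_not, hA i l, mul_inv_eq_one] at b3
    have : H i j T * H j k T * H k l T = H i k T * H k l T := by rw [mul_assoc, b1, b3, b2]
    exact mul_right_cancel this
  rw [this]
  linarith [XX_nonneg H i T, XX_nonneg H j T, XX_nonneg H k T]

/-- the functional to be minimised -/
noncomputable def Phi (Q : ℕ) (H0 H : Fin 4 → Fin 4 → Ω → Γ) : ℕ :=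
  Q * ∑ l, (univ.filter (fun T => badT H l T)).card +
    ∑ i, ∑ j, (univ.filter (fun T => H i j T ≠ H0 i j T)).card

theorem Phi_cast (Q : ℕ) (H0 H : Fin 4 → Fin 4 → Ω → Γ) :
    (Phi Q H0 H : ℝ) = Q * (∑ l, ∑ T, XX H l T) + ∑ i, ∑ j, nd (H i j) (H0 i j) := by
  unfold Phi XX nd
  push_cast
  simp only [Finset.card_filter]
  push_cast
  rfl

def IsMn (y : Fin 4 → ℕ) (Q : ℕ) (H0 H : Fin 4 → Fin 4 → Ω → Γ) : Prop :=
  Adm y H ∧ ∀ H', Adm y H' → Phi Q H0 H ≤ Phi Q H0 H'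

theorem exists_min (y : Fin 4 → ℕ) (Q : ℕ) (H0 : Fin 4 → Fin 4 → Ω → Γ) (h0 : Adm y H0) :
    ∃ H, IsMn y Q H0 H := by
  have hne : ∃ n, ∃ H, Adm y H ∧ Phi Q H0 H = n := ⟨_, H0, h0, rfl⟩
  obtain ⟨H, h1, h2⟩ := Nat.find_spec hne
  refine ⟨H, h1, fun H' h' => ?_⟩
  rw [h2]
  exact Nat.find_min' hne ⟨H', h', rfl⟩

theorem sum_split (S : Finset Ω) {a b : Ω → ℝ} (h : ∀ T, T ∉ S → a T = b T) :
    ∑ T, a T - ∑ T ∈ S, a T = ∑ T, b T - ∑ T ∈ S, b T := by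
  rw [← Finset.sum_sdiff (Finset.subset_univ S), ← Finset.sum_sdiff (f := b) (Finset.subset_univ S)]
  rw [add_sub_cancel_right, add_sub_cancel_right]
  apply Finset.sum_congr rfl
  intro T hT
  exact h T (Finset.mem_sdiff.1 hT).2

theorem min_fib {y : Fin 4 → ℕ} {Q : ℕ} {H0 H H' : Fin 4 → Fin 4 → Ω → Γ} (hm : IsMn y Q H0 H)
    (h' : Adm y H') (S : Finset Ω) (hS : ∀ T, T ∉ S → ∀ i j, H' i j T = H i j T) :
    Q * ∑ l, ∑ T ∈ S, XX H l T ≤ Q * (∑ l, ∑ T ∈ S, XX H' l T) +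
      ∑ i, ∑ j, ∑ T ∈ S, if H' i j T ≠ H i j T then (1:ℝ) else 0 := by
  have h1 : (Phi Q H0 H : ℝ) ≤ Phi Q H0 H' := by exact_mod_cast hm.2 H' h'
  rw [Phi_cast, Phi_cast] at h1
  have h2 : ∀ i j, nd (H' i j) (H0 i j) ≤ nd (H i j) (H0 i j) +
      ∑ T ∈ S, if H' i j T ≠ H i j T then (1:ℝ) else 0 := by
    intro i j
    have := nd_triangle (H' i j) (H i j) (H0 i j)
    have e : nd (H' i j) (H i j) = ∑ T ∈ S, if H' i j T ≠ H i j T then (1:ℝ) else 0 := by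
      unfold nd
      symm
      apply Finset.sum_subset (Finset.subset_univ S)
      intro T _ hT
      rw [if_neg (by rw [not_not]; exact hS T hT i j)]
    linarith
  have h3 : ∑ i, ∑ j, nd (H' i j) (H0 i j) ≤ ∑ i, ∑ j, nd (H i j) (H0 i j) +
      ∑ i, ∑ j, ∑ T ∈ S, if H' i j T ≠ H i j T then (1:ℝ) else 0 := by
    rw [← Finset.sum_add_distrib]
    apply Finset.sum_le_sum; intro i _
    rw [← Finset.sum_add_distrib]
    apply Finset.sum_le_sum; intro j _
    exact h2 i j
  have h4 : ∀ l, ∑ T, XX H l T - ∑ T ∈ S, XX H l T = ∑ T, XX H' l T - ∑ T ∈ S, XX H' l T := by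
    intro l
    apply sum_split
    intro T hT
    have : badT H l T ↔ badT H' l T := by unfold badT; simp only [hS T hT]
    unfold XX
    simp only [this]
  have h5 : ∑ l, ∑ T, XX H l T - ∑ l, ∑ T ∈ S, XX H l T = ∑ l, ∑ T, XX H' l T - ∑ l, ∑ T ∈ S, XX H' l T := by
    rw [← Finset.sum_sub_distrib, ← Finset.sum_sub_distrib]
    exact Finset.sum_congr rfl fun l _ => h4 l
  have h6 := congrArg (fun x => (Q:ℝ) * x) h5
  simp only [mul_sub] at h6
  linarith

/-- local modification at a colour `i` -/
theorem modif {y : Fin 4 → ℕ} {Q : ℕ} {H0 H : Fin 4 → Fin 4 → Ω → Γ} (hm : IsMn y Q H0 H)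
    (i : Fin 4) (J : Finset (Fin 4)) (hi : i ∉ J) (C : Set ℕ) (hC : ∀ b ∈ J, C ⊆ {y i, y b})
    (c : Fin 4 → Ω → Γ) (hc : ∀ b ∈ J, Meas {y i, y b} (c b)) (T0 : Ω) :
    ∃ H' : Fin 4 → Fin 4 → Ω → Γ, (∀ i j T, H' j i T = (H' i j T)⁻¹) ∧
      (∀ b ∈ J, ∀ T ∈ fib C T0, H' i b T = c b T) ∧
      (∀ a b, ¬ (a = i ∧ b ∈ J) → ¬ (b = i ∧ a ∈ J) → ∀ T, H' a b T = H a b T) ∧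
      Q * ∑ l, ∑ T ∈ fib C T0, XX H l T ≤ Q * (∑ l, ∑ T ∈ fib C T0, XX H' l T) +
        2 * J.card * (fib C T0).card := by
  let H' : Fin 4 → Fin 4 → Ω → Γ := fun a b T =>
    if a = i ∧ b ∈ J then (if Agr C T0 T then c b T else H a b T)
    else if b = i ∧ a ∈ J then (if Agr C T0 T then (c a T)⁻¹ else H a b T) else H a b T
  have key : ∀ a b T, T ∉ fib C T0 → H' a b T = H a b T := by
    intro a b T hT
    rw [mem_fib] at hT
    simp only [H', if_neg hT, ite_self]
  have hA : ∀ a b T, H' b a T = (H' a b T)⁻¹ := by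
    intro a b T
    have := hm.1.2 a b T
    simp only [H']
    by_cases h1 : a = i ∧ b ∈ J
    · have h2 : ¬ (b = i ∧ a ∈ J) := by rintro ⟨rfl, h⟩; exact hi h1.2
      rw [if_neg h2, if_pos h1, if_pos h1]
      split_ifs <;> simp [this]
    · rw [if_neg h1]
      by_cases h2 : b = i ∧ a ∈ J
      · rw [if_pos h2, if_pos h2]
        split_ifs <;> simp [this]
      · rw [if_neg h2, if_neg h1, if_neg h2, this]
  have hM : ∀ a b, Meas {y a, y b} (H' a b) := by
    intro a b T T' hT
    have := hm.1.1 a b T T' hT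
    simp only [H']
    by_cases h1 : a = i ∧ b ∈ J
    · rw [if_pos h1, if_pos h1]
      obtain ⟨rfl, h1⟩ := h1
      have hAg : Agr C T0 T ↔ Agr C T0 T' := ⟨fun h => h.trans (hT.mono (hC b h1)), fun h => h.trans (hT.mono (hC b h1)).symm⟩
      rw [hc b h1 T T' hT, this]
      simp only [hAg]
    · rw [if_neg h1, if_neg h1]
      by_cases h2 : b = i ∧ a ∈ J
      · rw [if_pos h2, if_pos h2]
        obtain ⟨rfl, h2⟩ := h2
        have hT' : Agr {y b, y a} T T' := hT.mono (by intro x; simp; tauto)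
        have hAg : Agr C T0 T ↔ Agr C T0 T' := ⟨fun h => h.trans (hT'.mono (hC a h2)), fun h => h.trans (hT'.mono (hC a h2)).symm⟩
        rw [hc a h2 T T' hT', this]
        simp only [hAg]
      · rw [if_neg h2, if_neg h2, this]
  refine ⟨H', hA, ?_, ?_, ?_⟩
  · intro b hb T hT
    rw [mem_fib] at hT
    simp only [H']
    rw [if_pos (⟨trivial, hb⟩), if_pos hT]
  · intro a b h1 h2 T
    simp only [H']
    rw [if_neg h1, if_neg h2]
  · have h1 := min_fib hm ⟨hM, hA⟩ (fib C T0) (fun T hT a b => key a b T hT)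
    refine h1.trans ?_
    have h2 : ∀ a b, (∑ T ∈ fib C T0, if H' a b T ≠ H a b T then (1:ℝ) else 0) ≤
        ((if a = i then 1 else 0) * (if b ∈ J then 1 else 0) + (if b = i then 1 else 0) * (if a ∈ J then 1 else 0)) * (fib C T0).card := by
      intro a b
      rw [mul_comm, ← nsmul_eq_mul, ← Finset.sum_const]
      apply Finset.sum_le_sum
      intro T _
      by_cases q1 : a = i ∧ b ∈ J
      · rw [if_pos q1.1, if_pos q1.2]
        have : (if H' a b T ≠ H a b T then (1:ℝ) else 0) ≤ 1 := by split_ifs <;> norm_num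
        have : (0:ℝ) ≤ (if b = i then 1 else 0) * (if a ∈ J then 1 else 0) := by split_ifs <;> norm_num
        linarith
      by_cases q2 : b = i ∧ a ∈ J
      · rw [if_pos q2.1, if_pos q2.2]
        have : (if H' a b T ≠ H a b T then (1:ℝ) else 0) ≤ 1 := by split_ifs <;> norm_num
        have : (0:ℝ) ≤ (if a = i then 1 else 0) * (if b ∈ J then 1 else 0) := by split_ifs <;> norm_num
        linarith
      have : H' a b T = H a b T := by simp only [H']; rw [if_neg q1, if_neg q2]
      rw [if_neg (by rw [not_not]; exact this)]
      split_ifs <;> norm_num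
    have h3 := Finset.sum_le_sum (s := univ) (fun a _ => Finset.sum_le_sum (s := univ) (fun b _ => h2 a b))
    have h4 : ∑ a : Fin 4, ∑ b : Fin 4, (((if a = i then (1:ℝ) else 0) * (if b ∈ J then 1 else 0) + (if b = i then 1 else 0) * (if a ∈ J then 1 else 0)) * (fib C T0).card) = 2 * J.card * (fib C T0).card := by
      simp only [← Finset.sum_mul, Finset.sum_add_distrib, ← Finset.mul_sum]
      congr 1
      simp
      ring
    rw [h4] at h3
    exact add_le_add le_rfl h3

end ltg


section ltg2
variable {Ω α : Type} [Fintype Ω] [Crd Ω α] {Γ : Type} [Group Γ]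

theorem sum4 {i j k l : Fin 4} (h : Dist4 i j k l) (f : Fin 4 → ℝ) : ∑ x, f x = f i + f j + f k + f l := by
  have hu : (univ : Finset (Fin 4)) = {i, j, k, l} := by
    ext x
    by_cases hx : x = l
    · simp [hx]
    · rcases mem4 h x hx with h | h | h <;> simp [h]
  obtain ⟨a1, a2, a3, a4, a5, a6⟩ := h
  rw [hu, sum_insert, sum_insert, sum_insert, sum_singleton]
  · ring
  all_goals simp; try tauto

theorem divhelp {q N S S' c : ℝ} (hq : 0 < q) (hN : 0 < N) (h : q * S ≤ q * S' + c * N) :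
    S / N ≤ S' / N + c / q := by
  rw [div_add_div _ _ hN.ne' hq.ne', div_le_div_iff₀ hN (by positivity)]
  nlinarith

theorem ite01 (p : Prop) : (if p then (0:ℝ) else 1) ≤ if ¬ p then 1 else 0 := by
  by_cases h : p <;> simp [h]

theorem edge_min {l : ℝ} (hl : 0 ≤ l) (h : PL Ω l) (hl4 : 4 * l ≤ 1) {y : Fin 4 → ℕ} (hy : Function.Injective y)
    {Q : ℕ} (hQ : 0 < Q) {H0 H : Fin 4 → Fin 4 → Ω → Γ} (hm : IsMn y Q H0 H) {i j k l : Fin 4} (hd : Dist4 i j k l)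
    (T0 : Ω) : ce {y i, y j} (XX H k) T0 + ce {y i, y j} (XX H l) T0 ≤
      9 * (ce {y i, y j} (XX H i) T0 + ce {y i, y j} (XX H j) T0) + 2 / Q := by
  set C : Set ℕ := {y i, y j} with hC
  obtain ⟨a1, a2, a3, a4, a5, a6⟩ := id hd
  have hA := hm.1.2
  let φ : Fin 4 → Ω → Γ := fun x T => if Agr C T0 T then H i x T * H x j T else 1
  have hφm : ∀ x, Meas (C ∪ ↑({y x} : Finset ℕ)) (φ x) := by
    intro x T T' hT
    have hT1 : Agr C T T' := hT.mono Set.subset_union_left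
    have hAg : Agr C T0 T ↔ Agr C T0 T' := ⟨fun h => h.trans hT1, fun h => h.trans hT1.symm⟩
    simp only [φ, hAg]
    rw [hm.1.1 i x T T' (hT.mono (by intro z; simp [hC]; tauto)), hm.1.1 x j T T' (hT.mono (by intro z; simp [hC]; tauto))]
  have hb := bip hl h C {y k} {y l} (by simp; linarith) (by simpa using fun h => a6 (hy h)) (φ k) (φ l) (hφm k) (hφm l)
  simp only [card_singleton, Nat.cast_one, mul_one] at hb
  obtain ⟨ψ, hψ, hψd⟩ := exists_sel C (φ k)
  have hn : nd (φ k) (φ l) ≤ ∑ T ∈ fib C T0, (XX H i T + XX H j T) := by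
    have e : nd (φ k) (φ l) = ∑ T ∈ fib C T0, if φ k T ≠ φ l T then (1:ℝ) else 0 := by
      unfold nd
      symm
      apply Finset.sum_subset (Finset.subset_univ _)
      intro T _ hT
      rw [mem_fib] at hT
      simp only [φ, if_neg hT]
      simp
    rw [e]
    apply Finset.sum_le_sum
    intro T hT
    rw [mem_fib] at hT
    split_ifs with hne
    · by_contra hlt
      push Not at hlt
      have b1 : XX H i T = 0 := by
        unfold XX at hlt ⊢
        split_ifs at hlt ⊢ <;> first | rfl | (exfalso; linarith)
      have b2 : XX H j T = 0 := by
        unfold XX at hlt ⊢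
        split_ifs at hlt ⊢ <;> first | rfl | (exfalso; linarith)
      rw [XX_eq hA (show Dist4 l k j i by unfold Dist4; tauto)] at b1
      rw [XX_eq hA (show Dist4 i l k j by unfold Dist4; tauto)] at b2
      apply hne
      simp only [φ, if_pos hT]
      have c1 : H l k T * H k j T = H l j T := by
        by_contra hcc; rw [if_neg hcc] at b1; norm_num at b1
      have c2 : H i l T * H l k T = H i k T := by
        by_contra hcc; rw [if_neg hcc] at b2; norm_num at b2
      rw [← c1, ← c2]; group
    · linarith [XX_nonneg H i T, XX_nonneg H j T]
  obtain ⟨H', hA', h1, h2, h3⟩ := modif hm i {j} (by simpa using a1) C (by intro b hb; rw [Finset.mem_singleton] at hb; subst hb; exact subset_rfl)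
    (fun _ _ => ψ T0) (fun _ _ _ _ _ => rfl) T0
  have f1 : ∀ T ∈ fib C T0, XX H' i T = XX H i T := by
    intro T hT
    have q : Dist4 j k l i := by unfold Dist4; tauto
    rw [XX_eq hA' q, XX_eq hA q, h2 j k, h2 k l, h2 j l] <;> simp [a1, a2, a3, a4, a5, a6, a1.symm, a2.symm, a3.symm, a4.symm, a5.symm, a6.symm]
  have f2 : ∀ T ∈ fib C T0, XX H' j T = XX H j T := by
    intro T hT
    have q : Dist4 i k l j := by unfold Dist4; tauto
    rw [XX_eq hA' q, XX_eq hA q, h2 i k, h2 k l, h2 i l] <;> simp [a1, a2, a3, a4, a5, a6, a1.symm, a2.symm, a3.symm, a4.symm, a5.symm, a6.symm]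
  have f3 : ∀ T ∈ fib C T0, XX H' l T ≤ if φ k T ≠ ψ T then 1 else 0 := by
    intro T hT
    have q : Dist4 i k j l := by unfold Dist4; tauto
    rw [XX_eq hA' q, h2 i k, h2 k j, h1 j (by simp) T hT]
    · have hT' := mem_fib.1 hT
      simp only [φ, if_pos hT', hψ T0 T hT']
      exact ite01 _
    all_goals simp [a1, a2, a3, a4, a5, a6, a1.symm, a2.symm, a3.symm, a4.symm, a5.symm, a6.symm]
  have f4 : ∀ T ∈ fib C T0, XX H' k T ≤ if φ l T ≠ ψ T then 1 else 0 := by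
    intro T hT
    have q : Dist4 i l j k := by unfold Dist4; tauto
    rw [XX_eq hA' q, h2 i l, h2 l j, h1 j (by simp) T hT]
    · have hT' := mem_fib.1 hT
      simp only [φ, if_pos hT', hψ T0 T hT']
      exact ite01 _
    all_goals simp [a1, a2, a3, a4, a5, a6, a1.symm, a2.symm, a3.symm, a4.symm, a5.symm, a6.symm]
  have g : ∀ a b : Ω → Γ, (∑ T ∈ fib C T0, if a T ≠ b T then (1:ℝ) else 0) ≤ nd a b := by
    intro a b
    exact Finset.sum_le_sum_of_subset_of_nonneg (Finset.subset_univ _) (fun T _ _ => by split_ifs <;> norm_num)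
  have g3 := (Finset.sum_le_sum f3).trans (g _ _)
  have g4 := (Finset.sum_le_sum f4).trans (g _ _)
  have g5 := nd_triangle (φ l) (φ k) ψ
  rw [nd_comm (φ l) (φ k)] at g5
  rw [sum4 hd, sum4 hd, Finset.sum_congr rfl f1, Finset.sum_congr rfl f2] at h3
  rw [Finset.sum_add_distrib] at hn
  have hQ' : (0:ℝ) < Q := by exact_mod_cast hQ
  have hp := fib_card_pos C T0
  rw [card_singleton] at h3
  unfold ce
  have k1 : ∑ T ∈ fib C T0, XX H' k T + ∑ T ∈ fib C T0, XX H' l T ≤ 9 * (∑ T ∈ fib C T0, XX H i T + ∑ T ∈ fib C T0, XX H j T) := by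
    linarith
  have k2 : Q * (∑ T ∈ fib C T0, XX H k T + ∑ T ∈ fib C T0, XX H l T) ≤ Q * (9 * (∑ T ∈ fib C T0, XX H i T + ∑ T ∈ fib C T0, XX H j T)) + 2 * (fib C T0).card := by
    have := mul_le_mul_of_nonneg_left k1 hQ'.le
    push_cast at h3
    linarith
  have k3 := divhelp hQ' hp k2
  rw [← add_div, ← add_div, ← mul_div_assoc]
  exact k3

end ltg2

section ltg3
variable {F V : Type} [Field F] [AddCommGroup V] [Module F V] [FiniteDimensional F V] [Fintype F]
variable {Γ : Type} [Group Γ]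

theorem vert_min {y : Fin 4 → ℕ}
    {Q : ℕ} (hQ : 0 < Q) {H0 H : Fin 4 → Fin 4 → Flg F V → Γ} (hm : IsMn y Q H0 H) {a b c i : Fin 4} (hd : Dist4 a b c i)
    (hcone : ConeP F V Γ {y i} (y a) (y b) (y c)) (T0 : Flg F V) :
    ce {y i} (XX H a) T0 + ce {y i} (XX H b) T0 + ce {y i} (XX H c) T0 ≤
      135 * ce {y i} (XX H i) T0 + 6 / Q := by
  set C : Set ℕ := {y i} with hC
  obtain ⟨a1, a2, a3, a4, a5, a6⟩ := id hd
  have hA := hm.1.2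
  have ms : ∀ u v, ({y u, y v} : Set ℕ) ⊆ C ∪ {y u, y v} := fun u v => Set.subset_union_right
  obtain ⟨c0, c1, c2, m0, m1, m2, hc⟩ := hcone (H a b) (H b c) (H a c) ((hm.1.1 a b).mono (ms _ _)) ((hm.1.1 b c).mono (ms _ _))
    ((hm.1.1 a c).mono (ms _ _))
  let cc : Fin 4 → Flg F V → Γ := fun x => if x = a then c0 else if x = b then c1 else c2
  have ca : cc a = c0 := if_pos rfl
  have cb : cc b = c1 := by simp only [cc]; rw [if_neg a1.symm]; simp
  have ccc : cc c = c2 := by simp only [cc]; rw [if_neg a2.symm, if_neg a4.symm]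
  obtain ⟨H', hA', h1, h2, h3⟩ := modif hm i {a, b, c} (by simp; tauto) C (by intro b hb; simp [hC]) cc (by
    intro x hx
    simp only [mem_insert, Finset.mem_singleton] at hx
    rcases hx with rfl | rfl | rfl
    · rw [ca]; exact m0
    · rw [cb]; exact m1
    · rw [ccc]; exact m2) T0
  have hc3 : ({a, b, c} : Finset (Fin 4)).card = 3 := by
    rw [card_insert_of_notMem, card_insert_of_notMem, card_singleton] <;> simp <;> tauto
  rw [hc3] at h3
  set fl : Flg F V → ℝ := (fun T => if H a b T = (c0 T)⁻¹ * c1 T ∧ H b c T = (c1 T)⁻¹ * c2 T ∧ H a c T = (c0 T)⁻¹ * c2 T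
        then 0 else 1) with hfl
  have f0 : ∀ T ∈ fib C T0, XX H' i T = XX H i T := by
    intro T hT
    rw [XX_eq hA' hd, XX_eq hA hd, h2 a b, h2 b c, h2 a c] <;> simp [a1, a2, a3, a4, a5, a6, a1.symm, a2.symm, a3.symm, a4.symm, a5.symm, a6.symm]
  have f1 : ∀ T ∈ fib C T0, XX H' a T ≤ fl T := by
    intro T hT
    have q : Dist4 i b c a := by unfold Dist4; tauto
    rw [XX_eq hA' q, h2 b c, h1 b (by simp) T hT, h1 c (by simp) T hT, cb, ccc]
    · simp only [hfl]
      split_ifs with u v v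
      · rfl
      · norm_num
      · exact absurd (by rw [v.2.1]; group) u
      · rfl
    all_goals simp [a1, a2, a3, a4, a5, a6, a1.symm, a2.symm, a3.symm, a4.symm, a5.symm, a6.symm]
  have f2 : ∀ T ∈ fib C T0, XX H' b T ≤ fl T := by
    intro T hT
    have q : Dist4 i a c b := by unfold Dist4; tauto
    rw [XX_eq hA' q, h2 a c, h1 a (by simp) T hT, h1 c (by simp) T hT, ca, ccc]
    · simp only [hfl]
      split_ifs with u v v
      · rfl
      · norm_num
      · exact absurd (by rw [v.2.2]; group) u
      · rfl
    all_goals simp [a1, a2, a3, a4, a5, a6, a1.symm, a2.symm, a3.symm, a4.symm, a5.symm, a6.symm]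
  have f3 : ∀ T ∈ fib C T0, XX H' c T ≤ fl T := by
    intro T hT
    have q : Dist4 i a b c := by unfold Dist4; tauto
    rw [XX_eq hA' q, h2 a b, h1 a (by simp) T hT, h1 b (by simp) T hT, ca, cb]
    · simp only [hfl]
      split_ifs with u v v
      · rfl
      · norm_num
      · exact absurd (by rw [v.1]; group) u
      · rfl
    all_goals simp [a1, a2, a3, a4, a5, a6, a1.symm, a2.symm, a3.symm, a4.symm, a5.symm, a6.symm]
  have g1 := Finset.sum_le_sum f1
  have g2 := Finset.sum_le_sum f2
  have g3 := Finset.sum_le_sum f3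
  have hQ' : (0:ℝ) < Q := by exact_mod_cast hQ
  have hp := fib_card_pos C T0
  have g0 := hc T0
  have e0 : (fun T => if H a b T * H b c T = H a c T then (0:ℝ) else 1) = XX H i := by
    funext T; rw [XX_eq hA hd]
  rw [e0] at g0
  rw [sum4 hd, sum4 hd, Finset.sum_congr rfl f0] at h3
  unfold ce at g0 ⊢
  rw [← mul_div_assoc, div_le_div_iff_of_pos_right hp] at g0
  have k1 : ∑ T ∈ fib C T0, XX H' a T + ∑ T ∈ fib C T0, XX H' b T + ∑ T ∈ fib C T0, XX H' c T ≤ 135 * ∑ T ∈ fib C T0, XX H i T := by linarith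
  have k2 : Q * (∑ T ∈ fib C T0, XX H a T + ∑ T ∈ fib C T0, XX H b T + ∑ T ∈ fib C T0, XX H c T) ≤ Q * (135 * ∑ T ∈ fib C T0, XX H i T) + 6 * (fib C T0).card := by
    have := mul_le_mul_of_nonneg_left k1 hQ'.le
    push_cast at h3
    linarith
  have k3 := divhelp hQ' hp k2
  rw [← add_div, ← add_div, ← mul_div_assoc]
  exact k3

end ltg3


section ltg4
variable {Ω α : Type} [Fintype Ω] [Crd Ω α] {Γ : Type} [Group Γ]

theorem nsq_XX (H : Fin 4 → Fin 4 → Ω → Γ) (l : Fin 4) : nsq (XX H l) = ∑ T, XX H l T := by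
  unfold nsq
  apply Finset.sum_congr rfl
  intro T _
  unfold XX
  split_ifs <;> norm_num

noncomputable def dv (C : Set ℕ) (i : ℕ) (X : Ω → ℝ) (T : Ω) : ℝ := ce (insert i C) X T - ce C X T

theorem dv_bound {l : ℝ} (hl : 0 ≤ l) (h : PL Ω l) {y : Fin 4 → ℕ} {H : Fin 4 → Fin 4 → Ω → Γ}
    (C : Set ℕ) (i : ℕ) (B : Finset ℕ) (hi : i ∉ B) (x : Fin 4) (hX : Meas (C ∪ ↑B) (XX H x)) (hB : B.card ≤ 3) :
    ∑ T, dv C i (XX H x) T ^ 2 ≤ 3 * l ^ 2 * ∑ T, XX H x T := by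
  have := VR_main hl h C i B hi (XX H x) hX
  rw [nsq_XX] at this
  have h0 : 0 ≤ ∑ T, XX H x T := Finset.sum_nonneg fun T _ => XX_nonneg H x T
  have hB' : (B.card : ℝ) ≤ 3 := by exact_mod_cast hB
  refine this.trans ?_
  have : l ^ 2 * B.card ≤ 3 * l ^ 2 := by nlinarith [sq_nonneg l]
  exact mul_le_mul_of_nonneg_right this h0

abbrev Q4 := Fin 4 × Fin 4 × Fin 4 × Fin 4

noncomputable def quads : Finset Q4 := univ.filter (fun p => Dist4 p.1 p.2.1 p.2.2.1 p.2.2.2)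

noncomputable def RR (y : Fin 4 → ℕ) (H : Fin 4 → Fin 4 → Ω → Γ) (p : Q4) (T : Ω) : ℝ :=
  144 * dv {y p.1, y p.2.1} (y p.2.2.1) (XX H p.2.2.1) T ^ 2 + 192 ^ 2 * dv {y p.2.1} (y p.1) (XX H p.1) T ^ 2 +
    120000 ^ 2 * dv ∅ (y p.2.1) (XX H p.2.1) T ^ 2

theorem RR_nonneg (y : Fin 4 → ℕ) (H : Fin 4 → Fin 4 → Ω → Γ) (p : Q4) (T : Ω) : 0 ≤ RR y H p T := by
  unfold RR; positivity

theorem RR_sum {l : ℝ} (hl : 0 ≤ l) (h : PL Ω l) {y : Fin 4 → ℕ} (hy : Function.Injective y)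
    {H : Fin 4 → Fin 4 → Ω → Γ} (hm : Adm y H) (p : Q4) (hp : p ∈ quads) :
    ∑ T, RR y H p T ≤ 10 ^ 11 * l ^ 2 * ∑ x, ∑ T, XX H x T := by
  obtain ⟨i, j, k, o⟩ := p
  simp only [quads, mem_filter, mem_univ, true_and] at hp
  obtain ⟨a1, a2, a3, a4, a5, a6⟩ := id hp
  have n : ∀ {a b}, a ≠ b → y a ≠ y b := fun h h' => h (hy h')
  have h0 : ∀ x, 0 ≤ ∑ T, XX H x T := fun x => Finset.sum_nonneg fun T _ => XX_nonneg H x T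
  have c1 := dv_bound (y := y) hl h {y i, y j} (y k) {y o} (by simpa using n a6) k
    ((XX_meas hm (show Dist4 i j o k by unfold Dist4; tauto)).mono (by intro x; simp; tauto)) (by simp)
  have c2 := dv_bound (y := y) hl h {y j} (y i) {y k, y o} (by simp [n a2, n a3]) i
    ((XX_meas hm (show Dist4 j k o i by unfold Dist4; tauto)).mono (by intro x; simp; tauto)) (by
      exact (card_le_two).trans (by norm_num))
  have c3 := dv_bound (y := y) hl h ∅ (y j) {y i, y k, y o} (by simp [n a1.symm, n a4, n a5]) j
    ((XX_meas hm (show Dist4 i k o j by unfold Dist4; tauto)).mono (by intro x; simp)) card_le_three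
  unfold RR
  simp only [Finset.sum_add_distrib, ← Finset.mul_sum]
  rw [sum4 hp (fun x => ∑ T, XX H x T)]
  have hl2 := sq_nonneg l
  have d1 := mul_nonneg hl2 (h0 i)
  have d2 := mul_nonneg hl2 (h0 j)
  have d3 := mul_nonneg hl2 (h0 k)
  have d4 := mul_nonneg hl2 (h0 o)
  nlinarith

theorem contagion {l : ℝ} (hl : 0 ≤ l) (h : PL Ω l) (hl2 : 10 ^ 15 * l ^ 2 ≤ 1) {y : Fin 4 → ℕ} (hy : Function.Injective y)
    {H0 H : Fin 4 → Fin 4 → Ω → Γ} (hm : IsMn y 2400 H0 H)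
    (hv : ∀ i j, i ≠ j → ∀ T, ce {y i} (XX H j) T ≤ 135 * ce {y i} (XX H i) T + 6 / 2400)
    (hg : ∀ i T, ce ∅ (XX H i) T ≤ 1 / 120000) : ∑ x, ∑ T, XX H x T = 0 := by
  have hA := hm.1.2
  have hl4 : 4 * l ≤ 1 := by nlinarith
  set R : Ω → ℝ := fun T => ∑ p ∈ quads, RR y H p T with hR
  have hRp : ∀ p ∈ quads, ∀ T, RR y H p T ≤ R T := fun p hp T =>
    Finset.single_le_sum (f := fun p => RR y H p T) (fun p _ => RR_nonneg y H p T) hp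
  have stepB : ∀ i j k o, Dist4 i j k o → ∀ T, 1 / 96 ≤ ce {y i, y j} (XX H i) T → 1 ≤ R T := by
    intro i j k o hd T hT
    refine le_trans ?_ (hRp (i, j, k, o) (by simp only [quads, mem_filter, mem_univ, true_and]; exact hd) T)
    unfold RR
    simp only
    have s1 := sq_nonneg (dv {y i, y j} (y k) (XX H k) T)
    have s2 := sq_nonneg (dv {y j} (y i) (XX H i) T)
    have s3 := sq_nonneg (dv ∅ (y j) (XX H j) T)
    by_cases q : 1 / 192 ≤ dv {y j} (y i) (XX H i) T
    · nlinarith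
    have q2 : ce {y j} (XX H i) T ≥ 1 / 192 := by
      unfold dv at q; linarith
    have q3 := hv j i hd.1.symm T
    have q4 := hg j T
    have q5 : 1 / 120000 ≤ dv ∅ (y j) (XX H j) T := by
      unfold dv
      rw [show (insert (y j) ∅ : Set ℕ) = {y j} by simp]
      linarith
    nlinarith
  have stepA : ∀ i j k o, Dist4 i j k o → ∀ T, 1 / 3 ≤ ce (insert (y k) {y i, y j}) (XX H k) T → 1 ≤ R T := by
    intro i j k o hd T hT
    have e := edge_min hl h hl4 hy (by norm_num) hm hd T
    by_cases q : 1 / 12 ≤ dv {y i, y j} (y k) (XX H k) T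
    · refine le_trans ?_ (hRp (i, j, k, o) (by simp only [quads, mem_filter, mem_univ, true_and]; exact hd) T)
      unfold RR
      simp only
      have s2 := sq_nonneg (dv {y j} (y i) (XX H i) T)
      have s3 := sq_nonneg (dv ∅ (y j) (XX H j) T)
      nlinarith
    have q2 : ce {y i, y j} (XX H k) T ≥ 1 / 4 := by
      unfold dv at q; linarith
    have q3 := ce_nonneg {y i, y j} T (XX_nonneg H o)
    by_cases q4 : 1 / 96 ≤ ce {y i, y j} (XX H i) T
    · exact stepB i j k o hd T q4
    · apply stepB j i k o (by unfold Dist4 at *; tauto) T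
      rw [Set.pair_comm]
      push_cast at e
      linarith
  have main : ∀ o T, XX H o T ≤ R T := by
    intro o T
    by_cases hb : badT H o T
    swap
    · rw [show XX H o T = 0 from if_neg hb]
      exact Finset.sum_nonneg fun p _ => RR_nonneg y H p T
    have hb1 : XX H o T = 1 := if_pos hb
    rw [hb1]
    obtain ⟨i, j, k, hd, _⟩ := hb
    have t := ce_mono {y i, y j, y k} T (fun U _ => tetra hA hd U)
    rw [ce_of_meas (XX_meas hm.1 hd), ce_add, ce_add, hb1] at t
    by_cases q1 : 1 / 3 ≤ ce {y i, y j, y k} (XX H k) T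
    · apply stepA i j k o hd T
      rwa [show (insert (y k) {y i, y j} : Set ℕ) = {y i, y j, y k} by ext x; simp; tauto]
    by_cases q2 : 1 / 3 ≤ ce {y i, y j, y k} (XX H j) T
    · apply stepA i k j o (by unfold Dist4 at *; tauto) T
      rwa [show (insert (y j) {y i, y k} : Set ℕ) = {y i, y j, y k} by ext x; simp; tauto]
    · apply stepA j k i o (by unfold Dist4 at *; tauto) T
      linarith
  have hD0 : 0 ≤ ∑ x, ∑ T, XX H x T := Finset.sum_nonneg fun x _ => Finset.sum_nonneg fun T _ => XX_nonneg H x T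
  have hs : ∑ T, R T ≤ 256 * (10 ^ 11 * l ^ 2 * ∑ x, ∑ T, XX H x T) := by
    rw [hR, Finset.sum_comm]
    have hc : (quads.card : ℝ) ≤ 256 := by
      have := Finset.card_le_univ quads
      rw [show Fintype.card Q4 = 256 by simp] at this
      exact_mod_cast this
    calc _ ≤ ∑ p ∈ quads, (10 ^ 11 * l ^ 2 * ∑ x, ∑ T, XX H x T) := Finset.sum_le_sum fun p hp => RR_sum hl h hy hm.1 p hp
      _ ≤ _ := by
        rw [Finset.sum_const, nsmul_eq_mul]
        exact mul_le_mul_of_nonneg_right hc (by positivity)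
  have hs2 : ∑ x, ∑ T, XX H x T ≤ 4 * ∑ T, R T := by
    calc _ ≤ ∑ x : Fin 4, ∑ T, R T := Finset.sum_le_sum fun x _ => Finset.sum_le_sum fun T _ => main x T
      _ = _ := by simp
  apply le_antisymm _ hD0
  by_contra hlt
  push Not at hlt
  nlinarith

end ltg4

section ltg5
variable {F V : Type} [Field F] [AddCommGroup V] [Module F V] [FiniteDimensional F V] [Fintype F]
variable {Γ : Type} [Group Γ]

theorem dist4_cases {i j k : Fin 4} (h : i < j) (h' : j < k) : ∃ l, Dist4 i j k l := by
  unfold Dist4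
  revert i j k; decide

theorem E1_empty {l : ℝ} (hl : 0 ≤ l) (hP : PL (Flg F V) l) (hl2 : 10 ^ 15 * l ^ 2 ≤ 1) (x h : ℕ) (hh : 0 < h)
    (hn : x + 3 * h ≤ Module.finrank F V) :
    E1 (Flg F V) Γ 4 (fun i => x + i * h) ∅ 1000000 := by
  intro H hH
  set y : Fin 4 → ℕ := fun i => x + i.val * h with hy
  have hyi : Function.Injective y := by
    intro a b hab
    simp only [hy] at hab
    have : a.val * h = b.val * h := by omega
    exact Fin.ext (Nat.eq_of_mul_eq_mul_right hh this)
  let H0 : Fin 4 → Fin 4 → Flg F V → Γ := fun i j T => if i < j then H i j T else if j < i then (H j i T)⁻¹ else 1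
  have hA0 : Adm y H0 := by
    constructor
    · intro i j T T' hT
      simp only [H0]
      split_ifs with h1 h2
      · exact hH i j h1 j.isLt T T' (hT.mono (by intro z; simp [hy]))
      · rw [hH j i h2 i.isLt T T' (hT.mono (by intro z; simp [hy]; tauto))]
      · rfl
    · intro i j T
      simp only [H0]
      rcases lt_trichotomy i j with h1 | h1 | h1
      · rw [if_neg (not_lt.2 h1.le), if_pos h1, if_pos h1]
      · subst h1; simp
      · rw [if_pos h1, if_neg (not_lt.2 h1.le), if_pos h1, inv_inv]
  set D := ∑ p ∈ trip 4, nd (H p.1 p.2.1 * H p.2.1 p.2.2) (H p.1 p.2.2) with hD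
  have hD0 : ∀ o, ∑ T, XX H0 o T ≤ D := by
    have key : ∀ i j k o : Fin 4, i < j → j < k → Dist4 i j k o → ∑ T, XX H0 o T ≤ D := by
      intro i j k o hij hjk hd
      have e : ∑ T, XX H0 o T = nd (H i j * H j k) (H i k) := by
        unfold nd
        apply Finset.sum_congr rfl
        intro T _
        rw [XX_eq hA0.2 hd]
        simp only [H0, if_pos hij, if_pos hjk, if_pos (hij.trans hjk), Pi.mul_apply, ite_not, Ne]
      rw [e, hD]
      apply Finset.single_le_sum (f := fun p : ℕ × ℕ × ℕ => nd (H p.1 p.2.1 * H p.2.1 p.2.2) (H p.1 p.2.2)) (a := (i.val, j.val, k.val)) (fun p _ => nd_nonneg _ _)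
      simp only [trip, mem_filter, mem_product, mem_range]
      exact ⟨⟨i.isLt, j.isLt, k.isLt⟩, hij, hjk⟩
    intro o
    have : ∃ i j k : Fin 4, i < j ∧ j < k ∧ Dist4 i j k o := by
      unfold Dist4
      revert o; decide
    obtain ⟨i, j, k, h1, h2, h3⟩ := this
    exact key i j k o h1 h2 h3
  have hDn : 0 ≤ D := Finset.sum_nonneg fun p _ => nd_nonneg _ _
  by_cases hbig : (Fintype.card (Flg F V) : ℝ) < 1000000 * D
  · refine ⟨1, 1, fun _ _ _ => rfl, fun _ _ _ => rfl, le_trans ?_ hbig.le⟩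
    unfold nd
    calc _ ≤ ∑ T : Flg F V, (1:ℝ) := Finset.sum_le_sum fun T _ => by split_ifs <;> norm_num
      _ = _ := by simp
  push Not at hbig
  obtain ⟨G, hG⟩ := exists_min y 2400 H0 hA0
  have hPhi : (Phi 2400 H0 G : ℝ) ≤ Phi 2400 H0 H0 := by exact_mod_cast hG.2 H0 hA0
  rw [Phi_cast, Phi_cast] at hPhi
  simp only [nd_self, Finset.sum_const_zero, add_zero] at hPhi
  have hsum0 : ∑ o, ∑ T, XX H0 o T ≤ 4 * D := by
    calc _ ≤ ∑ o : Fin 4, D := Finset.sum_le_sum fun o _ => hD0 o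
      _ = _ := by simp
  have hnn : 0 ≤ ∑ i, ∑ j, nd (G i j) (H0 i j) := Finset.sum_nonneg fun i _ => Finset.sum_nonneg fun j _ => nd_nonneg _ _
  have hXn : ∀ o, 0 ≤ ∑ T, XX G o T := fun o => Finset.sum_nonneg fun T _ => XX_nonneg G o T
  have hzero : ∑ o, ∑ T, XX G o T = 0 := by
    apply contagion hl hP hl2 hyi hG
    · have hc : ∀ i, ∃ a b c, Dist4 a b c i ∧ ConeP F V Γ {y i} (y a) (y b) (y c) := by
        intro i
        fin_cases i
        · refine ⟨1, 2, 3, by unfold Dist4; decide, ?_⟩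
          have := cone_up (F := F) (V := V) (Γ := Γ) {x} x h rfl (by simp) hn
          simpa [hy] using this
        · refine ⟨0, 2, 3, by unfold Dist4; decide, ?_⟩
          have := cone_jup (F := F) (V := V) (Γ := Γ) (x + h) h (by omega) (by omega)
          simp only [hy]
          convert this using 1
          · simp
          · simp
          · simp; ring
          · simp; ring
        · refine ⟨3, 1, 0, by unfold Dist4; decide, ?_⟩
          have := cone_jdown (F := F) (V := V) (Γ := Γ) (x + 2 * h) h (by omega) (by omega)
          simp only [hy]
          convert this using 1
          · simp; ring
          · simp; omega
          · simp
        · refine ⟨2, 1, 0, by unfold Dist4; decide, ?_⟩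
          have := cone_down (F := F) (V := V) (Γ := Γ) {x + 3 * h} (x + 3 * h) h rfl (by simp) hn (by omega)
          simp only [hy]
          convert this using 1
          · simp; omega
          · simp; omega
          · simp
      intro i j hij T
      obtain ⟨a, b, c, hd, hcone⟩ := hc i
      have := vert_min (by norm_num) hG hd hcone T
      push_cast at this
      have na := ce_nonneg {y i} T (XX_nonneg G a)
      have nb := ce_nonneg {y i} T (XX_nonneg G b)
      have nc := ce_nonneg {y i} T (XX_nonneg G c)
      rcases mem4 hd j hij.symm with rfl | rfl | rfl <;> linarith
    · intro i T
      have hf : fib ∅ T = (univ : Finset (Flg F V)) := by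
        ext U; rw [mem_fib]; simp [Agr]
      unfold ce
      rw [hf, Finset.card_univ]
      have hpos : (0:ℝ) < Fintype.card (Flg F V) := by
        have : Nonempty (Flg F V) := ⟨T⟩
        exact_mod_cast Fintype.card_pos
      rw [div_le_iff₀ hpos]
      have : ∑ T, XX G i T ≤ ∑ o, ∑ T, XX G o T := Finset.single_le_sum (f := fun o => ∑ T, XX G o T) (fun o _ => hXn o) (mem_univ i)
      push_cast at hPhi
      linarith
  have hz : ∀ o T, XX G o T = 0 := by
    intro o T
    have h1 : ∑ T, XX G o T ≤ 0 := by
      rw [← hzero]; exact Finset.single_le_sum (f := fun o => ∑ T, XX G o T) (fun o _ => hXn o) (mem_univ o)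
    have h2 : XX G o T ≤ ∑ T, XX G o T := Finset.single_le_sum (f := fun T => XX G o T) (fun T _ => XX_nonneg G o T) (mem_univ T)
    linarith [XX_nonneg G o T]
  let GG : ℕ → ℕ → Flg F V → Γ := fun i j T => if h : i < 4 ∧ j < 4 then G ⟨i, h.1⟩ ⟨j, h.2⟩ T else 1
  obtain ⟨c, hc1, hc2⟩ := flat_flags (F := F) (V := V) (Γ := Γ) (fun i => x + i * h)
    (by intro a b hab; simp only; nlinarith) hn GG (by
      intro i j hij hj T T' hT
      simp only [GG]
      rw [dif_pos ⟨by omega, hj⟩, dif_pos ⟨by omega, hj⟩]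
      exact hG.1.1 _ _ T T' hT) (by
      intro i j k hij hjk hk T
      simp only [GG]
      rw [dif_pos ⟨by omega, by omega⟩, dif_pos ⟨by omega, by omega⟩, dif_pos ⟨by omega, by omega⟩]
      obtain ⟨o, ho⟩ := dist4_cases (i := ⟨i, by omega⟩) (j := ⟨j, by omega⟩) (k := ⟨k, by omega⟩) hij hjk
      have := hz o T
      rw [XX_eq hG.1.2 ho] at this
      by_contra hcc
      rw [if_neg hcc] at this
      norm_num at this)
  refine ⟨c 0, c 1, by simpa using hc1 0, by simpa using hc1 1, ?_⟩
  have e : (c 0)⁻¹ * c 1 = G 0 1 := by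
    funext T
    have := hc2 0 1 (by norm_num) (by norm_num) T
    simp only [GG] at this
    rw [dif_pos ⟨by norm_num, by norm_num⟩] at this
    exact this.symm
  rw [e, nd_comm]
  have e2 : H0 0 1 = H 0 1 := by
    funext T
    simp only [H0]
    rw [if_pos (by decide)]; rfl
  rw [← e2]
  have h1 : nd (G 0 1) (H0 0 1) ≤ ∑ j, nd (G 0 j) (H0 0 j) := Finset.single_le_sum (f := fun j => nd (G 0 j) (H0 0 j)) (fun j _ => nd_nonneg _ _) (mem_univ 1)
  have h2 : ∑ j, nd (G 0 j) (H0 0 j) ≤ ∑ i, ∑ j, nd (G i j) (H0 i j) := Finset.single_le_sum (f := fun i => ∑ j, nd (G i j) (H0 i j)) (fun i _ => Finset.sum_nonneg fun j _ => nd_nonneg _ _) (mem_univ 0)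
  rw [hzero] at hPhi
  push_cast at hPhi
  linarith

end ltg5


section kneser
variable {β Γ : Type} [Group Γ]

noncomputable def I01 (p : Prop) : ℝ := if p then 1 else 0

theorem I01_nonneg (p : Prop) : 0 ≤ I01 p := by unfold I01; split_ifs <;> norm_num
theorem I01_le (p : Prop) : I01 p ≤ 1 := by unfold I01; split_ifs <;> norm_num
theorem I01_pos {p : Prop} (h : p) : I01 p = 1 := if_pos h
theorem I01_neg {p : Prop} (h : ¬ p) : I01 p = 0 := if_neg h

theorem avl (cs : Finset β) (P : β → Prop) [DecidablePred P] {m x : ℝ} (hm : m ≤ ((cs.filter P).card : ℝ)) (hx : 0 ≤ x)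
    (y : β → ℝ) (h : ∀ e ∈ cs, P e → x ≤ y e) (hy : ∀ e ∈ cs, 0 ≤ y e) : m * x ≤ ∑ e ∈ cs, y e := by
  calc m * x ≤ ((cs.filter P).card : ℝ) * x := mul_le_mul_of_nonneg_right hm hx
    _ = ∑ e ∈ cs.filter P, x := by rw [Finset.sum_const, nsmul_eq_mul]
    _ ≤ ∑ e ∈ cs.filter P, y e := Finset.sum_le_sum fun e he => h e (mem_filter.1 he).1 (mem_filter.1 he).2
    _ ≤ ∑ e ∈ cs, y e := Finset.sum_le_sum_of_subset_of_nonneg (filter_subset _ _) fun e he _ => hy e he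

theorem bestl (cs : Finset β) (P : β → Prop) [DecidablePred P] {m : ℝ} (hm : m ≤ ((cs.filter P).card : ℝ)) (hm0 : 0 < m)
    (y : β → ℝ) (hy : ∀ e ∈ cs, 0 ≤ y e) : ∃ b ∈ cs, P b ∧ m * y b ≤ ∑ e ∈ cs, y e := by
  have hne : (cs.filter P).Nonempty := by
    rw [← card_pos]
    have : (0:ℝ) < ((cs.filter P).card : ℝ) := lt_of_lt_of_le hm0 hm
    exact_mod_cast this
  obtain ⟨b, hb, hmin⟩ := Finset.exists_min_image (cs.filter P) y hne
  refine ⟨b, (mem_filter.1 hb).1, (mem_filter.1 hb).2, ?_⟩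
  exact avl cs P hm (hy b (mem_filter.1 hb).1) y (fun e he hp => hmin e (mem_filter.2 ⟨he, hp⟩)) hy

set_option maxHeartbeats 2000000 in
theorem ker1 (cs : Finset β) (dj : β → β → Prop) (hs : ∀ a b, dj a b → dj b a) (F : β → β → Γ)
    {δ : ℝ} (hδ : 0 < δ) (hδ1 : δ ≤ 1) (hne : cs.Nonempty)
    (av : ∀ a ∈ cs, ∀ b ∈ cs, ∀ c ∈ cs, ∀ d ∈ cs,
      δ * cs.card ≤ ((cs.filter (fun e => dj a e ∧ dj b e ∧ dj c e ∧ dj d e)).card : ℝ)) :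
    ∃ g : β → Γ, cs.card * ∑ a ∈ cs, ∑ b ∈ cs, I01 (dj a b ∧ F a b ≠ g a * (g b)⁻¹) ≤
      9 / δ ^ 3 * ∑ a ∈ cs, ∑ b ∈ cs, ∑ c ∈ cs, I01 (dj a b ∧ dj b c ∧ dj a c ∧ F a b * F b c ≠ F a c) := by
  set N : ℝ := (cs.card : ℝ) with hN
  have hN0 : 0 < N := by rw [hN]; exact_mod_cast hne.card_pos
  have hm0 : 0 < δ * N := mul_pos hδ hN0
  set X : β → β → β → ℝ := fun a b c => I01 (dj a b ∧ dj b c ∧ dj a c ∧ F a b * F b c ≠ F a c) with hX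
  have X0 : ∀ a b c, 0 ≤ X a b c := fun a b c => I01_nonneg _
  set E := ∑ a ∈ cs, ∑ b ∈ cs, ∑ c ∈ cs, X a b c with hE
  have hE0 : 0 ≤ E := Finset.sum_nonneg fun a _ => Finset.sum_nonneg fun b _ => Finset.sum_nonneg fun c _ => X0 a b c
  have hXg : ∀ a b c, dj a b → dj b c → dj a c → X a b c = 0 → F a b * F b c = F a c := by
    intro a b c h1 h2 h3 h
    by_contra hc
    have : X a b c = 1 := I01_pos ⟨h1, h2, h3, hc⟩
    linarith
  have X1 : ∀ a b c, X a b c = 0 ∨ X a b c = 1 := by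
    intro a b c; simp only [hX, I01]; split_ifs <;> simp
  let φ : β → β → β → Γ := fun B B0 b => F B b * F b B0
  let R : β → β → β → β → ℝ := fun B B0 b B1 => ∑ B2 ∈ cs, (X B b B2 + X b B2 B0 + X B B1 B2 + X B1 B2 B0)
  have R0 : ∀ B B0 b B1, 0 ≤ R B B0 b B1 := fun B B0 b B1 => Finset.sum_nonneg fun B2 _ => by
    linarith [X0 B b B2, X0 b B2 B0, X0 B B1 B2, X0 B1 B2 B0]
  have step1 : ∀ B ∈ cs, ∀ B0 ∈ cs, ∀ b ∈ cs, ∀ B1 ∈ cs, dj B b → dj B0 b → 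
      δ * N * I01 (dj B B1 ∧ dj B0 B1 ∧ φ B B0 B1 ≠ φ B B0 b) ≤ R B B0 b B1 := by
    intro B hB B0 hB0 b hb B1 hB1 h1 h2
    apply avl cs (fun e => _) (av B hB B0 hB0 b hb B1 hB1) (I01_nonneg _)
    · rintro B2 hB2 ⟨q1, q2, q3, q4⟩
      by_cases hp : dj B B1 ∧ dj B0 B1 ∧ φ B B0 B1 ≠ φ B B0 b
      swap
      · rw [I01_neg hp]; linarith [X0 B b B2, X0 b B2 B0, X0 B B1 B2, X0 B1 B2 B0]
      rw [I01_pos hp]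
      obtain ⟨p1, p2, p3⟩ := hp
      by_contra hlt
      push Not at hlt
      have z1 : X B b B2 = 0 := by rcases X1 B b B2 with h | h; exact h; linarith [X0 B b B2, X0 b B2 B0, X0 B B1 B2, X0 B1 B2 B0]
      have z2 : X b B2 B0 = 0 := by rcases X1 b B2 B0 with h | h; exact h; linarith [X0 B b B2, X0 b B2 B0, X0 B B1 B2, X0 B1 B2 B0]
      have z3 : X B B1 B2 = 0 := by rcases X1 B B1 B2 with h | h; exact h; linarith [X0 B b B2, X0 b B2 B0, X0 B B1 B2, X0 B1 B2 B0]
      have z4 : X B1 B2 B0 = 0 := by rcases X1 B1 B2 B0 with h | h; exact h; linarith [X0 B b B2, X0 b B2 B0, X0 B B1 B2, X0 B1 B2 B0]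
      have w1 := hXg _ _ _ h1 q3 q1 z1
      have w2 := hXg _ _ _ q3 (hs _ _ q2) (hs _ _ h2) z2
      have w3 := hXg _ _ _ p1 q4 q1 z3
      have w4 := hXg _ _ _ q4 (hs _ _ q2) (hs _ _ p2) z4
      apply p3
      simp only [φ]
      rw [← w2, ← w4, ← mul_assoc, ← mul_assoc, w1, w3]
    · intro e _; linarith [X0 B b e, X0 b e B0, X0 B B1 e, X0 B1 e B0]
  -- best middle point
  have step2 : ∀ B ∈ cs, ∀ B0 ∈ cs, ∃ u : Γ, (δ * N) * ((δ * N) * ∑ B1 ∈ cs, I01 (dj B B1 ∧ dj B0 B1 ∧ φ B B0 B1 ≠ u)) ≤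
      ∑ b ∈ cs, ∑ B1 ∈ cs, R B B0 b B1 := by
    intro B hB B0 hB0
    obtain ⟨b, hb, hpb, hle⟩ := bestl cs (fun b => dj B b ∧ dj B0 b) (m := δ * N) ((av B hB B0 hB0 B hB B0 hB0).trans (by
        norm_cast
        apply card_le_card
        intro e he
        rw [mem_filter] at he ⊢
        tauto)) hm0 (fun b => ∑ B1 ∈ cs, R B B0 b B1) (fun b _ => Finset.sum_nonneg fun B1 _ => R0 _ _ _ _)
    refine ⟨φ B B0 b, le_trans (mul_le_mul_of_nonneg_left ?_ hm0.le) hle⟩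
    rw [Finset.mul_sum]
    exact Finset.sum_le_sum fun B1 hB1 => step1 B hB B0 hB0 b hb B1 hB1 hpb.1 hpb.2
  have step2' : ∀ B B0, ∃ u : Γ, B ∈ cs → B0 ∈ cs → (δ * N) * ((δ * N) * ∑ B1 ∈ cs, I01 (dj B B1 ∧ dj B0 B1 ∧ φ B B0 B1 ≠ u)) ≤
      ∑ b ∈ cs, ∑ B1 ∈ cs, R B B0 b B1 := by
    intro B B0
    by_cases h : B ∈ cs ∧ B0 ∈ cs
    · obtain ⟨u, hu⟩ := step2 B h.1 B0 h.2
      exact ⟨u, fun _ _ => hu⟩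
    · exact ⟨1, fun a b => absurd ⟨a, b⟩ h⟩
  choose gg hgg using step2'
  set Z : β → β → ℝ := fun B0 B => ∑ B1 ∈ cs, I01 (dj B B1 ∧ dj B0 B1 ∧ φ B B0 B1 ≠ gg B B0) with hZ
  have Z0 : ∀ B0 B, 0 ≤ Z B0 B := fun B0 B => Finset.sum_nonneg fun _ _ => I01_nonneg _
  have hRsum : ∑ B0 ∈ cs, ∑ B ∈ cs, ∑ b ∈ cs, ∑ B1 ∈ cs, R B B0 b B1 = 4 * N ^ 2 * E := by
    simp only [R, Finset.sum_add_distrib]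
    have t1 : ∑ B0 ∈ cs, ∑ B ∈ cs, ∑ b ∈ cs, ∑ B1 ∈ cs, ∑ B2 ∈ cs, X B b B2 = N ^ 2 * E := by
      have : ∀ B b, ∑ B1 ∈ cs, ∑ B2 ∈ cs, X B b B2 = N * ∑ B2 ∈ cs, X B b B2 := by
        intro B b; rw [Finset.sum_const, nsmul_eq_mul]
      simp only [this, ← Finset.mul_sum]
      rw [Finset.sum_const, nsmul_eq_mul]; ring
    have t2 : ∑ B0 ∈ cs, ∑ B ∈ cs, ∑ b ∈ cs, ∑ B1 ∈ cs, ∑ B2 ∈ cs, X b B2 B0 = N ^ 2 * E := by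
      have : ∀ b B0, ∑ B1 ∈ cs, ∑ B2 ∈ cs, X b B2 B0 = N * ∑ B2 ∈ cs, X b B2 B0 := by
        intro B b; rw [Finset.sum_const, nsmul_eq_mul]
      simp only [this, ← Finset.mul_sum]
      simp only [Finset.sum_const, nsmul_eq_mul, ← Finset.mul_sum]
      have e : ∑ B0 ∈ cs, ∑ b ∈ cs, ∑ B2 ∈ cs, X b B2 B0 = E := by
        rw [hE, Finset.sum_comm]
        apply Finset.sum_congr rfl; intro b _
        rw [Finset.sum_comm]
      rw [e]; ring
    have t3 : ∑ B0 ∈ cs, ∑ B ∈ cs, ∑ b ∈ cs, ∑ B1 ∈ cs, ∑ B2 ∈ cs, X B B1 B2 = N ^ 2 * E := by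
      simp only [Finset.sum_const, nsmul_eq_mul, ← Finset.mul_sum]
      rw [hE]; ring
    have t4 : ∑ B0 ∈ cs, ∑ B ∈ cs, ∑ b ∈ cs, ∑ B1 ∈ cs, ∑ B2 ∈ cs, X B1 B2 B0 = N ^ 2 * E := by
      simp only [Finset.sum_const, nsmul_eq_mul, ← Finset.mul_sum]
      have e : ∑ B0 ∈ cs, ∑ b ∈ cs, ∑ B2 ∈ cs, X b B2 B0 = E := by
        rw [hE, Finset.sum_comm]
        apply Finset.sum_congr rfl; intro b _
        rw [Finset.sum_comm]
      rw [e]; ring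
    rw [t1, t2, t3, t4]; ring
  have hZsum : (δ * N) * ((δ * N) * ∑ B0 ∈ cs, ∑ B ∈ cs, Z B0 B) ≤ 4 * N ^ 2 * E := by
    rw [← hRsum, Finset.mul_sum, Finset.mul_sum]
    apply Finset.sum_le_sum; intro B0 hB0
    rw [Finset.mul_sum, Finset.mul_sum]
    apply Finset.sum_le_sum; intro B hB
    exact hgg B B0 hB hB0
  obtain ⟨B0, hB0, _, hbest⟩ := bestl cs (fun _ => True) (m := N) (by simp [hN]) hN0 (fun B0 => ∑ B ∈ cs, Z B0 B)
    (fun B0 _ => Finset.sum_nonneg fun B _ => Z0 _ _)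
  set z := ∑ B ∈ cs, Z B0 B with hz
  have hz1 : δ ^ 2 * N * z ≤ 4 * E := by
    have h1 : (δ * N) * ((δ * N) * (N * z)) ≤ 4 * N ^ 2 * E :=
      le_trans (by gcongr) hZsum
    have h2 : N ^ 2 * (δ ^ 2 * N * z) ≤ N ^ 2 * (4 * E) := by linarith
    exact le_of_mul_le_mul_left h2 (by positivity)
  refine ⟨fun B => gg B B0, ?_⟩
  set D := ∑ a ∈ cs, ∑ b ∈ cs, I01 (dj a b ∧ F a b ≠ gg a B0 * (gg b B0)⁻¹) with hD
  have fin : δ * N * D ≤ E + 2 * N * z := by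
    have : δ * N * D ≤ ∑ a ∈ cs, ∑ b ∈ cs, ∑ B1 ∈ cs, (X a b B1 + I01 (dj a B1 ∧ dj B0 B1 ∧ φ a B0 B1 ≠ gg a B0) +
        I01 (dj b B1 ∧ dj B0 B1 ∧ φ b B0 B1 ≠ gg b B0)) := by
      rw [hD, Finset.mul_sum]
      apply Finset.sum_le_sum; intro a ha
      rw [Finset.mul_sum]
      apply Finset.sum_le_sum; intro b hb
      apply avl cs (fun e => _) (av a ha b hb B0 hB0 B0 hB0) (I01_nonneg _)
      · rintro B1 hB1 ⟨q1, q2, q3, _⟩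
        by_cases hp : dj a b ∧ F a b ≠ gg a B0 * (gg b B0)⁻¹
        swap
        · rw [I01_neg hp]
          linarith [X0 a b B1, I01_nonneg (dj a B1 ∧ dj B0 B1 ∧ φ a B0 B1 ≠ gg a B0), I01_nonneg (dj b B1 ∧ dj B0 B1 ∧ φ b B0 B1 ≠ gg b B0)]
        rw [I01_pos hp]
        by_cases u1 : φ a B0 B1 ≠ gg a B0
        · rw [I01_pos (show dj a B1 ∧ dj B0 B1 ∧ φ a B0 B1 ≠ gg a B0 from ⟨q1, q3, u1⟩)]
          linarith [X0 a b B1, I01_nonneg (dj b B1 ∧ dj B0 B1 ∧ φ b B0 B1 ≠ gg b B0)]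
        by_cases u2 : φ b B0 B1 ≠ gg b B0
        · rw [I01_pos (show dj b B1 ∧ dj B0 B1 ∧ φ b B0 B1 ≠ gg b B0 from ⟨q2, q3, u2⟩)]
          linarith [X0 a b B1, I01_nonneg (dj a B1 ∧ dj B0 B1 ∧ φ a B0 B1 ≠ gg a B0)]
        rcases X1 a b B1 with h | h
        · exfalso
          apply hp.2
          have w := hXg _ _ _ hp.1 q2 q1 h
          push Not at u1 u2
          rw [← u1, ← u2]
          simp only [φ]
          rw [← w]; group
        · rw [h]
          linarith [I01_nonneg (dj a B1 ∧ dj B0 B1 ∧ φ a B0 B1 ≠ gg a B0), I01_nonneg (dj b B1 ∧ dj B0 B1 ∧ φ b B0 B1 ≠ gg b B0)]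
      · intro e _
        linarith [X0 a b e, I01_nonneg (dj a e ∧ dj B0 e ∧ φ a B0 e ≠ gg a B0), I01_nonneg (dj b e ∧ dj B0 e ∧ φ b B0 e ≠ gg b B0)]
    refine this.trans (le_of_eq ?_)
    simp only [Finset.sum_add_distrib]
    have : ∑ a ∈ cs, ∑ b ∈ cs, ∑ B1 ∈ cs, I01 (dj a B1 ∧ dj B0 B1 ∧ φ a B0 B1 ≠ gg a B0) = N * z := by
      simp only [Finset.sum_const, nsmul_eq_mul, ← Finset.mul_sum]
      rfl
    have h2 : ∑ a ∈ cs, ∑ b ∈ cs, ∑ B1 ∈ cs, I01 (dj b B1 ∧ dj B0 B1 ∧ φ b B0 B1 ≠ gg b B0) = N * z := by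
      rw [Finset.sum_const, nsmul_eq_mul]
    rw [this, h2]; ring
  have hd3 : 0 < δ ^ 3 := by positivity
  rw [div_mul_eq_mul_div, le_div_iff₀ hd3]
  have h1 : δ ^ 2 * (δ * N * D) ≤ δ ^ 2 * (E + 2 * N * z) := mul_le_mul_of_nonneg_left fin (by positivity)
  have h2 : δ ^ 2 * E ≤ E := by nlinarith [pow_le_one₀ hδ.le hδ1 (n := 2)]
  nlinarith

end kneser


theorem pickl {β : Type} (cs : Finset β) (P : β → Prop) [DecidablePred P] {m : ℝ}
    (hm : m ≤ ((cs.filter P).card : ℝ)) (y : β → ℝ) (hy : ∀ e ∈ cs, 0 ≤ y e) (hlt : ∑ e ∈ cs, y e < m) :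
    ∃ b ∈ cs, P b ∧ y b < 1 := by
  by_contra hc
  push Not at hc
  have := avl cs P hm (x := 1) zero_le_one y (fun e he hp => hc e he hp) hy
  linarith

theorem I01_lt {p : Prop} (h : I01 p < 1) : ¬ p := fun hp => by rw [I01_pos hp] at h; exact lt_irrefl _ h

theorem I01_congr {p q : Prop} (h : p ↔ q) : I01 p = I01 q := by rw [propext h]

theorem I01_mono {p q : Prop} (h : p → q) : I01 p ≤ I01 q := by
  by_cases hp : p
  · rw [I01_pos hp, I01_pos (h hp)]
  · rw [I01_neg hp]; exact I01_nonneg _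

section holon
variable {Ω α Γ : Type} [Fintype Ω] [Crd Ω α] [Group Γ]

def avw (D : ℕ → Set ℕ) (l : ℕ) (B : Finset ℕ) : Prop := ∀ c ∈ B, c ∉ D l

def Wd (D : ℕ → Set ℕ) (l : ℕ) (x x' : Ω) : Prop := Agr {c | c ∉ D l} x x'

/-- Avoidance hypothesis. -/
def AvH (D : ℕ → Set ℕ) (M : ℕ) (cs : Finset (Finset ℕ)) (δ : ℝ) : Prop :=
  ∀ a ∈ cs, ∀ b ∈ cs, ∀ c ∈ cs, ∀ d ∈ cs, ∀ i < M, ∀ j < M,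
    δ * cs.card ≤ ((cs.filter (fun e => (Disjoint a e ∧ Disjoint b e ∧ Disjoint c e ∧ Disjoint d e) ∧
      avw D i e ∧ avw D j e)).card : ℝ)

/-- Defect indicator. -/
noncomputable def dfi (fh : Finset ℕ → Finset ℕ → Ω → Γ) (g : Finset ℕ → Ω → Γ) (B B' : Finset ℕ) (T : Ω) : ℝ :=
  I01 (Disjoint B B' ∧ fh B B' T ≠ g B T * (g B' T)⁻¹)

theorem dfi_nonneg (fh : Finset ℕ → Finset ℕ → Ω → Γ) (g : Finset ℕ → Ω → Γ) (B B' : Finset ℕ) (T : Ω) :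
    0 ≤ dfi fh g B B' T := I01_nonneg _

theorem dfi_lt {fh : Finset ℕ → Finset ℕ → Ω → Γ} {g : Finset ℕ → Ω → Γ} {B B' : Finset ℕ} {T : Ω}
    (h : dfi fh g B B' T < 1) (hd : Disjoint B B') : fh B B' T = g B T * (g B' T)⁻¹ := by
  have := I01_lt h
  tauto

theorem wd_agr {D : ℕ → Set ℕ} {l : ℕ} {x x' : Ω} (h : Wd D l x x') {B : Finset ℕ} (hB : avw D l B) :
    Agr (B : Set ℕ) x x' := h.mono fun c hc => hB c hc

theorem agr_union {C D : Set ℕ} {x x' : Ω} (h : Agr C x x') (h' : Agr D x x') : Agr (C ∪ D) x x' := by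
  intro c hc
  rcases hc with hc | hc
  · exact h c hc
  · exact h' c hc

variable {D : ℕ → Set ℕ} {M : ℕ} {cs : Finset (Finset ℕ)} {δ : ℝ} {fh : Finset ℕ → Finset ℕ → Ω → Γ}
  {g : Finset ℕ → Ω → Γ}

theorem av2 (hav : AvH D M cs δ) {l : ℕ} (hl : l < M) {a b : Finset ℕ} (ha : a ∈ cs) (hb : b ∈ cs) :
    δ * cs.card ≤ ((cs.filter (fun e => avw D l e ∧ Disjoint a e ∧ Disjoint b e)).card : ℝ) := by
  refine (hav a ha b hb a ha b hb l hl l hl).trans ?_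
  norm_cast
  apply card_le_card
  intro e he
  rw [mem_filter] at he ⊢
  tauto

theorem av0 (hav : AvH D M cs δ) (hne : cs.Nonempty) {l l' : ℕ} (hl : l < M) (hl' : l' < M) :
    δ * cs.card ≤ ((cs.filter (fun e => avw D l e ∧ avw D l' e)).card : ℝ) := by
  obtain ⟨a, ha⟩ := hne
  refine (hav a ha a ha a ha a ha l hl l' hl').trans ?_
  norm_cast
  apply card_le_card
  intro e he
  rw [mem_filter] at he ⊢
  tauto

def gd1 (cs : Finset (Finset ℕ)) (δ : ℝ) (fh : Finset ℕ → Finset ℕ → Ω → Γ) (g : Finset ℕ → Ω → Γ) (T : Ω) : Prop :=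
  ∑ B ∈ cs, ∑ B' ∈ cs, dfi fh g B B' T ≤ δ ^ 3 / 32 * (cs.card : ℝ) ^ 2

def gd2 (cs : Finset (Finset ℕ)) (δ : ℝ) (fh : Finset ℕ → Finset ℕ → Ω → Γ) (g : Finset ℕ → Ω → Γ) (B : Finset ℕ) (T : Ω) : Prop :=
  ∑ B' ∈ cs, dfi fh g B B' T ≤ δ / 4 * (cs.card : ℝ)

theorem comp_ex (hδ : 0 < δ) (hne : cs.Nonempty) (hav : AvH D M cs δ)
    (hfh : ∀ B ∈ cs, ∀ B' ∈ cs, Meas ((B : Set ℕ) ∪ B') (fh B B')) {l : ℕ} (hl : l < M) {x x' : Ω}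
    (hx : gd1 cs δ fh g x) (hx' : gd1 cs δ fh g x') (hw : Wd D l x x') :
    ∃ v : Γ, ∑ B ∈ cs, I01 (avw D l B ∧ (g B x)⁻¹ * g B x' ≠ v) ≤ δ / 8 * cs.card := by
  obtain ⟨N, hN⟩ : ∃ N : ℝ, N = (cs.card : ℝ) := ⟨_, rfl⟩
  have hN0 : 0 < N := by rw [hN]; exact_mod_cast hne.card_pos
  have hm0 : 0 < δ * N := mul_pos hδ hN0
  obtain ⟨u, hu⟩ : ∃ u : Finset ℕ → Γ, u = fun B => (g B x)⁻¹ * g B x' := ⟨_, rfl⟩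
  obtain ⟨y, hy⟩ : ∃ y : Finset ℕ → Finset ℕ → ℝ, y = fun B B' => dfi fh g B B' x + dfi fh g B B' x' := ⟨_, rfl⟩
  have y0 : ∀ B B', 0 ≤ y B B' := fun B B' => by
    rw [hy]; exact add_nonneg (dfi_nonneg _ _ _ _ _) (dfi_nonneg _ _ _ _ _)
  have key : ∀ B ∈ cs, ∀ B' ∈ cs, avw D l B → avw D l B' → Disjoint B B' → u B ≠ u B' → 1 ≤ y B B' := by
    intro B hB B' hB' a1 a2 hd hne
    by_contra hlt
    push Not at hlt
    rw [hy] at hlt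
    simp only at hlt
    have e1 := dfi_lt (lt_of_le_of_lt (le_add_of_nonneg_right (dfi_nonneg fh g B B' x')) hlt) hd
    have e2 := dfi_lt (lt_of_le_of_lt (le_add_of_nonneg_left (dfi_nonneg fh g B B' x)) hlt) hd
    have e3 := hfh B hB B' hB' x x' (agr_union (wd_agr hw a1) (wd_agr hw a2))
    apply hne
    rw [hu]
    rw [e1, e2] at e3
    simp only
    have : g B x' = g B x * (g B' x)⁻¹ * g B' x' := by rw [e3]; group
    rw [this]; group
  have tot : ∑ B ∈ cs, ∑ B' ∈ cs, y B B' ≤ δ ^ 3 / 16 * N ^ 2 := by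
    have : ∑ B ∈ cs, ∑ B' ∈ cs, y B B' = (∑ B ∈ cs, ∑ B' ∈ cs, dfi fh g B B' x) + ∑ B ∈ cs, ∑ B' ∈ cs, dfi fh g B B' x' := by
      rw [hy]; simp only [Finset.sum_add_distrib]
    rw [this]
    unfold gd1 at hx hx'
    rw [← hN] at hx hx'
    linarith
  have h0 := av0 hav hne hl hl
  rw [← hN] at h0
  obtain ⟨B0, hB0, ⟨ha0, _⟩, hbest⟩ := bestl cs _ h0 hm0 (fun B0 => ∑ B ∈ cs, I01 (avw D l B0 ∧ avw D l B ∧ u B ≠ u B0))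
    (fun B0 _ => Finset.sum_nonneg fun _ _ => I01_nonneg _)
  refine ⟨u B0, ?_⟩
  have c1 : ∑ B ∈ cs, I01 (avw D l B ∧ (g B x)⁻¹ * g B x' ≠ u B0) = ∑ B ∈ cs, I01 (avw D l B0 ∧ avw D l B ∧ u B ≠ u B0) := by
    apply Finset.sum_congr rfl; intro B _
    apply I01_congr
    rw [hu]; tauto
  rw [c1, ← hN]
  have c2 : δ * N * ∑ B0 ∈ cs, ∑ B ∈ cs, I01 (avw D l B0 ∧ avw D l B ∧ u B ≠ u B0) ≤
      ∑ B0 ∈ cs, ∑ B ∈ cs, ∑ B'' ∈ cs, (y B B'' + y B0 B'') := by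
    rw [Finset.mul_sum]
    apply Finset.sum_le_sum; intro B0 hB0
    rw [Finset.mul_sum]
    apply Finset.sum_le_sum; intro B hB
    have h2 := av2 hav hl hB0 hB
    rw [← hN] at h2
    apply avl cs _ h2 (I01_nonneg _)
    · rintro e he ⟨q1, q2, q3⟩
      by_cases hp : avw D l B0 ∧ avw D l B ∧ u B ≠ u B0
      swap
      · rw [I01_neg hp]; exact add_nonneg (y0 _ _) (y0 _ _)
      rw [I01_pos hp]
      by_cases hq : u B = u e
      · have := key B0 hB0 e he hp.1 q1 q2 (fun h => hp.2.2 (hq.trans h.symm))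
        linarith [y0 B e]
      · have := key B hB e he hp.2.1 q1 q3 hq
        linarith [y0 B0 e]
    · intro e _; exact add_nonneg (y0 _ _) (y0 _ _)
  have c3 : ∑ B0 ∈ cs, ∑ B ∈ cs, ∑ B'' ∈ cs, (y B B'' + y B0 B'') = 2 * N * ∑ B ∈ cs, ∑ B' ∈ cs, y B B' := by
    simp only [Finset.sum_add_distrib, Finset.sum_const, nsmul_eq_mul, ← Finset.mul_sum, ← hN]
    ring
  rw [c3] at c2
  obtain ⟨z, hz⟩ : ∃ z : ℝ, z = ∑ B ∈ cs, I01 (avw D l B0 ∧ avw D l B ∧ u B ≠ u B0) := ⟨_, rfl⟩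
  rw [← hz] at hbest ⊢
  have c4 : δ * N * (δ * N * z) ≤ 2 * N * (δ ^ 3 / 16 * N ^ 2) :=
    (mul_le_mul_of_nonneg_left hbest hm0.le).trans (c2.trans (mul_le_mul_of_nonneg_left tot (by positivity)))
  have c5 : (δ * N) ^ 2 * z ≤ (δ * N) ^ 2 * (δ / 8 * N) := by nlinarith
  exact le_of_mul_le_mul_left c5 (by positivity)

/-- Compatible holonomy. -/
def HolC (cs : Finset (Finset ℕ)) (D : ℕ → Set ℕ) (M : ℕ) (δ : ℝ) (fh : Finset ℕ → Finset ℕ → Ω → Γ) (g : Finset ℕ → Ω → Γ)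
    (H : ℕ → Ω → Ω → Γ) : Prop :=
  ∀ l < M, ∀ x x' : Ω, gd1 cs δ fh g x → gd1 cs δ fh g x' → Wd D l x x' →
    ∑ B ∈ cs, I01 (avw D l B ∧ (g B x)⁻¹ * g B x' ≠ H l x x') ≤ δ / 8 * cs.card

theorem hol_ex (hδ : 0 < δ) (hne : cs.Nonempty) (hav : AvH D M cs δ)
    (hfh : ∀ B ∈ cs, ∀ B' ∈ cs, Meas ((B : Set ℕ) ∪ B') (fh B B')) : ∃ H, HolC cs D M δ fh g H := by
  have : ∀ (l : ℕ) (x x' : Ω), ∃ v : Γ, l < M → gd1 cs δ fh g x → gd1 cs δ fh g x' → Wd D l x x' →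
    ∑ B ∈ cs, I01 (avw D l B ∧ (g B x)⁻¹ * g B x' ≠ v) ≤ δ / 8 * cs.card := by
    intro l x x'
    by_cases h : l < M ∧ gd1 cs δ fh g x ∧ gd1 cs δ fh g x' ∧ Wd D l x x'
    · obtain ⟨v, hv⟩ := comp_ex hδ hne hav hfh h.1 h.2.1 h.2.2.1 h.2.2.2
      exact ⟨v, fun _ _ _ _ => hv⟩
    · exact ⟨1, fun a b c d => absurd ⟨a, b, c, d⟩ h⟩
  choose H hH using this
  exact ⟨H, fun l hl x x' a b c => hH l x x' hl a b c⟩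

variable {H : ℕ → Ω → Ω → Γ}

theorem hol_tri (hδ : 0 < δ) (hne : cs.Nonempty) (hav : AvH D M cs δ) (hH : HolC cs D M δ fh g H)
    {l : ℕ} (hl : l < M) {x x' x'' : Ω}
    (hx : gd1 cs δ fh g x) (hx' : gd1 cs δ fh g x') (hx'' : gd1 cs δ fh g x'') (h1 : Wd D l x x') (h2 : Wd D l x' x'') :
    H l x x' * H l x' x'' = H l x x'' := by
  have hm0 : 0 < δ * (cs.card : ℝ) := mul_pos hδ (by exact_mod_cast hne.card_pos)
  have e1 := hH l hl x x' hx hx' h1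
  have e2 := hH l hl x' x'' hx' hx'' h2
  have e3 := hH l hl x x'' hx hx'' (h1.trans h2)
  obtain ⟨B, hB, ⟨a, _⟩, hlt⟩ := pickl cs _ (av0 hav hne hl hl) (fun B => I01 (avw D l B ∧ (g B x)⁻¹ * g B x' ≠ H l x x') +
    I01 (avw D l B ∧ (g B x')⁻¹ * g B x'' ≠ H l x' x'') + I01 (avw D l B ∧ (g B x)⁻¹ * g B x'' ≠ H l x x''))
    (fun e _ => by
      have z1 := I01_nonneg (avw D l e ∧ (g e x)⁻¹ * g e x' ≠ H l x x')
      have z2 := I01_nonneg (avw D l e ∧ (g e x')⁻¹ * g e x'' ≠ H l x' x'')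
      have z3 := I01_nonneg (avw D l e ∧ (g e x)⁻¹ * g e x'' ≠ H l x x'')
      linarith)
    (by simp only [Finset.sum_add_distrib]; linarith)
  have z1 := I01_nonneg (avw D l B ∧ (g B x)⁻¹ * g B x' ≠ H l x x')
  have z2 := I01_nonneg (avw D l B ∧ (g B x')⁻¹ * g B x'' ≠ H l x' x'')
  have z3 := I01_nonneg (avw D l B ∧ (g B x)⁻¹ * g B x'' ≠ H l x x'')
  have w1 := I01_lt (p := avw D l B ∧ (g B x)⁻¹ * g B x' ≠ H l x x') (by linarith)
  have w2 := I01_lt (p := avw D l B ∧ (g B x')⁻¹ * g B x'' ≠ H l x' x'') (by linarith)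
  have w3 := I01_lt (p := avw D l B ∧ (g B x)⁻¹ * g B x'' ≠ H l x x'') (by linarith)
  push Not at w1 w2 w3
  rw [← w1 a, ← w2 a, ← w3 a]; group

theorem hol_sq (hδ : 0 < δ) (hne : cs.Nonempty) (hav : AvH D M cs δ) (hH : HolC cs D M δ fh g H)
    {i j : ℕ} (hi : i < M) (hj : j < M) {x x' y y' : Ω}
    (hx : gd1 cs δ fh g x) (hx' : gd1 cs δ fh g x') (hy : gd1 cs δ fh g y) (hy' : gd1 cs δ fh g y')
    (h1 : Wd D i x y) (h2 : Wd D i x' y') (h3 : Wd D j x x') (h4 : Wd D j y y') :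
    H i x y * H j y y' = H j x x' * H i x' y' := by
  have hm0 : 0 < δ * (cs.card : ℝ) := mul_pos hδ (by exact_mod_cast hne.card_pos)
  have e1 := hH i hi x y hx hy h1
  have e2 := hH i hi x' y' hx' hy' h2
  have e3 := hH j hj x x' hx hx' h3
  have e4 := hH j hj y y' hy hy' h4
  obtain ⟨B, hB, ⟨a, b⟩, hlt⟩ := pickl cs _ (av0 hav hne hi hj) (fun B => I01 (avw D i B ∧ (g B x)⁻¹ * g B y ≠ H i x y) +
    I01 (avw D i B ∧ (g B x')⁻¹ * g B y' ≠ H i x' y') + I01 (avw D j B ∧ (g B x)⁻¹ * g B x' ≠ H j x x')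
     + I01 (avw D j B ∧ (g B y)⁻¹ * g B y' ≠ H j y y'))
    (fun e _ => by
      have z1 := I01_nonneg (avw D i e ∧ (g e x)⁻¹ * g e y ≠ H i x y)
      have z2 := I01_nonneg (avw D i e ∧ (g e x')⁻¹ * g e y' ≠ H i x' y')
      have z3 := I01_nonneg (avw D j e ∧ (g e x)⁻¹ * g e x' ≠ H j x x')
      have z4 := I01_nonneg (avw D j e ∧ (g e y)⁻¹ * g e y' ≠ H j y y')
      linarith)
    (by simp only [Finset.sum_add_distrib]; linarith)
  have z1 := I01_nonneg (avw D i B ∧ (g B x)⁻¹ * g B y ≠ H i x y)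
  have z2 := I01_nonneg (avw D i B ∧ (g B x')⁻¹ * g B y' ≠ H i x' y')
  have z3 := I01_nonneg (avw D j B ∧ (g B x)⁻¹ * g B x' ≠ H j x x')
  have z4 := I01_nonneg (avw D j B ∧ (g B y)⁻¹ * g B y' ≠ H j y y')
  have w1 := I01_lt (p := avw D i B ∧ (g B x)⁻¹ * g B y ≠ H i x y) (by linarith)
  have w2 := I01_lt (p := avw D i B ∧ (g B x')⁻¹ * g B y' ≠ H i x' y') (by linarith)
  have w3 := I01_lt (p := avw D j B ∧ (g B x)⁻¹ * g B x' ≠ H j x x') (by linarith)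
  have w4 := I01_lt (p := avw D j B ∧ (g B y)⁻¹ * g B y' ≠ H j y y') (by linarith)
  push Not at w1 w2 w3 w4
  rw [← w1 a, ← w2 a, ← w3 b, ← w4 b]; group

theorem hol_fill (hδ : 0 < δ) (hne : cs.Nonempty) (hav : AvH D M cs δ) (hH : HolC cs D M δ fh g H)
    (hfh : ∀ B ∈ cs, ∀ B' ∈ cs, Meas ((B : Set ℕ) ∪ B') (fh B B'))
    {l : ℕ} (hl : l < M) {x x' : Ω}
    (hx : gd1 cs δ fh g x) (hx' : gd1 cs δ fh g x') (h1 : Wd D l x x')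
    {B : Finset ℕ} (hB : B ∈ cs) (hb : gd2 cs δ fh g B x) (hb' : gd2 cs δ fh g B x') (hag : Agr (B : Set ℕ) x x') :
    g B x * H l x x' = g B x' := by
  have hm0 : 0 < δ * (cs.card : ℝ) := mul_pos hδ (by exact_mod_cast hne.card_pos)
  have e1 := hH l hl x x' hx hx' h1
  obtain ⟨B', hB', ⟨a, d1, _⟩, hlt⟩ := pickl cs _ (av2 hav hl hB hB) (fun B' => I01 (avw D l B' ∧ (g B' x)⁻¹ * g B' x' ≠ H l x x') +
    dfi fh g B B' x + dfi fh g B B' x')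
    (fun e _ => by
      have z1 := I01_nonneg (avw D l e ∧ (g e x)⁻¹ * g e x' ≠ H l x x')
      linarith [dfi_nonneg fh g B e x, dfi_nonneg fh g B e x'])
    (by simp only [Finset.sum_add_distrib]; unfold gd2 at hb hb'; linarith)
  have z1 := I01_nonneg (avw D l B' ∧ (g B' x)⁻¹ * g B' x' ≠ H l x x')
  have z2 := dfi_nonneg fh g B B' x
  have z3 := dfi_nonneg fh g B B' x'
  have w1 := I01_lt (p := avw D l B' ∧ (g B' x)⁻¹ * g B' x' ≠ H l x x') (by linarith)
  push Not at w1
  have w2 := dfi_lt (fh := fh) (g := g) (B := B) (B' := B') (T := x) (by linarith) d1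
  have w3 := dfi_lt (fh := fh) (g := g) (B := B) (B' := B') (T := x') (by linarith) d1
  have w4 := hfh B hB B' hB' x x' (agr_union hag (wd_agr h1 a))
  rw [← w1 a]
  rw [w2, w3] at w4
  rw [← mul_assoc, w4]; group

end holon


section mixing
variable {F V : Type} [Field F] [Finite F] [AddCommGroup V] [Module F V] [FiniteDimensional F V]

noncomputable def mx (t : ℕ → ℕ) (j : ℕ) (T T' : Flg F V) : Flg F V :=
  if h : T'.f (t j) = T.f (t j) then hyb T' T (t j) h else T

structure Cut (t : ℕ → ℕ) (M : ℕ) (A : Set ℕ) (n : ℕ) : Prop where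
  mono : Monotone t
  zero : t 0 = 0
  top : n ≤ t M
  mem : ∀ j, 0 < j → j < M → t j ∈ A

def Dn (t : ℕ → ℕ) (l : ℕ) : Set ℕ := {c | t l < c ∧ c < t (l + 1)}

variable {t : ℕ → ℕ} {M : ℕ} {A : Set ℕ}

theorem cut_eq (hc : Cut t M A (Module.finrank F V)) {T T' : Flg F V} (h : Agr A T T') {j : ℕ} (hj : j ≤ M) :
    T'.f (t j) = T.f (t j) := by
  rcases Nat.eq_zero_or_pos j with rfl | h0
  · rw [hc.zero, T'.zero, T.zero]
  rcases hj.eq_or_lt with rfl | h1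
  · rw [T'.top hc.top, T.top hc.top]
  · exact (h _ (hc.mem j h0 h1)).symm

theorem mx_lo (hc : Cut t M A (Module.finrank F V)) {T T' : Flg F V} (h : Agr A T T') {j : ℕ} (hj : j ≤ M)
    {i : ℕ} (hi : i ≤ t j) : (mx t j T T').f i = T'.f i := by
  unfold mx; rw [dif_pos (cut_eq hc h hj)]; exact hyb_le _ hi

theorem mx_hi (hc : Cut t M A (Module.finrank F V)) {T T' : Flg F V} (h : Agr A T T') {j : ℕ} (hj : j ≤ M)
    {i : ℕ} (hi : t j ≤ i) : (mx t j T T').f i = T.f i := by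
  unfold mx; rw [dif_pos (cut_eq hc h hj)]; exact hyb_ge _ hi

theorem mx_agr {C : Set ℕ} {T T' : Flg F V} (h : Agr C T T') (j : ℕ) : Agr C T (mx t j T T') := by
  intro c hcC
  unfold mx
  show T.f c = _
  split_ifs with hh
  · rcases le_total c (t j) with h1 | h1
    · exact (h c hcC).trans (hyb_le hh h1).symm
    · exact (hyb_ge hh h1).symm
  · rfl

theorem mx_zero (hc : Cut t M A (Module.finrank F V)) {T T' : Flg F V} (h : Agr A T T') : mx t 0 T T' = T := by
  apply Flg.ext'; intro i
  exact mx_hi hc h (Nat.zero_le _) (by rw [hc.zero]; exact Nat.zero_le _)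

theorem mx_top (hc : Cut t M A (Module.finrank F V)) {T T' : Flg F V} (h : Agr A T T') : mx t M T T' = T' := by
  apply Flg.ext'; intro i
  rcases le_total i (t M) with h1 | h1
  · exact mx_lo hc h le_rfl h1
  · rw [mx_hi hc h le_rfl h1, T.top (hc.top.trans h1), T'.top (hc.top.trans h1)]

theorem mx_mx (hc : Cut t M A (Module.finrank F V)) {T T' : Flg F V} (h : Agr A T T') {j : ℕ} (hj : j ≤ M) :
    mx t j (mx t j T T') (mx t j T' T) = T := by
  have h1 : Agr A (mx t j T T') (mx t j T' T) := ((mx_agr h j).symm.trans h).trans (mx_agr h.symm j)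
  apply Flg.ext'; intro i
  rcases le_total i (t j) with hi | hi
  · rw [mx_lo hc h1 hj hi, mx_lo hc h.symm hj hi]
  · rw [mx_hi hc h1 hj hi, mx_hi hc h hj hi]

theorem mx_succ (hc : Cut t M A (Module.finrank F V)) {T T' : Flg F V} (h : Agr A T T') {j : ℕ} (hj : j < M) :
    Wd (Dn t) j (mx t (j + 1) T T') (mx t j T T') := by
  intro i hi
  show (mx t (j + 1) T T').f i = (mx t j T T').f i
  have hi' : ¬ (t j < i ∧ i < t (j + 1)) := hi
  have hm := hc.mono (Nat.le_succ j)
  rcases le_or_gt i (t j) with h1 | h1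
  · rw [mx_lo hc h hj.le h1, mx_lo hc h hj (h1.trans hm)]
  · have h2 : t (j + 1) ≤ i := by omega
    rw [mx_hi hc h hj.le h1.le, mx_hi hc h hj h2]

theorem mx_wd (hc : Cut t M A (Module.finrank F V)) {U x x' : Flg F V} (h : Agr A U x) (h' : Agr A U x') {l : ℕ}
    (hw : Wd (Dn t) l x x') {n : ℕ} (hn : n ≤ M) : Wd (Dn t) l (mx t n U x) (mx t n U x') := by
  intro i hi
  show (mx t n U x).f i = (mx t n U x').f i
  rcases le_total i (t n) with h1 | h1
  · rw [mx_lo hc h hn h1, mx_lo hc h' hn h1]; exact hw i hi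
  · rw [mx_hi hc h hn h1, mx_hi hc h' hn h1]

theorem mx_wd_eq (hc : Cut t M A (Module.finrank F V)) {U x x' : Flg F V} (h : Agr A U x) (h' : Agr A U x') {l : ℕ}
    (hw : Wd (Dn t) l x x') {n : ℕ} (hn : n ≤ M) (hnl : n ≤ l) : mx t n U x = mx t n U x' := by
  apply Flg.ext'; intro i
  rcases le_total i (t n) with h1 | h1
  · rw [mx_lo hc h hn h1, mx_lo hc h' hn h1]
    apply hw i
    intro hi
    have := hc.mono hnl
    have : t l < i := hi.1
    omega
  · rw [mx_hi hc h hn h1, mx_hi hc h' hn h1]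

variable {Γ : Type} [Group Γ]

noncomputable def cc (t : ℕ → ℕ) (H : ℕ → Flg F V → Flg F V → Γ) (U x : Flg F V) : ℕ → Γ
  | 0 => 1
  | n + 1 => H n (mx t (n + 1) U x) (mx t n U x) * cc t H U x n

variable {cs : Finset (Finset ℕ)} {δ : ℝ} {fh : Finset ℕ → Finset ℕ → Flg F V → Γ}
  {g : Finset ℕ → Flg F V → Γ} {H : ℕ → Flg F V → Flg F V → Γ}

theorem cc_eq (hc : Cut t M A (Module.finrank F V)) {U x x' : Flg F V} (h : Agr A U x) (h' : Agr A U x') {l : ℕ}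
    (hw : Wd (Dn t) l x x') {n : ℕ} (hn : n ≤ M) (hnl : n ≤ l) : cc t H U x n = cc t H U x' n := by
  induction n with
  | zero => rfl
  | succ n ih =>
    rw [cc, cc, ih (by omega) (by omega), mx_wd_eq hc h h' hw hn hnl, mx_wd_eq hc h h' hw (n := n) (by omega) (by omega)]

theorem cc_hol (hδ : 0 < δ) (hne : cs.Nonempty) (hav : AvH (Dn t) M cs δ) (hH : HolC cs (Dn t) M δ fh g H)
    (hc : Cut t M A (Module.finrank F V)) {U x x' : Flg F V} (h : Agr A U x) (h' : Agr A U x') {l : ℕ} (hl : l < M)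
    (hw : Wd (Dn t) l x x') (g1 : ∀ i ≤ M, gd1 cs δ fh g (mx t i U x)) (g2 : ∀ i ≤ M, gd1 cs δ fh g (mx t i U x'))
    {n : ℕ} (hnl : l + 1 ≤ n) (hn : n ≤ M) :
    H l (mx t n U x) (mx t n U x') * cc t H U x' n = cc t H U x n := by
  induction n, hnl using Nat.le_induction with
  | base =>
    rw [cc, cc, cc_eq hc h h' hw hl.le le_rfl, ← mx_wd_eq hc h h' hw hl.le le_rfl, ← mul_assoc,
      hol_tri hδ hne hav hH hl (g1 _ hn) (g2 _ hn) (g1 _ hl.le) (mx_wd hc h h' hw hn)]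
    rw [mx_wd_eq hc h h' hw hl.le le_rfl]
    exact mx_succ hc h' hl
  | succ n hnl ih =>
    have hn' : n < M := hn
    rw [cc, cc, ← ih hn'.le, ← mul_assoc, ← mul_assoc]
    congr 1
    exact hol_sq hδ hne hav hH hl hn' (g1 _ hn) (g1 _ hn'.le) (g2 _ hn) (g2 _ hn'.le) (mx_wd hc h h' hw hn)
      (mx_wd hc h h' hw hn'.le) (mx_succ hc h hn') (mx_succ hc h' hn')

noncomputable def Th (t : ℕ → ℕ) (M : ℕ) (H : ℕ → Flg F V → Flg F V → Γ) (g : Finset ℕ → Flg F V → Γ) (U : Flg F V)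
    (B : Finset ℕ) (T : Flg F V) : Γ := g B T * cc t H U T M

theorem Th_step (hδ : 0 < δ) (hne : cs.Nonempty) (hav : AvH (Dn t) M cs δ) (hH : HolC cs (Dn t) M δ fh g H)
    (hfh : ∀ B ∈ cs, ∀ B' ∈ cs, Meas ((B : Set ℕ) ∪ B') (fh B B'))
    (hc : Cut t M A (Module.finrank F V)) {U x x' : Flg F V} (h : Agr A U x) (h' : Agr A U x') {l : ℕ} (hl : l < M)
    (hw : Wd (Dn t) l x x') (g1 : ∀ i ≤ M, gd1 cs δ fh g (mx t i U x)) (g2 : ∀ i ≤ M, gd1 cs δ fh g (mx t i U x'))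
    {B : Finset ℕ} (hB : B ∈ cs) (hb : gd2 cs δ fh g B x) (hb' : gd2 cs δ fh g B x') (hag : Agr (B : Set ℕ) x x') :
    Th t M H g U B x = Th t M H g U B x' := by
  have e := cc_hol hδ hne hav hH hc h h' hl hw g1 g2 (n := M) hl le_rfl
  rw [mx_top hc h, mx_top hc h'] at e
  have a1 := g1 M le_rfl
  have a2 := g2 M le_rfl
  rw [mx_top hc h] at a1
  rw [mx_top hc h'] at a2
  unfold Th
  rw [← e, ← mul_assoc, hol_fill hδ hne hav hH hfh hl a1 a2 hw hB hb hb' hag]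

noncomputable def b1 (cs : Finset (Finset ℕ)) (δ : ℝ) (fh : Finset ℕ → Finset ℕ → Flg F V → Γ)
    (g : Finset ℕ → Flg F V → Γ) (T : Flg F V) : ℝ := I01 (¬ gd1 cs δ fh g T)
noncomputable def b2 (cs : Finset (Finset ℕ)) (δ : ℝ) (fh : Finset ℕ → Finset ℕ → Flg F V → Γ)
    (g : Finset ℕ → Flg F V → Γ) (B : Finset ℕ) (T : Flg F V) : ℝ := I01 (¬ gd2 cs δ fh g B T)

theorem Th_pt (hδ : 0 < δ) (hne : cs.Nonempty) (hav : AvH (Dn t) M cs δ) (hH : HolC cs (Dn t) M δ fh g H)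
    (hfh : ∀ B ∈ cs, ∀ B' ∈ cs, Meas ((B : Set ℕ) ∪ B') (fh B B'))
    (hc : Cut t M A (Module.finrank F V)) {U x x' : Flg F V} (h : Agr A U x)
    {B : Finset ℕ} (hB : B ∈ cs) (hag : Agr (A ∪ (B : Set ℕ)) x x') :
    I01 (Th t M H g U B x ≠ Th t M H g U B x') ≤ ∑ j ∈ range (M + 1), b2 cs δ fh g B (mx t j x x') +
      ∑ j ∈ range (M + 1), ∑ i ∈ range (M + 1), b1 cs δ fh g (mx t i U (mx t j x x')) := by
  have hA : Agr A x x' := hag.mono Set.subset_union_left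
  have n2 : ∀ j ∈ range (M + 1), 0 ≤ b2 cs δ fh g B (mx t j x x') := fun j _ => I01_nonneg _
  have n1 : ∀ j, ∀ i ∈ range (M + 1), 0 ≤ b1 cs δ fh g (mx t i U (mx t j x x')) := fun j i _ => I01_nonneg _
  have n1' : ∀ j ∈ range (M + 1), 0 ≤ ∑ i ∈ range (M + 1), b1 cs δ fh g (mx t i U (mx t j x x')) :=
    fun j _ => Finset.sum_nonneg (n1 j)
  by_cases k2 : ∃ j ≤ M, ¬ gd2 cs δ fh g B (mx t j x x')
  · obtain ⟨j, hj, hh⟩ := k2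
    have := Finset.single_le_sum n2 (mem_range.2 (Nat.lt_succ_of_le hj))
    rw [b2, I01_pos hh] at this
    have := Finset.sum_nonneg n1'
    have := I01_le (Th t M H g U B x ≠ Th t M H g U B x')
    linarith
  by_cases k1 : ∃ j ≤ M, ∃ i ≤ M, ¬ gd1 cs δ fh g (mx t i U (mx t j x x'))
  · obtain ⟨j, hj, i, hi, hh⟩ := k1
    have e1 := Finset.single_le_sum (n1 j) (mem_range.2 (Nat.lt_succ_of_le hi))
    have e2 := Finset.single_le_sum n1' (mem_range.2 (Nat.lt_succ_of_le hj))
    rw [b1, I01_pos hh] at e1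
    have := Finset.sum_nonneg n2
    have := I01_le (Th t M H g U B x ≠ Th t M H g U B x')
    linarith
  push Not at k1 k2
  have main : ∀ j ≤ M, Th t M H g U B (mx t j x x') = Th t M H g U B x := by
    intro j
    induction j with
    | zero => intro _; rw [mx_zero hc hA]
    | succ j ih =>
      intro hj
      have hj' : j < M := hj
      rw [← ih hj'.le]
      have r1 := mx_agr (t := t) hag (j + 1)
      have r2 := mx_agr (t := t) hag j
      have q1 := r1.mono (D := A ∪ (B : Set ℕ)) (C := A) Set.subset_union_left
      have q2 := r2.mono (D := A ∪ (B : Set ℕ)) (C := A) Set.subset_union_left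
      exact Th_step hδ hne hav hH hfh hc (h.trans q1) (h.trans q2) hj' (mx_succ hc hA hj') (fun i hi => k1 _ hj i hi)
        (fun i hi => k1 _ hj'.le i hi) hB (k2 _ hj) (k2 _ hj'.le)
        ((r1.symm.trans r2).mono Set.subset_union_right)
  have := main M le_rfl
  rw [mx_top hc hA] at this
  rw [I01_neg (by rw [this]; simp)]
  exact add_nonneg (Finset.sum_nonneg n2) (Finset.sum_nonneg n1')

end mixing


section genpair
variable {Ω α : Type} [Fintype Ω] [Crd Ω α]

theorem sum_pairs (C : Set ℕ) (Y : Ω → Ω → ℝ) :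
    ∑ T, ce C (fun U => Y T U) T = ∑ p ∈ (univ : Finset (Ω × Ω)).filter (fun p => Agr C p.1 p.2), Y p.1 p.2 / ((fib C p.1).card : ℝ) := by
  rw [Finset.sum_filter, Fintype.sum_prod_type]
  apply Finset.sum_congr rfl; intro T _
  unfold ce
  rw [Finset.sum_div, ← Finset.sum_filter]
  rfl

theorem sum_pair_comm (C : Set ℕ) (Y : Ω → Ω → ℝ) :
    ∑ T, ce C (fun U => Y T U) T = ∑ T, ce C (fun U => Y U T) T := by
  rw [sum_pairs, sum_pairs]
  refine Finset.sum_bij' (fun p _ => (p.2, p.1)) (fun p _ => (p.2, p.1)) ?_ ?_ ?_ ?_ ?_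
  · intro p hp; rw [mem_filter] at hp ⊢; exact ⟨mem_univ _, hp.2.symm⟩
  · intro p hp; rw [mem_filter] at hp ⊢; exact ⟨mem_univ _, hp.2.symm⟩
  · intro p hp; rfl
  · intro p hp; rfl
  · intro p hp; rw [mem_filter] at hp; simp only; rw [fib_eq hp.2]

theorem sel_ex (A : Set ℕ) (L : Ω → Ω → ℝ) : ∃ s : Ω → Ω, Meas A s ∧ (∀ T, Agr A T (s T)) ∧
    ∑ T, L (s T) T ≤ ∑ T, ce A (fun U => L U T) T := by
  by_cases hn : Nonempty Ω
  swap
  · exact ⟨id, fun T => absurd ⟨T⟩ hn, fun T => absurd ⟨T⟩ hn, by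
      have : IsEmpty Ω := not_nonempty_iff.1 hn
      simp⟩
  have h0 : ∀ T : Ω, ∃ U, Agr A T U ∧ ce A (fun T' => L U T') T ≤ ce A (fun U => ce A (fun T' => L U T') T) T :=
    fun T => ce_exists_le A (fun U => ce A (fun T' => L U T') T) T
  choose s0 h1 h2 using h0
  have hr : ∀ S : Finset Ω, ∃ x : Ω, S.Nonempty → x ∈ S := fun S => by
    by_cases h : S.Nonempty
    · exact ⟨h.choose, fun _ => h.choose_spec⟩
    · exact ⟨hn.some, fun h' => absurd h' h⟩
  choose rep hrep using hr
  have hra : ∀ T : Ω, Agr A T (rep (fib A T)) := fun T => mem_fib.1 (hrep _ ⟨T, self_mem_fib A T⟩)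
  have hm : Meas A (fun T : Ω => s0 (rep (fib A T))) := (meas_fib A).comp (fun S => s0 (rep S))
  refine ⟨fun T => s0 (rep (fib A T)), hm, fun T => (hra T).trans (h1 _), ?_⟩
  rw [← sum_ce A]
  calc ∑ T, ce A (fun T' => L (s0 (rep (fib A T'))) T') T = ∑ T, ce A (fun T' => L (s0 (rep (fib A T))) T') T := by
        apply Finset.sum_congr rfl; intro T _
        apply ce_congr; intro U hU
        rw [fib_eq hU]
    _ ≤ ∑ T, ce A (fun U => ce A (fun T' => L U T') T) T := by
        apply Finset.sum_le_sum; intro T _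
        have := h2 (rep (fib A T))
        have e1 : ∀ U, ce A (fun T' => L U T') (rep (fib A T)) = ce A (fun T' => L U T') T :=
          fun U => (ce_meas A _ _ _ (hra T)).symm
        simp only [e1] at this
        rwa [← ce_meas A (fun U => ce A (fun T' => L U T') T) T _ (hra T)] at this
    _ = ∑ T, ce A (fun U => ce A (fun T' => L U T') U) T := by
        apply Finset.sum_congr rfl; intro T _
        apply ce_congr; intro U hU
        exact ce_meas A _ _ _ hU
    _ = ∑ U, ce A (fun T' => L U T') U := sum_ce A _
    _ = _ := sum_pair_comm A L

theorem dis_pair {γ : Type*} (C : Set ℕ) (φ : Ω → γ) :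
    dis C φ = ∑ T, ce C (fun U => I01 (φ T ≠ φ U)) T := by
  rw [dis_eq]
  apply Finset.sum_congr rfl; intro T _
  rw [← ce_const C 1 T, ← ce_sub]
  apply ce_congr; intro U _
  simp only [ind, I01]
  by_cases h : φ T = φ U
  · simp [h]
  · simp [h, Ne.symm h]
end genpair

section swap
variable {F V : Type} [Field F] [Finite F] [AddCommGroup V] [Module F V] [FiniteDimensional F V]
variable {t : ℕ → ℕ} {M : ℕ} {A : Set ℕ}

theorem swap_sum (hc : Cut t M A (Module.finrank F V)) {C : Set ℕ} (hAC : A ⊆ C) {j : ℕ} (hj : j ≤ M) (Z : Flg F V → ℝ) :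
    ∑ T, ce C (fun U => Z (mx t j T U)) T = ∑ T, Z T := by
  rw [← sum_ce C Z]
  have e : ∑ T, ce C Z T = ∑ T, ce C (fun U => Z T) T := by
    rw [sum_ce]; simp only [ce_const]
  rw [e, sum_pairs, sum_pairs]
  refine Finset.sum_bij' (fun p _ => (mx t j p.1 p.2, mx t j p.2 p.1)) (fun p _ => (mx t j p.1 p.2, mx t j p.2 p.1)) ?_ ?_ ?_ ?_ ?_
  · intro p hp; rw [mem_filter] at hp ⊢
    exact ⟨mem_univ _, ((mx_agr hp.2 j).symm.trans hp.2).trans (mx_agr hp.2.symm j)⟩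
  · intro p hp; rw [mem_filter] at hp ⊢
    exact ⟨mem_univ _, ((mx_agr hp.2 j).symm.trans hp.2).trans (mx_agr hp.2.symm j)⟩
  · intro p hp; rw [mem_filter] at hp
    have h := hp.2.mono hAC
    exact Prod.ext (mx_mx hc h hj) (mx_mx hc h.symm hj)
  · intro p hp; rw [mem_filter] at hp
    have h := hp.2.mono hAC
    exact Prod.ext (mx_mx hc h hj) (mx_mx hc h.symm hj)
  · intro p hp; rw [mem_filter] at hp
    simp only
    rw [fib_eq (mx_agr (t := t) hp.2 j)]

theorem swap_loc (hc : Cut t M A (Module.finrank F V)) {C : Set ℕ} (hAC : A ⊆ C) {j : ℕ} (hj : j ≤ M) (Z : Flg F V → ℝ)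
    (U : Flg F V) : ce A (fun T => ce C (fun T' => Z (mx t j T T')) T) U = ce A Z U := by
  unfold ce
  congr 1
  have h := swap_sum hc hAC hj (fun T => if Agr A U T then Z T else 0)
  unfold fib
  rw [Finset.sum_filter, Finset.sum_filter, ← h]
  apply Finset.sum_congr rfl; intro T _
  split_ifs with hT
  · apply ce_congr; intro T' hT'
    rw [if_pos (hT.trans ((mx_agr hT' j).mono hAC))]
  · symm
    refine (ce_congr C T (Y := fun _ => 0) ?_).trans (ce_const C 0 T)
    intro T' hT'
    rw [if_neg]
    intro h2
    exact hT (h2.trans ((mx_agr hT' j).mono hAC).symm)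

variable {Γ : Type} [Group Γ]

theorem D2_eq (cs : Finset (Finset ℕ)) (fh : Finset ℕ → Finset ℕ → Flg F V → Γ) (g : Finset ℕ → Flg F V → Γ) :
    D2 cs fh g = ∑ T, ∑ B ∈ cs, ∑ B' ∈ cs, dfi fh g B B' T := by
  unfold D2
  rw [Finset.sum_comm' (s := univ) (t := fun _ => cs) (t' := cs) (s' := fun _ => univ) (by simp)]
  apply Finset.sum_congr rfl; intro B _
  rw [Finset.sum_comm' (s := univ) (t := fun _ => cs) (t' := cs) (s' := fun _ => univ) (by simp)]
  apply Finset.sum_congr rfl; intro B' _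
  split_ifs with h
  · unfold nd
    apply Finset.sum_congr rfl; intro T _
    simp only [dfi, I01, h, true_and, Pi.mul_apply, Pi.inv_apply]
  · symm
    apply Finset.sum_eq_zero; intro T _
    exact I01_neg fun h' => h h'.1

theorem base_avg {cs : Finset (Finset ℕ)} {δ : ℝ} {fh : Finset ℕ → Finset ℕ → Flg F V → Γ}
    (hδ : 0 < δ) (hδ1 : δ ≤ 1) (hne : cs.Nonempty) (hav : AvH (Dn t) M cs δ)
    (hfh : ∀ B ∈ cs, ∀ B' ∈ cs, Meas ((B : Set ℕ) ∪ B') (fh B B'))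
    (hc : Cut t M A (Module.finrank F V)) (g : Finset ℕ → Flg F V → Γ) :
    ∃ G : Finset ℕ → Flg F V → Γ, (∀ B ∈ cs, Meas (A ∪ (B : Set ℕ)) (G B)) ∧
      D2 cs fh G ≤ 73 * ((M : ℝ) + 1) ^ 2 / δ ^ 3 * D2 cs fh g := by
  obtain ⟨H, hH⟩ := hol_ex (g := g) hδ hne hav hfh
  obtain ⟨N, hN⟩ : ∃ N : ℝ, N = (cs.card : ℝ) := ⟨_, rfl⟩
  have hN0 : 0 < N := by rw [hN]; exact_mod_cast hne.card_pos
  obtain ⟨R, hR⟩ : ∃ R : Finset ℕ, R = range (M + 1) := ⟨_, rfl⟩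
  have hRM : ∀ j ∈ R, j ≤ M := fun j hj => by rw [hR, mem_range] at hj; omega
  have hRc : (R.card : ℝ) = (M : ℝ) + 1 := by rw [hR, card_range]; push_cast; rfl
  obtain ⟨L, hL⟩ : ∃ L : Flg F V → Flg F V → ℝ, L = fun U T => ∑ B ∈ cs, ce (A ∪ (B : Set ℕ)) (fun T' =>
    ∑ j ∈ R, ∑ i ∈ R, b1 cs δ fh g (mx t i U (mx t j T T'))) T := ⟨_, rfl⟩
  obtain ⟨s, hs1, hs2, hs3⟩ := sel_ex A L
  obtain ⟨S1, hS1⟩ : ∃ S1 : ℝ, S1 = ∑ T, b1 cs δ fh g T := ⟨_, rfl⟩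
  obtain ⟨S2, hS2⟩ : ∃ S2 : ℝ, S2 = ∑ B ∈ cs, ∑ T, b2 cs δ fh g B T := ⟨_, rfl⟩
  have hLs : ∑ T, ce A (fun U => L U T) T = N * ((M : ℝ) + 1) ^ 2 * S1 := by
    rw [← sum_pair_comm A L, hL]
    simp only [ce_sum, ← Finset.sum_add_distrib]
    have q : ∀ B ∈ cs, ∀ j ∈ R, ∀ i ∈ R, ∑ U, ce A (fun T => ce (A ∪ (B : Set ℕ)) (fun T' => b1 cs δ fh g (mx t i U (mx t j T T'))) T) U = S1 := by
      intro B hB j hj i hi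
      have : ∀ U : Flg F V, ce A (fun T => ce (A ∪ (B : Set ℕ)) (fun T' => b1 cs δ fh g (mx t i U (mx t j T T'))) T) U =
          ce A (fun T => b1 cs δ fh g (mx t i U T)) U := fun U =>
        swap_loc hc Set.subset_union_left (hRM j hj) (fun T => b1 cs δ fh g (mx t i U T)) U
      simp only [this]
      rw [hS1]
      exact swap_sum hc (subset_refl A) (hRM i hi) _
    rw [Finset.sum_comm]
    rw [Finset.sum_congr rfl (g := fun B => ∑ j ∈ R, ∑ i ∈ R, S1)]
    · simp only [Finset.sum_const, nsmul_eq_mul, hRc, ← hN]; ring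
    · intro B hB
      rw [Finset.sum_comm]
      apply Finset.sum_congr rfl; intro j hj
      rw [Finset.sum_comm]
      apply Finset.sum_congr rfl; intro i hi
      exact q B hB j hj i hi
  have hdis : ∑ B ∈ cs, dis (A ∪ (B : Set ℕ)) (fun T => Th t M H g (s T) B T) ≤
      ((M : ℝ) + 1) * S2 + N * ((M : ℝ) + 1) ^ 2 * S1 := by
    have e1 : ∀ B ∈ cs, dis (A ∪ (B : Set ℕ)) (fun T => Th t M H g (s T) B T) ≤
        ∑ T, ((∑ j ∈ R, ce (A ∪ (B : Set ℕ)) (fun T' => b2 cs δ fh g B (mx t j T T')) T) +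
          ce (A ∪ (B : Set ℕ)) (fun T' => ∑ j ∈ R, ∑ i ∈ R, b1 cs δ fh g (mx t i (s T) (mx t j T T'))) T) := by
      intro B hB
      rw [dis_pair]
      apply Finset.sum_le_sum; intro T _
      rw [← ce_sum, ← ce_add]
      apply ce_mono; intro T' hT'
      have hss : s T' = s T := (hs1 T T' (hT'.mono Set.subset_union_left)).symm
      rw [hss, hR]
      exact Th_pt hδ hne hav hH hfh hc (hs2 T).symm hB hT'
    refine (Finset.sum_le_sum e1).trans ?_
    have e2 : ∀ B ∈ cs, ∑ T, ((∑ j ∈ R, ce (A ∪ (B : Set ℕ)) (fun T' => b2 cs δ fh g B (mx t j T T')) T) +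
          ce (A ∪ (B : Set ℕ)) (fun T' => ∑ j ∈ R, ∑ i ∈ R, b1 cs δ fh g (mx t i (s T) (mx t j T T'))) T) =
          ((M : ℝ) + 1) * ∑ T, b2 cs δ fh g B T + ∑ T, ce (A ∪ (B : Set ℕ)) (fun T' => ∑ j ∈ R, ∑ i ∈ R, b1 cs δ fh g (mx t i (s T) (mx t j T T'))) T := by
      intro B hB
      rw [Finset.sum_add_distrib]
      congr 1
      rw [Finset.sum_comm]
      rw [Finset.sum_congr rfl (fun j hj => swap_sum hc (C := A ∪ (B : Set ℕ)) Set.subset_union_left (hRM j hj) (b2 cs δ fh g B))]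
      rw [Finset.sum_const, nsmul_eq_mul, hRc]
    rw [Finset.sum_congr rfl e2, Finset.sum_add_distrib, ← Finset.mul_sum, ← hS2]
    apply add_le_add_right
    rw [Finset.sum_comm, ← hLs]
    refine le_trans (le_of_eq ?_) hs3
    rw [hL]
  have hsel := fun B : Finset ℕ => exists_sel (A ∪ (B : Set ℕ)) (fun T => Th t M H g (s T) B T)
  choose G hG1 hG2 using hsel
  refine ⟨G, fun B _ => hG1 B, ?_⟩
  have hp := D2_pert cs fh (fun B T => Th t M H g (s T) B T) G
  have hD : D2 cs fh (fun B T => Th t M H g (s T) B T) = D2 cs fh g := by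
    rw [D2_eq, D2_eq]
    apply Finset.sum_congr rfl; intro T _
    apply Finset.sum_congr rfl; intro B _
    apply Finset.sum_congr rfl; intro B' _
    unfold dfi
    apply I01_congr
    have : Th t M H g (s T) B T * (Th t M H g (s T) B' T)⁻¹ = g B T * (g B' T)⁻¹ := by
      unfold Th; group
    rw [this]
  obtain ⟨W, hW⟩ : ∃ W : ℝ, W = D2 cs fh g := ⟨_, rfl⟩
  rw [hD, ← hW, ← hN] at hp
  rw [← hW]
  have hW' : W = ∑ T, ∑ B ∈ cs, ∑ B' ∈ cs, dfi fh g B B' T := by rw [hW, D2_eq]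
  have hW0 : 0 ≤ W := by
    rw [hW']
    exact Finset.sum_nonneg fun _ _ => Finset.sum_nonneg fun _ _ => Finset.sum_nonneg fun _ _ => dfi_nonneg _ _ _ _ _
  have hb1 : δ ^ 3 / 32 * N ^ 2 * S1 ≤ W := by
    rw [hS1, hW', Finset.mul_sum]
    apply Finset.sum_le_sum; intro T _
    unfold b1
    by_cases h : gd1 cs δ fh g T
    · rw [I01_neg (not_not.2 h), mul_zero]
      exact Finset.sum_nonneg fun _ _ => Finset.sum_nonneg fun _ _ => dfi_nonneg _ _ _ _ _
    · rw [I01_pos h, mul_one]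
      unfold gd1 at h
      rw [← hN] at h
      exact (not_le.1 h).le
  have hb2 : δ / 4 * N * S2 ≤ W := by
    rw [hS2, hW', Finset.sum_comm, Finset.mul_sum]
    apply Finset.sum_le_sum; intro T _
    rw [Finset.mul_sum]
    apply Finset.sum_le_sum; intro B _
    unfold b2
    by_cases h : gd2 cs δ fh g B T
    · rw [I01_neg (not_not.2 h), mul_zero]
      exact Finset.sum_nonneg fun _ _ => dfi_nonneg _ _ _ _ _
    · rw [I01_pos h, mul_one]
      unfold gd2 at h
      rw [← hN] at h
      exact (not_le.1 h).le
  have hnd : ∑ B ∈ cs, nd (fun T => Th t M H g (s T) B T) (G B) ≤ ((M : ℝ) + 1) * S2 + N * ((M : ℝ) + 1) ^ 2 * S1 :=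
    (Finset.sum_le_sum fun B _ => hG2 B).trans hdis
  have hm1 : (1 : ℝ) ≤ (M : ℝ) + 1 := by linarith [Nat.cast_nonneg (α := ℝ) M]
  obtain ⟨m, hm⟩ : ∃ m : ℝ, m = (M : ℝ) + 1 := ⟨_, rfl⟩
  rw [← hm] at hm1 hnd ⊢
  have hm2 : m ≤ m ^ 2 := by nlinarith
  have d3 : δ ^ 3 ≤ δ := by
    have := pow_le_pow_of_le_one hδ.le hδ1 (show 1 ≤ 3 by norm_num)
    simpa using this
  have d31 : δ ^ 3 ≤ 1 := pow_le_one₀ hδ.le hδ1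
  have hfin : D2 cs fh G ≤ W + 2 * (N * (m * S2 + N * m ^ 2 * S1)) :=
    hp.trans (by gcongr)
  have hd0 : 0 < δ ^ 3 := by positivity
  have hS20 : 0 ≤ S2 := by rw [hS2]; exact Finset.sum_nonneg fun _ _ => Finset.sum_nonneg fun _ _ => I01_nonneg _
  rw [div_mul_eq_mul_div, le_div_iff₀ hd0]
  have k1 : δ ^ 3 * (N * (N * m ^ 2 * S1)) ≤ 32 * m ^ 2 * W := by nlinarith [sq_nonneg m]
  have k2 : δ ^ 3 * (N * (m * S2)) ≤ 4 * m ^ 2 * W := by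
    have a1 : δ * N * S2 ≤ 4 * W := by linarith
    have a2 : δ ^ 3 * (N * S2) ≤ δ * (N * S2) := mul_le_mul_of_nonneg_right d3 (by positivity)
    have a3 : m * (δ ^ 3 * (N * S2)) ≤ m * (4 * W) := mul_le_mul_of_nonneg_left (by linarith) (by linarith)
    have a4 : m * (4 * W) ≤ m ^ 2 * (4 * W) := mul_le_mul_of_nonneg_right hm2 (by linarith)
    linarith
  have k3 : δ ^ 3 * W ≤ m ^ 2 * W := mul_le_mul_of_nonneg_right (by nlinarith) hW0
  calc D2 cs fh G * δ ^ 3 ≤ (W + 2 * (N * (m * S2 + N * m ^ 2 * S1))) * δ ^ 3 := mul_le_mul_of_nonneg_right hfin hd0.le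
    _ = δ ^ 3 * W + 2 * (δ ^ 3 * (N * (m * S2))) + 2 * (δ ^ 3 * (N * (N * m ^ 2 * S1))) := by ring
    _ ≤ m ^ 2 * W + 2 * (4 * m ^ 2 * W) + 2 * (32 * m ^ 2 * W) := by linarith
    _ = 73 * m ^ 2 * W := by ring

noncomputable def E3 (cs : Finset (Finset ℕ)) (fh : Finset ℕ → Finset ℕ → Flg F V → Γ) : ℝ :=
  ∑ T, ∑ B ∈ cs, ∑ B' ∈ cs, ∑ B'' ∈ cs, I01 (Disjoint B B' ∧ Disjoint B' B'' ∧ Disjoint B B'' ∧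
    fh B B' T * fh B' B'' T ≠ fh B B'' T)

theorem base_lem {cs : Finset (Finset ℕ)} {δ : ℝ} {fh : Finset ℕ → Finset ℕ → Flg F V → Γ}
    (hδ : 0 < δ) (hδ1 : δ ≤ 1) (hne : cs.Nonempty) (hav : AvH (Dn t) M cs δ) (hM : 0 < M)
    (hfh : ∀ B ∈ cs, ∀ B' ∈ cs, Meas ((B : Set ℕ) ∪ B') (fh B B'))
    (hc : Cut t M A (Module.finrank F V)) :
    PP cs fh A (657 * ((M : ℝ) + 1) ^ 2 / δ ^ 6 * E3 cs fh) := by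
  have hk : ∀ T : Flg F V, ∃ g : Finset ℕ → Γ, (cs.card : ℝ) * ∑ a ∈ cs, ∑ b ∈ cs, I01 (Disjoint a b ∧ fh a b T ≠ g a * (g b)⁻¹) ≤
      9 / δ ^ 3 * ∑ a ∈ cs, ∑ b ∈ cs, ∑ c ∈ cs, I01 (Disjoint a b ∧ Disjoint b c ∧ Disjoint a c ∧ fh a b T * fh b c T ≠ fh a c T) := by
    intro T
    apply ker1 cs (fun a b => Disjoint a b) (fun a b h => h.symm) (fun a b => fh a b T) hδ hδ1 hne
    intro a ha b hb c hc d hd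
    refine (hav a ha b hb c hc d hd 0 hM 0 hM).trans ?_
    norm_cast
    apply card_le_card
    intro e he
    simp only [mem_filter] at he ⊢
    exact ⟨he.1, he.2.1⟩
  choose g hg using hk
  obtain ⟨G, hG1, hG2⟩ := base_avg hδ hδ1 hne hav hfh hc (fun B T => g T B)
  refine ⟨G, hG1, ?_⟩
  have hW : (cs.card : ℝ) * D2 cs fh (fun B T => g T B) ≤ 9 / δ ^ 3 * E3 cs fh := by
    rw [D2_eq, E3, Finset.mul_sum, Finset.mul_sum]
    exact Finset.sum_le_sum fun T _ => hg T
  calc (cs.card : ℝ) * D2 cs fh G ≤ cs.card * (73 * ((M : ℝ) + 1) ^ 2 / δ ^ 3 * D2 cs fh (fun B T => g T B)) :=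
        mul_le_mul_of_nonneg_left hG2 (Nat.cast_nonneg _)
    _ = 73 * ((M : ℝ) + 1) ^ 2 / δ ^ 3 * (cs.card * D2 cs fh (fun B T => g T B)) := by ring
    _ ≤ 73 * ((M : ℝ) + 1) ^ 2 / δ ^ 3 * (9 / δ ^ 3 * E3 cs fh) := mul_le_mul_of_nonneg_left hW (by positivity)
    _ = _ := by field_simp; ring

end swap


theorem PP_mono {Ω α : Type} [Fintype Ω] [Crd Ω α] {Γ : Type} [Group Γ] {cs : Finset (Finset ℕ)}
    {fh : Finset ℕ → Finset ℕ → Ω → Γ} {A : Set ℕ} {e e' : ℝ} (h : PP cs fh A e) (hee : e ≤ e') : PP cs fh A e' := by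
  obtain ⟨g, h1, h2⟩ := h
  exact ⟨g, h1, h2.trans hee⟩

def ext1 (t : ℕ → ℕ) (j v : ℕ) : ℕ → ℕ := fun i => if i ≤ j then t i else v

theorem ext1_le {t : ℕ → ℕ} {j v i : ℕ} (h : i ≤ j) : ext1 t j v i = t i := if_pos h
theorem ext1_gt {t : ℕ → ℕ} {j v i : ℕ} (h : j < i) : ext1 t j v i = v := if_neg (by omega)

def Aset (t : ℕ → ℕ) (j : ℕ) : Set ℕ := {c | ∃ i, 1 ≤ i ∧ i ≤ j ∧ t i = c}

theorem Aset_ext (t : ℕ → ℕ) (j v : ℕ) : Aset (ext1 t j v) (j + 1) = Aset t j ∪ {v} := by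
  ext c
  constructor
  · rintro ⟨i, h1, h2, h3⟩
    rcases Nat.lt_or_ge j i with h | h
    · right; rw [ext1_gt h] at h3; exact h3.symm
    · left; rw [ext1_le h] at h3; exact ⟨i, h1, h, h3⟩
  · rintro (⟨i, h1, h2, h3⟩ | h)
    · exact ⟨i, h1, by omega, by rw [ext1_le h2]; exact h3⟩
    · exact ⟨j + 1, by omega, le_rfl, by rw [ext1_gt (by omega)]; exact h.symm⟩

structure St (lo hi h : ℕ) (j : ℕ) (t : ℕ → ℕ) : Prop where
  zero : t 0 = 0
  one : 1 ≤ j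
  mono : ∀ i < j, t i ≤ t (i + 1)
  win : ∀ l < j, ((Icc lo hi).filter (fun c => c ∈ Dn t l)).card ≤ 3 * h
  lo_le : lo ≤ t j
  le_hi : t j ≤ hi

theorem Dn_ext {t : ℕ → ℕ} {j v l : ℕ} (h : l < j) : Dn (ext1 t j v) l = Dn t l := by
  unfold Dn; rw [ext1_le h.le, ext1_le h]

theorem Dn_ext_last {t : ℕ → ℕ} {j v : ℕ} : Dn (ext1 t j v) j = {c | t j < c ∧ c < v} := by
  unfold Dn; rw [ext1_le le_rfl, ext1_gt (Nat.lt_succ_self _)]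

theorem win_last {lo hi h a v : ℕ} (D : Set ℕ) (hD : D = {c | a < c ∧ c < v}) (hh : v ≤ a + 3 * h ∨ hi ≤ a + 3 * h) :
    ((Icc lo hi).filter (fun c => c ∈ D)).card ≤ 3 * h := by
  calc _ ≤ (Ioc a (a + 3 * h)).card := by
        apply card_le_card
        intro c hc
        rw [mem_filter, mem_Icc] at hc
        have h0 := hc.2
        rw [hD] at h0
        have h1 := h0.1
        have h2 := h0.2
        rw [mem_Ioc]; omega
    _ = 3 * h := by rw [Nat.card_Ioc]; omega

theorem St.ext {lo hi h j : ℕ} {t : ℕ → ℕ} (hs : St lo hi h j t) {v : ℕ} (h1 : t j ≤ v) (h2 : v ≤ t j + 3 * h)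
    (h3 : v ≤ hi) : St lo hi h (j + 1) (ext1 t j v) where
  zero := by rw [ext1_le (Nat.zero_le _)]; exact hs.zero
  one := by omega
  mono := by
    intro i hi'
    rcases Nat.lt_succ_iff_lt_or_eq.1 hi' with hij | rfl
    · rw [ext1_le hij.le, ext1_le hij]; exact hs.mono i hij
    · rw [ext1_le le_rfl, ext1_gt (Nat.lt_succ_self _)]; exact h1
  win := by
    intro l hl
    rcases Nat.lt_succ_iff_lt_or_eq.1 hl with hij | rfl
    · rw [Dn_ext hij]; exact hs.win l hij
    · exact win_last _ Dn_ext_last (Or.inl h2)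
  lo_le := by rw [ext1_gt (Nat.lt_succ_self _)]; exact hs.lo_le.trans h1
  le_hi := by rw [ext1_gt (Nat.lt_succ_self _)]; exact h3

theorem St.le {lo hi h j : ℕ} {t : ℕ → ℕ} (hs : St lo hi h j t) {i : ℕ} (hij : i ≤ j) : t i ≤ t j := by
  have : ∀ n, ∀ i, i + n = j → t i ≤ t j := by
    intro n
    induction n with
    | zero => intro i h; rw [show i = j by omega]
    | succ n ih => intro i h; exact (hs.mono i (by omega)).trans (ih (i + 1) (by omega))
  exact this (j - i) i (by omega)

section recursion
variable {F V : Type} [Field F] [AddCommGroup V] [Module F V] [FiniteDimensional F V] [Fintype F] [Fintype (Submodule F V)]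
variable {Γ : Type} [Group Γ]

theorem E3_nonneg (cs : Finset (Finset ℕ)) (fh : Finset ℕ → Finset ℕ → Flg F V → Γ) : 0 ≤ E3 cs fh :=
  Finset.sum_nonneg fun _ _ => Finset.sum_nonneg fun _ _ => Finset.sum_nonneg fun _ _ => Finset.sum_nonneg fun _ _ => I01_nonneg _

theorem base_st {lo hi h : ℕ} (hin : hi ≤ Module.finrank F V) {cs : Finset (Finset ℕ)} {δ : ℝ} {fh : Finset ℕ → Finset ℕ → Flg F V → Γ}
    (hδ : 0 < δ) (hδ1 : δ ≤ 1) (hne : cs.Nonempty)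
    (hQ : ∀ (t : ℕ → ℕ) (M : ℕ), (∀ l < M, ((Icc lo hi).filter (fun c => c ∈ Dn t l)).card ≤ 3 * h) → AvH (Dn t) M cs δ)
    (hfh : ∀ B ∈ cs, ∀ B' ∈ cs, Meas ((B : Set ℕ) ∪ B') (fh B B')) {Mx : ℕ} {j : ℕ} {t : ℕ → ℕ}
    (hs : St lo hi h j t) (hx : hi < t j + 3 * h) (hM : j + 1 ≤ Mx) :
    PP cs fh (Aset t j) (657 * ((Mx : ℝ) + 1) ^ 2 / δ ^ 6 * E3 cs fh) := by
  have hav : AvH (Dn (ext1 t j (Module.finrank F V))) (j + 1) cs δ := by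
    apply hQ
    intro l hl
    rcases Nat.lt_succ_iff_lt_or_eq.1 hl with hij | rfl
    · rw [Dn_ext hij]; exact hs.win l hij
    · exact win_last _ Dn_ext_last (Or.inr hx.le)
  have hc : Cut (ext1 t j (Module.finrank F V)) (j + 1) (Aset t j) (Module.finrank F V) := by
    refine ⟨?_, ?_, ?_, ?_⟩
    · apply monotone_nat_of_le_succ
      intro i
      rcases lt_trichotomy i j with hij | rfl | hij
      · rw [ext1_le hij.le, ext1_le hij]; exact hs.mono i hij
      · rw [ext1_le le_rfl, ext1_gt (Nat.lt_succ_self _)]; exact hs.le_hi.trans hin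
      · rw [ext1_gt hij, ext1_gt (by omega)]
    · rw [ext1_le (Nat.zero_le _)]; exact hs.zero
    · rw [ext1_gt (Nat.lt_succ_self _)]
    · intro i hi0 hij
      rw [ext1_le (by omega)]
      exact ⟨i, hi0, by omega, rfl⟩
  refine PP_mono (base_lem hδ hδ1 hne hav (Nat.succ_pos _) hfh hc) ?_
  apply mul_le_mul_of_nonneg_right _ (E3_nonneg _ _)
  have : ((j + 1 : ℕ) : ℝ) ≤ Mx := by exact_mod_cast hM
  gcongr

theorem rec_lem {l : ℝ} (hl : 0 ≤ l) (hPL : PL (Flg F V) l) {lo hi h r : ℕ} (hh : 0 < h) (hin : hi ≤ Module.finrank F V)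
    {cs : Finset (Finset ℕ)} {δ : ℝ} {fh : Finset ℕ → Finset ℕ → Flg F V → Γ}
    (hcs : ∀ B ∈ cs, B.card = r + 1) (hne : cs.Nonempty) (havd : Avd cs)
    (hlr : 2 * (r + 1) * l ≤ 1 / 2)
    (hδ : 0 < δ) (hδ1 : δ ≤ 1)
    (hQ : ∀ (t : ℕ → ℕ) (M : ℕ), (∀ l < M, ((Icc lo hi).filter (fun c => c ∈ Dn t l)).card ≤ 3 * h) → AvH (Dn t) M cs δ)
    (hfh : ∀ B ∈ cs, ∀ B' ∈ cs, Meas ((B : Set ℕ) ∪ B') (fh B B')) {Mx : ℕ} (fuel : ℕ) :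
    ∀ (j : ℕ) (t : ℕ → ℕ), St lo hi h j t → hi < t j + 3 * h + fuel * h → j + 1 + fuel ≤ Mx →
    PP cs fh (Aset t j) ((300000 * (r + 1) * 1000000) ^ fuel * (657 * ((Mx : ℝ) + 1) ^ 2 / δ ^ 6 * E3 cs fh)) := by
  have hE0 : 0 ≤ 657 * ((Mx : ℝ) + 1) ^ 2 / δ ^ 6 * E3 cs fh := mul_nonneg (by positivity) (E3_nonneg _ _)
  have hK1 : (1 : ℝ) ≤ 300000 * (r + 1) * 1000000 := by
    have := Nat.cast_nonneg (α := ℝ) r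
    nlinarith
  induction fuel with
  | zero =>
    intro j t hs hx hM
    rw [pow_zero, one_mul]
    exact base_st hin hδ hδ1 hne hQ hfh hs (by omega) (by omega)
  | succ n ih =>
    intro j t hs hx hM
    by_cases hb : hi < t j + 3 * h
    · exact PP_mono (base_st hin hδ hδ1 hne hQ hfh hs hb (by omega : j + 1 ≤ Mx))
        (le_mul_of_one_le_left hE0 (one_le_pow₀ hK1))
    have hcone : ConeP F V Γ (Aset t j) (t j + h) (t j + 2 * h) (t j + 3 * h) := by
      apply cone_up
      · exact ⟨j, hs.one, le_rfl, rfl⟩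
      · rintro c ⟨i, _, hij, rfl⟩; exact hs.le hij
      · omega
    have hE : E1 (Flg F V) Γ 3 (fun i => t j + (i + 1) * h) (Aset t j) 45 := by
      apply E1_of_cone
      have e1 : t j + (0 + 1) * h = t j + h := by ring
      have e2 : t j + (1 + 1) * h = t j + 2 * h := by ring
      have e3 : t j + (2 + 1) * h = t j + 3 * h := by ring
      simp only [e1, e2, e3]
      exact hcone
    refine PP_mono (step hl hPL (Aset t j) cs r hcs hne havd hlr fh 3 (by norm_num) (by norm_num) (fun i => t j + (i + 1) * h)
      (by intro hc; nlinarith) 45 (by norm_num) hE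
      ((300000 * (r + 1) * 1000000) ^ n * (657 * ((Mx : ℝ) + 1) ^ 2 / δ ^ 6 * E3 cs fh)) (mul_nonneg (pow_nonneg (by linarith) _) hE0) ?_) ?_
    · intro i hi3
      have hih : (i + 1) * h ≤ 3 * h := Nat.mul_le_mul_right _ (by omega)
      have hih2 : h ≤ (i + 1) * h := Nat.le_mul_of_pos_left _ (by omega)
      have hs' := hs.ext (v := t j + (i + 1) * h) (by omega) (by omega) (by omega)
      have := ih (j + 1) _ hs' (by
        rw [ext1_gt (Nat.lt_succ_self _)]
        have : (n + 1) * h = n * h + h := by ring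
        omega) (by omega)
      rw [Aset_ext] at this
      exact this
    · rw [pow_succ]
      have := mul_nonneg (pow_nonneg (show (0:ℝ) ≤ 300000 * (r + 1) * 1000000 by linarith) n) hE0
      have h2 : (300000 * ((r:ℝ) + 1) * 45) ≤ 300000 * ((r:ℝ) + 1) * 1000000 := by
        have := Nat.cast_nonneg (α := ℝ) r
        nlinarith
      calc _ ≤ 300000 * ((r:ℝ) + 1) * 1000000 * ((300000 * (r + 1) * 1000000) ^ n * (657 * ((Mx : ℝ) + 1) ^ 2 / δ ^ 6 * E3 cs fh)) :=
            mul_le_mul_of_nonneg_right h2 this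
        _ = _ := by ring

theorem main_rec {l : ℝ} (hl : 0 ≤ l) (hPL : PL (Flg F V) l) (hl2 : 10 ^ 15 * l ^ 2 ≤ 1) {lo hi h r : ℕ} (hh : 0 < h)
    (hin : hi ≤ Module.finrank F V)
    {cs : Finset (Finset ℕ)} {δ : ℝ} {fh : Finset ℕ → Finset ℕ → Flg F V → Γ}
    (hcs : ∀ B ∈ cs, B.card = r + 1) (hne : cs.Nonempty) (havd : Avd cs)
    (hlr : 2 * (r + 1) * l ≤ 1 / 2)
    (hδ : 0 < δ) (hδ1 : δ ≤ 1)
    (hQ : ∀ (t : ℕ → ℕ) (M : ℕ), (∀ l < M, ((Icc lo hi).filter (fun c => c ∈ Dn t l)).card ≤ 3 * h) → AvH (Dn t) M cs δ)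
    (hfh : ∀ B ∈ cs, ∀ B' ∈ cs, Meas ((B : Set ℕ) ∪ B') (fh B B')) (fuel : ℕ) (hlo : lo + 3 * h ≤ hi)
    (hf : hi < lo + 3 * h + fuel * h) :
    PP cs fh ∅ ((300000 * (r + 1) * 1000000) ^ (fuel + 1) * (657 * ((fuel + 2 : ℕ) + 1) ^ 2 / δ ^ 6 * E3 cs fh)) := by
  have hE0 : 0 ≤ 657 * (((fuel + 2 : ℕ) : ℝ) + 1) ^ 2 / δ ^ 6 * E3 cs fh := mul_nonneg (by positivity) (E3_nonneg _ _)
  have hs := step hl hPL ∅ cs r hcs hne havd hlr fh 4 (by norm_num) (by norm_num) (fun i => lo + i * h)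
    (by intro hc; nlinarith) 1000000 (by norm_num) (E1_empty hl hPL hl2 lo h hh (by omega))
    ((300000 * (r + 1) * 1000000) ^ fuel * (657 * ((fuel + 2 : ℕ) + 1) ^ 2 / δ ^ 6 * E3 cs fh)) (mul_nonneg (by positivity) hE0) ?_
  · refine PP_mono hs (le_of_eq ?_)
    rw [pow_succ]; ring
  · intro i hi4
    have hih : i * h ≤ 3 * h := Nat.mul_le_mul_right _ (by omega)
    have hst : St lo hi h 1 (ext1 (fun _ => 0) 0 (lo + i * h)) := by
      refine ⟨ext1_le le_rfl, le_rfl, ?_, ?_, ?_, ?_⟩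
      · intro a ha
        rw [ext1_le (by omega)]; exact Nat.zero_le _
      · intro a ha
        have : a = 0 := by omega
        subst this
        calc _ ≤ (Ico lo (lo + 3 * h)).card := by
              apply card_le_card
              intro c hc
              rw [mem_filter, mem_Icc] at hc
              have h0 := hc.2
              rw [Dn_ext_last] at h0
              have h1 := h0.2
              rw [mem_Ico]; omega
          _ = 3 * h := by rw [Nat.card_Ico]; omega
      · rw [ext1_gt (by omega)]; omega
      · rw [ext1_gt (by omega)]; omega
    have := rec_lem hl hPL hh hin hcs hne havd hlr hδ hδ1 hQ hfh (Mx := fuel + 2) fuel 1 _ hst (by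
      rw [ext1_gt (by omega)]; omega) (by omega)
    have e : Aset (ext1 (fun _ => 0) 0 (lo + i * h)) 1 = ∅ ∪ {lo + i * h} := by
      rw [show (1 : ℕ) = 0 + 1 by rfl, Aset_ext]
      congr 1
      ext c
      constructor
      · rintro ⟨i, h1, h2, _⟩; omega
      · intro h; exact absurd h (Set.notMem_empty _)
    rw [e] at this
    exact this
end recursion


theorem desc_cmp (s q n m : ℕ) (h : (s + 1) * q + m ≤ n + 1) :
    s ^ m * n.descFactorial m ≤ (s + 1) ^ m * (n - q).descFactorial m := by
  induction m with
  | zero => simp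
  | succ m ih =>
    rw [Nat.descFactorial_succ, Nat.descFactorial_succ, pow_succ, pow_succ]
    have ih' := ih (by omega)
    have h1 : s * (n - m) ≤ (s + 1) * (n - q - m) := by
      have hq : (s + 1) * q + m ≤ n := by omega
      have hq2 : (s + 1) * q = s * q + q := by ring
      obtain ⟨e, rfl⟩ : ∃ e, n = (s + 1) * q + m + e := ⟨n - ((s + 1) * q + m), by omega⟩
      have e1 : (s + 1) * q + m + e - m = (s + 1) * q + e := by omega
      have e2 : (s + 1) * q + m + e - q - m = s * q + e := by omega
      rw [e1, e2]
      nlinarith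
    calc s ^ m * s * ((n - m) * n.descFactorial m) = (s * (n - m)) * (s ^ m * n.descFactorial m) := by ring
      _ ≤ ((s + 1) * (n - q - m)) * ((s + 1) ^ m * (n - q).descFactorial m) := Nat.mul_le_mul h1 ih'
      _ = _ := by ring

theorem cnt_lem (S Q : Finset ℕ) (s q m : ℕ) (hq : (S ∩ Q).card ≤ q) (h : (s + 1) * q + m ≤ S.card + 1) :
    s ^ m * (S.powersetCard m).card ≤ (s + 1) ^ m * ((S.powersetCard m).filter (fun B => Disjoint B Q)).card := by
  have e : (S.powersetCard m).filter (fun B => Disjoint B Q) = (S \ Q).powersetCard m := by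
    ext B
    simp only [mem_filter, mem_powersetCard, subset_sdiff]
    tauto
  have hc : S.card - q ≤ (S \ Q).card := by
    have := card_sdiff_add_card_inter S Q
    omega
  rw [e, card_powersetCard, card_powersetCard]
  have h1 : s ^ m * S.card.choose m ≤ (s + 1) ^ m * (S.card - q).choose m := by
    have := desc_cmp s q S.card m h
    rw [Nat.descFactorial_eq_factorial_mul_choose, Nat.descFactorial_eq_factorial_mul_choose] at this
    have hp := Nat.factorial_pos m
    refine Nat.le_of_mul_le_mul_left (c := m.factorial) ?_ hp
    calc _ = s ^ m * (m.factorial * S.card.choose m) := by ring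
      _ ≤ _ := this
      _ = _ := by ring
  exact h1.trans (Nat.mul_le_mul_left _ (Nat.choose_le_choose m hc))

theorem cnt_real (S Q : Finset ℕ) (s q m : ℕ) (hq : (S ∩ Q).card ≤ q) (h : (s + 1) * q + m ≤ S.card + 1) :
    (1 - 1 / ((s : ℝ) + 1)) ^ m * ((S.powersetCard m).card : ℝ) ≤
      (((S.powersetCard m).filter (fun B => Disjoint B Q)).card : ℝ) := by
  have := cnt_lem S Q s q m hq h
  have hs : (0 : ℝ) < (s : ℝ) + 1 := by positivity
  have e : 1 - 1 / ((s : ℝ) + 1) = s / ((s : ℝ) + 1) := by field_simp; ring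
  rw [e, div_pow, div_mul_eq_mul_div, div_le_iff₀ (by positivity), mul_comm (_ : ℝ) (((s : ℝ) + 1) ^ m)]
  exact_mod_cast this

theorem avd_pow {S : Finset ℕ} {r : ℕ} (h : 4 * (r + 1) ^ 2 + (r + 1) ≤ S.card + 1) : Avd (S.powersetCard (r + 1)) := by
  intro B hB B' hB'
  rw [mem_powersetCard] at hB hB'
  have hc := cnt_real S (B ∪ B') (2 * r + 1) (2 * (r + 1)) (r + 1)
    ((card_le_card inter_subset_right).trans ((card_union_le _ _).trans (by omega))) (by nlinarith)
  have e : (S.powersetCard (r + 1)).filter (fun D => Disjoint B D ∧ Disjoint D B') =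
      (S.powersetCard (r + 1)).filter (fun D => Disjoint D (B ∪ B')) := by
    apply filter_congr
    intro D _
    rw [disjoint_union_right, disjoint_comm]
  rw [e]
  have hb : (1 : ℝ) / 2 ≤ (1 - 1 / (((2 * r + 1 : ℕ) : ℝ) + 1)) ^ (r + 1) := by
    have h1 := one_add_mul_le_pow (a := -(1 / (((2 * r + 1 : ℕ) : ℝ) + 1))) (by
      have : 1 / (((2 * r + 1 : ℕ) : ℝ) + 1) ≤ 1 := by
        rw [div_le_one (by positivity)]
        have := Nat.cast_nonneg (α := ℝ) (2 * r + 1)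
        linarith
      linarith) (r + 1)
    have h2 : 1 + ((r + 1 : ℕ) : ℝ) * -(1 / (((2 * r + 1 : ℕ) : ℝ) + 1)) = 1 / 2 := by
      push_cast
      have : (2 * (r : ℝ) + 1 + 1) ≠ 0 := by positivity
      field_simp
      ring
    rw [h2] at h1
    calc (1 : ℝ) / 2 ≤ _ := h1
      _ = _ := by ring
  have h0 : (0 : ℝ) ≤ ((S.powersetCard (r + 1)).card : ℝ) := Nat.cast_nonneg _
  nlinarith [mul_le_mul_of_nonneg_right hb h0]

theorem exp_low {s m : ℕ} (hs : 1 ≤ s) (hm : m ≤ (s + 1) ^ 2) :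
    Real.exp (-(2 * ((s : ℝ) + 1))) ≤ (1 - 1 / ((s : ℝ) + 1)) ^ m := by
  have hs' : (1 : ℝ) ≤ s := by exact_mod_cast hs
  have h1 : Real.exp (-(2 / ((s : ℝ) + 1))) ≤ 1 - 1 / ((s : ℝ) + 1) := by
    have h2 : 1 / (s : ℝ) + 1 ≤ Real.exp (1 / (s : ℝ)) := Real.add_one_le_exp _
    have h3 : Real.exp (1 / (s : ℝ)) ≤ Real.exp (2 / ((s : ℝ) + 1)) := by
      apply Real.exp_le_exp.2
      rw [div_le_div_iff₀ (by linarith) (by linarith)]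
      linarith
    rw [Real.exp_neg]
    have e : 1 - 1 / ((s : ℝ) + 1) = (1 / (s : ℝ) + 1)⁻¹ := by
      field_simp
      ring
    rw [e]
    exact inv_anti₀ (by positivity) (h2.trans h3)
  calc _ ≤ Real.exp (m * -(2 / ((s : ℝ) + 1))) := by
        apply Real.exp_le_exp.2
        have hm' : (m : ℝ) ≤ ((s : ℝ) + 1) ^ 2 := by exact_mod_cast hm
        have : (m : ℝ) * (2 / ((s : ℝ) + 1)) ≤ 2 * ((s : ℝ) + 1) := by
          rw [mul_div_assoc', div_le_iff₀ (by linarith)]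
          nlinarith
        linarith
    _ = Real.exp (-(2 / ((s : ℝ) + 1))) ^ m := Real.exp_nat_mul _ _
    _ ≤ _ := pow_le_pow_left₀ (Real.exp_nonneg _) h1 _

theorem avh_pow {lo hi r s h : ℕ} (hs : 1 ≤ s) (hm : r + 1 ≤ (s + 1) ^ 2)
    (hc : (s + 1) * (4 * (r + 1) + 6 * h) + (r + 1) ≤ (Icc lo hi).card + 1) (t : ℕ → ℕ) (M : ℕ)
    (hw : ∀ l < M, ((Icc lo hi).filter (fun c => c ∈ Dn t l)).card ≤ 3 * h) :
    AvH (Dn t) M ((Icc lo hi).powersetCard (r + 1)) (Real.exp (-(2 * ((s : ℝ) + 1)))) := by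
  intro a ha b hb c hc' d hd i hi' j hj
  rw [mem_powersetCard] at ha hb hc' hd
  set Q := ((a ∪ b) ∪ (c ∪ d)) ∪ ((Icc lo hi).filter (fun c => c ∈ Dn t i) ∪ (Icc lo hi).filter (fun c => c ∈ Dn t j)) with hQ
  have hQc : ((Icc lo hi) ∩ Q).card ≤ 4 * (r + 1) + 6 * h := by
    refine (card_le_card inter_subset_right).trans ?_
    have h1 := hw i hi'
    have h2 := hw j hj
    have gen : ∀ X Y : Finset ℕ, X.card ≤ 3 * h → Y.card ≤ 3 * h →
        (((a ∪ b) ∪ (c ∪ d)) ∪ (X ∪ Y)).card ≤ 4 * (r + 1) + 6 * h := by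
      intro X Y hX hY
      have k1 := ha.2
      have k2 := hb.2
      have k3 := hc'.2
      have k4 := hd.2
      have h3 := card_union_le a b
      have h4 := card_union_le c d
      have h5 := card_union_le (a ∪ b) (c ∪ d)
      have h6 := card_union_le X Y
      have h7 := card_union_le ((a ∪ b) ∪ (c ∪ d)) (X ∪ Y)
      omega
    exact gen _ _ h1 h2
  have hr := cnt_real (Icc lo hi) Q s _ (r + 1) hQc hc
  refine (mul_le_mul_of_nonneg_right (exp_low hs hm) (Nat.cast_nonneg _)).trans (hr.trans ?_)
  rw [Nat.cast_le]
  apply card_le_card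
  intro B hB
  simp only [mem_filter] at hB ⊢
  obtain ⟨hB1, hB2⟩ := hB
  rw [hQ] at hB2
  simp only [disjoint_union_right] at hB2
  obtain ⟨⟨⟨x1, x2⟩, x3, x4⟩, x5, x6⟩ := hB2
  refine ⟨hB1, ⟨x1.symm, x2.symm, x3.symm, x4.symm⟩, ?_, ?_⟩
  · intro c hc hcd
    exact Finset.disjoint_left.1 x5 hc (mem_filter.2 ⟨(mem_powersetCard.1 hB1).1 hc, hcd⟩)
  · intro c hc hcd
    exact Finset.disjoint_left.1 x6 hc (mem_filter.2 ⟨(mem_powersetCard.1 hB1).1 hc, hcd⟩)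

noncomputable def Kc (r : ℕ) : ℝ := (300000 * ((r : ℝ) + 1) * 1000000) ^ (64 * (Nat.sqrt r + 1) + 1) *
  (657 * (((64 * (Nat.sqrt r + 1) + 2 : ℕ) : ℝ) + 1) ^ 2 / Real.exp (-(2 * ((Nat.sqrt r : ℝ) + 1))) ^ 6)

theorem Kc_le {r : ℕ} (hr : 2 ≤ r) : 1000 * Kc r ≤ Real.exp (5000 * Real.sqrt r * Real.log ((r : ℝ) + 1) ^ 2) := by
  set x := Real.sqrt r with hx
  set L := Real.log ((r : ℝ) + 1) with hL
  have hr' : (2 : ℝ) ≤ r := by exact_mod_cast hr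
  have hx1 : 1 ≤ x := by
    rw [hx, Real.one_le_sqrt]; linarith
  have hL1 : 1 ≤ L := by
    rw [hL, Real.le_log_iff_exp_le (by linarith)]
    have := Real.exp_one_lt_d9
    linarith
  have hs : ((Nat.sqrt r : ℕ) : ℝ) ≤ x := by
    rw [hx]
    apply Real.le_sqrt_of_sq_le
    exact_mod_cast Nat.sqrt_le' r
  set s := Nat.sqrt r with hsdef
  have e10 : (10 : ℝ) ≤ Real.exp (7 / 3) := by
    have h1 : (10 : ℝ) ^ 3 ≤ Real.exp (7 / 3) ^ 3 := by
      rw [← Real.exp_nat_mul]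
      have h2 : Real.exp ((3 : ℕ) * (7 / 3)) = Real.exp 1 ^ 7 := by
        rw [← Real.exp_nat_mul]; norm_num
      rw [h2]
      have h3 : (2.718 : ℝ) ^ 7 ≤ Real.exp 1 ^ 7 := pow_le_pow_left₀ (by norm_num) (by have := Real.exp_one_gt_d9; linarith) _
      refine le_trans ?_ h3
      norm_num
    exact le_of_pow_le_pow_left₀ (by norm_num) (Real.exp_nonneg _) h1
  have e1000 : (1000 : ℝ) ≤ Real.exp 7 := by
    calc (1000 : ℝ) = 10 ^ 3 := by norm_num
      _ ≤ Real.exp (7 / 3) ^ 3 := pow_le_pow_left₀ (by norm_num) e10 _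
      _ = Real.exp 7 := by rw [← Real.exp_nat_mul]; norm_num
  have eb : (300000 * 1000000 : ℝ) ≤ Real.exp 28 := by
    calc (300000 * 1000000 : ℝ) ≤ 10 ^ 12 := by norm_num
      _ ≤ Real.exp (7 / 3) ^ 12 := pow_le_pow_left₀ (by norm_num) e10 _
      _ = Real.exp 28 := by rw [← Real.exp_nat_mul]; norm_num
  have hrL : ((r : ℝ) + 1) = Real.exp L := by rw [hL, Real.exp_log (by linarith)]
  have b1 : (300000 * ((r : ℝ) + 1) * 1000000) ^ (64 * (s + 1) + 1) ≤ Real.exp (129 * 29 * x * L ^ 2) := by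
    have h1 : 300000 * ((r : ℝ) + 1) * 1000000 ≤ Real.exp (29 * L) := by
      calc 300000 * ((r : ℝ) + 1) * 1000000 = 300000 * 1000000 * Real.exp L := by rw [hrL]; ring
        _ ≤ Real.exp 28 * Real.exp L := mul_le_mul_of_nonneg_right eb (Real.exp_nonneg _)
        _ = Real.exp (28 + L) := (Real.exp_add _ _).symm
        _ ≤ _ := Real.exp_le_exp.2 (by linarith)
    calc _ ≤ Real.exp (29 * L) ^ (64 * (s + 1) + 1) := pow_le_pow_left₀ (by positivity) h1 _
      _ = Real.exp ((64 * (s + 1) + 1 : ℕ) * (29 * L)) := (Real.exp_nat_mul _ _).symm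
      _ ≤ _ := by
        apply Real.exp_le_exp.2
        push_cast
        have h2 : 64 * ((s : ℝ) + 1) + 1 ≤ 129 * x := by linarith
        calc (64 * ((s : ℝ) + 1) + 1) * (29 * L) ≤ 129 * x * (29 * L) := mul_le_mul_of_nonneg_right h2 (by linarith)
          _ ≤ 129 * x * (29 * (L ^ 2)) := by gcongr; nlinarith
          _ = _ := by ring
  have hxL : x ≤ x * L ^ 2 := le_mul_of_one_le_right (by linarith) (by nlinarith)
  have b2 : (((64 * (s + 1) + 2 : ℕ) : ℝ) + 1) ^ 2 ≤ Real.exp (260 * (x * L ^ 2)) := by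
    have h1 := Real.add_one_le_exp (((64 * (s + 1) + 2 : ℕ) : ℝ))
    calc _ ≤ Real.exp (((64 * (s + 1) + 2 : ℕ) : ℝ)) ^ 2 := pow_le_pow_left₀ (by positivity) h1 _
      _ = Real.exp ((2 : ℕ) * ((64 * (s + 1) + 2 : ℕ) : ℝ)) := (Real.exp_nat_mul _ _).symm
      _ ≤ _ := by
        apply Real.exp_le_exp.2
        push_cast
        linarith
  have b3 : (Real.exp (-(2 * ((s : ℝ) + 1))) ^ 6)⁻¹ ≤ Real.exp (24 * (x * L ^ 2)) := by
    rw [← Real.exp_nat_mul, ← Real.exp_neg]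
    apply Real.exp_le_exp.2
    push_cast
    linarith
  have b4 : (1000 : ℝ) ≤ Real.exp (7 * (x * L ^ 2)) := e1000.trans (Real.exp_le_exp.2 (by linarith))
  have b5 : (657 : ℝ) ≤ Real.exp (7 * (x * L ^ 2)) := le_trans (by norm_num) b4
  have e : 1000 * Kc r = 1000 * ((300000 * ((r : ℝ) + 1) * 1000000) ^ (64 * (s + 1) + 1) *
      (657 * (((64 * (s + 1) + 2 : ℕ) : ℝ) + 1) ^ 2 * (Real.exp (-(2 * ((s : ℝ) + 1))) ^ 6)⁻¹)) := by
    unfold Kc; rw [div_eq_mul_inv]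
  rw [e]
  calc _ ≤ Real.exp (7 * (x * L ^ 2)) * (Real.exp (129 * 29 * x * L ^ 2) *
        (Real.exp (7 * (x * L ^ 2)) * Real.exp (260 * (x * L ^ 2)) * Real.exp (24 * (x * L ^ 2)))) := by gcongr
    _ = Real.exp (7 * (x * L ^ 2) + (129 * 29 * x * L ^ 2 + (7 * (x * L ^ 2) + 260 * (x * L ^ 2) + 24 * (x * L ^ 2)))) := by
      simp only [Real.exp_add]
    _ ≤ _ := by
      apply Real.exp_le_exp.2
      nlinarith

theorem r5_facts {r k : ℕ} (hr : 2 ≤ r) (hk : r ^ 5 ≤ k) : 8 * r ^ 2 ≤ k ∧ 16 * r ≤ k := by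
  have h3 : 2 ^ 3 ≤ r ^ 3 := Nat.pow_le_pow_left hr 3
  have e : r ^ 5 = r ^ 3 * r ^ 2 := by ring
  have h1 : 8 * r ^ 2 ≤ k := by
    calc 8 * r ^ 2 ≤ r ^ 3 * r ^ 2 := Nat.mul_le_mul_right _ (by omega)
      _ ≤ k := by omega
  exact ⟨h1, by nlinarith⟩

section fin
variable {F V : Type} [Field F] [AddCommGroup V] [Module F V] [FiniteDimensional F V] [Fintype F] [Fintype (Submodule F V)]
variable {Γ : Type} [Group Γ]

theorem part8 {r k d : ℕ} (hr : 2 ≤ r) (hk : r ^ 5 ≤ k) (hd : k < d) (hn : Module.finrank F V = 2 * d)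
    (hq : 2 * 10 ^ 15 + 32 * (r + 1) ^ 2 ≤ Fintype.card F)
    {fh : Finset ℕ → Finset ℕ → Flg F V → Γ}
    (hfh : ∀ B ∈ (Icc (d - k) (d + k)).powersetCard (r + 1), ∀ B' ∈ (Icc (d - k) (d + k)).powersetCard (r + 1),
      Meas ((B : Set ℕ) ∪ B') (fh B B')) :
    PP ((Icc (d - k) (d + k)).powersetCard (r + 1)) fh ∅ (Kc r * E3 ((Icc (d - k) (d + k)).powersetCard (r + 1)) fh) := by
  obtain ⟨f1, f2⟩ := r5_facts hr hk
  have hcard : (Icc (d - k) (d + k)).card = 2 * k + 1 := by rw [Nat.card_Icc]; omega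
  have hs2 : r + 1 ≤ (Nat.sqrt r + 1) ^ 2 := Nat.lt_succ_sqrt' r
  have hs1 : 1 ≤ Nat.sqrt r := by rw [Nat.le_sqrt]; omega
  have hsr : Nat.sqrt r + 1 ≤ r := by
    have := Nat.sqrt_lt_self (n := r) (by omega)
    omega
  set s := Nat.sqrt r with hs
  obtain ⟨h, hh⟩ : ∃ h, h = k / (16 * (s + 1)) := ⟨_, rfl⟩
  have hle : 16 * (s + 1) * h ≤ k := by rw [hh]; exact Nat.mul_div_le _ _
  have hlt : k < 16 * (s + 1) * (h + 1) := by
    rw [hh]; exact Nat.lt_mul_div_succ k (by omega)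
  have hpos : 0 < h := by
    rw [hh]; exact Nat.div_pos (by omega) (by omega)
  set q := (Fintype.card F : ℝ) with hqd
  have hq' : 2 * 10 ^ 15 + 32 * ((r : ℝ) + 1) ^ 2 ≤ q := by rw [hqd]; exact_mod_cast hq
  have hq0 : 0 < q := by positivity
  have hl2 : Real.sqrt (2 / q) ^ 2 = 2 / q := Real.sq_sqrt (by positivity)
  have hsh : 0 < (s + 1) * h := by positivity
  have := main_rec (Γ := Γ) (Real.sqrt_nonneg _) (PL_flags (F := F) (V := V)) (lo := d - k) (hi := d + k) (r := r)
    (by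
      rw [hl2, mul_div_assoc', div_le_one hq0]
      nlinarith) hpos (by omega) (cs := (Icc (d - k) (d + k)).powersetCard (r + 1))
    (fun B hB => (mem_powersetCard.1 hB).2)
    (by rw [powersetCard_nonempty, hcard]; omega)
    (avd_pow (by rw [hcard]; nlinarith))
    (by
      apply abs_le_of_sq_le_sq' _ (by norm_num) |>.2
      rw [mul_pow, hl2, mul_div_assoc', div_le_iff₀ hq0]
      nlinarith) (Real.exp_pos (-(2 * ((s : ℝ) + 1)))) (by rw [Real.exp_le_one_iff]; have := Nat.cast_nonneg (α := ℝ) s; linarith)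
    (fun t M hw => avh_pow hs1 hs2 (by
      rw [hcard]
      have a1 : (s + 1) * (4 * (r + 1) + 6 * h) = 4 * ((s + 1) * (r + 1)) + 6 * ((s + 1) * h) := by ring
      have a2 : (s + 1) * (r + 1) ≤ r * (r + 1) := Nat.mul_le_mul_right _ hsr
      have a3 : 16 * ((s + 1) * h) ≤ k := by rw [← mul_assoc]; exact hle
      nlinarith) t M hw) hfh (64 * (s + 1))
    (by
      have a3 : 16 * ((s + 1) * h) ≤ k := by rw [← mul_assoc]; exact hle
      nlinarith [Nat.sub_add_cancel hd.le])
    (by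
      have a4 : 16 * (s + 1) * (h + 1) = 16 * ((s + 1) * h) + 16 * (s + 1) := by ring
      have a5 : s + 1 ≤ (s + 1) * h := Nat.le_mul_of_pos_right _ hpos
      have a6 : 64 * (s + 1) * h = 64 * ((s + 1) * h) := by ring
      omega)
  refine PP_mono this (le_of_eq ?_)
  unfold Kc
  rw [← hs]; ring
end fin


theorem I01_card {β : Type} (s : Finset β) (p : β → Prop) [DecidablePred p] : ∑ x ∈ s, I01 (p x) = ((s.filter p).card : ℝ) := by
  rw [← sum_boole]
  apply sum_congr rfl
  intro x _
  unfold I01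
  congr

section rp
variable {α : Type} [Fintype α]

noncomputable def RP (r m : ℕ) (T : Finset α) : Finset (Finset (Finset α)) :=
  Finset.univ.filter fun P : Finset (Finset α) =>
    P.card = m ∧ (∀ e ∈ P, e.card = r + 1 ∧ e ⊆ T) ∧ ∀ e ∈ P, ∀ e' ∈ P, e ≠ e' → Disjoint e e'

theorem mem_RP {r m : ℕ} {T : Finset α} {P : Finset (Finset α)} : P ∈ RP r m T ↔
    P.card = m ∧ (∀ e ∈ P, e.card = r + 1 ∧ e ⊆ T) ∧ ∀ e ∈ P, ∀ e' ∈ P, e ≠ e' → Disjoint e e' := by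
  unfold RP; simp only [mem_filter, mem_univ, true_and]

theorem RP_sub {r m j : ℕ} {T : Finset α} {P E : Finset (Finset α)} (hP : P ∈ RP r m T) (hE : E ∈ P.powersetCard j) :
    E ∈ RP r j T := by
  rw [mem_RP] at hP ⊢
  rw [mem_powersetCard] at hE
  exact ⟨hE.2, fun e he => hP.2.1 e (hE.1 he), fun e he e' he' => hP.2.2 e (hE.1 he) e' (hE.1 he')⟩

theorem RP_ne (r m : ℕ) : ∀ T : Finset α, m * (r + 1) ≤ T.card → (RP r m T).Nonempty := by
  induction m with
  | zero => intro T _; exact ⟨∅, mem_RP.2 ⟨rfl, by simp, by simp⟩⟩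
  | succ m ih =>
    intro T hT
    have h1 : (m + 1) * (r + 1) = m * (r + 1) + (r + 1) := by ring
    obtain ⟨e, he, hec⟩ := exists_subset_card_eq (s := T) (n := r + 1) (by omega)
    obtain ⟨P, hP⟩ := ih (T \ e) (by rw [card_sdiff_of_subset he]; omega)
    rw [mem_RP] at hP
    have hne : ∀ x ∈ P, Disjoint x e := fun x hx => disjoint_of_subset_left (hP.2.1 x hx).2 sdiff_disjoint
    have hnot : e ∉ P := by
      intro h
      have := hne e h
      rw [disjoint_self_iff_empty] at this
      rw [this, card_empty] at hec; omega
    refine ⟨insert e P, mem_RP.2 ⟨by rw [card_insert_of_notMem hnot, hP.1], ?_, ?_⟩⟩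
    · intro x hx
      rcases mem_insert.1 hx with rfl | hx
      · exact ⟨hec, he⟩
      · exact ⟨(hP.2.1 x hx).1, (hP.2.1 x hx).2.trans sdiff_subset⟩
    · intro x hx y hy hxy
      rcases mem_insert.1 hx with hx | hx <;> rcases mem_insert.1 hy with hy | hy
      · exact absurd (hx.trans hy.symm) hxy
      · rw [hx]; exact (hne y hy).symm
      · rw [hy]; exact hne x hx
      · exact hP.2.2 x hx y hy hxy

theorem RP_card_le (r m : ℕ) {T T' : Finset α} (h : T.card = T'.card) : (RP r m T).card ≤ (RP r m T').card := by
  have e0 : {x // x ∈ T} ≃ {x // x ∈ T'} := Finset.equivOfCardEq h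
  let σ : Equiv.Perm α := Equiv.extendSubtype e0
  have hσ : ∀ x ∈ T, σ x ∈ T' := fun x hx => Equiv.extendSubtype_mem e0 x hx
  apply card_le_card_of_injOn (fun P => P.map (mapEmbedding σ.toEmbedding).toEmbedding)
  · intro P hP
    rw [mem_coe, mem_RP] at hP ⊢
    refine ⟨by rw [card_map]; exact hP.1, ?_, ?_⟩
    · intro e he
      obtain ⟨e, he', rfl⟩ := mem_map.1 he
      refine ⟨?_, ?_⟩
      · show (e.map σ.toEmbedding).card = _
        rw [card_map]; exact (hP.2.1 e he').1
      · intro y hy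
        obtain ⟨x, hx, rfl⟩ := mem_map.1 (show y ∈ e.map σ.toEmbedding from hy)
        exact hσ x ((hP.2.1 e he').2 hx)
    · intro e he e' he' hne
      obtain ⟨e, he1, rfl⟩ := mem_map.1 he
      obtain ⟨e', he2, rfl⟩ := mem_map.1 he'
      show Disjoint (e.map σ.toEmbedding) (e'.map σ.toEmbedding)
      rw [disjoint_map]
      exact hP.2.2 e he1 e' he2 (fun h => hne (by rw [h]))
  · intro P _ P' _ h
    exact map_injective _ h

theorem RP_card_eq (r m : ℕ) {T T' : Finset α} (h : T.card = T'.card) : (RP r m T).card = (RP r m T').card :=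
  le_antisymm (RP_card_le r m h) (RP_card_le r m h.symm)

theorem RP_union_card {r j : ℕ} {T : Finset α} {E : Finset (Finset α)} (hE : E ∈ RP r j T) :
    (T \ E.biUnion id).card = T.card - j * (r + 1) := by
  rw [mem_RP] at hE
  rw [card_sdiff_of_subset (show E.biUnion id ⊆ T from biUnion_subset.2 fun e he => (hE.2.1 e he).2), card_biUnion (t := id) (fun e he e' he' h => hE.2.2 e he e' he' h)]
  congr 1
  rw [sum_congr rfl (fun e he => show (id e).card = r + 1 from (hE.2.1 e he).1), sum_const, hE.1, smul_eq_mul]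

theorem RP_ext_card {r m j : ℕ} (hj : j ≤ m) {T : Finset α} {E : Finset (Finset α)} (hE : E ∈ RP r j T) :
    ((RP r m T).filter (fun P => E ⊆ P)).card = (RP r (m - j) (T \ E.biUnion id)).card := by
  have hE' := mem_RP.1 hE
  have key : ∀ Q ∈ RP r (m - j) (T \ E.biUnion id), Disjoint Q E := by
    intro Q hQ
    rw [Finset.disjoint_left]
    intro e he he'
    have h1 := (mem_RP.1 hQ).2.1 e he
    have h2 : e = ∅ := by
      rw [← disjoint_self_iff_empty]
      exact disjoint_of_subset_left h1.2 (disjoint_of_subset_right (subset_biUnion_of_mem id he') sdiff_disjoint)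
    rw [h2, card_empty] at h1
    omega
  apply card_bij' (fun P _ => P \ E) (fun Q _ => Q ∪ E)
  · intro P hP
    rw [mem_filter] at hP
    obtain ⟨hP, hEP⟩ := hP
    rw [mem_RP] at hP ⊢
    refine ⟨by rw [card_sdiff_of_subset hEP, hP.1, hE'.1], ?_, ?_⟩
    · intro e he
      rw [mem_sdiff] at he
      refine ⟨(hP.2.1 e he.1).1, ?_⟩
      rw [subset_sdiff]
      refine ⟨(hP.2.1 e he.1).2, ?_⟩
      rw [disjoint_biUnion_right]
      intro e' he'
      exact hP.2.2 e he.1 e' (hEP he') (fun h => he.2 (h ▸ he'))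
    · intro e he e' he'
      exact hP.2.2 e (mem_sdiff.1 he).1 e' (mem_sdiff.1 he').1
  · intro Q hQ
    have hd := key Q hQ
    rw [mem_RP] at hQ
    rw [mem_filter, mem_RP]
    refine ⟨⟨by rw [card_union_of_disjoint hd, hQ.1, hE'.1]; omega, ?_, ?_⟩, subset_union_right⟩
    · intro e he
      rcases mem_union.1 he with he | he
      · exact ⟨(hQ.2.1 e he).1, (hQ.2.1 e he).2.trans sdiff_subset⟩
      · exact hE'.2.1 e he
    · have cr : ∀ e ∈ Q, ∀ e' ∈ E, Disjoint e e' := fun e he e' he' =>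
        disjoint_of_subset_left (hQ.2.1 e he).2 (disjoint_of_subset_right (subset_biUnion_of_mem id he') sdiff_disjoint)
      intro e he e' he' hne
      rcases mem_union.1 he with he | he <;> rcases mem_union.1 he' with he' | he'
      · exact hQ.2.2 e he e' he' hne
      · exact cr e he e' he'
      · exact (cr e' he' e he).symm
      · exact hE'.2.2 e he e' he' hne
  · intro P hP
    rw [mem_filter] at hP
    exact sdiff_union_of_subset hP.2
  · intro Q hQ
    rw [union_sdiff_right, sdiff_eq_self_of_disjoint (key Q hQ)]

/-- averaging over partitions equals averaging over `j`-subsets -/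
theorem RP_avg {r m j : ℕ} (hj : j ≤ m) {T : Finset α} (hT : m * (r + 1) ≤ T.card) (φ : Finset (Finset α) → ℝ) :
    (∑ P ∈ RP r m T, (∑ E ∈ P.powersetCard j, φ E) / ((P.powersetCard j).card : ℝ)) / ((RP r m T).card : ℝ) =
      (∑ E ∈ RP r j T, φ E) / ((RP r j T).card : ℝ) := by
  obtain ⟨E0, hE0⟩ := RP_ne r j T (le_trans (Nat.mul_le_mul_right _ hj) hT)
  have hm0 := RP_ne r m T hT
  obtain ⟨N, hN⟩ : ∃ N, N = (RP r (m - j) (T \ E0.biUnion id)).card := ⟨_, rfl⟩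
  have hcst : ∀ E ∈ RP r j T, ((RP r m T).filter (fun P => E ⊆ P)).card = N := by
    intro E hE
    rw [RP_ext_card hj hE, hN]
    exact RP_card_eq _ _ (by rw [RP_union_card hE, RP_union_card hE0])
  have dc : ∀ φ : Finset (Finset α) → ℝ, ∑ P ∈ RP r m T, ∑ E ∈ P.powersetCard j, φ E = N * ∑ E ∈ RP r j T, φ E := by
    intro φ
    rw [sum_comm' (t' := RP r j T) (s' := fun E => (RP r m T).filter (fun P => E ⊆ P))]
    · rw [mul_sum]
      apply sum_congr rfl
      intro E hE
      rw [sum_const, hcst E hE, nsmul_eq_mul]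
    · intro P E
      rw [mem_filter, mem_powersetCard]
      constructor
      · rintro ⟨hP, h1, h2⟩
        exact ⟨⟨hP, h1⟩, RP_sub hP (mem_powersetCard.2 ⟨h1, h2⟩)⟩
      · rintro ⟨⟨hP, h1⟩, h2⟩
        exact ⟨hP, h1, (mem_RP.1 h2).1⟩
  have hpc : ∀ P ∈ RP r m T, ((P.powersetCard j).card : ℝ) = (m.choose j : ℕ) := by
    intro P hP
    rw [card_powersetCard, (mem_RP.1 hP).1]
  have hch : 0 < m.choose j := Nat.choose_pos hj
  have d1 := dc (fun _ => 1)
  simp only [sum_const, nsmul_eq_mul, mul_one] at d1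
  rw [sum_congr rfl hpc, sum_const, nsmul_eq_mul] at d1
  rw [sum_congr rfl (fun P hP => by rw [hpc P hP]), ← sum_div, dc, div_div]
  have p1 : (0 : ℝ) < (RP r m T).card := by exact_mod_cast card_pos.2 hm0
  have p2 : (0 : ℝ) < (RP r j T).card := by exact_mod_cast card_pos.2 ⟨E0, hE0⟩
  have p3 : (0 : ℝ) < (m.choose j : ℕ) := by exact_mod_cast hch
  rw [div_eq_div_iff (by positivity) (by positivity), mul_comm ((m.choose j : ℕ) : ℝ), d1]
  ring

theorem RP3_sum (r : ℕ) (T : Finset α) (ψ : Finset α → Finset α → Finset α → Prop) :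
    ∑ a ∈ T.powersetCard (r + 1), ∑ b ∈ T.powersetCard (r + 1), ∑ c ∈ T.powersetCard (r + 1),
      I01 (Disjoint a b ∧ Disjoint b c ∧ Disjoint a c ∧ ψ a b c) ≤
    27 * ∑ E ∈ RP r 3 T, I01 (∃ a ∈ E, ∃ b ∈ E, ∃ c ∈ E, a ≠ b ∧ b ≠ c ∧ a ≠ c ∧ ψ a b c) := by
  set ct := T.powersetCard (r + 1) with hct
  let p : Finset α × Finset α × Finset α → Prop := fun t => Disjoint t.1 t.2.1 ∧ Disjoint t.2.1 t.2.2 ∧ Disjoint t.1 t.2.2 ∧ ψ t.1 t.2.1 t.2.2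
  let G := (RP r 3 T).filter (fun E => ∃ a ∈ E, ∃ b ∈ E, ∃ c ∈ E, a ≠ b ∧ b ≠ c ∧ a ≠ c ∧ ψ a b c)
  have e1 : ∑ a ∈ ct, ∑ b ∈ ct, ∑ c ∈ ct, I01 (Disjoint a b ∧ Disjoint b c ∧ Disjoint a c ∧ ψ a b c) =
      (((ct ×ˢ (ct ×ˢ ct)).filter p).card : ℝ) := by
    rw [← I01_card, sum_product]
    apply sum_congr rfl; intro a _
    rw [sum_product]
  have e2 : ∑ E ∈ RP r 3 T, I01 (∃ a ∈ E, ∃ b ∈ E, ∃ c ∈ E, a ≠ b ∧ b ≠ c ∧ a ≠ c ∧ ψ a b c) = (G.card : ℝ) := by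
    exact I01_card _ _
  rw [e1, e2]
  have ne : ∀ a ∈ ct, ∀ b ∈ ct, Disjoint a b → a ≠ b := by
    rintro a ha b _ hd rfl
    rw [disjoint_self_iff_empty] at hd
    have := (mem_powersetCard.1 ha).2
    rw [hd, card_empty] at this; omega
  have := card_le_mul_card_image_of_maps_to (s := (ct ×ˢ (ct ×ˢ ct)).filter p) (t := G)
    (f := fun t => ({t.1, t.2.1, t.2.2} : Finset (Finset α))) ?_ 27 ?_
  · exact_mod_cast this
  · rintro ⟨a, b, c⟩ ht
    rw [mem_filter, mem_product, mem_product] at ht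
    obtain ⟨⟨ha, hb, hc⟩, d1, d2, d3, hψ⟩ := ht
    simp only at ha hb hc d1 d2 d3 hψ
    have n1 := ne a ha b hb d1
    have n2 := ne b hb c hc d2
    have n3 := ne a ha c hc d3
    simp only [G]
    rw [mem_filter, mem_RP]
    refine ⟨⟨card_eq_three.2 ⟨a, b, c, n1, n3, n2, rfl⟩, ?_, ?_⟩, a, by simp, b, by simp, c, by simp, n1, n2, n3, hψ⟩
    · intro e he
      simp only [mem_insert, mem_singleton] at he
      rw [hct] at ha hb hc
      rcases he with rfl | rfl | rfl
      · exact (mem_powersetCard.1 ha).symm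
      · exact (mem_powersetCard.1 hb).symm
      · exact (mem_powersetCard.1 hc).symm
    · intro e he e' he' hne
      simp only [mem_insert, mem_singleton] at he he'
      rcases he with rfl | rfl | rfl <;> rcases he' with rfl | rfl | rfl <;>
        first | exact absurd rfl hne | assumption | (apply Disjoint.symm; assumption)
  · intro E hE
    have hE3 : E.card = 3 := (mem_RP.1 (mem_filter.1 hE).1).1
    calc _ ≤ (E ×ˢ (E ×ˢ E)).card := by
          apply card_le_card
          rintro ⟨a, b, c⟩ ht
          have := (mem_filter.1 ht).2
          simp only at this
          rw [mem_product, mem_product, ← this]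
          simp
      _ = 27 := by rw [card_product, card_product, hE3]

theorem RP2_sum (r : ℕ) (T : Finset α) (χ : Finset α → Finset α → Prop) :
    ∑ E ∈ RP r 2 T, I01 (∃ a ∈ E, ∃ b ∈ E, a ≠ b ∧ χ a b) ≤
    ∑ a ∈ T.powersetCard (r + 1), ∑ b ∈ T.powersetCard (r + 1), I01 (Disjoint a b ∧ χ a b) := by
  set ct := T.powersetCard (r + 1) with hct
  let p : Finset α × Finset α → Prop := fun t => Disjoint t.1 t.2 ∧ χ t.1 t.2
  let G := (RP r 2 T).filter (fun E => ∃ a ∈ E, ∃ b ∈ E, a ≠ b ∧ χ a b)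
  have e1 : ∑ a ∈ ct, ∑ b ∈ ct, I01 (Disjoint a b ∧ χ a b) = (((ct ×ˢ ct).filter p).card : ℝ) := by
    rw [← I01_card, sum_product]
  have e2 : ∑ E ∈ RP r 2 T, I01 (∃ a ∈ E, ∃ b ∈ E, a ≠ b ∧ χ a b) = (G.card : ℝ) := by
    exact I01_card _ _
  rw [e1, e2, Nat.cast_le]
  refine le_trans (card_le_card ?_) (card_image_le (f := fun t : Finset α × Finset α => ({t.1, t.2} : Finset (Finset α))))
  intro E hE
  obtain ⟨hE, a, ha, b, hb, hab, hχ⟩ := mem_filter.1 hE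
  rw [mem_RP] at hE
  refine mem_image.2 ⟨(a, b), mem_filter.2 ⟨mem_product.2 ⟨?_, ?_⟩, hE.2.2 a ha b hb hab, hχ⟩, ?_⟩
  · exact mem_powersetCard.2 (hE.2.1 a ha).symm
  · exact mem_powersetCard.2 (hE.2.1 b hb).symm
  · apply eq_of_subset_of_card_le
    · intro e he
      simp only [mem_insert, mem_singleton] at he
      rcases he with rfl | rfl <;> assumption
    · rw [hE.1]; simp only; rw [card_pair hab]

theorem RP2_low (r : ℕ) (T : Finset α) :
    ∑ a ∈ T.powersetCard (r + 1), ∑ b ∈ T.powersetCard (r + 1), I01 (Disjoint a b) ≤ 4 * ((RP r 2 T).card : ℝ) := by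
  set ct := T.powersetCard (r + 1) with hct
  let p : Finset α × Finset α → Prop := fun t => Disjoint t.1 t.2
  have e1 : ∑ a ∈ ct, ∑ b ∈ ct, I01 (Disjoint a b) = (((ct ×ˢ ct).filter p).card : ℝ) := by
    rw [← I01_card, sum_product]
  rw [e1]
  have ne : ∀ a ∈ ct, ∀ b ∈ ct, Disjoint a b → a ≠ b := by
    rintro a ha b _ hd rfl
    rw [disjoint_self_iff_empty] at hd
    have := (mem_powersetCard.1 ha).2
    rw [hd, card_empty] at this; omega
  have := card_le_mul_card_image_of_maps_to (s := (ct ×ˢ ct).filter p) (t := RP r 2 T)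
    (f := fun t => ({t.1, t.2} : Finset (Finset α))) ?_ 4 ?_
  · exact_mod_cast this
  · rintro ⟨a, b⟩ ht
    rw [mem_filter, mem_product] at ht
    obtain ⟨⟨ha, hb⟩, d1⟩ := ht
    simp only [p] at ha hb d1
    have n1 := ne a ha b hb d1
    rw [mem_RP]
    refine ⟨card_pair n1, ?_, ?_⟩
    · intro e he
      simp only [mem_insert, mem_singleton] at he
      rw [hct] at ha hb
      rcases he with rfl | rfl
      · exact (mem_powersetCard.1 ha).symm
      · exact (mem_powersetCard.1 hb).symm
    · intro e he e' he' hne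
      simp only [mem_insert, mem_singleton] at he he'
      rcases he with rfl | rfl <;> rcases he' with rfl | rfl <;>
        first | exact absurd rfl hne | assumption | (apply Disjoint.symm; assumption)
  · intro E hE
    have hE3 : E.card = 2 := (mem_RP.1 hE).1
    calc _ ≤ (E ×ˢ E).card := by
          apply card_le_card
          rintro ⟨a, b⟩ ht
          have := (mem_filter.1 ht).2
          simp only at this
          rw [mem_product, ← this]
          simp
      _ = 4 := by rw [card_product, hE3]

theorem RP3_up (r : ℕ) (T : Finset α) : ((RP r 3 T).card : ℝ) ≤ ((T.powersetCard (r + 1)).card : ℝ) ^ 3 := by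
  have h1 : RP r 3 T ⊆ (T.powersetCard (r + 1)).powersetCard 3 := by
    intro E hE
    rw [mem_RP] at hE
    exact mem_powersetCard.2 ⟨fun e he => mem_powersetCard.2 (hE.2.1 e he).symm, hE.1⟩
  have h2 := card_le_card h1
  rw [card_powersetCard] at h2
  have h3 := Nat.choose_le_pow (T.powersetCard (r + 1)).card 3
  exact_mod_cast h2.trans h3
end rp


section link
variable {F V : Type} [Field F] [AddCommGroup V] [Module F V] [FiniteDimensional F V] [Fintype F] [Fintype (Submodule F V)]

theorem img_inj {B B' : Finset ℕ} {x y : Flg F V} (hB : ∀ c ∈ B, c ≤ Module.finrank F V) (hB' : ∀ c ∈ B', c ≤ Module.finrank F V)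
    (h : B.image x.f = B'.image y.f) : B = B' ∧ ∀ c ∈ B, x.f c = y.f c := by
  have k1 : ∀ c ∈ B, c ∈ B' ∧ x.f c = y.f c := by
    intro c hc
    have : x.f c ∈ B'.image y.f := h ▸ mem_image_of_mem _ hc
    obtain ⟨c', hc', e⟩ := mem_image.1 this
    have : c' = c := by rw [← y.rk (hB' c' hc'), e, x.rk (hB c hc)]
    subst this
    exact ⟨hc', e.symm⟩
  refine ⟨Subset.antisymm (fun c hc => (k1 c hc).1) ?_, fun c hc => (k1 c hc).2⟩
  intro c hc
  have : y.f c ∈ B.image x.f := h ▸ mem_image_of_mem _ hc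
  obtain ⟨c', hc', e⟩ := mem_image.1 this
  have : c' = c := by rw [← x.rk (hB c' hc'), e, y.rk (hB' c hc)]
  exact this ▸ hc'

theorem flg_injOn (x : Flg F V) {S : Finset ℕ} (hS : ∀ c ∈ S, c ≤ Module.finrank F V) : Set.InjOn x.f (S : Set ℕ) := by
  intro a ha b hb h
  rw [← x.rk (hS a ha), h, x.rk (hS b hb)]

theorem img_powerset (x : Flg F V) {S : Finset ℕ} (hS : ∀ c ∈ S, c ≤ Module.finrank F V) (m : ℕ) (X : Finset (Submodule F V) → ℝ) :
    ∑ a ∈ (S.image x.f).powersetCard m, X a = ∑ B ∈ S.powersetCard m, X (B.image x.f) := by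
  symm
  apply sum_bij (fun B _ => B.image x.f)
  · intro B hB
    rw [mem_powersetCard] at hB ⊢
    exact ⟨image_subset_image hB.1, by rw [card_image_of_injOn (flg_injOn x fun c hc => hS c (hB.1 hc)), hB.2]⟩
  · intro B hB B' hB' h
    exact (img_inj (fun c hc => hS c ((mem_powersetCard.1 hB).1 hc)) (fun c hc => hS c ((mem_powersetCard.1 hB').1 hc)) h).1
  · intro t ht
    rw [mem_powersetCard] at ht
    obtain ⟨B, hB, rfl⟩ := subset_image_iff.1 ht.1
    refine ⟨B, mem_powersetCard.2 ⟨hB, ?_⟩, rfl⟩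
    rw [← ht.2, card_image_of_injOn (flg_injOn x fun c hc => hS c (hB hc))]
  · intro B _; rfl

theorem img_disj (x : Flg F V) {B B' : Finset ℕ} (hB : ∀ c ∈ B, c ≤ Module.finrank F V) (hB' : ∀ c ∈ B', c ≤ Module.finrank F V) :
    Disjoint (B.image x.f) (B'.image x.f) ↔ Disjoint B B' := by
  rw [Finset.disjoint_left, Finset.disjoint_left]
  constructor
  · intro h c hc hc'
    exact h (mem_image_of_mem _ hc) (mem_image_of_mem _ hc')
  · intro h w hw hw'
    obtain ⟨c, hc, rfl⟩ := mem_image.1 hw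
    obtain ⟨c', hc', e⟩ := mem_image.1 hw'
    have : c' = c := by rw [← x.rk (hB' c' hc'), e, x.rk (hB c hc)]
    exact h hc (this ▸ hc')

theorem exists_flag_chain {lo hi : ℕ} (hle : lo ≤ hi) (hhi : hi ≤ Module.finrank F V) (W : ℕ → Submodule F V)
    (hW : ∀ i, lo ≤ i → i ≤ hi → Module.finrank F (W i) = i) (hm : ∀ i, lo ≤ i → i < hi → W i ≤ W (i + 1)) :
    ∃ x : Flg F V, ∀ i, lo ≤ i → i ≤ hi → x.f i = W i := by
  obtain ⟨a, ha⟩ := exists_flag_through (W lo)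
  obtain ⟨b, hb⟩ := exists_flag_through (W hi)
  rw [hW lo le_rfl hle] at ha
  rw [hW hi hle le_rfl] at hb
  let f : ℕ → Submodule F V := fun i => if i ≤ lo then a.f i else if i ≤ hi then W i else b.f i
  have f1 : ∀ i, i ≤ lo → f i = a.f i := fun i h => if_pos h
  have f2 : ∀ i, lo ≤ i → i ≤ hi → f i = W i := by
    intro i h h'
    rcases eq_or_lt_of_le h with rfl | h
    · rw [f1 _ le_rfl, ha]
    · show (if i ≤ lo then a.f i else if i ≤ hi then W i else b.f i) = _
      rw [if_neg (by omega), if_pos h']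
  have f3 : ∀ i, hi ≤ i → f i = b.f i := by
    intro i h
    rcases eq_or_lt_of_le h with rfl | h
    · rw [f2 _ hle le_rfl, hb]
    · show (if i ≤ lo then a.f i else if i ≤ hi then W i else b.f i) = _
      rw [if_neg (by omega), if_neg (by omega)]
  refine ⟨⟨f, monotone_nat_of_le_succ ?_, ?_⟩, f2⟩
  · intro i
    by_cases h1 : i < lo
    · rw [f1 i h1.le, f1 (i + 1) h1]; exact a.mono (Nat.le_succ i)
    by_cases h2 : i < hi
    · rw [f2 i (by omega) (by omega), f2 (i + 1) (by omega) (by omega)]; exact hm i (by omega) h2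
    · rw [f3 i (by omega), f3 (i + 1) (by omega)]; exact b.mono (Nat.le_succ i)
  · intro i
    by_cases h1 : i < lo
    · rw [f1 i h1.le]; exact a.rank i
    by_cases h2 : i ≤ hi
    · rw [f2 i (by omega) h2, hW i (by omega) h2]; omega
    · rw [f3 i (by omega)]; exact b.rank i
end link

section link2
variable {F : Type} [Field F] [Fintype F] {n : ℕ}

theorem img_face (x : Flg F (Fin n → F)) {S B : Finset ℕ} (hS : ∀ c ∈ S, c ≤ n) (hB : B ⊆ S) :
    IsFlagFace F n S (B.image x.f) := by
  have hn : Module.finrank F (Fin n → F) = n := Module.finrank_fin_fun F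
  refine ⟨?_, ?_⟩
  · intro a ha b hb _
    rw [mem_coe, mem_image] at ha hb
    obtain ⟨i, _, rfl⟩ := ha
    obtain ⟨j, _, rfl⟩ := hb
    rcases le_total i j with h | h
    · exact Or.inl (x.mono h)
    · exact Or.inr (x.mono h)
  · intro w hw
    obtain ⟨i, hi, rfl⟩ := mem_image.1 hw
    rw [x.rk (by rw [hn]; exact hS i (hB hi))]
    exact hB hi

theorem img_max (x : Flg F (Fin n → F)) {S : Finset ℕ} (hS : ∀ c ∈ S, c ≤ n) : S.image x.f ∈ maxFlagFaces F n S := by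
  have hn : Module.finrank F (Fin n → F) = n := Module.finrank_fin_fun F
  unfold maxFlagFaces
  simp only [mem_filter, mem_univ, true_and]
  refine ⟨img_face x hS Subset.rfl, fun i hi => ⟨x.f i, mem_image_of_mem _ hi, x.rk (by rw [hn]; exact hS i hi)⟩⟩

theorem max_img {lo hi : ℕ} (hle : lo ≤ hi) (hhi : hi ≤ n) {T : Finset (Submodule F (Fin n → F))}
    (hT : T ∈ maxFlagFaces F n (Icc lo hi)) : ∃ x : Flg F (Fin n → F), (Icc lo hi).image x.f = T := by
  have hn : Module.finrank F (Fin n → F) = n := Module.finrank_fin_fun F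
  unfold maxFlagFaces at hT
  simp only [mem_filter, mem_univ, true_and] at hT
  obtain ⟨⟨hch, hrk⟩, hex⟩ := hT
  have hex' : ∀ i, ∃ w : Submodule F (Fin n → F), i ∈ Icc lo hi → w ∈ T ∧ Module.finrank F w = i := by
    intro i
    by_cases h : i ∈ Icc lo hi
    · obtain ⟨w, h1, h2⟩ := hex i h
      exact ⟨w, fun _ => ⟨h1, h2⟩⟩
    · exact ⟨⊥, fun h' => absurd h' h⟩
  choose W hW using hex'
  have cmp : ∀ w ∈ T, ∀ w' ∈ T, Module.finrank F w ≤ Module.finrank F w' → w ≤ w' := by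
    intro w hw w' hw' h
    rcases hch.total hw hw' with h' | h'
    · exact h'
    · exact (Submodule.eq_of_le_of_finrank_le h' h).ge
  obtain ⟨x, hx⟩ := exists_flag_chain (F := F) (V := Fin n → F) hle (by omega) W
    (fun i h1 h2 => (hW i (mem_Icc.2 ⟨h1, h2⟩)).2)
    (fun i h1 h2 => by
      have a1 := hW i (mem_Icc.2 ⟨h1, by omega⟩)
      have a2 := hW (i + 1) (mem_Icc.2 ⟨by omega, by omega⟩)
      exact cmp _ a1.1 _ a2.1 (by rw [a1.2, a2.2]; omega))
  refine ⟨x, ?_⟩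
  ext w
  rw [mem_image]
  constructor
  · rintro ⟨i, hi', rfl⟩
    have := mem_Icc.1 hi'
    rw [hx i this.1 this.2]
    exact (hW i hi').1
  · intro hw
    have hi' := hrk w hw
    refine ⟨_, hi', ?_⟩
    have := mem_Icc.1 hi'
    rw [hx _ this.1 this.2]
    obtain ⟨b1, b2⟩ := hW _ hi'
    exact le_antisymm (cmp _ b1 _ hw b2.le) (cmp _ hw _ b1 b2.ge)

theorem fib_const {lo hi : ℕ} (hle : lo ≤ hi) (hhi : hi ≤ n) : ∃ c : ℝ, 0 < c ∧ ∀ X : Finset (Submodule F (Fin n → F)) → ℝ,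
    ∑ x : Flg F (Fin n → F), X ((Icc lo hi).image x.f) = c * ∑ T ∈ maxFlagFaces F n (Icc lo hi), X T := by
  have hS : ∀ c ∈ Icc lo hi, c ≤ n := fun c hc => (mem_Icc.1 hc).2.trans hhi
  obtain ⟨x0⟩ := exists_flag (F := F) (V := Fin n → F)
  let ρ : Flg F (Fin n → F) → Finset (Submodule F (Fin n → F)) := fun x => (Icc lo hi).image x.f
  have key : ∀ x y : Flg F (Fin n → F), (univ.filter (fun z => ρ z = ρ x)).card ≤ (univ.filter (fun z => ρ z = ρ y)).card := by
    intro x y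
    obtain ⟨γ, hγ⟩ := trans_gl' x y
    have hρ : ∀ z, ρ (act γ z) = (ρ z).image (fun w => w.map γ.toLinearMap) := by
      intro z
      simp only [ρ]
      rw [image_image]
      rfl
    apply card_le_card_of_injOn (act γ)
    · intro z hz
      simp only [coe_filter, mem_univ, true_and, Set.mem_ofPred_eq] at hz ⊢
      rw [hρ, hz, ← hρ, hγ]
    · exact (act γ).injective.injOn
  refine ⟨((univ.filter (fun z => ρ z = ρ x0)).card : ℝ), ?_, ?_⟩
  · have : 0 < (univ.filter (fun z => ρ z = ρ x0)).card := card_pos.2 ⟨x0, by simp⟩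
    exact_mod_cast this
  · intro X
    rw [← sum_fiberwise_of_maps_to (s := univ) (t := maxFlagFaces F n (Icc lo hi)) (g := ρ) (fun x _ => img_max x hS), mul_sum]
    apply sum_congr rfl
    intro T hT
    obtain ⟨x, rfl⟩ := max_img hle hhi hT
    rw [sum_congr rfl (g := fun _ => X ((Icc lo hi).image x.f))]
    · rw [sum_const, nsmul_eq_mul]
      congr 2
      exact le_antisymm (key _ _) (key _ _)
    · intro z hz
      have : ρ z = (Icc lo hi).image x.f := (mem_filter.1 hz).2
      rw [← this]

theorem rp_eq (r m : ℕ) (T : Finset (Submodule F (Fin n → F))) : rPartitions F n r m T = RP r m T := rfl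

theorem wt_eq {S : Finset ℕ} {r m : ℕ} {Γ : Type} [Group Γ]
    (f : Finset (Submodule F (Fin n → F)) → Finset (Submodule F (Fin n → F)) → Γ) (hm : 3 ≤ m)
    (hT : ∀ T ∈ maxFlagFaces F n S, m * (r + 1) ≤ T.card) :
    facesWt F n S r m Γ f = (∑ T ∈ maxFlagFaces F n S, (∑ E ∈ RP r 3 T, I01 (∃ a ∈ E, ∃ b ∈ E, ∃ c ∈ E, a ≠ b ∧ b ≠ c ∧ a ≠ c ∧
                  f a b * f b c * f c a ≠ 1)) / ((RP r 3 T).card : ℝ)) / ((maxFlagFaces F n S).card : ℝ) := by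
  unfold facesWt
  congr 1
  apply sum_congr rfl
  intro T h
  rw [rp_eq, ← RP_avg hm (hT T h)]
  unfold I01
  congr!

theorem dist_eq' {S : Finset ℕ} {r m : ℕ} {Γ : Type} [Group Γ]
    (f : Finset (Submodule F (Fin n → F)) → Finset (Submodule F (Fin n → F)) → Γ) (g : Finset (Submodule F (Fin n → F)) → Γ) (hm : 2 ≤ m)
    (hT : ∀ T ∈ maxFlagFaces F n S, m * (r + 1) ≤ T.card) :
    facesDist F n S r m Γ f g = (∑ T ∈ maxFlagFaces F n S, (∑ E ∈ RP r 2 T, I01 (∃ a ∈ E, ∃ b ∈ E, a ≠ b ∧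
      f a b ≠ g a * (g b)⁻¹)) / ((RP r 2 T).card : ℝ)) / ((maxFlagFaces F n S).card : ℝ) := by
  unfold facesDist
  congr 1
  apply sum_congr rfl
  intro T h
  rw [rp_eq, ← RP_avg hm (hT T h)]
  unfold I01
  congr!
end link2


section last
variable {F : Type} [Field F] [Fintype F] {n : ℕ} {Γ : Type} [Group Γ]

/-- descend a family of measurable functions on flags to a function on faces -/
theorem exists_g {S : Finset ℕ} (hS : ∀ c ∈ S, c ≤ n) (r : ℕ) (G : Finset ℕ → Flg F (Fin n → F) → Γ)
    (hG : ∀ B ∈ S.powersetCard (r + 1), Meas (∅ ∪ (B : Set ℕ)) (G B)) :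
    ∃ g : Finset (Submodule F (Fin n → F)) → Γ, ∀ B ∈ S.powersetCard (r + 1), ∀ x : Flg F (Fin n → F), g (B.image x.f) = G B x := by
  have hn : Module.finrank F (Fin n → F) = n := Module.finrank_fin_fun F
  have hex : ∀ t : Finset (Submodule F (Fin n → F)), ∃ y : Γ, ∀ B ∈ S.powersetCard (r + 1), ∀ x : Flg F (Fin n → F),
      B.image x.f = t → y = G B x := by
    intro t
    by_cases h : ∃ B ∈ S.powersetCard (r + 1), ∃ x : Flg F (Fin n → F), B.image x.f = t
    · obtain ⟨B, hB, x, hx⟩ := h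
      refine ⟨G B x, ?_⟩
      intro B' hB' x' hx'
      obtain ⟨e, he⟩ := img_inj (x := x) (y := x') (B := B) (B' := B')
        (fun c hc => by rw [hn]; exact hS c ((mem_powersetCard.1 hB).1 hc))
        (fun c hc => by rw [hn]; exact hS c ((mem_powersetCard.1 hB').1 hc)) (hx.trans hx'.symm)
      subst e
      apply hG B hB
      intro c hc
      exact he c (by simpa using hc)
    · refine ⟨1, ?_⟩
      intro B hB x hx
      exact absurd ⟨B, hB, x, hx⟩ h
  choose g hg using hex
  exact ⟨g, fun B hB x => hg _ B hB x rfl⟩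

theorem final_bound {r k d : ℕ} (hr : 2 ≤ r) (hk : r ^ 5 ≤ k) (hd : k < d)
    (hq : 2 * 10 ^ 15 + 32 * (r + 1) ^ 2 ≤ Fintype.card F)
    (f : Finset (Submodule F (Fin (2 * d) → F)) → Finset (Submodule F (Fin (2 * d) → F)) → Γ)
    (hf : ∀ e e' : Finset (Submodule F (Fin (2 * d) → F)), e ≠ e' →
                    e.card = r + 1 → e'.card = r + 1 → Disjoint e e' →
                    IsFlagFace F (2 * d) (Finset.Icc (d - k) (d + k)) (e ∪ e') →
                    f e e' = (f e' e)⁻¹) :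
    ∃ g : Finset (Submodule F (Fin (2 * d) → F)) → Γ,
      facesDist F (2 * d) (Finset.Icc (d - k) (d + k)) r ((2 * k + 1) / (r + 1)) Γ f g ≤
        216 * Kc r * facesWt F (2 * d) (Finset.Icc (d - k) (d + k)) r ((2 * k + 1) / (r + 1)) Γ f := by
  obtain ⟨f1, f2⟩ := r5_facts hr hk
  have hn : Module.finrank F (Fin (2 * d) → F) = 2 * d := Module.finrank_fin_fun F
  obtain ⟨S, hSd⟩ : ∃ S, S = Icc (d - k) (d + k) := ⟨_, rfl⟩
  have hcard : S.card = 2 * k + 1 := by rw [hSd, Nat.card_Icc]; omega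
  have hS : ∀ c ∈ S, c ≤ 2 * d := by
    intro c hc
    rw [hSd, mem_Icc] at hc; omega
  have hS' : ∀ c ∈ S, c ≤ Module.finrank F (Fin (2 * d) → F) := fun c hc => by rw [hn]; exact hS c hc
  set fh : Finset ℕ → Finset ℕ → Flg F (Fin (2 * d) → F) → Γ := fun B B' x => f (B.image x.f) (B'.image x.f) with hfhd
  have hfh : ∀ B B' : Finset ℕ, Meas ((B : Set ℕ) ∪ B') (fh B B') := by
    intro B B' x y hxy
    have e1 : B.image x.f = B.image y.f := image_congr fun c hc => hxy c (Or.inl hc)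
    have e2 : B'.image x.f = B'.image y.f := image_congr fun c hc => hxy c (Or.inr hc)
    simp only [hfhd]
    rw [e1, e2]
  obtain ⟨G, hG1, hG2⟩ := part8 (Γ := Γ) (fh := fh) hr hk hd hn hq (fun B _ B' _ => hfh B B')
  rw [← hSd] at hf hG1 hG2 ⊢
  obtain ⟨cs, hcs⟩ : ∃ cs, cs = S.powersetCard (r + 1) := ⟨_, rfl⟩
  obtain ⟨g, hg⟩ := exists_g hS r G hG1
  refine ⟨g, ?_⟩
  rw [← hcs] at hG1 hG2 hg
  have hcsS : ∀ B ∈ cs, B ⊆ S := fun B hB => (mem_powersetCard.1 (hcs ▸ hB)).1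
  have hcsn : ∀ B ∈ cs, ∀ c ∈ B, c ≤ Module.finrank F (Fin (2 * d) → F) := fun B hB c hc => hS' c (hcsS B hB hc)
  have hm3 : 3 ≤ (2 * k + 1) / (r + 1) := by
    rw [Nat.le_div_iff_mul_le (by omega)]; nlinarith
  have hle : d - k ≤ d + k := by omega
  have hhi : d + k ≤ 2 * d := by omega
  have hTc : ∀ T ∈ maxFlagFaces F (2 * d) S, (2 * k + 1) / (r + 1) * (r + 1) ≤ T.card := by
    intro T hT
    rw [hSd] at hT
    obtain ⟨x, rfl⟩ := max_img hle hhi hT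
    rw [← hSd, card_image_of_injOn (flg_injOn x hS'), hcard]
    exact Nat.div_mul_le_self _ _
  rw [wt_eq f hm3 hTc, dist_eq' f g (by omega) hTc]
  obtain ⟨c, hc0, hc⟩ := fib_const (F := F) hle hhi
  rw [← hSd] at hc
  set XD : Finset (Submodule F (Fin (2 * d) → F)) → ℝ := fun T => (∑ E ∈ RP r 2 T, I01 (∃ a ∈ E, ∃ b ∈ E, a ≠ b ∧
      f a b ≠ g a * (g b)⁻¹)) / ((RP r 2 T).card : ℝ) with hXD
  set XW : Finset (Submodule F (Fin (2 * d) → F)) → ℝ := fun T => (∑ E ∈ RP r 3 T, I01 (∃ a ∈ E, ∃ b ∈ E, ∃ c ∈ E, a ≠ b ∧ b ≠ c ∧ a ≠ c ∧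
                  f a b * f b c * f c a ≠ 1)) / ((RP r 3 T).card : ℝ) with hXW
  set N : ℝ := (cs.card : ℝ) with hN
  have hne : cs.Nonempty := by
    rw [hcs, powersetCard_nonempty, hcard]; nlinarith
  have hN0 : 0 < N := by rw [hN]; exact_mod_cast card_pos.2 hne
  have havd : Avd cs := by
    rw [hcs]; apply avd_pow; rw [hcard]; nlinarith
  -- pointwise bounds
  have hD : ∀ x : Flg F (Fin (2 * d) → F), XD (S.image x.f) ≤ 8 / N ^ 2 * ∑ B ∈ cs, ∑ B' ∈ cs, dfi fh G B B' x := by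
    intro x
    have a1 := RP2_sum r (S.image x.f) (fun a b => f a b ≠ g a * (g b)⁻¹)
    have a2 : ∑ a ∈ (S.image x.f).powersetCard (r + 1), ∑ b ∈ (S.image x.f).powersetCard (r + 1), I01 (Disjoint a b ∧ f a b ≠ g a * (g b)⁻¹)
        = ∑ B ∈ cs, ∑ B' ∈ cs, dfi fh G B B' x := by
      rw [img_powerset x hS', ← hcs]
      apply sum_congr rfl
      intro B hB
      rw [img_powerset x hS', ← hcs]
      apply sum_congr rfl
      intro B' hB'
      unfold dfi
      apply I01_congr
      rw [img_disj x (hcsn B hB) (hcsn B' hB'), hg B hB, hg B' hB']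
    rw [a2] at a1
    have a3 := RP2_low r (S.image x.f)
    have a4 : N * N ≤ 2 * ∑ a ∈ (S.image x.f).powersetCard (r + 1), ∑ b ∈ (S.image x.f).powersetCard (r + 1), I01 (Disjoint a b) := by
      rw [img_powerset x hS', ← hcs, mul_sum]
      have : N * N = ∑ B ∈ cs, N := by rw [sum_const, nsmul_eq_mul]
      rw [this]
      apply sum_le_sum
      intro B hB
      rw [img_powerset x hS', ← hcs]
      refine (havd B hB B hB).trans ?_
      rw [← I01_card]
      apply mul_le_mul_of_nonneg_left _ (by norm_num)
      apply sum_le_sum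
      intro B' hB'
      apply I01_mono
      intro h
      rw [img_disj x (hcsn B hB) (hcsn B' hB')]
      exact h.1
    have hR : 0 < ((RP r 2 (S.image x.f)).card : ℝ) := by nlinarith
    have hs0 : 0 ≤ ∑ B ∈ cs, ∑ B' ∈ cs, dfi fh G B B' x := sum_nonneg fun _ _ => sum_nonneg fun _ _ => dfi_nonneg _ _ _ _ _
    simp only [hXD]
    rw [div_le_iff₀ hR]
    refine a1.trans ?_
    rw [div_mul_eq_mul_div, div_mul_eq_mul_div, le_div_iff₀ (by positivity)]
    have : N ^ 2 ≤ 8 * ((RP r 2 (S.image x.f)).card : ℝ) := by nlinarith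
    nlinarith [mul_le_mul_of_nonneg_left this hs0]
  have hW : ∀ x : Flg F (Fin (2 * d) → F), (∑ B ∈ cs, ∑ B' ∈ cs, ∑ B'' ∈ cs, I01 (Disjoint B B' ∧ Disjoint B' B'' ∧ Disjoint B B'' ∧
    fh B B' x * fh B' B'' x ≠ fh B B'' x)) ≤ 27 * N ^ 3 * XW (S.image x.f) := by
    intro x
    have a1 := RP3_sum r (S.image x.f) (fun a b c => f a b * f b c * f c a ≠ 1)
    have a2 : ∑ B ∈ cs, ∑ B' ∈ cs, ∑ B'' ∈ cs, I01 (Disjoint B B' ∧ Disjoint B' B'' ∧ Disjoint B B'' ∧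
        fh B B' x * fh B' B'' x ≠ fh B B'' x) ≤ ∑ a ∈ (S.image x.f).powersetCard (r + 1), ∑ b ∈ (S.image x.f).powersetCard (r + 1),
        ∑ c ∈ (S.image x.f).powersetCard (r + 1), I01 (Disjoint a b ∧ Disjoint b c ∧ Disjoint a c ∧ f a b * f b c * f c a ≠ 1) := by
      rw [img_powerset x hS', ← hcs]
      apply sum_le_sum
      intro B hB
      rw [img_powerset x hS', ← hcs]
      apply sum_le_sum
      intro B' hB'
      rw [img_powerset x hS', ← hcs]
      apply sum_le_sum
      intro B'' hB''
      apply I01_mono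
      rintro ⟨d1, d2, d3, hne⟩
      have d3' := (img_disj x (hcsn B hB) (hcsn B'' hB'')).2 d3
      refine ⟨(img_disj x (hcsn B hB) (hcsn B' hB')).2 d1, (img_disj x (hcsn B' hB') (hcsn B'' hB'')).2 d2, d3', ?_⟩
      have cB : ∀ B ∈ cs, (B.image x.f).card = r + 1 := by
        intro B hB
        rw [card_image_of_injOn (flg_injOn x (hcsn B hB))]
        exact (mem_powersetCard.1 (hcs ▸ hB)).2
      have hant := hf (B''.image x.f) (B.image x.f) (by
          intro h
          rw [h, disjoint_self_iff_empty] at d3'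
          have := cB B hB
          rw [d3', card_empty] at this
          omega) (cB B'' hB'') (cB B hB) d3'.symm (by
          rw [← image_union]
          exact img_face x hS (union_subset (hcsS B'' hB'') (hcsS B hB)))
      rw [hant]
      intro h
      exact hne (mul_inv_eq_one.1 h)
    have a3 := RP3_up r (S.image x.f)
    have a4 : (((S.image x.f).powersetCard (r + 1)).card : ℝ) = N := by
      rw [card_powersetCard, card_image_of_injOn (flg_injOn x hS'), hN, hcs, card_powersetCard]
    rw [a4] at a3
    have hR : 0 < ((RP r 3 (S.image x.f)).card : ℝ) := by
      have := RP_ne r 3 (S.image x.f) (by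
        rw [card_image_of_injOn (flg_injOn x hS'), hcard]; nlinarith)
      exact_mod_cast card_pos.2 this
    simp only [hXW]
    refine (a2.trans a1).trans ?_
    rw [mul_div_assoc', le_div_iff₀ hR]
    have hs0 : 0 ≤ ∑ E ∈ RP r 3 (S.image x.f), I01 (∃ a ∈ E, ∃ b ∈ E, ∃ c ∈ E, a ≠ b ∧ b ≠ c ∧ a ≠ c ∧
                  f a b * f b c * f c a ≠ 1) := sum_nonneg fun _ _ => I01_nonneg _
    nlinarith [mul_le_mul_of_nonneg_left a3 hs0]
  have sD : c * ∑ T ∈ maxFlagFaces F (2 * d) S, XD T ≤ 8 / N ^ 2 * D2 cs fh G := by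
    rw [← hc, D2_eq, mul_sum]
    exact sum_le_sum fun x _ => hD x
  have sW : E3 cs fh ≤ 27 * N ^ 3 * (c * ∑ T ∈ maxFlagFaces F (2 * d) S, XW T) := by
    rw [← hc, mul_sum]
    exact sum_le_sum fun x _ => hW x
  have hK : 0 ≤ Kc r := by unfold Kc; positivity
  have main : ∑ T ∈ maxFlagFaces F (2 * d) S, XD T ≤ 216 * Kc r * ∑ T ∈ maxFlagFaces F (2 * d) S, XW T := by
    obtain ⟨A, hA⟩ : ∃ A, A = ∑ T ∈ maxFlagFaces F (2 * d) S, XD T := ⟨_, rfl⟩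
    obtain ⟨B, hB⟩ : ∃ B, B = ∑ T ∈ maxFlagFaces F (2 * d) S, XW T := ⟨_, rfl⟩
    rw [← hA] at sD ⊢
    rw [← hB] at sW ⊢
    have h1 : N ^ 3 * (c * A) ≤ 8 * (N * D2 cs fh G) := by
      rw [div_mul_eq_mul_div, le_div_iff₀ (by positivity)] at sD
      nlinarith [mul_le_mul_of_nonneg_left sD hN0.le]
    have h2 : N ^ 3 * (c * A) ≤ 8 * (Kc r * (27 * N ^ 3 * (c * B))) :=
      h1.trans (mul_le_mul_of_nonneg_left (hG2.trans (mul_le_mul_of_nonneg_left sW hK)) (by norm_num))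
    have hp : 0 < N ^ 3 * c := by positivity
    refine le_of_mul_le_mul_left ?_ hp
    linarith
  rw [← mul_div_assoc]
  exact div_le_div_of_nonneg_right main (Nat.cast_nonneg _)
end last

theorem wt_nonneg (F : Type) [Field F] [Fintype F] (n : ℕ) (S : Finset ℕ) (r m : ℕ) (Γ : Type) [Group Γ]
    (f : Finset (Submodule F (Fin n → F)) → Finset (Submodule F (Fin n → F)) → Γ) : 0 ≤ facesWt F n S r m Γ f := by
  unfold facesWt
  refine div_nonneg (sum_nonneg fun _ _ => div_nonneg (sum_nonneg fun _ _ => div_nonneg (sum_nonneg fun _ _ => ?_)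
    (Nat.cast_nonneg _)) (Nat.cast_nonneg _)) (Nat.cast_nonneg _)
  split_ifs <;> norm_num

theorem stmt_13 :
    ∃ C : ℝ, 0 < C ∧
      ∀ r k : ℕ, 2 ≤ r → r ^ 5 ≤ k →
        ∃ q₀ : ℕ, ∀ q : ℕ, q₀ ≤ q → IsPrimePow q →
          ∀ d : ℕ, k < d →
            ∀ (F : Type) [Field F] [Fintype F], Fintype.card F = q →
              ∀ (Γ : Type) [Group Γ],
                ∀ f : Finset (Submodule F (Fin (2 * d) → F)) →
                    Finset (Submodule F (Fin (2 * d) → F)) → Γ,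
                  (∀ e e' : Finset (Submodule F (Fin (2 * d) → F)), e ≠ e' →
                    e.card = r + 1 → e'.card = r + 1 → Disjoint e e' →
                    IsFlagFace F (2 * d) (Finset.Icc (d - k) (d + k)) (e ∪ e') →
                    f e e' = (f e' e)⁻¹) →
                  ∃ g : Finset (Submodule F (Fin (2 * d) → F)) → Γ,
                    Real.exp (-(C * Real.sqrt (r : ℝ) * (Real.log ((r : ℝ) + 1)) ^ 2)) *
                        facesDist F (2 * d) (Finset.Icc (d - k) (d + k)) r
                          ((2 * k + 1) / (r + 1)) Γ f g ≤
                      facesWt F (2 * d) (Finset.Icc (d - k) (d + k)) r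
                        ((2 * k + 1) / (r + 1)) Γ f := by
  refine ⟨5000, by norm_num, ?_⟩
  intro r k hr hk
  refine ⟨2 * 10 ^ 15 + 32 * (r + 1) ^ 2, ?_⟩
  intro q hq _ d hd F _ _ hF Γ _ f hf
  obtain ⟨g, hg⟩ := final_bound hr hk hd (by rw [hF]; exact hq) f hf
  refine ⟨g, ?_⟩
  have hK := Kc_le hr
  have hK0 : 0 ≤ Kc r := by unfold Kc; positivity
  have hw := wt_nonneg F (2 * d) (Finset.Icc (d - k) (d + k)) r ((2 * k + 1) / (r + 1)) Γ f
  rw [Real.exp_neg, inv_mul_le_iff₀ (Real.exp_pos _)]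
  refine hg.trans (mul_le_mul_of_nonneg_right ?_ hw)
  linarith
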